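/- Let k ≥ 1, m ≥ 0, 0 < R₀ < R₁ and 0 < r < 1/2. Let U : ℝ^k → ℝ be smooth and ℤ^k-periodic with β := U(0) and α := max_{|q| = r} U < β, set γ := β − α, and let h₁,…,h_k : ℝ^m → ℝ be smooth with h_i(0) = 0. Define H(p,q,p',q') := Σ_{i=1}^k p_i h_i(p') + U(q) on ℝ^{2k} × ℝ^{2m}. Let 𝓕, 𝓒, 𝓛, 𝓗 ⊂ ℝ^{2k} be the lifted floor, ceiling, low wall and high wall of the torus Lagrangian tetragon with parameters R₀, R₁ and T = r, and write Z := {0} × ℝ^m ⊂ ℝ^m(p') × ℝ^m(q'). Let F : ℝ^{2k} × ℝ^{2m} × ℝ → ℝ be smooth, 1-periodic in each q_i, each q'_j and in t, with δ := | inf_{(𝓗×Z)×ℝ} F − sup_{(𝓛×Z)×ℝ} F | < γ, and suppose G := H + F is complete. Then there exists a Hamiltonian chord of G from 𝓕 × Z to 𝓒 × Z of time-length at most (R₁−R₀)·r/(γ−δ); in particular, along this chord the value of |p| increases from R₀ at the initial endpoint to R₁ at the final endpoint. -/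

import Mathlib

open Real Set

noncomputable section

/-- `ℝ^k` as a function type; the Euclidean norm is `eucNorm`. -/
abbrev Vec (k : ℕ) := Fin k → ℝ

/-- The phase space `ℝ^{2k} = ℝ^k(p) × ℝ^k(q)`. -/
abbrev Phase (k : ℕ) := Vec k × Vec k

/-- The product phase space `ℝ^{2k} × ℝ^{2m}`, with coordinates `((p,q),(p',q'))`. -/
abbrev Phase2 (k m : ℕ) := Phase k × Phase m

/-- Euclidean norm on `ℝ^k`. -/
def eucNorm {k : ℕ} (x : Vec k) : ℝ := Real.sqrt (∑ i, x i ^ 2)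

/-- The vector of partial derivatives of `f` at `x` (the gradient w.r.t. the Euclidean
structure). -/
def gradVec {k : ℕ} (f : Vec k → ℝ) (x : Vec k) : Vec k :=
  fun i => fderiv ℝ f x (Pi.single i 1)

/-- `γ` solves Hamilton's equations `p' = -∂G/∂q`, `q' = ∂G/∂p`, `(p')' = -∂G/∂q'`,
`(q')' = ∂G/∂p'` of the time-dependent Hamiltonian `G` (for the symplectic form
`dp∧dq + dp'∧dq'`) at every time `t ∈ S`. -/
def IsHamSolOn2 {k m : ℕ} (G : Phase2 k m × ℝ → ℝ) (γ : ℝ → Phase2 k m) (S : Set ℝ) :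
    Prop :=
  ∀ t ∈ S,
    HasDerivAt (fun s => (γ s).1.1)
      (-(gradVec (fun q => G ((((γ t).1.1, q), (γ t).2), t)) (γ t).1.2)) t ∧
    HasDerivAt (fun s => (γ s).1.2)
      (gradVec (fun p => G (((p, (γ t).1.2), (γ t).2), t)) (γ t).1.1) t ∧
    HasDerivAt (fun s => (γ s).2.1)
      (-(gradVec (fun q' => G (((γ t).1, ((γ t).2.1, q')), t)) (γ t).2.2)) t ∧
    HasDerivAt (fun s => (γ s).2.2)
      (gradVec (fun p' => G (((γ t).1, (p', (γ t).2.2)), t)) (γ t).2.1) t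

/-- `G` is complete: through every initial condition there is a solution of Hamilton's
equations defined on all of `ℝ`. -/
def HamComplete2 {k m : ℕ} (G : Phase2 k m × ℝ → ℝ) : Prop :=
  ∀ (t₀ : ℝ) (x₀ : Phase2 k m), ∃ γ : ℝ → Phase2 k m, γ t₀ = x₀ ∧ IsHamSolOn2 G γ Set.univ

/-- The stabilization `X × Z ⊆ ℝ^{2k} × ℝ^{2m}` of a set `X ⊆ ℝ^{2k}`, where
`Z = {p' = 0}` is the lift of the zero section `𝕋^m ⊂ T*𝕋^m`. -/
def stab {k m : ℕ} (X : Set (Phase k)) : Set (Phase2 k m) :=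
  {x | x.1 ∈ X ∧ x.2.1 = 0}

/-- Lifted floor (for `R = R₀`) resp. ceiling (for `R = R₁`) of the Lagrangian tetragon in
`T*𝕋^k`: the set `{(p, t·p/|p| + m) : |p| = R, t ∈ [0,T], m ∈ ℤ^k}`. -/
def torusFloor (k : ℕ) (R T : ℝ) : Set (Phase k) :=
  {x | eucNorm x.1 = R ∧ ∃ (t : ℝ) (m : Fin k → ℤ), t ∈ Icc 0 T ∧
        x.2 = (t / eucNorm x.1) • x.1 + fun i => (m i : ℝ)}

/-- Lifted high wall `{(p, m) : R₀ ≤ |p| ≤ R₁, m ∈ ℤ^k}`. -/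
def torusHigh (k : ℕ) (R₀ R₁ : ℝ) : Set (Phase k) :=
  {x | R₀ ≤ eucNorm x.1 ∧ eucNorm x.1 ≤ R₁ ∧ ∃ m : Fin k → ℤ, x.2 = fun i => (m i : ℝ)}

/-- Lifted low wall `{(p, T·p/|p| + m) : R₀ ≤ |p| ≤ R₁, m ∈ ℤ^k}`. -/
def torusLow (k : ℕ) (R₀ R₁ T : ℝ) : Set (Phase k) :=
  {x | R₀ ≤ eucNorm x.1 ∧ eucNorm x.1 ≤ R₁ ∧ ∃ m : Fin k → ℤ,
        x.2 = (T / eucNorm x.1) • x.1 + fun i => (m i : ℝ)}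

section Preliminaries
open MeasureTheory AddCircle

open Metric MeasureTheory Topology Filter in
/-- `det (1 + t M)` is a polynomial in `t` of degree at most the dimension, so its value at `1` is
determined by its values at enough nodes. -/
theorem det_one_add_eq_sum_basis {E : Type*} [AddCommGroup E] [Module ℝ E] [FiniteDimensional ℝ E]
    (v : ℕ → ℝ) (hv : Function.Injective v) (M : E →ₗ[ℝ] E) :
    LinearMap.det (1 + M) = ∑ i ∈ Finset.range (Module.finrank ℝ E + 1),
      LinearMap.det (1 + v i • M) *
        (Lagrange.basis (Finset.range (Module.finrank ℝ E + 1)) v i).eval 1 := by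
  let b := Module.finBasis ℝ E
  let A := LinearMap.toMatrix b b M
  let f : Polynomial ℝ := Matrix.det ((Polynomial.X : Polynomial ℝ) • A.map Polynomial.C
    + (1 : Matrix _ _ ℝ).map Polynomial.C)
  have hf : ∀ t : ℝ, f.eval t = LinearMap.det (1 + t • M) := by
    intro t
    rw [← LinearMap.det_toMatrix b, ← Polynomial.coe_evalRingHom, RingHom.map_det]
    congr 1
    ext i j
    simp only [RingHom.mapMatrix_apply, Matrix.map_apply, Matrix.add_apply, Matrix.smul_apply,
      smul_eq_mul, map_add, Polynomial.coe_evalRingHom, Polynomial.eval_X,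
      Polynomial.eval_C, map_smul, LinearMap.toMatrix_one, A, Polynomial.eval_mul]
    ring
  have hdeg : f.degree < (Finset.range (Module.finrank ℝ E + 1)).card := by
    refine lt_of_le_of_lt Polynomial.degree_le_natDegree ?_
    have := Polynomial.natDegree_det_X_add_C_le A 1
    rw [Fintype.card_fin] at this
    rw [Finset.card_range]
    exact_mod_cast Nat.lt_succ_of_le this
  have key := Lagrange.eq_interpolate (s := Finset.range (Module.finrank ℝ E + 1))
    (hv.injOn) hdeg
  have h1 := congrArg (Polynomial.eval 1) key
  rw [hf, one_smul, Lagrange.interpolate_apply, Polynomial.eval_finsetSum] at h1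
  rw [h1]
  refine Finset.sum_congr rfl fun i _ => ?_
  rw [Polynomial.eval_mul, Polynomial.eval_C, hf]

open Metric MeasureTheory Topology Filter in
theorem no_smooth_retraction {E : Type*} [NormedAddCommGroup E] [InnerProductSpace ℝ E]
    [FiniteDimensional ℝ E] (r : E → E) (V : Set E) (hV : IsOpen V)
    (hBV : closedBall (0 : E) 1 ⊆ V) (hr : ContDiffOn ℝ 1 r V)
    (h1 : ∀ x ∈ closedBall (0 : E) 1, ‖r x‖ = 1) (h2 : ∀ x ∈ sphere (0 : E) 1, r x = x) :
    False := by
  borelize E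
  let g : E → E := fun x => r x - x
  have hg : ContDiffOn ℝ 1 g V := hr.sub contDiffOn_id
  have hgd : ∀ x ∈ V, HasFDerivAt g (fderiv ℝ g x) x := fun x hx =>
    ((hg.differentiableOn one_ne_zero).differentiableAt (hV.mem_nhds hx)).hasFDerivAt
  have hgc : ContinuousOn (fderiv ℝ g) V := hg.continuousOn_fderiv_of_isOpen hV le_rfl
  obtain ⟨C, hC⟩ := (isCompact_closedBall (0 : E) 1).exists_bound_of_continuousOn
    (hgc.mono hBV)
  have hC0 : 0 ≤ C := (norm_nonneg _).trans (hC 0 (by simp))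
  have hlip : ∀ x ∈ closedBall (0 : E) 1, ∀ y ∈ closedBall (0 : E) 1,
      ‖g y - g x‖ ≤ C * ‖y - x‖ := fun x hx y hy =>
    (convex_closedBall (0 : E) 1).norm_image_sub_le_of_norm_hasFDerivWithin_le
      (fun z hz => (hgd z (hBV hz)).hasFDerivWithinAt) hC hx hy
  -- for small `t` the map `x + t g x` is a bijection of the open ball
  have vol : ∀ t : ℝ, 0 ≤ t → t * (C + 1) < 1 →
      ∫ x in ball (0 : E) 1, (1 + t • fderiv ℝ g x).det = volume.real (ball (0 : E) 1) := by
    intro t ht htC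
    have htC' : t * C < 1 := by nlinarith
    have ht1 : t < 1 := by nlinarith
    let f : E → E := fun x => x + t • g x
    have hfd : ∀ x ∈ V, HasFDerivAt f (1 + t • fderiv ℝ g x) x := fun x hx =>
      (hasFDerivAt_id x).add ((hgd x hx).const_smul t)
    have hinj : InjOn f (closedBall 0 1) := by
      intro x hx y hy hxy
      have e : x - y = t • (g y - g x) := by
        have : x + t • g x = y + t • g y := hxy
        rw [smul_sub]
        rw [sub_eq_sub_iff_add_eq_add, this, add_comm]
      have := hlip x hx y hy
      have h3 : ‖x - y‖ ≤ t * C * ‖x - y‖ := by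
        calc ‖x - y‖ = t * ‖g y - g x‖ := by rw [e, norm_smul, Real.norm_of_nonneg ht]
          _ ≤ t * (C * ‖y - x‖) := by gcongr
          _ = _ := by rw [norm_sub_rev]; ring
      have : ‖x - y‖ = 0 := by nlinarith [norm_nonneg (x - y)]
      exact sub_eq_zero.mp (norm_eq_zero.mp this)
    have hfx : ∀ x, f x = (1 - t) • x + t • r x := by
      intro x; simp only [f, g]; module
    have hdet : ∀ x ∈ closedBall (0 : E) 1, ∀ s ∈ Icc (0 : ℝ) t,
        (1 + s • fderiv ℝ g x).det ≠ 0 := by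
      intro x hx s hs h0
      have hn : ‖-(s • fderiv ℝ g x)‖ < 1 := by
        rw [norm_neg, norm_smul, Real.norm_of_nonneg hs.1]
        calc s * ‖fderiv ℝ g x‖ ≤ t * C := by
              gcongr
              · exact hs.2
              · exact hC x hx
          _ < 1 := htC'
      have hu : IsUnit (1 - -(s • fderiv ℝ g x)) := isUnit_one_sub_of_norm_lt_one hn
      rw [sub_neg_eq_add] at hu
      have h4 : IsUnit ((1 + s • fderiv ℝ g x : E →L[ℝ] E) : E →ₗ[ℝ] E) :=
        hu.map (ContinuousLinearMap.toLinearMapRingHom (R₁ := ℝ) (M₁ := E))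
      exact (LinearMap.isUnit_iff_isUnit_det _).mp h4 |>.ne_zero h0
    have hcd : Continuous fun A : E →L[ℝ] E => A.det := ContinuousLinearMap.continuous_det
    have hpos : ∀ x ∈ closedBall (0 : E) 1, 0 < (1 + t • fderiv ℝ g x).det := by
      intro x hx
      by_contra hneg
      push Not at hneg
      have hc : ContinuousOn (fun s : ℝ => (1 + s • fderiv ℝ g x).det) (Icc 0 t) := by
        apply Continuous.continuousOn
        exact hcd.comp (by fun_prop)
      have := intermediate_value_Icc' ht hc
      have h01 : (1 + (0 : ℝ) • fderiv ℝ g x).det = 1 := by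
        rw [zero_smul, add_zero]
        exact LinearMap.det_id
      obtain ⟨s, hs, h0⟩ := this (show (0 : ℝ) ∈ _ by
        simp only [h01]
        exact ⟨hneg, zero_le_one⟩)
      exact hdet x hx s hs h0
    have himg : f '' ball 0 1 = ball 0 1 := by
      have hsub : f '' ball 0 1 ⊆ ball 0 1 := by
        rintro _ ⟨x, hx, rfl⟩
        rw [mem_ball_zero_iff] at hx ⊢
        rw [hfx]
        have hx1 := h1 x (by rw [mem_closedBall_zero_iff]; exact hx.le)
        calc ‖(1 - t) • x + t • r x‖ ≤ ‖(1 - t) • x‖ + ‖t • r x‖ := norm_add_le _ _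
          _ = (1 - t) * ‖x‖ + t := by
            rw [norm_smul, norm_smul, hx1, Real.norm_of_nonneg ht,
              Real.norm_of_nonneg (by linarith)]; ring
          _ < 1 := by nlinarith
      have hopen : IsOpen (f '' ball 0 1) := by
        rw [isOpen_iff_mem_nhds]
        rintro _ ⟨x, hx, rfl⟩
        have hxc := ball_subset_closedBall hx
        have hfs : HasStrictFDerivAt f (1 + t • fderiv ℝ g x) x := by
          have : ContDiffOn ℝ 1 f V := contDiffOn_id.add (hg.const_smul t)
          exact (this.contDiffAt (hV.mem_nhds (hBV hxc))).hasStrictFDerivAt'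
            (hfd x (hBV hxc)) one_ne_zero
        have hsurj : (1 + t • fderiv ℝ g x).range = ⊤ := by
          have : IsUnit ((1 + t • fderiv ℝ g x : E →L[ℝ] E) : E →ₗ[ℝ] E) :=
            (LinearMap.isUnit_iff_isUnit_det _).mpr (hpos x hxc).ne'.isUnit
          exact LinearMap.range_eq_top.mpr ((Module.End.isUnit_iff _).mp this).2
        rw [← hfs.map_nhds_eq_of_surj hsurj]
        exact image_mem_map (isOpen_ball.mem_nhds hx)
      have hcl : IsClosed (f '' closedBall 0 1) := by
        refine ((isCompact_closedBall _ _).image_of_continuousOn ?_).isClosed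
        exact fun x hx => (hfd x (hBV hx)).continuousAt.continuousWithinAt
      have hcl' : f '' closedBall 0 1 ∩ ball 0 1 ⊆ f '' ball 0 1 := by
        rintro _ ⟨⟨x, hx, rfl⟩, hfx1⟩
        by_cases hxb : x ∈ ball (0 : E) 1
        · exact ⟨x, hxb, rfl⟩
        · exfalso
          have hxs : x ∈ sphere (0 : E) 1 := by
            rw [mem_closedBall_zero_iff] at hx
            rw [mem_ball_zero_iff, not_lt] at hxb
            rw [mem_sphere_zero_iff_norm]
            exact le_antisymm hx hxb
          rw [hfx, h2 x hxs, ← add_smul, sub_add_cancel, one_smul] at hfx1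
          exact hxb hfx1
      refine hsub.antisymm ?_
      have hconn : IsPreconnected (ball (0 : E) 1) := (convex_ball _ _).isPreconnected
      refine hconn.subset_of_closure_inter_subset hopen ?_ ?_
      · exact ⟨f 0, hsub ⟨0, by simp, rfl⟩, ⟨0, by simp, rfl⟩⟩
      · refine fun y hy => hcl' ⟨?_, hy.2⟩
        exact closure_minimal (image_mono ball_subset_closedBall) hcl hy.1
    have := integral_image_eq_integral_abs_det_fderiv_smul volume
      (measurableSet_ball (x := (0 : E)) (ε := 1))
      (fun x hx => (hfd x (hBV (ball_subset_closedBall hx))).hasFDerivWithinAt)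
      (hinj.mono ball_subset_closedBall) (fun _ => (1 : ℝ))
    rw [himg] at this
    simp only [smul_eq_mul, mul_one, integral_const, MeasurableSet.univ,
      measureReal_restrict_apply, univ_inter] at this
    rw [this]
    refine setIntegral_congr_fun measurableSet_ball fun x hx => ?_
    exact (abs_of_pos (hpos x (ball_subset_closedBall hx))).symm
  -- the derivative of a map into the sphere is singular
  have hsing : ∀ x ∈ ball (0 : E) 1, (1 + fderiv ℝ g x).det = 0 := by
    intro x hx
    have hxV := hBV (ball_subset_closedBall hx)
    have hrd : HasFDerivAt r (1 + fderiv ℝ g x) x := by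
      have : HasFDerivAt (fun x => x + g x) (1 + fderiv ℝ g x) x :=
        (hasFDerivAt_id x).add (hgd x hxV)
      have e : (fun x => x + g x) = r := by ext; simp [g]
      rwa [e] at this
    have hconst : HasFDerivAt (fun y => inner ℝ (r y) (r y)) (0 : E →L[ℝ] ℝ) x := by
      refine (hasFDerivAt_const (1 : ℝ) x).congr_of_eventuallyEq ?_
      filter_upwards [isOpen_ball.mem_nhds hx] with y hy
      rw [real_inner_self_eq_norm_sq, h1 y (ball_subset_closedBall hy), one_pow]
    have hin := hrd.inner ℝ hrd
    have heq := hin.unique hconst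
    by_contra hne
    have : IsUnit ((1 + fderiv ℝ g x : E →L[ℝ] E) : E →ₗ[ℝ] E) :=
      (LinearMap.isUnit_iff_isUnit_det _).mpr (Ne.isUnit hne)
    obtain ⟨v, hv⟩ := ((Module.End.isUnit_iff _).mp this).2 (r x)
    have h3 := congrArg (fun L : E →L[ℝ] ℝ => L v) heq
    have hv' : (1 + fderiv ℝ g x) v = r x := hv
    simp only [ContinuousLinearMap.comp_apply, fderivInnerCLM_apply,
      ContinuousLinearMap.prod_apply, zero_apply, hv',
      real_inner_self_eq_norm_sq, h1 x (ball_subset_closedBall hx)] at h3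
    norm_num at h3
  let v : ℕ → ℝ := fun i => 1 / ((C + 1) * (i + 2))
  have hvinj : Function.Injective v := by
    intro i j hij
    simp only [v] at hij
    have hi : (0 : ℝ) < (C + 1) * (i + 2) := by positivity
    have hj : (0 : ℝ) < (C + 1) * (j + 2) := by positivity
    rw [div_eq_div_iff hi.ne' hj.ne', one_mul, one_mul] at hij
    have := mul_left_cancel₀ (by positivity : C + 1 ≠ 0) hij
    exact_mod_cast (add_right_cancel this).symm
  have hv0 : ∀ i, 0 ≤ v i := fun i => by positivity
  have hv1 : ∀ i, v i * (C + 1) < 1 := by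
    intro i
    simp only [v]
    rw [div_mul_eq_mul_div, one_mul, div_lt_one (by positivity)]
    nlinarith [Nat.cast_nonneg (α := ℝ) i]
  set S := Finset.range (Module.finrank ℝ E + 1)
  have hint : ∀ i, IntegrableOn (fun x => (1 + v i • fderiv ℝ g x).det) (ball (0 : E) 1) := by
    intro i
    have hc : ContinuousOn (fun x => (1 + v i • fderiv ℝ g x).det) (closedBall (0 : E) 1) :=
      ContinuousLinearMap.continuous_det.comp_continuousOn
        (continuousOn_const.add ((continuous_const_smul (v i)).comp_continuousOn (hgc.mono hBV)))
    exact (hc.integrableOn_compact (isCompact_closedBall _ _)).mono_set ball_subset_closedBall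
  have h0 : ∫ x in ball (0 : E) 1, (1 + fderiv ℝ g x).det = 0 :=
    setIntegral_eq_zero_of_forall_eq_zero hsing
  have hsum : ∫ x in ball (0 : E) 1, (1 + fderiv ℝ g x).det
      = ∑ i ∈ S, volume.real (ball (0 : E) 1) * (Lagrange.basis S v i).eval 1 := by
    calc ∫ x in ball (0 : E) 1, (1 + fderiv ℝ g x).det
        = ∫ x in ball (0 : E) 1, ∑ i ∈ S,
          (1 + v i • fderiv ℝ g x).det * (Lagrange.basis S v i).eval 1 := by
          congr 1; ext x
          exact det_one_add_eq_sum_basis v hvinj (fderiv ℝ g x : E →ₗ[ℝ] E)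
      _ = ∑ i ∈ S, ∫ x in ball (0 : E) 1,
          (1 + v i • fderiv ℝ g x).det * (Lagrange.basis S v i).eval 1 :=
          integral_finsetSum _ fun i _ => (hint i).mul_const _
      _ = _ := by
          refine Finset.sum_congr rfl fun i _ => ?_
          rw [integral_mul_const, vol (v i) (hv0 i) (hv1 i)]
  rw [h0, ← Finset.mul_sum, ← Polynomial.eval_finsetSum,
    Lagrange.sum_basis hvinj.injOn (by simp [S]), Polynomial.eval_one, mul_one] at hsum
  have : 0 < volume.real (ball (0 : E) 1) :=
    ENNReal.toReal_pos (measure_ball_pos volume 0 one_pos).ne' measure_ball_lt_top.ne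
  exact this.ne hsum

open Metric Topology in
theorem exists_fixedPoint_of_norm_le_one {E : Type*} [NormedAddCommGroup E]
    [InnerProductSpace ℝ E] [FiniteDimensional ℝ E] (φ : E → E) (hφ : Continuous φ)
    (hb : ∀ x, ‖φ x‖ ≤ 1) : ∃ x, φ x = x := by
  by_contra! hne
  have hK := isCompact_closedBall (0 : E) 1
  obtain ⟨x₀, -, hx₀⟩ := hK.exists_isMinOn ⟨0, by simp⟩
    (f := fun x => ‖x - φ x‖) (by fun_prop)
  set δ := ‖x₀ - φ x₀‖ with hδ
  have hδ0 : 0 < δ := norm_pos_iff.mpr (sub_ne_zero.mpr (hne x₀).symm)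
  have hδle : ∀ x ∈ closedBall (0 : E) 1, δ ≤ ‖x - φ x‖ := fun x hx => hx₀ hx
  set ε := δ / 4 with hε
  have hε0 : 0 < ε := by positivity
  have huc := (isCompact_closedBall (0 : E) 2).uniformContinuousOn_of_continuous hφ.continuousOn
  rw [Metric.uniformContinuousOn_iff] at huc
  obtain ⟨η, hη, hη'⟩ := huc ε hε0
  obtain ⟨ψ₀, hψ₀, hclose⟩ := hφ.exists_contDiff_dist_le_of_forall_mem_ball_dist_le
    (lt_min hη one_pos)
  have hcl : ∀ a ∈ closedBall (0 : E) 1, ‖ψ₀ a - φ a‖ ≤ ε := by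
    intro a ha
    rw [← dist_eq_norm]
    refine hclose a ε fun x hx => (hη' x ?_ a ?_ ?_).le
    · rw [mem_closedBall_zero_iff] at ha ⊢
      have : dist x a < 1 := (mem_ball.mp hx).trans_le (min_le_right _ _)
      rw [dist_eq_norm] at this
      have := norm_le_norm_add_norm_sub' x a
      linarith
    · rw [mem_closedBall_zero_iff] at ha ⊢
      linarith
    · exact (mem_ball.mp hx).trans_le (min_le_left _ _)
  let ψ : E → E := fun x => (1 + ε)⁻¹ • ψ₀ x
  have hψ : ContDiff ℝ 1 ψ := (hψ₀.of_le (by exact_mod_cast le_top)).const_smul _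
  have hψ1 : ∀ x ∈ closedBall (0 : E) 1, ‖ψ x‖ ≤ 1 := by
    intro x hx
    have h := norm_le_norm_add_norm_sub' (ψ₀ x) (φ x)
    have h1 := hcl x hx
    have h2 := hb x
    simp only [ψ]
    rw [norm_smul, Real.norm_of_nonneg (by positivity), inv_mul_le_iff₀ (by positivity)]
    linarith
  have hψne : ∀ x ∈ closedBall (0 : E) 1, x - ψ x ≠ 0 := by
    intro x hx h0
    have e : x - φ x = (ψ₀ x - φ x) - ε • ψ x := by
      have : ψ₀ x = ψ x + ε • ψ x := by
        simp only [ψ]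
        have h5 : ψ₀ x = (1 + ε) • (1 + ε)⁻¹ • ψ₀ x := (smul_inv_smul₀ (by positivity) _).symm
        rw [add_smul, one_smul] at h5
        exact h5
      rw [this]
      have h6 := sub_eq_zero.mp h0
      calc x - φ x = ψ x - φ x := by rw [← h6]
        _ = _ := by abel
    have h1 := hδle x hx
    rw [e] at h1
    have h2 := norm_sub_le (ψ₀ x - φ x) (ε • ψ x)
    rw [norm_smul, Real.norm_of_nonneg hε0.le] at h2
    have h3 := hcl x hx
    have h4 := hψ1 x hx
    nlinarith
  let u : E → E := fun x => x - ψ x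
  have hu : ContDiff ℝ 1 u := contDiff_id.sub hψ
  let D : E → ℝ := fun x => (inner ℝ x (u x)) ^ 2 + ‖u x‖ ^ 2 * (1 - ‖x‖ ^ 2)
  have hD : ContDiff ℝ 1 D :=
    ((contDiff_id.inner ℝ hu).pow 2).add ((hu.norm_sq ℝ).mul
      (contDiff_const.sub (contDiff_id.norm_sq ℝ)))
  have hin : ∀ x ∈ closedBall (0 : E) 1, ‖x‖ = 1 → 0 < inner ℝ x (u x) := by
    intro x hx hx1
    have e : ‖u x‖ ^ 2 = 2 * inner ℝ x (u x) - 1 + ‖ψ x‖ ^ 2 := by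
      have h7 : ‖ψ x‖ ^ 2 = ‖x - u x‖ ^ 2 := by simp [u]
      have h8 := norm_sub_sq_real x (u x)
      rw [hx1] at h8
      linarith
    have h1 := hψ1 x hx
    have h2 : 0 < ‖u x‖ := norm_pos_iff.mpr (hψne x hx)
    nlinarith [norm_nonneg (ψ x)]
  have hDpos : ∀ x ∈ closedBall (0 : E) 1, 0 < D x := by
    intro x hx
    have h2 : 0 < ‖u x‖ := norm_pos_iff.mpr (hψne x hx)
    have hx' := mem_closedBall_zero_iff.mp hx
    rcases hx'.lt_or_eq with h | h
    · have : 0 < 1 - ‖x‖ ^ 2 := by nlinarith [norm_nonneg x]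
      positivity
    · have := hin x hx h
      simp only [D, h]
      norm_num
      positivity
  let V : Set E := {x | 0 < D x} ∩ {x | u x ≠ 0}
  have hV : IsOpen V := (isOpen_lt continuous_const hD.continuous).inter
    (isOpen_ne_fun hu.continuous continuous_const)
  let s : E → ℝ := fun x => (-inner ℝ x (u x) + √(D x)) / ‖u x‖ ^ 2
  refine no_smooth_retraction (fun x => x + s x • u x) V hV
    (fun x hx => ⟨hDpos x hx, hψne x hx⟩) ?_ ?_ ?_
  · refine contDiffOn_id.add (ContDiffOn.smul ?_ hu.contDiffOn)
    refine ContDiffOn.div ?_ (hu.norm_sq ℝ).contDiffOn ?_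
    · refine ((contDiff_id.inner ℝ hu).neg.contDiffOn).add ?_
      exact hD.contDiffOn.sqrt fun x hx => hx.1.ne'
    · intro x hx
      have := norm_pos_iff.mpr hx.2
      positivity
  · intro x hx
    have h2 : 0 < ‖u x‖ := norm_pos_iff.mpr (hψne x hx)
    have h3 : ‖x + s x • u x‖ ^ 2 = 1 := by
      rw [norm_add_sq_real, real_inner_smul_right, norm_smul, mul_pow, Real.norm_eq_abs, sq_abs]
      have hs : s x * ‖u x‖ ^ 2 = -inner ℝ x (u x) + √(D x) := by
        simp only [s]; field_simp
      have hsq : √(D x) ^ 2 = D x := Real.sq_sqrt (hDpos x hx).le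
      have : (‖x‖ ^ 2 + 2 * (s x * inner ℝ x (u x)) + s x ^ 2 * ‖u x‖ ^ 2 - 1)
          * ‖u x‖ ^ 2 = 0 := by
        have e : (‖x‖ ^ 2 + 2 * (s x * inner ℝ x (u x)) + s x ^ 2 * ‖u x‖ ^ 2 - 1)
          * ‖u x‖ ^ 2 = (s x * ‖u x‖ ^ 2) ^ 2 + 2 * (s x * ‖u x‖ ^ 2) * inner ℝ x (u x)
            + (‖x‖ ^ 2 - 1) * ‖u x‖ ^ 2 := by ring
        rw [e, hs]
        have : (-inner ℝ x (u x) + √(D x)) ^ 2 + 2 * (-inner ℝ x (u x) + √(D x)) * inner ℝ x (u x)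
            + (‖x‖ ^ 2 - 1) * ‖u x‖ ^ 2 = √(D x) ^ 2 - (inner ℝ x (u x)) ^ 2
            + (‖x‖ ^ 2 - 1) * ‖u x‖ ^ 2 := by ring
        rw [this, hsq]
        simp only [D]; ring
      rcases mul_eq_zero.mp this with h | h
      · linarith
      · exact absurd h (by positivity)
    have := norm_nonneg (x + s x • u x)
    nlinarith
  · intro x hx
    have hx1 : ‖x‖ = 1 := mem_sphere_zero_iff_norm.mp hx
    have h := hin x (sphere_subset_closedBall hx) hx1
    have : s x = 0 := by
      simp only [s, D, hx1]
      norm_num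
      left
      rw [Real.sqrt_sq h.le]; ring
    simp [this]

open Metric Topology in
/-- Brouwer's fixed point theorem for bounded continuous self-maps of a finite-dimensional
normed space. -/
theorem exists_fixedPoint_of_bounded {E : Type*} [NormedAddCommGroup E] [NormedSpace ℝ E]
    [FiniteDimensional ℝ E] (φ : E → E) (hφ : Continuous φ) (R : ℝ) (hb : ∀ x, ‖φ x‖ ≤ R) :
    ∃ x, φ x = x := by
  let e := toEuclidean (E := E)
  have hR : 0 ≤ R := (norm_nonneg _).trans (hb 0)
  set R' := ‖e.toContinuousLinearMap‖ * R + 1 with hR'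
  have hR'0 : 0 < R' := by positivity
  obtain ⟨x, hx⟩ := exists_fixedPoint_of_norm_le_one
    (fun x => R'⁻¹ • e (φ (e.symm (R' • x)))) (by fun_prop) (by
      intro x
      rw [norm_smul, Real.norm_of_nonneg (by positivity), inv_mul_le_iff₀ hR'0, mul_one]
      calc ‖e (φ (e.symm (R' • x)))‖ ≤ ‖e.toContinuousLinearMap‖ * ‖φ (e.symm (R' • x))‖ :=
            e.toContinuousLinearMap.le_opNorm _
        _ ≤ ‖e.toContinuousLinearMap‖ * R := by gcongr; exact hb _
        _ ≤ R' := by linarith)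
  refine ⟨e.symm (R' • x), ?_⟩
  rw [← e.injective.eq_iff, e.apply_symm_apply]
  conv_rhs => rw [← hx]
  rw [smul_inv_smul₀ hR'0.ne']

open Metric Topology Filter in
/-- Schauder's fixed point theorem for maps with relatively compact range. -/
theorem exists_fixedPoint_of_compact {X : Type*} [NormedAddCommGroup X] [NormedSpace ℝ X]
    (g : X → X) (hg : Continuous g) (K : Set X) (hK : IsCompact K) (hgK : ∀ x, g x ∈ K) :
    ∃ x, g x = x := by
  have key : ∀ ε : ℝ, 0 < ε → ∃ x, ‖g x - x‖ ≤ ε := by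
    intro ε hε
    obtain ⟨t, htK, htf, htc⟩ := hK.finite_cover_balls hε
    let s := htf.toFinset
    let w : X → X → ℝ := fun c y => max 0 (ε - ‖y - c‖)
    have hw0 : ∀ c y, 0 ≤ w c y := fun c y => le_max_left _ _
    let W : X → ℝ := fun y => ∑ c ∈ s, w c y
    have hWpos : ∀ y ∈ K, 0 < W y := by
      intro y hy
      obtain ⟨c, hc, hyc⟩ := mem_iUnion₂.mp (htc hy)
      refine Finset.sum_pos' (fun c _ => hw0 c y) ⟨c, htf.mem_toFinset.mpr hc, ?_⟩
      rw [mem_ball, dist_eq_norm] at hyc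
      exact lt_max_of_lt_right (by linarith)
    let S := Submodule.span ℝ (t : Set X)
    have : FiniteDimensional ℝ S := FiniteDimensional.span_of_finite ℝ htf
    let N : X → X := fun y => ∑ c ∈ s, w c y • c
    have hNS : ∀ y, N y ∈ S := fun y => Submodule.sum_mem _ fun c hc =>
      Submodule.smul_mem _ _ (Submodule.subset_span (htf.mem_toFinset.mp hc))
    have hwc : ∀ c, Continuous (w c) := fun c => by fun_prop
    have hNc : Continuous N := continuous_finsetSum _ fun c _ => (hwc c).smul continuous_const
    have hWc : Continuous W := continuous_finsetSum _ fun c _ => hwc c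
    let φ : S → S := fun x => ⟨(W (g x))⁻¹ • N (g x), S.smul_mem _ (hNS _)⟩
    have hφc : Continuous φ := by
      refine Continuous.subtype_mk ?_ _
      have hgx : Continuous fun x : S => g x := hg.comp continuous_subtype_val
      exact ((hWc.comp hgx).inv₀ fun x => (hWpos _ (hgK _)).ne').smul (hNc.comp hgx)
    have hest : ∀ y ∈ K, ‖(W y)⁻¹ • N y - y‖ ≤ ε := by
      intro y hy
      have h0 := hWpos y hy
      have e : (W y)⁻¹ • N y - y = (W y)⁻¹ • ∑ c ∈ s, w c y • (c - y) := by
        simp only [smul_sub, Finset.sum_sub_distrib, ← Finset.sum_smul]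
        rw [show ∑ c ∈ s, w c y = W y from rfl, inv_smul_smul₀ h0.ne']
      rw [e, norm_smul, Real.norm_of_nonneg (by positivity), inv_mul_le_iff₀ h0]
      refine (norm_sum_le _ _).trans ?_
      rw [Finset.sum_mul]
      refine Finset.sum_le_sum fun c _ => ?_
      rw [norm_smul, Real.norm_of_nonneg (hw0 c y)]
      by_cases hc : ‖y - c‖ ≤ ε
      · rw [norm_sub_rev c y]
        exact mul_le_mul_of_nonneg_left hc (hw0 _ _)
      · have : w c y = 0 := max_eq_left (by linarith [not_le.mp hc])
        rw [this]; simp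
    obtain ⟨B, hB⟩ := hK.isBounded.exists_norm_le
    obtain ⟨x, hx⟩ := exists_fixedPoint_of_bounded φ hφc (B + ε) (by
      intro x
      have h1 := hest _ (hgK x)
      have h2 := hB _ (hgK x)
      have h3 := norm_le_norm_add_norm_sub' ((W (g x))⁻¹ • N (g x)) (g x)
      have : ‖φ x‖ = ‖(W (g x))⁻¹ • N (g x)‖ := rfl
      linarith)
    refine ⟨x, ?_⟩
    have hx' : (W (g x))⁻¹ • N (g x) = x := congrArg Subtype.val hx
    have := hest _ (hgK x)
    rwa [hx', norm_sub_rev] at this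
  choose x hx using fun n : ℕ => key (1 / (n + 1)) (by positivity)
  obtain ⟨y, -, φ, hφ, hlim⟩ := hK.tendsto_subseq fun n => hgK (x n)
  have hdiff : Tendsto (fun n => g (x (φ n)) - x (φ n)) atTop (𝓝 0) := by
    refine squeeze_zero_norm (fun n => hx (φ n)) ?_
    exact tendsto_one_div_add_atTop_nhds_zero_nat.comp hφ.tendsto_atTop
  have hxlim : Tendsto (fun n => x (φ n)) atTop (𝓝 y) := by
    have := hlim.sub hdiff
    simpa using this
  refine ⟨y, ?_⟩
  exact tendsto_nhds_unique ((hg.tendsto y).comp hxlim) hlim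

open Metric Topology Filter in
/-- A Leray–Schauder continuation principle: a compact homotopy `K τ`, `τ ∈ [0,1]`, without fixed
points on the boundary, whose initial map has `0` as only fixed point and contracts near `0`,
ends at a map with a fixed point. -/
theorem exists_fixedPoint_of_homotopy {X : Type*} [NormedAddCommGroup X] [NormedSpace ℝ X]
    (Ω : Set X) (hΩ : IsOpen Ω) (h0Ω : (0 : X) ∈ Ω) (b : ℝ) (hb : 0 < b) (K : ℝ × X → X)
    (hK : ContinuousOn K (Icc 0 1 ×ˢ closure Ω)) (C : Set X) (hC : IsCompact C)
    (hKC : ∀ z ∈ Icc (0 : ℝ) 1 ×ˢ closure Ω, K z ∈ C)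
    (hbd : ∀ τ ∈ Icc (0 : ℝ) 1, ∀ x ∈ closure Ω, K (τ, x) = x → x ∈ Ω)
    (hK0 : ∀ x ∈ closure Ω, K (0, x) = x → x = 0)
    (hKb : ∀ x ∈ closure Ω, ‖x‖ ≤ b → ‖K (0, x)‖ ≤ ‖x‖ / 2) :
    ∃ x ∈ Ω, K (1, x) = x := by
  let c : ℝ → ℝ := fun τ => max 0 (min 1 τ)
  have hc : Continuous c := by fun_prop
  have hc01 : ∀ τ, c τ ∈ Icc (0 : ℝ) 1 := fun τ =>
    ⟨le_max_left _ _, max_le zero_le_one (min_le_left _ _)⟩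
  have hcneg : ∀ τ ≤ 0, c τ = 0 := fun τ h =>
    max_eq_left ((min_le_right _ _).trans h)
  have hcid : ∀ τ ∈ Icc (0 : ℝ) 1, c τ = τ := fun τ h => by
    simp only [c, min_eq_right h.2, max_eq_right h.1]
  let O : Set (ℝ × X) := {z | z.2 ∈ Ω ∧ (‖z.2‖ < b ∨ 0 < z.1)}
  have hO : IsOpen O := by
    refine (hΩ.preimage continuous_snd).inter (IsOpen.union ?_ ?_)
    · exact isOpen_lt continuous_snd.norm continuous_const
    · exact isOpen_lt continuous_const continuous_fst
  have hOcl : ∀ z ∈ closure O, z.2 ∈ closure Ω ∧ (‖z.2‖ ≤ b ∨ 0 ≤ z.1) := by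
    have hcl : IsClosed {z : ℝ × X | z.2 ∈ closure Ω ∧ (‖z.2‖ ≤ b ∨ 0 ≤ z.1)} := by
      refine (isClosed_closure.preimage continuous_snd).inter (IsClosed.union ?_ ?_)
      · exact isClosed_le continuous_snd.norm continuous_const
      · exact isClosed_le continuous_const continuous_fst
    have hsub : O ⊆ {z : ℝ × X | z.2 ∈ closure Ω ∧ (‖z.2‖ ≤ b ∨ 0 ≤ z.1)} :=
      fun z hz => ⟨subset_closure hz.1, hz.2.imp le_of_lt le_of_lt⟩
    exact fun z hz => closure_minimal hsub hcl hz
  let σ : ℝ → ℝ := fun s => max 0 (min 1 (s + 2))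
  have hσ : Continuous σ := by fun_prop
  let Hm : ℝ × (ℝ × X) → ℝ × X := fun p => (max p.1 (-1), σ p.1 • K (c p.2.1, p.2.2))
  have hHm : ContinuousOn Hm (univ ×ˢ closure O) := by
    refine ContinuousOn.prodMk (by fun_prop) (ContinuousOn.smul (by fun_prop) ?_)
    refine hK.comp (by fun_prop) ?_
    rintro ⟨s, τ, x⟩ ⟨-, hz⟩
    exact ⟨hc01 τ, (hOcl _ hz).1⟩
  have hfix : ∀ s ∈ Icc (-2 : ℝ) 1, ∀ z ∈ closure O, Hm (s, z) = z → z ∈ O := by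
    rintro s ⟨hs1, hs2⟩ ⟨τ, x⟩ hz hzf
    obtain ⟨hx, hor⟩ := hOcl _ hz
    simp only at hx hor
    have e1 : max s (-1) = τ := congrArg Prod.fst hzf
    have e2 : σ s • K (c τ, x) = x := congrArg Prod.snd hzf
    have hzero : x = 0 → (τ, x) ∈ O := fun h => ⟨h ▸ h0Ω, Or.inl (by simp [h, hb])⟩
    rcases lt_trichotomy τ 0 with h | h | h
    · apply hzero
      have hxb : ‖x‖ ≤ b := hor.resolve_right (not_le.mpr h)
      rw [hcneg τ h.le] at e2
      have h1 := hKb x hx hxb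
      have h2 : ‖x‖ ≤ ‖K (0, x)‖ := by
        conv_lhs => rw [← e2]
        rw [norm_smul, Real.norm_of_nonneg (le_max_left _ _)]
        exact mul_le_of_le_one_left (norm_nonneg _) (max_le zero_le_one (min_le_left _ _))
      have h3 : ‖x‖ = 0 := by linarith [norm_nonneg x]
      exact norm_eq_zero.mp h3
    · apply hzero
      have hs : s = 0 := by
        rcases max_choice s (-1) with h' | h' <;> rw [h'] at e1 <;> linarith
      have hσ1 : σ s = 1 := by simp [σ, hs]
      rw [hσ1, one_smul, hcneg τ h.le] at e2
      exact hK0 x hx e2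
    · have hs : s = τ := by
        rcases max_choice s (-1) with h' | h' <;> rw [h'] at e1 <;> linarith
      have hσ1 : σ s = 1 := by
        simp only [σ]
        rw [min_eq_left (by linarith), max_eq_right zero_le_one]
      have hτ : τ ∈ Icc (0 : ℝ) 1 := ⟨h.le, hs ▸ hs2⟩
      rw [hσ1, one_smul, hcid τ hτ] at e2
      exact ⟨hbd τ hτ x hx e2, Or.inr h⟩
  let Sg : Set (ℝ × X) := {z | z ∈ closure O ∧ ∃ s ∈ Icc (-2 : ℝ) 1, Hm (s, z) = z}
  have hSg : IsClosed Sg := by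
    have h1 : IsClosed {p : ℝ × (ℝ × X) | p ∈ univ ×ˢ closure O ∧ Hm p - p.2 ∈ ({0} : Set _)} :=
      (hHm.sub continuousOn_snd).preimage_isClosed_of_isClosed
        (isClosed_univ.prod isClosed_closure) isClosed_singleton
    have h2 : IsClosed ((fun p : Icc (-2 : ℝ) 1 × (ℝ × X) => ((p.1 : ℝ), p.2)) ⁻¹'
        {p : ℝ × (ℝ × X) | p ∈ univ ×ˢ closure O ∧ Hm p - p.2 ∈ ({0} : Set _)}) :=
      h1.preimage (by fun_prop)
    have h3 := isClosedMap_snd_of_compactSpace _ h2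
    convert h3 using 1
    ext z
    constructor
    · rintro ⟨hz, s, hs, h⟩
      exact ⟨(⟨s, hs⟩, z), ⟨⟨mem_univ _, hz⟩, by simp [h]⟩, rfl⟩
    · rintro ⟨⟨s, w⟩, ⟨⟨-, hz⟩, h⟩, rfl⟩
      exact ⟨hz, s, s.2, sub_eq_zero.mp h⟩
  have hdisj : Disjoint Oᶜ Sg := by
    rw [Set.disjoint_left]
    rintro z hz ⟨hzc, s, hs, h⟩
    exact hz (hfix s hs z hzc h)
  obtain ⟨l, hl0, hl1, hl⟩ := exists_continuous_zero_one_of_isClosed hO.isClosed_compl hSg hdisj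
  let sf : ℝ × X → ℝ := fun z => -2 + 3 * l z
  have hsf : Continuous sf := by fun_prop
  have hsfmem : ∀ z, sf z ∈ Icc (-2 : ℝ) 1 := fun z => by
    have := hl z
    simp only [sf]
    constructor <;> linarith [this.1, this.2]
  have hHm2 : ∀ z, Hm (-2, z) = (-1, 0) := fun z => by
    simp only [Hm, σ]
    norm_num
  classical
  let g : ℝ × X → ℝ × X := fun z => if z ∈ closure O then Hm (sf z, z) else (-1, 0)
  have hgO : ∀ z ∉ O, g z = (-1, 0) := by
    intro z hz
    simp only [g]
    split_ifs
    · have : sf z = -2 := by simp only [sf, hl0 hz]; simp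
      rw [this, hHm2]
    · rfl
  have hg : Continuous g := by
    rw [← continuousOn_univ]
    have hu : (univ : Set (ℝ × X)) = closure O ∪ Oᶜ := by
      ext z
      simp only [mem_univ, mem_union, mem_compl_iff, true_iff]
      by_cases h : z ∈ O
      · exact Or.inl (subset_closure h)
      · exact Or.inr h
    rw [hu]
    refine ContinuousOn.union_of_isClosed ?_ ?_ isClosed_closure hO.isClosed_compl
    · have : ContinuousOn (fun z => Hm (sf z, z)) (closure O) :=
        hHm.comp (by fun_prop) fun z hz => ⟨mem_univ _, hz⟩
      exact this.congr fun z hz => by simp only [g, if_pos hz]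
    · exact (continuousOn_const (c := ((-1 : ℝ), (0 : X)))).congr fun z hz => hgO z hz
  let Cc : Set (ℝ × X) := (fun p : ℝ × (ℝ × X) => (p.1, p.2.1 • p.2.2)) ''
    (Icc (-1) 1 ×ˢ (Icc 0 1 ×ˢ C))
  have hCc : IsCompact Cc := (isCompact_Icc.prod (isCompact_Icc.prod hC)).image (by fun_prop)
  have hσ01 : ∀ s, σ s ∈ Icc (0 : ℝ) 1 := fun s =>
    ⟨le_max_left _ _, max_le zero_le_one (min_le_left _ _)⟩
  have hgC : ∀ z, g z ∈ Cc := by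
    intro z
    simp only [g]
    split_ifs with h
    · refine ⟨(max (sf z) (-1), σ (sf z), K (c z.1, z.2)), ⟨⟨le_max_right _ _, ?_⟩,
        hσ01 _, hKC _ ⟨hc01 _, (hOcl z h).1⟩⟩, rfl⟩
      exact max_le (hsfmem z).2 (by norm_num)
    · refine ⟨(-1, 0, K (0, 0)), ⟨by norm_num, by norm_num,
        hKC _ ⟨by norm_num, subset_closure h0Ω⟩⟩, by simp⟩
  obtain ⟨z, hz⟩ := exists_fixedPoint_of_compact g hg Cc hCc hgC
  have hzO : z ∈ O := by
    by_contra h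
    have h1 := hgO z h
    rw [hz] at h1
    exact h (h1 ▸ ⟨h0Ω, Or.inl (by simpa using hb)⟩)
  have hzg : Hm (sf z, z) = z := by
    have h : g z = Hm (sf z, z) := if_pos (subset_closure hzO)
    rw [← h, hz]
  have hzS : z ∈ Sg := ⟨subset_closure hzO, sf z, hsfmem z, hzg⟩
  have hs1 : sf z = 1 := by simp only [sf, hl1 hzS]; norm_num
  rw [hs1] at hzg
  have e1 : max 1 (-1) = z.1 := congrArg Prod.fst hzg
  have e2 : σ 1 • K (c z.1, z.2) = z.2 := congrArg Prod.snd hzg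
  rw [max_eq_left (by norm_num)] at e1
  have hσ1 : σ 1 = 1 := by simp only [σ]; norm_num
  rw [hσ1, one_smul, ← e1, hcid 1 (by norm_num)] at e2
  exact ⟨z.2, hzO.1, e2⟩

/-- The circle `ℝ/ℤ`. -/
abbrev Circ := UnitAddCircle

/-- Square-integrable `V`-valued functions on the circle. -/
abbrev L2 (V : Type*) [NormedAddCommGroup V] := Lp V 2 (haarAddCircle (T := (1 : ℝ)))

section Basics
variable {κ : Type*} [Fintype κ]

local notation "V" => EuclideanSpace ℂ κ

theorem L2.integrable (f : L2 V) : Integrable f (haarAddCircle (T := (1 : ℝ))) :=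
  (Lp.memLp f).integrable (by norm_num)

theorem L2.integral_norm_le (f : L2 V) :
    ∫ t, ‖f t‖ ∂(haarAddCircle (T := (1 : ℝ))) ≤ ‖f‖ := by
  rw [Lp.norm_def, integral_norm_eq_lintegral_enorm (Lp.aestronglyMeasurable f),
    ← eLpNorm_one_eq_lintegral_enorm]
  exact ENNReal.toReal_mono (Lp.eLpNorm_ne_top f)
    (eLpNorm_le_eLpNorm_of_exponent_le (by norm_num) (Lp.aestronglyMeasurable f))

/-- The Fourier coefficient as a continuous linear map. -/
def coef (k : ℤ) : L2 V →L[ℂ] V :=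
  LinearMap.mkContinuous
    { toFun := fun f => fourierCoeff f k
      map_add' := fun f g => by
        rw [fourierCoeff_congr_ae (Lp.coeFn_add f g), fourierCoeff.add (L2.integrable f) (L2.integrable g)]
        rfl
      map_smul' := fun c f => by
        rw [fourierCoeff_congr_ae (Lp.coeFn_smul c f), fourierCoeff.const_smul]
        rfl } 1 (by
    intro f
    simp only [LinearMap.coe_mk, AddHom.coe_mk, one_mul]
    refine (norm_integral_le_integral_norm _).trans (le_trans (le_of_eq ?_) (L2.integral_norm_le f))
    simp [norm_smul, Circle.norm_coe])

theorem coef_apply (k : ℤ) (f : L2 V) : coef k f = fourierCoeff f k := rfl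

/-- A continuous function as an element of `L2`. -/
def toL2 : C(Circ, V) →L[ℂ] L2 V := ContinuousMap.toLp 2 haarAddCircle ℂ

theorem coeFn_toL2 (f : C(Circ, V)) : toL2 f =ᵐ[haarAddCircle] f :=
  ContinuousMap.coeFn_toLp haarAddCircle f

theorem coef_toL2 (k : ℤ) (f : C(Circ, V)) : coef k (toL2 f) = fourierCoeff f k := by
  rw [coef_apply, fourierCoeff_congr_ae (coeFn_toL2 f)]

/-- The monomial `e_k c`. -/
def monom (k : ℤ) : V →L[ℂ] C(Circ, V) :=
  LinearMap.mkContinuous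
    { toFun := fun c => ⟨fun t => fourier k t • c, by fun_prop⟩
      map_add' := fun c d => by ext1 t; simp
      map_smul' := fun a c => by ext1 t; simp [smul_comm a] } 1 (by
    intro c
    rw [ContinuousMap.norm_le _ (by positivity)]
    intro t
    simp [norm_smul, Circle.norm_coe])

@[simp] theorem monom_apply (k : ℤ) (c : V) (t : Circ) : monom k c t = fourier k t • c := rfl

variable [DecidableEq κ]

theorem inner_monom (k : ℤ) (i : κ) (f : L2 V) :
    inner ℂ (toL2 (monom k (EuclideanSpace.single i 1))) f = coef k f i := by
  rw [L2.inner_def, coef_apply, fourierCoeff]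
  have h1 := (EuclideanSpace.proj (𝕜 := ℂ) i : V →L[ℂ] ℂ).integral_comp_comm
    ((L2.integrable f).fourier_smul (-k))
  rw [show ((∫ t, (fourier (-k) t : ℂ) • f t ∂haarAddCircle : V) i) = (EuclideanSpace.proj (𝕜 := ℂ) i : V →L[ℂ] ℂ) (∫ t, (fourier (-k) t : ℂ) • f t ∂haarAddCircle : V) from rfl, ← h1]
  refine integral_congr_ae ?_
  filter_upwards [coeFn_toL2 (monom k (EuclideanSpace.single i (1 : ℂ)) : C(Circ, V))] with t ht
  rw [ht, monom_apply, inner_smul_left, EuclideanSpace.inner_single_left, fourier_neg]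
  simp

theorem fourierCoeff_monom (k l : ℤ) (c : V) :
    fourierCoeff (monom l c) k = if k = l then c else 0 := by
  have h := congrFun (fourierCoeff_fourier (T := (1 : ℝ)) l) k
  have h2 : fourierCoeff (monom l c) k = fourierCoeff (fourier l : Circ → ℂ) k • c := by
    rw [fourierCoeff, fourierCoeff, ← integral_smul_const]
    simp [smul_smul]
  rw [h2, h, Pi.single_apply]
  split_ifs <;> simp

theorem coef_monom (k l : ℤ) (c : V) : coef k (toL2 (monom l c)) = if k = l then c else 0 := by
  rw [coef_toL2, fourierCoeff_monom]

theorem eq_zero_of_coef (f : L2 V) (h : ∀ k, coef k f = 0) : f = 0 := by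
  have h1 : ∀ i : κ, (EuclideanSpace.proj (𝕜 := ℂ) i : V →L[ℂ] ℂ).compLp f = 0 := by
    intro i
    rw [← (fourierBasis (T := (1 : ℝ))).repr.map_eq_zero_iff]
    ext k
    rw [fourierBasis_repr, fourierCoeff_congr_ae (ContinuousLinearMap.coeFn_compLp _ f), fourierCoeff]
    have h1 := (EuclideanSpace.proj (𝕜 := ℂ) i : V →L[ℂ] ℂ).integral_comp_comm
      ((L2.integrable f).fourier_smul (-k))
    simp only [map_smul] at h1
    rw [h1, ← fourierCoeff, ← coef_apply, h]
    simp
  have h2 : ∀ᵐ t ∂(haarAddCircle (T := (1 : ℝ))), ∀ i : κ, f t i = 0 := by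
    rw [ae_all_iff]
    intro i
    have h3 := ContinuousLinearMap.coeFn_compLp (EuclideanSpace.proj (𝕜 := ℂ) i : V →L[ℂ] ℂ) f
    rw [h1 i] at h3
    filter_upwards [h3, Lp.coeFn_zero ℂ 2 (haarAddCircle (T := (1 : ℝ)))] with t h4 h5
    rw [h5] at h4
    exact h4.symm
  rw [Lp.eq_zero_iff_ae_eq_zero]
  filter_upwards [h2] with t ht
  ext i
  exact ht i

/-- The Fourier Hilbert basis. -/
def fourierHB : HilbertBasis (ℤ × κ) ℂ (L2 V) :=
  HilbertBasis.mkOfOrthogonalEqBot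
    (v := fun p => toL2 (monom p.1 (EuclideanSpace.single p.2 1))) (by
      rw [orthonormal_iff_ite]
      intro p q
      rw [inner_monom, coef_monom]
      by_cases h : p.1 = q.1 <;> by_cases h2 : p.2 = q.2 <;> simp [Prod.ext_iff, h, h2]) (by
      rw [Submodule.eq_bot_iff]
      intro f hf
      refine eq_zero_of_coef f fun k => ?_
      ext i
      rw [← inner_monom]
      exact (Submodule.mem_orthogonal _ f).1 hf _ (Submodule.subset_span ⟨(k, i), rfl⟩))

theorem fourierHB_apply (p : ℤ × κ) :
    (fourierHB : HilbertBasis (ℤ × κ) ℂ (L2 V)) p =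
      toL2 (monom p.1 (EuclideanSpace.single p.2 1)) := by
  simp [fourierHB]

theorem fourierHB_repr (f : L2 V) (p : ℤ × κ) : fourierHB.repr f p = coef p.1 f p.2 := by
  rw [HilbertBasis.repr_apply_apply, fourierHB_apply, inner_monom]

theorem hasSum_inner_coef (f g : L2 V) :
    HasSum (fun k => inner ℂ (coef k f) (coef k g)) (inner ℂ f g) := by
  have h := fourierHB.hasSum_inner_mul_inner f g
  have h2 := h.prod_fiberwise (g := fun k => inner ℂ (coef k f) (coef k g)) (fun k => by
    have : inner ℂ (coef k f) (coef k g) =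
        ∑ i, inner ℂ f ((fourierHB : HilbertBasis (ℤ × κ) ℂ (L2 V)) (k, i)) *
          inner ℂ ((fourierHB : HilbertBasis (ℤ × κ) ℂ (L2 V)) (k, i)) g := by
      rw [PiLp.inner_apply]
      refine Finset.sum_congr rfl fun i _ => ?_
      rw [← inner_conj_symm f, fourierHB_apply, inner_monom, inner_monom]
      simp [mul_comm]
    rw [this]
    exact hasSum_fintype _)
  exact h2

theorem hasSum_norm_sq_coef (f : L2 V) : HasSum (fun k => ‖coef k f‖ ^ 2) (‖f‖ ^ 2) := by
  have h := (hasSum_inner_coef f f)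
  simp only [inner_self_eq_norm_sq_to_K] at h
  exact_mod_cast h

theorem coef_ext {f g : L2 V} (h : ∀ k, coef k f = coef k g) : f = g := by
  rw [← sub_eq_zero]
  exact eq_zero_of_coef _ fun k => by rw [map_sub, h, sub_self]

/-- Partial Fourier sums over finite sets of indices. -/
def partialSum (s : Finset (ℤ × κ)) (f : L2 V) : C(Circ, V) :=
  ∑ p ∈ s, monom p.1 (coef p.1 f p.2 • EuclideanSpace.single p.2 1)

theorem tendsto_partialSum (f : L2 V) :
    Filter.Tendsto (fun s => toL2 (partialSum s f)) Filter.atTop (nhds f) := by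
  have h := fourierHB.hasSum_repr f
  simp only [fourierHB_repr, fourierHB_apply] at h
  refine h.congr fun s => ?_
  simp [partialSum, map_sum]

/-- The closed subspace of functions with Fourier modes in `S`. -/
def modes (S : Set ℤ) : Submodule ℂ (L2 V) := ⨅ k ∈ Sᶜ, (coef k).ker

theorem mem_modes {S : Set ℤ} {f : L2 V} : f ∈ modes S ↔ ∀ k ∉ S, coef k f = 0 := by
  simp [modes, Submodule.mem_iInf]

instance (S : Set ℤ) : CompleteSpace (modes S : Submodule ℂ (L2 V)) := by
  have : IsClosed ((modes S : Submodule ℂ (L2 V)) : Set (L2 V)) := by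
    have : ((modes S : Submodule ℂ (L2 V)) : Set (L2 V)) = ⋂ k ∈ Sᶜ, {f | coef k f = 0} := by
      ext f; simp [mem_modes]
    rw [this]
    exact isClosed_biInter fun k _ => isClosed_eq (coef k).continuous continuous_const
  exact this.completeSpace_coe

/-- The orthogonal projection to the functions with Fourier modes in `S`. -/
def proj (S : Set ℤ) : L2 V →L[ℂ] L2 V := (modes S).starProjection

theorem norm_proj_le (S : Set ℤ) (f : L2 V) : ‖proj S f‖ ≤ ‖f‖ :=
  (modes S).norm_starProjection_apply_le f

theorem proj_mem (S : Set ℤ) (f : L2 V) : proj S f ∈ (modes S : Submodule ℂ (L2 V)) :=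
  (modes S).starProjection_apply_mem f

open Classical in
theorem coef_proj (S : Set ℤ) (f : L2 V) (k : ℤ) :
    coef k (proj S f) = if k ∈ S then coef k f else 0 := by
  split_ifs with h
  · rw [eq_comm, ← sub_eq_zero, ← map_sub]
    ext i
    rw [← inner_monom]
    have h1 : f - proj S f ∈ (modes S : Submodule ℂ (L2 V))ᗮ :=
      (modes S).sub_starProjection_mem_orthogonal f
    refine (Submodule.mem_orthogonal _ _).1 h1 _ (mem_modes.2 fun l hl => ?_)
    rw [coef_monom, if_neg]
    rintro rfl
    exact hl h
  · exact mem_modes.1 (proj_mem S f) k h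

end Basics

section Mul
variable {κ : Type*} [Fintype κ] [DecidableEq κ]

local notation "V" => EuclideanSpace ℂ κ

/-- Continuous matrix-valued functions on the circle. -/
abbrev MatFun (κ : Type*) [Fintype κ] :=
  C(Circ, EuclideanSpace ℂ κ →L[ℂ] EuclideanSpace ℂ κ)

/-- Multiplication by a continuous matrix-valued function. -/
def mulOp : MatFun κ →L[ℂ] (L2 V →L[ℂ] L2 V) :=
  ((ContinuousLinearMap.id ℂ (V →L[ℂ] V)).holderL (haarAddCircle (T := (1 : ℝ))) ⊤ 2 2) ∘L
    (ContinuousMap.toLp ⊤ haarAddCircle ℂ)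

theorem coeFn_mulOp (M : MatFun κ) (f : L2 V) :
    mulOp M f =ᵐ[haarAddCircle] fun t => M t (f t) := by
  have h := (ContinuousLinearMap.id ℂ (V →L[ℂ] V)).coeFn_holder (r := 2)
    (ContinuousMap.toLp ⊤ (haarAddCircle (T := (1 : ℝ))) ℂ M) f
  have h2 := ContinuousMap.coeFn_toLp (p := ⊤) (haarAddCircle (T := (1 : ℝ))) (𝕜 := ℂ) M
  filter_upwards [h, h2] with t h3 h4
  rw [h4] at h3
  exact h3

theorem norm_mulOp_le {M : MatFun κ} {c : ℝ} (h : ∀ t, ‖M t‖ ≤ c) (f : L2 V) :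
    ‖mulOp M f‖ ≤ c * ‖f‖ := by
  refine Lp.norm_le_mul_norm_of_ae_le_mul ?_
  filter_upwards [coeFn_mulOp M f] with t ht
  rw [ht]
  exact (M t).le_of_opNorm_le (h t) _

theorem mulOp_mul (M N : MatFun κ) (f : L2 V) : mulOp (M * N) f = mulOp M (mulOp N f) := by
  refine Lp.ext ?_
  filter_upwards [coeFn_mulOp (M * N) f, coeFn_mulOp M (mulOp N f), coeFn_mulOp N f] with t h1 h2 h3
  rw [h1, h2, h3]
  rfl

theorem mulOp_one (f : L2 V) : mulOp (1 : MatFun κ) f = f := by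
  refine Lp.ext ?_
  filter_upwards [coeFn_mulOp (1 : MatFun κ) f] with t h1
  rw [h1]
  rfl

/-- The function `M f` for continuous `M` and `f`. -/
def mulC (M : MatFun κ) (f : C(Circ, V)) : C(Circ, V) := ⟨fun t => M t (f t), by fun_prop⟩

theorem mulOp_toL2 (M : MatFun κ) (f : C(Circ, V)) : mulOp M (toL2 f) = toL2 (mulC M f) := by
  refine Lp.ext ?_
  filter_upwards [coeFn_mulOp M (toL2 f), coeFn_toL2 f, coeFn_toL2 (mulC M f)] with t h1 h2 h3
  rw [h1, h2, h3]
  rfl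

theorem fourierCoeff_mulC_monom (M : MatFun κ) (k l : ℤ) (c : V) :
    fourierCoeff (mulC M (monom l c)) k = fourierCoeff (mulC M (monom 0 c)) (k - l) := by
  refine integral_congr_ae (Filter.Eventually.of_forall fun t => ?_)
  simp only [mulC, ContinuousMap.coe_mk, monom_apply, map_smul, fourier_zero, one_smul]
  rw [smul_smul, ← fourier_add]
  congr 2
  ring_nf

/-- The Fourier coefficients of a product. -/
theorem hasSum_coef_mulOp (M : MatFun κ) (f : L2 V) (k : ℤ) :
    HasSum (fun p : ℤ × κ => coef p.1 f p.2 •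
      fourierCoeff (mulC M (monom 0 (EuclideanSpace.single p.2 1))) (k - p.1))
      (coef k (mulOp M f)) := by
  have h := (fourierHB.hasSum_repr f).mapL ((coef k : L2 V →L[ℂ] V) ∘L mulOp M)
  simp only [fourierHB_repr, fourierHB_apply] at h
  refine h.congr_fun ?_
  intro p
  simp only [map_smul, ContinuousLinearMap.comp_apply]
  rw [mulOp_toL2, coef_toL2, fourierCoeff_mulC_monom M k p.1]

/-- Multiplication by `e_n C`. -/
def monomMat (n : ℤ) (c : V →L[ℂ] V) : MatFun κ := ⟨fun t => fourier n t • c, by fun_prop⟩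

theorem coef_mulOp_monomMat (n : ℤ) (c : V →L[ℂ] V) (f : L2 V) (k : ℤ) :
    coef k (mulOp (monomMat n c) f) = c (coef (k - n) f) := by
  rw [coef_apply, coef_apply, fourierCoeff_congr_ae (coeFn_mulOp _ f), fourierCoeff, fourierCoeff,
    ← c.integral_comp_comm ((L2.integrable f).fourier_smul _)]
  refine integral_congr_ae (Filter.Eventually.of_forall fun t => ?_)
  simp only [monomMat, ContinuousMap.coe_mk, smul_apply, map_smul]
  rw [smul_smul, ← fourier_add]
  congr 2
  ring_nf

/-- A finite-mode projection is compact. -/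
theorem isCompactOperator_proj {S : Set ℤ} (hS : S.Finite) :
    IsCompactOperator (proj S : L2 V →L[ℂ] L2 V) := by
  have h : (proj S : L2 V →L[ℂ] L2 V) =
      ∑ k ∈ hS.toFinset, (toL2 ∘L monom k) ∘L coef k := by
    ext1 f
    refine coef_ext fun k => ?_
    simp only [sum_apply, map_sum, ContinuousLinearMap.comp_apply, coef_monom,
      coef_proj, Finset.sum_ite_eq]
    by_cases hk : k ∈ S <;> simp [hk]
  rw [h]
  refine Submodule.sum_mem (compactOperator (RingHom.id ℂ) (L2 V) (L2 V)) fun k _ => ?_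
  have h1 := isCompactOperator_of_locallyCompactSpace_dom (coef k : L2 V →L[ℂ] V)
  exact h1.clm_comp (toL2 ∘L monom k : V →L[ℂ] L2 V)

/-- Hankel operators with continuous symbol are compact. -/
theorem isCompactOperator_hankel (M : MatFun κ) :
    IsCompactOperator ((proj (Iio 0) : L2 V →L[ℂ] L2 V) ∘L mulOp M ∘L proj (Ici 0)) := by
  let T : MatFun κ →L[ℂ] (L2 V →L[ℂ] L2 V) :=
    (ContinuousLinearMap.compL ℂ (L2 V) (L2 V) (L2 V) (proj (Iio 0))) ∘L
      ((ContinuousLinearMap.compL ℂ (L2 V) (L2 V) (L2 V)).flip (proj (Ici 0))) ∘L mulOp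
  let G : Submodule ℂ (MatFun κ) := (compactOperator (RingHom.id ℂ) (L2 V) (L2 V)).comap T.toLinearMap
  have hG : IsClosed (G : Set (MatFun κ)) :=
    (isClosed_setOfPred_isCompactOperator (𝕜₁ := ℂ) (σ₁₂ := RingHom.id ℂ) (M₁ := L2 V) (M₂ := L2 V)).preimage T.continuous
  have h1 : ∀ n c, monomMat n c ∈ G := by
    intro n c
    have : T (monomMat n c) = proj (Ico n 0) ∘L T (monomMat n c) := by
      ext1 f
      refine coef_ext fun k => ?_
      simp only [T, ContinuousLinearMap.comp_apply, ContinuousLinearMap.compL_apply,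
        ContinuousLinearMap.flip_apply, coef_proj, coef_mulOp_monomMat, mem_Iio, mem_Ici, mem_Ico]
      by_cases hk : k < 0 <;> by_cases hn : n ≤ k <;> simp [hk, hn]
    change IsCompactOperator (T (monomMat n c))
    rw [this]
    exact (isCompactOperator_proj (Set.finite_Ico n 0)).comp_clm _
  have h2 : ∀ (c : V →L[ℂ] V) (f : C(Circ, ℂ)),
      (⟨fun t => f t • c, by fun_prop⟩ : MatFun κ) ∈ G := by
    intro c f
    let S : C(Circ, ℂ) →L[ℂ] MatFun κ :=
      LinearMap.mkContinuous
        { toFun := fun f => (⟨fun t => f t • c, by fun_prop⟩ : MatFun κ)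
          map_add' := fun f g => by ext1 t; exact add_smul (f t) (g t) c
          map_smul' := fun a f => by ext1 t; simp [mul_smul] } ‖c‖ (by
        intro f
        rw [ContinuousMap.norm_le _ (by positivity)]
        intro t
        simp only [LinearMap.coe_mk, AddHom.coe_mk, ContinuousMap.coe_mk, norm_smul]
        rw [mul_comm]
        gcongr
        exact f.norm_coe_le_norm t)
    have h3 : (Submodule.span ℂ (range (fourier (T := (1 : ℝ))))) ≤ G.comap S.toLinearMap := by
      rw [Submodule.span_le]
      rintro _ ⟨n, rfl⟩
      exact h1 n c
    have h4 := Submodule.topologicalClosure_minimal _ h3 (hG.preimage S.continuous)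
    rw [span_fourier_closure_eq_top] at h4
    exact h4 (Submodule.mem_top (x := f))
  change M ∈ G
  let b := Module.finBasis ℂ (V →L[ℂ] V)
  have h5 : M = ∑ i, (⟨fun t => (LinearMap.toContinuousLinearMap (b.coord i)) (M t) • b i, by fun_prop⟩ : MatFun κ) := by
    ext1 t
    rw [ContinuousMap.sum_apply]
    exact (b.sum_repr (M t)).symm
  rw [h5]
  exact Submodule.sum_mem _ fun i _ => h2 (b i) ⟨fun t => (LinearMap.toContinuousLinearMap (b.coord i)) (M t), by fun_prop⟩

theorem norm_sq_sum_smul_le {J E : Type*} [NormedAddCommGroup E] [NormedSpace ℂ E] (s : Finset J)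
    (a : J → ℂ) (v : J → E) :
    ‖∑ p ∈ s, a p • v p‖ ^ 2 ≤ (∑ p ∈ s, ‖a p‖ ^ 2) * ∑ p ∈ s, ‖v p‖ ^ 2 := by
  refine le_trans ?_ (Finset.sum_mul_sq_le_sq_mul_sq s (fun p => ‖a p‖) fun p => ‖v p‖)
  gcongr
  refine (norm_sum_le _ _).trans (le_of_eq ?_)
  simp [norm_smul]

theorem norm_sq_le_of_hasSum {J E : Type*} [NormedAddCommGroup E] [NormedSpace ℂ E]
    {a : J → ℂ} {v : J → E} {x : E} (hx : HasSum (fun p => a p • v p) x) {A B : ℝ}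
    (hA : ∀ s : Finset J, ∑ p ∈ s, ‖a p‖ ^ 2 ≤ A) (hB : ∀ s : Finset J, ∑ p ∈ s, ‖v p‖ ^ 2 ≤ B) :
    ‖x‖ ^ 2 ≤ A * B := by
  have h0 : 0 ≤ A := by simpa using hA ∅
  refine le_of_tendsto ((continuous_norm.pow 2).continuousAt.tendsto.comp hx)
    (Filter.Eventually.of_forall fun s => ?_)
  refine (norm_sq_sum_smul_le s a v).trans ?_
  have := hA s
  have := hB s
  gcongr

theorem sum_norm_sq_coef_le (f : L2 V) (s : Finset (ℤ × κ)) :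
    ∑ p ∈ s, ‖coef p.1 f p.2‖ ^ 2 ≤ ‖f‖ ^ 2 := by
  have h := fourierHB.orthonormal.sum_inner_products_le f (s := s)
  simpa only [fourierHB_apply, inner_monom] using h

/-- The square-summed Fourier coefficients of the columns of a matrix-valued function. -/
def colCoef (M : MatFun κ) (s : ℤ) : ℝ :=
  ∑ j, ‖fourierCoeff (mulC M (monom 0 (EuclideanSpace.single j 1))) s‖ ^ 2

theorem colCoef_nonneg (M : MatFun κ) (s : ℤ) : 0 ≤ colCoef M s :=
  Finset.sum_nonneg fun _ _ => by positivity

theorem summable_colCoef (M : MatFun κ) : Summable (colCoef M) := by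
  refine summable_sum fun j _ => ?_
  simp only [← coef_toL2]
  exact (hasSum_norm_sq_coef _).summable

/-- Hilbert–Schmidt estimate for Hankel operators. -/
theorem norm_hankel_le (M : MatFun κ) {f : L2 V} (hf : ∀ k, 0 ≤ k → coef k f = 0) {K : ℤ} (hK : 0 ≤ K)
    {η : ℝ} (hη : ∀ T : Finset ℤ, (∀ s ∈ T, K < s) → ∑ s ∈ T, (s : ℝ) * colCoef M s ≤ η) :
    ‖proj (Ioi K) (mulOp M f)‖ ^ 2 ≤ η * ‖f‖ ^ 2 := by
  have hs := summable_colCoef M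
  have key : ∀ k : ℤ, ‖coef k (mulOp M f)‖ ^ 2 ≤
      ‖f‖ ^ 2 * ∑' s, if k < s then colCoef M s else 0 := by
    intro k
    have hs' : Summable fun s => if k < s then colCoef M s else 0 :=
      Summable.of_nonneg_of_le (fun s => by split_ifs <;> simp [colCoef_nonneg])
        (fun s => by split_ifs <;> simp [colCoef_nonneg]) hs
    have h1 : HasSum (fun p : ℤ × κ => coef p.1 f p.2 • (if p.1 < 0 then
      fourierCoeff (mulC M (monom 0 (EuclideanSpace.single p.2 1))) (k - p.1) else 0))
      (coef k (mulOp M f)) := by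
      refine (hasSum_coef_mulOp M f k).congr_fun fun p => ?_
      by_cases hp : p.1 < 0
      · simp [hp]
      · simp [hp, hf p.1 (not_lt.1 hp)]
    refine norm_sq_le_of_hasSum h1 (sum_norm_sq_coef_le f) fun s => ?_
    have h2 : ∑ p ∈ s, ‖(if p.1 < 0 then
        fourierCoeff (mulC M (monom 0 (EuclideanSpace.single p.2 1))) (k - p.1) else 0)‖ ^ 2 ≤
        ∑ l ∈ s.image Prod.fst, if k < k - l then colCoef M (k - l) else 0 := by
      refine (Finset.sum_le_sum_of_subset_of_nonneg (t := s.image Prod.fst ×ˢ Finset.univ)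
        (fun p hp => by simp; exact ⟨p.2, hp⟩) (fun _ _ _ => by positivity)).trans (le_of_eq ?_)
      rw [Finset.sum_product]
      refine Finset.sum_congr rfl fun l _ => ?_
      by_cases hl : l < 0
      · have : k < k - l := by omega
        simp [hl, colCoef]
      · have : ¬ k < k - l := by omega
        simp only [hl, this, if_false, norm_zero]
        simp
    refine h2.trans ?_
    rw [← (Equiv.subLeft k).tsum_eq]
    exact ((Equiv.subLeft k).summable_iff.2 hs').sum_le_tsum _ (fun l _ => by
      change (0 : ℝ) ≤ if k < Equiv.subLeft k l then colCoef M (Equiv.subLeft k l) else 0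
      split_ifs <;> simp [colCoef_nonneg])
  refine hasSum_le_of_sum_le (hasSum_norm_sq_coef _) fun T => ?_
  have h3 : ∑ k ∈ T, ‖coef k (proj (Ioi K) (mulOp M f))‖ ^ 2 ≤
      ∑ k ∈ T.filter (K < ·), ‖f‖ ^ 2 * ∑' s, (if k < s then colCoef M s else 0) := by
    rw [Finset.sum_filter]
    refine Finset.sum_le_sum fun k _ => ?_
    rw [coef_proj]
    by_cases hk : K < k
    · simpa [hk] using key k
    · simp [hk]
  refine h3.trans ?_
  rw [← Finset.mul_sum, mul_comm]
  gcongr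
  have hs' : ∀ k : ℤ, Summable fun s => if k < s then colCoef M s else 0 := fun k =>
    Summable.of_nonneg_of_le (fun s => by split_ifs <;> simp [colCoef_nonneg])
        (fun s => by split_ifs <;> simp [colCoef_nonneg]) hs
  rw [← Summable.tsum_finsetSum fun k _ => hs' k]
  refine hasSum_le_of_sum_le (summable_sum fun k _ => hs' k).hasSum fun S => ?_
  refine le_trans ?_ (hη (S.filter (K < ·)) (by simp))
  rw [Finset.sum_filter]
  refine Finset.sum_le_sum fun s _ => ?_
  rw [← Finset.sum_filter, Finset.sum_const, nsmul_eq_mul]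
  have hsub : (T.filter (K < ·)).filter (· < s) ⊆ Finset.Ioo K s := by
    intro k
    simp
    tauto
  have hc := Finset.card_le_card hsub
  rw [Int.card_Ioo] at hc
  split_ifs with h
  · have : ((((T.filter (K < ·)).filter (· < s)).card : ℤ) : ℝ) ≤ (s : ℝ) := by
      exact_mod_cast (by omega)
    have h0 := colCoef_nonneg M s
    push_cast at this
    gcongr
  · have : ((T.filter (K < ·)).filter (· < s)).card = 0 := by omega
    simp [this]

end Mul

section HS

variable {J H F : Type*} [NormedAddCommGroup H] [InnerProductSpace ℂ H]
  [NormedAddCommGroup F] [NormedSpace ℂ F] [CompleteSpace F]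

theorem HilbertBasis.sum_norm_sq_repr_le (b : HilbertBasis J ℂ H) (f : H) (s : Finset J) :
    ∑ p ∈ s, ‖b.repr f p‖ ^ 2 ≤ ‖f‖ ^ 2 := by
  have h := b.orthonormal.sum_inner_products_le f (s := s)
  simpa only [b.repr_apply_apply] using h

theorem HilbertBasis.summable_smul (b : HilbertBasis J ℂ H) {v : J → F}
    (hv : Summable fun p => ‖v p‖ ^ 2) (f : H) : Summable fun p => b.repr f p • v p := by
  have h1 : Summable fun p => ‖b.repr f p‖ ^ 2 :=
    summable_of_sum_le (fun _ => by positivity) (b.sum_norm_sq_repr_le f)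
  refine Summable.of_norm_bounded (h1.add hv) fun p => ?_
  rw [norm_smul]
  nlinarith [sq_nonneg (‖b.repr f p‖ - ‖v p‖), sq_nonneg (‖b.repr f p‖), sq_nonneg ‖v p‖]

/-- The operator sending the `p`-th basis vector to `v p`, for square-summable `v`. -/
def HilbertBasis.hsOp (b : HilbertBasis J ℂ H) (v : J → F) (hv : Summable fun p => ‖v p‖ ^ 2) :
    H →L[ℂ] F :=
  LinearMap.mkContinuous
    { toFun := fun f => ∑' p, b.repr f p • v p
      map_add' := fun f g => by
        rw [← (b.summable_smul hv f).tsum_add (b.summable_smul hv g)]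
        simp [add_smul]
      map_smul' := fun c f => by
        rw [RingHom.id_apply, ← (b.summable_smul hv f).tsum_const_smul]
        simp [smul_smul] } (√(∑' p, ‖v p‖ ^ 2)) (by
    intro f
    have h := norm_sq_le_of_hasSum (b.summable_smul hv f).hasSum (b.sum_norm_sq_repr_le f)
      (fun s => hv.sum_le_tsum s fun _ _ => by positivity)
    refine (pow_le_pow_iff_left₀ (norm_nonneg _) (by positivity) two_ne_zero).1 ?_
    rw [mul_pow, Real.sq_sqrt (tsum_nonneg fun _ => by positivity), mul_comm]
    exact h)

theorem HilbertBasis.hasSum_hsOp (b : HilbertBasis J ℂ H) (v : J → F)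
    (hv : Summable fun p => ‖v p‖ ^ 2) (f : H) :
    HasSum (fun p => b.repr f p • v p) (b.hsOp v hv f) :=
  (b.summable_smul hv f).hasSum

theorem HilbertBasis.norm_hsOp_le (b : HilbertBasis J ℂ H) (v : J → F)
    (hv : Summable fun p => ‖v p‖ ^ 2) : ‖b.hsOp v hv‖ ≤ √(∑' p, ‖v p‖ ^ 2) :=
  LinearMap.mkContinuous_norm_le _ (by positivity) _

theorem HilbertBasis.isCompactOperator_hsOp (b : HilbertBasis J ℂ H) (v : J → F)
    (hv : Summable fun p => ‖v p‖ ^ 2) : IsCompactOperator (b.hsOp v hv) := by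
  classical
  have h0 : ∀ s : Finset J, Summable fun p => ‖(if p ∈ s then 0 else v p)‖ ^ 2 := fun s =>
    Summable.of_nonneg_of_le (fun _ => by positivity) (fun p => by split_ifs <;> simp) hv
  let T : Finset J → (H →L[ℂ] F) := fun s => b.hsOp v hv - b.hsOp _ (h0 s)
  have hT : ∀ s, IsCompactOperator (T s) := by
    intro s
    have : T s = ∑ p ∈ s, (ContinuousLinearMap.smulRight (1 : ℂ →L[ℂ] ℂ) (v p)) ∘L
        (innerSL ℂ (b p)) := by
      ext1 f
      have h1 := (b.hasSum_hsOp v hv f).sub (b.hasSum_hsOp _ (h0 s) f)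
      have h2 : HasSum (fun p => b.repr f p • v p - b.repr f p • (if p ∈ s then 0 else v p))
          (∑ p ∈ s, b.repr f p • v p) := by
        have h4 := hasSum_sum_of_ne_finset_zero (L := SummationFilter.unconditional J) (s := s)
          (f := fun p => b.repr f p • v p - b.repr f p • (if p ∈ s then 0 else v p))
          (fun p hp => by simp [hp])
        rw [Finset.sum_congr rfl (g := fun p => b.repr f p • v p) (fun p hp => by simp [hp])] at h4
        exact h4
      rw [sub_apply, h1.unique h2]
      simp [b.repr_apply_apply]
    rw [this]
    refine Submodule.sum_mem (compactOperator (RingHom.id ℂ) H F) fun p _ => ?_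
    have h1 := isCompactOperator_of_locallyCompactSpace_dom (innerSL ℂ (b p))
    exact h1.clm_comp (ContinuousLinearMap.smulRight (1 : ℂ →L[ℂ] ℂ) (v p))
  refine isCompactOperator_of_tendsto (l := Filter.atTop) (F := T) ?_ (Filter.Eventually.of_forall hT)
  rw [tendsto_iff_norm_sub_tendsto_zero]
  have h3 : Filter.Tendsto (fun s : Finset J => √(∑' p, ‖(if p ∈ s then 0 else v p)‖ ^ 2))
      Filter.atTop (nhds 0) := by
    have h4 := (tendsto_tsum_compl_atTop_zero (fun p => ‖v p‖ ^ 2)).sqrt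
    rw [Real.sqrt_zero] at h4
    refine h4.congr fun s => ?_
    congr 1
    refine (tsum_subtype {p | p ∉ s} (fun p => ‖v p‖ ^ 2)).trans (tsum_congr fun p => ?_)
    by_cases hp : p ∈ s <;> simp [hp]
  refine squeeze_zero (fun _ => norm_nonneg _) (fun s => ?_) h3
  have : T s - b.hsOp v hv = - b.hsOp _ (h0 s) := by simp [T]
  rw [this, norm_neg]
  exact b.norm_hsOp_le _ _

end HS

section Prim
variable {κ : Type*} [Fintype κ] [DecidableEq κ]

local notation "V" => EuclideanSpace ℂ κ

/-- The primitive of the basis vector `e_k b_i`, vanishing at `0`. -/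
def primVec (p : ℤ × κ) : C(Circ, V) :=
  (2 * π * Complex.I * p.1 : ℂ)⁻¹ •
    (monom p.1 (EuclideanSpace.single p.2 1) - monom 0 (EuclideanSpace.single p.2 1))

theorem summable_primVec : Summable fun p : ℤ × κ => ‖primVec p‖ ^ 2 := by
  have h1 : Summable fun k : ℤ => 1 / (k : ℝ) ^ 2 := Real.summable_one_div_int_pow.2 (by norm_num)
  have h2 : Summable fun _ : κ => (1 : ℝ) := (hasSum_fintype _).summable
  have h3 := h1.mul_of_nonneg h2 (fun k => by positivity) (fun _ => by norm_num)
  refine Summable.of_nonneg_of_le (fun _ => by positivity) (fun p => ?_) h3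
  have h4 : ‖(monom p.1 (EuclideanSpace.single p.2 1) : C(Circ, V)) -
      monom 0 (EuclideanSpace.single p.2 1)‖ ≤ 2 := by
    rw [ContinuousMap.norm_le _ (by norm_num)]
    intro t
    refine (norm_sub_le _ _).trans ?_
    simp [norm_smul, Circle.norm_coe]
    norm_num
  rw [primVec, norm_smul, mul_pow, norm_inv]
  simp only [Complex.norm_mul, Complex.norm_I, Complex.norm_real, Complex.norm_intCast]
  have h5 : (‖(2 : ℂ)‖ * ‖π‖ * 1 * |(p.1 : ℝ)|)⁻¹ ^ 2 = (4 * π ^ 2)⁻¹ * (1 / (p.1 : ℝ) ^ 2) := by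
    rw [inv_pow, mul_pow, sq_abs, Real.norm_of_nonneg Real.pi_pos.le]
    simp [mul_pow]
    norm_num
    ring
  rw [h5]
  have h6 := Real.pi_gt_three
  calc (4 * π ^ 2)⁻¹ * (1 / (p.1 : ℝ) ^ 2) * _ ^ 2 ≤ (4 * π ^ 2)⁻¹ * (1 / (p.1 : ℝ) ^ 2) * 2 ^ 2 := by
        gcongr
    _ ≤ 4⁻¹ * (1 / (p.1 : ℝ) ^ 2) * 2 ^ 2 := by
        gcongr
        nlinarith
    _ = _ := by ring

/-- The primitive vanishing at `0` of the mean-zero part of `f`. -/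
def prim : L2 V →L[ℂ] C(Circ, V) := fourierHB.hsOp primVec summable_primVec

theorem isCompactOperator_prim : IsCompactOperator (prim : L2 V →L[ℂ] C(Circ, V)) :=
  fourierHB.isCompactOperator_hsOp _ _

theorem hasSum_prim (f : L2 V) :
    HasSum (fun p : ℤ × κ => coef p.1 f p.2 • (primVec p : C(Circ, V))) (prim f) := by
  have h := fourierHB.hasSum_hsOp (primVec (κ := κ)) summable_primVec f
  have e : (fun p => fourierHB.repr f p • (primVec p : C(Circ, V))) =
      fun p : ℤ × κ => coef p.1 f p.2 • (primVec p : C(Circ, V)) := by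
    ext1 p
    rw [fourierHB_repr]
  rw [e] at h
  exact h

theorem prim_apply_zero (f : L2 V) : prim f 0 = 0 := by
  have h := (hasSum_prim f).mapL (ContinuousMap.evalCLM ℂ (0 : Circ))
  have h2 : ∀ p : ℤ × κ, (primVec p : C(Circ, V)) 0 = 0 := by
    intro p
    simp [primVec]
  refine h.unique ?_
  convert hasSum_zero using 1
  ext1 p
  simp [h2]

theorem prim_monom (k : ℤ) (i : κ) :
    prim (toL2 (monom k (EuclideanSpace.single i 1))) = (primVec (k, i) : C(Circ, V)) := by
  refine (hasSum_prim _).unique ?_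
  convert hasSum_ite_eq (k, i) (primVec (k, i) : C(Circ, V)) using 1
  ext1 p
  rw [coef_monom]
  by_cases h1 : p.1 = k <;> by_cases h2 : p.2 = i
  · obtain rfl : p = (k, i) := Prod.ext h1 h2
    rw [if_pos h1, if_pos rfl, PiLp.single_apply, if_pos h2, one_smul]
  all_goals
    have hp : p ≠ (k, i) := fun h => by simp_all
    have h0 : (if p.1 = k then (EuclideanSpace.single i (1 : ℂ) : V) else 0) p.2 = 0 := by
      simp [h1, h2]
    rw [if_neg hp, h0]
    exact zero_smul ℂ (primVec p : C(Circ, V))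

theorem hasDerivAt_monom (k : ℤ) (c : V) (t : ℝ) :
    HasDerivAt (fun s : ℝ => monom k c (s : Circ)) ((2 * π * Complex.I * k : ℂ) • monom k c (t : Circ)) t := by
  have h := (hasDerivAt_fourier (1 : ℝ) k t).smul_const c
  have e : (2 * π * Complex.I * k : ℂ) • monom k c (t : Circ) =
      (2 * π * Complex.I * k / (1 : ℝ) * fourier k (t : Circ) : ℂ) • c := by
    rw [monom_apply, smul_smul]
    simp
  rw [e]
  exact h

theorem hasDerivAt_prim_partialSum (f : L2 V) (hf : coef 0 f = 0) (s : Finset (ℤ × κ)) (t : ℝ) :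
    HasDerivAt (fun x : ℝ => prim (toL2 (partialSum s f)) (x : Circ)) (partialSum s f (t : Circ)) t := by
  have h1 : ∀ x : Circ, prim (toL2 (partialSum s f)) x =
      ∑ p ∈ s, coef p.1 f p.2 • (primVec p : C(Circ, V)) x := by
    intro x
    rw [partialSum]
    simp only [map_sum, map_smul, prim_monom, ContinuousMap.sum_apply, ContinuousMap.smul_apply]
  simp only [h1]
  simp only [partialSum, ContinuousMap.sum_apply]
  refine HasDerivAt.fun_sum fun p _ => ?_
  have h2 := ((hasDerivAt_monom p.1 (EuclideanSpace.single p.2 (1 : ℂ)) t).sub_const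
    (EuclideanSpace.single p.2 (1 : ℂ))).const_smul (coef p.1 f p.2 * (2 * π * Complex.I * p.1 : ℂ)⁻¹)
  have e : (coef p.1 f p.2 * (2 * π * Complex.I * p.1 : ℂ)⁻¹) • (2 * π * Complex.I * p.1 : ℂ) •
      monom p.1 (EuclideanSpace.single p.2 (1 : ℂ)) (t : Circ) =
      (monom p.1 (coef p.1 f p.2 • EuclideanSpace.single p.2 (1 : ℂ)) (t : Circ) : V) := by
    by_cases hp : p.1 = 0
    · simp [hp, hf]
    · have : (2 * π * Complex.I * p.1 : ℂ) ≠ 0 := by simp [hp, Real.pi_ne_zero]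
      rw [smul_smul, mul_assoc, inv_mul_cancel₀ this, mul_one, map_smul]
      rfl
  rw [e] at h2
  refine h2.congr_of_eventuallyEq (Filter.Eventually.of_forall fun x => ?_)
  simp [primVec, smul_smul]

end Prim

section Sequences

theorem sum_ite_lt_two_pow_le {x : ℝ} (hx : 0 < x) (n : ℕ) :
    ∑ j ∈ Finset.range n, (if x < 2 ^ j then ((2 : ℝ) ^ j)⁻¹ else 0) ≤ 2 / x := by
  have h : ∀ n : ℕ, ∑ j ∈ Finset.range n, (if x < 2 ^ j then ((2 : ℝ) ^ j)⁻¹ else 0) ≤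
      2 * (x⁻¹ - min x⁻¹ ((2 : ℝ) ^ n)⁻¹) := by
    intro n
    induction n with
    | zero => simp
    | succ n ih =>
      rw [Finset.sum_range_succ]
      have h2 : ((2 : ℝ) ^ (n + 1))⁻¹ = ((2 : ℝ) ^ n)⁻¹ / 2 := by rw [pow_succ, mul_inv]; ring
      have h3 : (0 : ℝ) < ((2 : ℝ) ^ n)⁻¹ := by positivity
      rw [h2]
      split_ifs with h1
      · have h4 := inv_anti₀ hx h1.le
        rw [min_eq_right h4] at ih
        rw [min_eq_right (by linarith)]
        linarith
      · have : min x⁻¹ (((2 : ℝ) ^ n)⁻¹ / 2) ≤ min x⁻¹ ((2 : ℝ) ^ n)⁻¹ :=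
          min_le_min_left _ (by linarith)
        linarith
  refine (h n).trans ?_
  have : 0 ≤ min x⁻¹ ((2 : ℝ) ^ n)⁻¹ := by positivity
  rw [div_eq_mul_inv]
  linarith

theorem sum_ite_two_pow_le {x : ℝ} (hx : 0 ≤ x) (n : ℕ) :
    ∑ j ∈ Finset.range n, (if (2 : ℝ) ^ j ≤ x then (2 : ℝ) ^ j else 0) ≤ 2 * x := by
  have h : ∀ n : ℕ, ∑ j ∈ Finset.range n, (if (2 : ℝ) ^ j ≤ x then (2 : ℝ) ^ j else 0) ≤
      min ((2 : ℝ) ^ n) (2 * x) := by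
    intro n
    induction n with
    | zero => simpa using hx
    | succ n ih =>
      rw [Finset.sum_range_succ, pow_succ]
      have h3 : (0 : ℝ) < (2 : ℝ) ^ n := by positivity
      have ⟨h4, h5⟩ := le_min_iff.1 ih
      split_ifs with h1
      · rw [le_min_iff]; constructor <;> linarith
      · rw [le_min_iff]; constructor <;> linarith
  exact (h n).trans (min_le_right _ _)

/-- Square-integrable amplitudes with at most one negative mode, balanced by a positive energy
estimate. -/
structure EnergySeq (C : ℝ) (s : ℤ → ℝ) : Prop where
  nonneg : ∀ k, 0 ≤ s k
  summable : Summable s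
  summable_sq : Summable fun k : ℤ => (k : ℝ) ^ 2 * s k
  eq_zero : ∀ k ≤ -2, s k = 0
  energy : ∀ ε : ℝ, |∑' k : ℤ, sin (2 * π * k * ε) * s k| ≤
    C * ∑' k : ℤ, 4 * sin (π * k * ε) ^ 2 * s k

namespace EnergySeq
variable {C : ℝ} {s : ℤ → ℝ}

theorem summable_mul (hs : EnergySeq C s) {f : ℤ → ℝ} {a b : ℝ}
    (hf : ∀ k, |f k| ≤ a + b * (k : ℝ) ^ 2) : Summable fun k => f k * s k := by
  refine Summable.of_norm_bounded (g := fun k => a * s k + b * ((k : ℝ) ^ 2 * s k))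
    ((hs.summable.mul_left a).add (hs.summable_sq.mul_left b)) fun k => ?_
  rw [norm_mul, Real.norm_of_nonneg (hs.nonneg k), Real.norm_eq_abs]
  nlinarith [mul_le_mul_of_nonneg_right (hf k) (hs.nonneg k)]

theorem summable_abs (hs : EnergySeq C s) : Summable fun k : ℤ => |(k : ℝ)| * s k :=
  hs.summable_mul (a := 1) (b := 1) fun k => by
    rw [abs_abs]
    nlinarith [sq_nonneg (|(k : ℝ)| - 1), sq_abs (k : ℝ), abs_nonneg (k : ℝ)]

theorem summable_id (hs : EnergySeq C s) : Summable fun k : ℤ => (k : ℝ) * s k :=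
  hs.summable_mul (a := 1) (b := 1) fun k => by
    nlinarith [sq_nonneg (|(k : ℝ)| - 1), sq_abs (k : ℝ), abs_nonneg (k : ℝ)]

theorem summable_sin (hs : EnergySeq C s) (g : ℤ → ℝ) : Summable fun k : ℤ => sin (g k) * s k :=
  hs.summable_mul (a := 1) (b := 0) fun k => by simpa using abs_sin_le_one _

theorem summable_sin_sq (hs : EnergySeq C s) (g : ℤ → ℝ) :
    Summable fun k : ℤ => sin (g k) ^ 2 * s k :=
  hs.summable_mul (a := 1) (b := 0) fun k => by
    rw [abs_of_nonneg (sq_nonneg _)]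
    simpa using sin_sq_le_one _

theorem abs_sub_sin_le (x : ℝ) : |x - sin x| ≤ 2 * x ^ 2 := by
  have h : ∀ x : ℝ, 0 ≤ x → |x - sin x| ≤ 2 * x ^ 2 := by
    intro x hx
    rw [abs_of_nonneg (sub_nonneg.2 (sin_le hx))]
    rcases hx.eq_or_lt with rfl | h0
    · simp
    rcases le_or_gt x 1 with h1 | h1
    · have := sin_gt_sub_cube h0
      nlinarith [sq_nonneg x]
    · have := neg_one_le_sin x
      nlinarith
  rcases le_total 0 x with hx | hx
  · exact h x hx
  · have := h (-x) (by linarith)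
    rw [sin_neg, neg_sq] at this
    have e : x - sin x = -(-x - -sin x) := by ring
    rw [e, abs_neg]
    exact this

theorem tsum_id (hs : EnergySeq C s) (hC : 0 ≤ C) : ∑' k : ℤ, (k : ℝ) * s k = 0 := by
  set Q := ∑' k : ℤ, (k : ℝ) ^ 2 * s k with hQ
  set D := ∑' k : ℤ, (k : ℝ) * s k with hD
  have hQ0 : 0 ≤ Q := tsum_nonneg fun k => mul_nonneg (sq_nonneg _) (hs.nonneg k)
  have key : ∀ ε : ℝ, 0 < ε → |D| * (2 * π) ≤ (8 * π ^ 2 * Q + C * (4 * π ^ 2 * Q)) * ε := by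
    intro ε hε
    have h1 : |2 * π * ε * D - ∑' k : ℤ, sin (2 * π * k * ε) * s k| ≤ 8 * π ^ 2 * ε ^ 2 * Q := by
      rw [hD, ← tsum_mul_left, ← (hs.summable_id.mul_left _).tsum_sub (hs.summable_sin _), hQ,
        ← tsum_mul_left, ← Real.norm_eq_abs]
      refine tsum_of_norm_bounded (hs.summable_sq.mul_left _).hasSum fun k => ?_
      have h2 := abs_sub_sin_le (2 * π * k * ε)
      have h3 : 2 * π * ε * (k * s k) - sin (2 * π * k * ε) * s k =
          (2 * π * k * ε - sin (2 * π * k * ε)) * s k := by ring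
      rw [h3, norm_mul, Real.norm_of_nonneg (hs.nonneg k), Real.norm_eq_abs]
      refine (mul_le_mul_of_nonneg_right h2 (hs.nonneg k)).trans (le_of_eq ?_)
      ring
    have h2 : ∑' k : ℤ, 4 * sin (π * k * ε) ^ 2 * s k ≤ 4 * π ^ 2 * ε ^ 2 * Q := by
      rw [hQ, ← tsum_mul_left]
      refine Summable.tsum_le_tsum (fun k => ?_) ?_ (hs.summable_sq.mul_left _)
      · have h4 : sin (π * k * ε) ^ 2 ≤ (π * k * ε) ^ 2 := by
          rw [← sq_abs, ← sq_abs (π * k * ε)]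
          exact pow_le_pow_left₀ (abs_nonneg _) (abs_sin_le_abs) 2
        nlinarith [mul_le_mul_of_nonneg_right h4 (hs.nonneg k)]
      · simpa only [mul_assoc] using (hs.summable_sin_sq fun k => π * k * ε).mul_left 4
    have h3 := (hs.energy ε).trans (mul_le_mul_of_nonneg_left h2 hC)
    have h4 := abs_sub_abs_le_abs_sub (2 * π * ε * D) (∑' k : ℤ, sin (2 * π * k * ε) * s k)
    rw [abs_mul, abs_of_pos (by positivity : 0 < 2 * π * ε)] at h4
    have h5 : (|D| * (2 * π)) * ε ≤ ((8 * π ^ 2 * Q + C * (4 * π ^ 2 * Q)) * ε) * ε := by nlinarith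
    exact le_of_mul_le_mul_right h5 hε
  set a := 8 * π ^ 2 * Q + C * (4 * π ^ 2 * Q)
  have h6 : |D| * (2 * π) ≤ 0 := by
    refine le_of_forall_pos_le_add fun η hη => ?_
    have ha : 0 ≤ a := by positivity
    refine (key (η / (a + 1)) (by positivity)).trans ?_
    rw [zero_add, mul_div_assoc', div_le_iff₀ (by positivity)]
    nlinarith
  have h7 : |D| ≤ 0 := by nlinarith [Real.pi_pos]
  exact abs_nonpos_iff.1 h7

theorem tsum_abs (hs : EnergySeq C s) (hC : 0 ≤ C) : ∑' k : ℤ, |(k : ℝ)| * s k = 2 * s (-1) := by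
  have h1 := (hs.summable_abs.hasSum).sub (hs.summable_id.hasSum)
  rw [hs.tsum_id hC, sub_zero] at h1
  have h2 : HasSum (fun k : ℤ => |(k : ℝ)| * s k - k * s k) (2 * s (-1)) := by
    convert hasSum_ite_eq (-1 : ℤ) (2 * s (-1)) using 1
    ext1 k
    split_ifs with hk
    · subst hk; norm_num; ring
    · rcases le_or_gt 0 k with h | h
      · rw [abs_of_nonneg (by exact_mod_cast h)]; ring
      · rw [hs.eq_zero k (by omega)]; ring
  exact h1.unique h2

theorem sum_le (hs : EnergySeq C s) (hC : 0 ≤ C) (T : Finset ℤ) (hT : ∀ k ∈ T, 0 < k) :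
    ∑ k ∈ T, (k : ℝ) * s k ≤ s (-1) := by
  have h1 : ∑ k ∈ insert (-1) T, |(k : ℝ)| * s k ≤ ∑' k : ℤ, |(k : ℝ)| * s k :=
    hs.summable_abs.sum_le_tsum _ fun k _ => mul_nonneg (abs_nonneg _) (hs.nonneg k)
  rw [Finset.sum_insert (fun h => by have := hT _ h; omega), hs.tsum_abs hC] at h1
  have h2 : ∑ k ∈ T, |(k : ℝ)| * s k = ∑ k ∈ T, (k : ℝ) * s k :=
    Finset.sum_congr rfl fun k hk => by rw [abs_of_pos (by exact_mod_cast hT k hk)]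
  rw [h2] at h1
  norm_num at h1
  linarith

theorem abs_sin_nat_mul_le (n : ℕ) (x : ℝ) : |sin (n * x)| ≤ n * |sin x| := by
  induction n with
  | zero => simp
  | succ n ih =>
    push_cast
    rw [add_mul, one_mul, sin_add, add_mul, one_mul]
    refine (abs_add_le _ _).trans ?_
    rw [abs_mul, abs_mul]
    have h1 := abs_cos_le_one x
    have h2 := abs_cos_le_one (n * x)
    nlinarith [abs_nonneg (sin x), abs_nonneg (sin (n * x))]

theorem dyadic_lower_bound (hC : 0 ≤ C) {j : ℕ} (hj : 2 ≤ j) {k : ℤ} (hk : -1 ≤ k) :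
    (if (1 + 2 * C) * 2 ^ j ≤ k then (k : ℝ) else 0) -
      4 * C * π ^ 2 * (k : ℝ) ^ 2 * (if |(k : ℝ)| / (1 + 2 * C) < 2 ^ j then ((2 : ℝ) ^ j)⁻¹ else 0) ≤
    2 ^ j * (k * sin (2 * π * ((2 : ℝ) ^ j)⁻¹) - sin (2 * π * k * ((2 : ℝ) ^ j)⁻¹) -
      C * (4 * sin (π * k * ((2 : ℝ) ^ j)⁻¹) ^ 2)) := by
  have hp : (0 : ℝ) < 2 ^ j := by positivity
  have h4 : (4 : ℝ) ≤ 2 ^ j := by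
    calc (4 : ℝ) = 2 ^ 2 := by norm_num
      _ ≤ 2 ^ j := pow_le_pow_right₀ (by norm_num) hj
  set q := ((2 : ℝ) ^ j)⁻¹ with hq
  have hq0 : 0 < q := by positivity
  have hq4 : q ≤ 1 / 4 := by rw [hq, one_div]; exact inv_anti₀ (by norm_num) h4
  have hpq : (2 : ℝ) ^ j * q = 1 := mul_inv_cancel₀ hp.ne'
  have hM : 0 < 1 + 2 * C := by positivity
  have hk' : (-1 : ℝ) ≤ k := by exact_mod_cast hk
  by_cases h1 : (1 + 2 * C) * 2 ^ j ≤ (k : ℝ)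
  · have hk0 : 0 < (k : ℝ) := lt_of_lt_of_le (by positivity) h1
    rw [if_pos h1, abs_of_pos hk0, if_neg (by rw [not_lt, le_div_iff₀ hM]; linarith), mul_zero,
      sub_zero]
    have h2 : 4 * q ≤ sin (2 * π * q) := by
      have := Real.mul_le_sin (x := 2 * π * q) (by positivity) (by nlinarith [Real.pi_pos])
      have e : 2 / π * (2 * π * q) = 4 * q := by field_simp; ring
      rwa [e] at this
    have h3 := sin_le_one (2 * π * k * q)
    have h5 := sin_sq_le_one (π * k * q)
    have h6 : (1 + 2 * C) ≤ k * q := by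
      have := mul_le_mul_of_nonneg_right h1 hq0.le
      rwa [mul_assoc, hpq, mul_one] at this
    have h7 : (k : ℝ) * q ≤ k * sin (2 * π * q) - sin (2 * π * k * q) -
        C * (4 * sin (π * k * q) ^ 2) := by nlinarith
    calc (k : ℝ) = 2 ^ j * (k * q) := by rw [mul_comm (k : ℝ), ← mul_assoc, hpq, one_mul]
      _ ≤ _ := by gcongr
  · have h2 : 0 ≤ k * sin (2 * π * q) - sin (2 * π * k * q) := by
      rcases (by omega : k = -1 ∨ 0 ≤ k) with rfl | h
      · have e : 2 * π * ((-1 : ℤ) : ℝ) * q = -(2 * π * q) := by push_cast; ring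
        rw [e, sin_neg]; push_cast; linarith
      · obtain ⟨n, rfl⟩ := Int.eq_ofNat_of_zero_le h
        have := abs_sin_nat_mul_le n (2 * π * q)
        have hs0 : 0 ≤ sin (2 * π * q) := sin_nonneg_of_nonneg_of_le_pi (by positivity)
          (by nlinarith [Real.pi_pos])
        rw [abs_of_nonneg hs0] at this
        have h8 := (le_abs_self _).trans this
        have e : 2 * π * ((n : ℤ) : ℝ) * q = n * (2 * π * q) := by push_cast; ring
        rw [e]; push_cast; linarith
    have h3 : sin (π * k * q) ^ 2 ≤ (π * k * q) ^ 2 := by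
      rw [← sq_abs, ← sq_abs (π * k * q)]
      exact pow_le_pow_left₀ (abs_nonneg _) (abs_sin_le_abs) 2
    have h5 : |(k : ℝ)| / (1 + 2 * C) < 2 ^ j := by
      rw [div_lt_iff₀ hM]
      rcases abs_cases (k : ℝ) with h | h <;> nlinarith
    rw [if_neg h1, if_pos h5]
    have h9 : 2 ^ j * (C * (4 * sin (π * k * q) ^ 2)) ≤ 2 ^ j * (C * (4 * (π * k * q) ^ 2)) := by
      gcongr
    have e : 2 ^ j * (C * (4 * (π * k * q) ^ 2)) = 4 * C * π ^ 2 * (k : ℝ) ^ 2 * q := by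
      calc _ = (2 ^ j * q) * (4 * C * π ^ 2 * (k : ℝ) ^ 2 * q) := by ring
        _ = _ := by rw [hpq, one_mul]
    nlinarith [mul_nonneg hp.le h2]

theorem exists_tail_le (hC : 0 ≤ C) (E : ℝ) {η : ℝ} (hη : 0 < η) :
    ∃ K : ℕ, ∀ s, EnergySeq C s → s (-1) ≤ E → ∀ T : Finset ℤ, (∀ k ∈ T, (K : ℤ) ≤ k) →
      ∑ k ∈ T, (k : ℝ) * s k ≤ η := by
  obtain ⟨N, hN⟩ := exists_nat_gt (16 * C * π ^ 2 * (1 + 2 * C) * E / η)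
  obtain ⟨K, hK⟩ := exists_nat_ge ((1 + 2 * C) * 2 ^ (N + 2))
  refine ⟨K, fun s hs hE T hT => ?_⟩
  have hM : 0 < 1 + 2 * C := by positivity
  set Ψ : ℕ → ℤ → ℝ := fun j k => 2 ^ j * (k * sin (2 * π * ((2 : ℝ) ^ j)⁻¹) -
    sin (2 * π * k * ((2 : ℝ) ^ j)⁻¹) - C * (4 * sin (π * k * ((2 : ℝ) ^ j)⁻¹) ^ 2)) with hΨ
  have h1 : ∀ j, ∃ v ≤ 0, HasSum (fun k => Ψ j k * s k) v := by
    intro j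
    set q := ((2 : ℝ) ^ j)⁻¹
    have a1 := hs.summable_id.hasSum.mul_left (sin (2 * π * q))
    have a2 := (hs.summable_sin fun k => 2 * π * k * q).hasSum
    have a3 : Summable fun k : ℤ => 4 * sin (π * k * q) ^ 2 * s k := by
      simpa only [mul_assoc] using (hs.summable_sin_sq fun k => π * k * q).mul_left 4
    have a4 := ((a1.sub a2).sub (a3.hasSum.mul_left C)).mul_left (2 ^ j)
    have e : (fun k => Ψ j k * s k) = fun i : ℤ => 2 ^ j * (sin (2 * π * q) * (↑i * s i) -
        sin (2 * π * ↑i * q) * s i - C * (4 * sin (π * ↑i * q) ^ 2 * s i)) := by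
      ext1 k
      simp only [hΨ, q]
      ring
    refine ⟨_, ?_, e ▸ a4⟩
    rw [hs.tsum_id hC, mul_zero, zero_sub]
    have := neg_le_of_abs_le (hs.energy q)
    exact mul_nonpos_of_nonneg_of_nonpos (by positivity) (by linarith)
  choose v hv hv2 using h1
  have h2 : HasSum (fun k => (∑ j ∈ Finset.Ico 2 (N + 2), Ψ j k * s k) +
      8 * C * π ^ 2 * (1 + 2 * C) * (|(k : ℝ)| * s k))
      ((∑ j ∈ Finset.Ico 2 (N + 2), v j) + 8 * C * π ^ 2 * (1 + 2 * C) * (2 * s (-1))) := by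
    rw [← hs.tsum_abs hC]
    exact (hasSum_sum fun j _ => hv2 j).add (hs.summable_abs.hasSum.mul_left _)
  have h3 : ∀ k : ℤ, -1 ≤ k → ∑ j ∈ Finset.Ico 2 (N + 2),
      (if (1 + 2 * C) * 2 ^ j ≤ k then (k : ℝ) else 0) ≤
      (∑ j ∈ Finset.Ico 2 (N + 2), Ψ j k) + 8 * C * π ^ 2 * (1 + 2 * C) * |(k : ℝ)| := by
    intro k hk
    have b1 := Finset.sum_le_sum fun j (hj : j ∈ Finset.Ico 2 (N + 2)) =>
      dyadic_lower_bound hC (Finset.mem_Ico.1 hj).1 hk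
    rw [Finset.sum_sub_distrib, ← Finset.mul_sum] at b1
    have b2 : 4 * C * π ^ 2 * (k : ℝ) ^ 2 * ∑ j ∈ Finset.Ico 2 (N + 2),
        (if |(k : ℝ)| / (1 + 2 * C) < 2 ^ j then ((2 : ℝ) ^ j)⁻¹ else 0) ≤
        8 * C * π ^ 2 * (1 + 2 * C) * |(k : ℝ)| := by
      by_cases hk0 : k = 0
      · simp [hk0]
      have hk1 : 0 < |(k : ℝ)| := by positivity
      have b3 : ∑ j ∈ Finset.Ico 2 (N + 2),
          (if |(k : ℝ)| / (1 + 2 * C) < 2 ^ j then ((2 : ℝ) ^ j)⁻¹ else 0) ≤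
          2 / (|(k : ℝ)| / (1 + 2 * C)) := by
        refine (Finset.sum_le_sum_of_subset_of_nonneg (t := Finset.range (N + 2)) ?_ ?_).trans
          (sum_ite_lt_two_pow_le (by positivity) _)
        · intro j hj; exact Finset.mem_range.2 (Finset.mem_Ico.1 hj).2
        · intro j _ _; split_ifs <;> positivity
      refine (mul_le_mul_of_nonneg_left b3 (by positivity)).trans (le_of_eq ?_)
      rw [← sq_abs (k : ℝ)]
      field_simp
      ring
    linarith
  have h4 : ∀ k : ℤ, 0 ≤ (∑ j ∈ Finset.Ico 2 (N + 2), Ψ j k * s k) +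
      8 * C * π ^ 2 * (1 + 2 * C) * (|(k : ℝ)| * s k) := by
    intro k
    rcases lt_or_ge k (-1) with hk | hk
    · simp [hs.eq_zero k (by omega)]
    · rw [← Finset.sum_mul, ← mul_assoc, ← add_mul]
      refine mul_nonneg (le_trans (Finset.sum_nonneg fun j _ => ?_) (h3 k hk)) (hs.nonneg k)
      split_ifs with h
      · exact le_trans (by positivity) h
      · exact le_rfl
  have h5 := sum_le_hasSum T (fun k _ => h4 k) h2
  have h6 : ∀ k ∈ T, N * ((k : ℝ) * s k) ≤ (∑ j ∈ Finset.Ico 2 (N + 2), Ψ j k * s k) +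
      8 * C * π ^ 2 * (1 + 2 * C) * (|(k : ℝ)| * s k) := by
    intro k hk
    have c1 : (K : ℝ) ≤ k := by exact_mod_cast hT k hk
    have c2 : (-1 : ℤ) ≤ k := by have := hT k hk; omega
    rw [← Finset.sum_mul, ← mul_assoc, ← mul_assoc, ← add_mul]
    refine mul_le_mul_of_nonneg_right (le_trans (le_of_eq ?_) (h3 k c2)) (hs.nonneg k)
    rw [Finset.sum_congr rfl (g := fun _ => (k : ℝ))]
    · simp
    · intro j hj
      rw [if_pos]
      refine le_trans ?_ (hK.trans c1)
      gcongr
      · norm_num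
      · exact (Finset.mem_Ico.1 hj).2.le
  have h7 := (Finset.sum_le_sum h6).trans h5
  rw [← Finset.mul_sum] at h7
  have h8 : ∑ j ∈ Finset.Ico 2 (N + 2), v j ≤ 0 := Finset.sum_nonpos fun j _ => hv j
  have h9 : 8 * C * π ^ 2 * (1 + 2 * C) * (2 * s (-1)) ≤ 16 * C * π ^ 2 * (1 + 2 * C) * E := by
    have : 16 * C * π ^ 2 * (1 + 2 * C) * s (-1) ≤ 16 * C * π ^ 2 * (1 + 2 * C) * E := by gcongr
    linarith
  have h10 : 16 * C * π ^ 2 * (1 + 2 * C) * E < N * η := by rwa [div_lt_iff₀ hη] at hN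
  by_contra! h11
  have hN0 : (0 : ℝ) ≤ N := N.cast_nonneg
  nlinarith [mul_le_mul_of_nonneg_left h11.le hN0]

theorem two_pow_mul_sin_sq_le (k : ℤ) (j : ℕ) :
    (2 : ℝ) ^ j * sin (π * k * ((2 : ℝ) ^ j)⁻¹) ^ 2 ≤
      π ^ 2 * (k : ℝ) ^ 2 * ((2 : ℝ) ^ j)⁻¹ := by
  have hp : (0 : ℝ) < 2 ^ j := by positivity
  set q := ((2 : ℝ) ^ j)⁻¹ with hq
  have hpq : (2 : ℝ) ^ j * q = 1 := mul_inv_cancel₀ hp.ne'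
  have h3 : sin (π * k * q) ^ 2 ≤ (π * k * q) ^ 2 := by
    rw [← sq_abs, ← sq_abs (π * k * q)]
    exact pow_le_pow_left₀ (abs_nonneg _) (abs_sin_le_abs) 2
  calc (2 : ℝ) ^ j * sin (π * k * q) ^ 2 ≤ 2 ^ j * (π * k * q) ^ 2 := by gcongr
    _ = (2 ^ j * q) * (π ^ 2 * (k : ℝ) ^ 2 * q) := by ring
    _ = _ := by rw [hpq, one_mul]

theorem sum_two_pow_mul_sin_sq_le (k : ℤ) (J n : ℕ) :
    ∑ j ∈ Finset.Ico J n, (2 : ℝ) ^ j * sin (π * k * ((2 : ℝ) ^ j)⁻¹) ^ 2 ≤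
      4 * π ^ 2 * |(k : ℝ)| := by
  by_cases hk0 : k = 0
  · simp [hk0]
  have hk : 1 ≤ |(k : ℝ)| := by exact_mod_cast Int.one_le_abs hk0
  have hpi := Real.pi_gt_three
  have h1 : ∀ j : ℕ, (2 : ℝ) ^ j * sin (π * k * ((2 : ℝ) ^ j)⁻¹) ^ 2 ≤
      π ^ 2 * (if (2 : ℝ) ^ j ≤ |(k : ℝ)| then (2 : ℝ) ^ j else 0) +
      π ^ 2 * (k : ℝ) ^ 2 * (if |(k : ℝ)| < 2 ^ j then ((2 : ℝ) ^ j)⁻¹ else 0) := by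
    intro j
    by_cases h : (2 : ℝ) ^ j ≤ |(k : ℝ)|
    · rw [if_pos h, if_neg (not_lt.2 h), mul_zero, add_zero, mul_comm]
      have := sin_sq_le_one (π * k * ((2 : ℝ) ^ j)⁻¹)
      exact mul_le_mul_of_nonneg_right (by nlinarith) (by positivity)
    · rw [if_neg h, if_pos (not_le.1 h), mul_zero, zero_add]
      exact two_pow_mul_sin_sq_le k j
  refine (Finset.sum_le_sum fun j _ => h1 j).trans ?_
  refine (Finset.sum_le_sum_of_subset_of_nonneg (t := Finset.range n)
    (fun j hj => Finset.mem_range.2 (Finset.mem_Ico.1 hj).2) fun j _ _ => ?_).trans ?_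
  · split_ifs <;> positivity
  rw [Finset.sum_add_distrib, ← Finset.mul_sum, ← Finset.mul_sum]
  have h2 := sum_ite_two_pow_le (abs_nonneg (k : ℝ)) n
  have h3 := sum_ite_lt_two_pow_le (x := |(k : ℝ)|) (by positivity) n
  refine (add_le_add (mul_le_mul_of_nonneg_left h2 (by positivity))
    (mul_le_mul_of_nonneg_left h3 (by positivity))).trans (le_of_eq ?_)
  rw [← sq_abs (k : ℝ)]
  field_simp
  ring

theorem sum_inv_two_pow_le (J n : ℕ) :
    ∑ j ∈ Finset.Ico J n, ((2 : ℝ) ^ j)⁻¹ ≤ 2 * ((2 : ℝ) ^ J)⁻¹ := by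
  rcases le_total n J with h | h
  · rw [Finset.Ico_eq_empty_of_le h]; simp
  have : ∀ m, ∑ j ∈ Finset.Ico J (J + m), ((2 : ℝ) ^ j)⁻¹ =
      2 * ((2 : ℝ) ^ J)⁻¹ - 2 * ((2 : ℝ) ^ (J + m))⁻¹ := by
    intro m
    induction m with
    | zero => simp
    | succ m ih =>
      rw [← add_assoc, Finset.sum_Ico_succ_top (by omega), ih, pow_succ _ (J + m), mul_inv]
      ring
  obtain ⟨m, rfl⟩ := Nat.exists_eq_add_of_le h
  rw [this m]
  have : 0 ≤ ((2 : ℝ) ^ (J + m))⁻¹ := by positivity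
  linarith

theorem le_two_pow_mul_sin_sq {k : ℤ} {j : ℕ} (h1 : (2 : ℝ) ^ j ≤ 4 * k) (h2 : 2 * (k : ℝ) ≤ 2 ^ j) :
    (k : ℝ) ≤ 2 ^ j * sin (π * k * ((2 : ℝ) ^ j)⁻¹) ^ 2 := by
  have hp : (0 : ℝ) < 2 ^ j := by positivity
  set q := ((2 : ℝ) ^ j)⁻¹ with hq
  have hq0 : 0 < q := by positivity
  have hpq : (2 : ℝ) ^ j * q = 1 := mul_inv_cancel₀ hp.ne'
  have a1 : 1 ≤ 4 * k * q := by nlinarith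
  have a2 : 2 * k * q ≤ 1 := by nlinarith
  have hpi := Real.pi_pos
  have a3 : 0 ≤ -cos (2 * (π * k * q)) := by
    rw [Left.nonneg_neg_iff]
    exact cos_nonpos_of_pi_div_two_le_of_le (by nlinarith) (by nlinarith)
  have a4 : 1 / 2 ≤ sin (π * k * q) ^ 2 := by
    rw [sin_sq_eq_half_sub]
    linarith
  nlinarith

theorem exists_tail_le_of_le (hC : 0 ≤ C) {D : ℝ} (hD : 0 ≤ D) (E : ℝ) {η : ℝ} (hη : 0 < η) :
    ∃ K : ℕ, ∀ s b : ℤ → ℝ, EnergySeq C s → s (-1) ≤ E → (∀ k, 0 ≤ b k) → Summable b →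
      (∀ ε : ℝ, ∑' k : ℤ, sin (π * k * ε) ^ 2 * b k ≤ D * ∑' k : ℤ, sin (π * k * ε) ^ 2 * s k) →
      ∀ T : Finset ℤ, (∀ k ∈ T, (K : ℤ) < k) → ∑ k ∈ T, (k : ℝ) * b k ≤ η := by
  have hpi := Real.pi_pos
  obtain ⟨K₀, hK₀⟩ := exists_tail_le hC E (η := η / (2 * (D * (4 * π ^ 2) + 1))) (by positivity)
  obtain ⟨J, hJ⟩ := pow_unbounded_of_one_lt (8 * D * π ^ 2 * (K₀ + 1) * E / η) (one_lt_two)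
  refine ⟨2 ^ J, fun s b hs hsE hb hbs hbD T hT => ?_⟩
  obtain ⟨N, hN⟩ : ∃ N : ℕ, ∀ k ∈ T, 4 * k ≤ 2 ^ N := by
    obtain ⟨B, hB⟩ := T.finite_toSet.bddAbove
    obtain ⟨N, hN⟩ := pow_unbounded_of_one_lt (4 * B) (by norm_num : (1 : ℤ) < 2)
    exact ⟨N, fun k hk => by have := hB hk; linarith⟩
  set Ω : ℤ → ℝ := fun k => ∑ j ∈ Finset.Ico J (N + 1), (2 : ℝ) ^ j *
    sin (π * k * ((2 : ℝ) ^ j)⁻¹) ^ 2 with hΩ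
  have hΩ0 : ∀ k, 0 ≤ Ω k := fun k => Finset.sum_nonneg fun j _ => by positivity
  have h1 : ∀ k ∈ T, (k : ℝ) ≤ Ω k := by
    intro k hk
    have hk1 := hT k hk
    have hk0 : 0 < k := lt_of_le_of_lt (by positivity) hk1
    obtain ⟨j, hj1, hj2⟩ : ∃ j : ℕ, (2 : ℤ) ^ j ≤ 4 * k ∧ 4 * k < 2 ^ (j + 1) := by
      obtain ⟨j, h1, h2⟩ := exists_nat_pow_near (x := 4 * k) (y := 2) (by omega) (by norm_num)
      exact ⟨j, h1, h2⟩
    have hjJ : J ≤ j := by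
      by_contra! h
      have : (2 : ℤ) ^ (j + 1) ≤ 2 ^ J := pow_le_pow_right₀ (by norm_num) (by omega)
      push_cast at hk1
      omega
    have hjN : j ≤ N := by
      have : (2 : ℤ) ^ j ≤ 2 ^ N := hj1.trans (hN k hk)
      exact (pow_le_pow_iff_right₀ (by norm_num)).1 this
    have h3 : (k : ℝ) ≤ 2 ^ j * sin (π * k * ((2 : ℝ) ^ j)⁻¹) ^ 2 := by
      refine le_two_pow_mul_sin_sq (by exact_mod_cast hj1) ?_
      have h4 : 2 * k ≤ 2 ^ j := by rw [pow_succ] at hj2; omega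
      exact_mod_cast h4
    exact h3.trans (Finset.single_le_sum (f := fun j : ℕ => (2 : ℝ) ^ j *
      sin (π * k * ((2 : ℝ) ^ j)⁻¹) ^ 2) (fun j _ => by positivity)
      (Finset.mem_Ico.2 ⟨hjJ, Nat.lt_succ_of_le hjN⟩))
  have hbsum : ∀ g : ℤ → ℝ, Summable fun k : ℤ => sin (g k) ^ 2 * b k := fun g => by
    refine Summable.of_nonneg_of_le (fun k => mul_nonneg (sq_nonneg _) (hb k)) (fun k => ?_) hbs
    have := sin_sq_le_one (g k)
    nlinarith [hb k]
  have h2 : HasSum (fun k => Ω k * b k) (∑ j ∈ Finset.Ico J (N + 1), (2 : ℝ) ^ j *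
      ∑' k : ℤ, sin (π * k * ((2 : ℝ) ^ j)⁻¹) ^ 2 * b k) := by
    have h := hasSum_sum fun j (_ : j ∈ Finset.Ico J (N + 1)) =>
      (hbsum fun k => π * k * ((2 : ℝ) ^ j)⁻¹).hasSum.mul_left ((2 : ℝ) ^ j)
    have e : (fun k => Ω k * b k) = fun k : ℤ => ∑ j ∈ Finset.Ico J (N + 1), (2 : ℝ) ^ j *
      (sin (π * k * ((2 : ℝ) ^ j)⁻¹) ^ 2 * b k) := by
      ext1 k
      simp only [hΩ, Finset.sum_mul, mul_assoc]
    exact e ▸ h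
  have h3 : HasSum (fun k => Ω k * s k) (∑ j ∈ Finset.Ico J (N + 1), (2 : ℝ) ^ j *
      ∑' k : ℤ, sin (π * k * ((2 : ℝ) ^ j)⁻¹) ^ 2 * s k) := by
    have h := hasSum_sum fun j (_ : j ∈ Finset.Ico J (N + 1)) =>
      (hs.summable_sin_sq fun k => π * k * ((2 : ℝ) ^ j)⁻¹).hasSum.mul_left ((2 : ℝ) ^ j)
    have e : (fun k => Ω k * s k) = fun k : ℤ => ∑ j ∈ Finset.Ico J (N + 1), (2 : ℝ) ^ j *
      (sin (π * k * ((2 : ℝ) ^ j)⁻¹) ^ 2 * s k) := by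
      ext1 k
      simp only [hΩ, Finset.sum_mul, mul_assoc]
    exact e ▸ h
  have h4 : ∑ j ∈ Finset.Ico J (N + 1), (2 : ℝ) ^ j *
      ∑' k : ℤ, sin (π * k * ((2 : ℝ) ^ j)⁻¹) ^ 2 * b k ≤
      D * ∑ j ∈ Finset.Ico J (N + 1), (2 : ℝ) ^ j *
      ∑' k : ℤ, sin (π * k * ((2 : ℝ) ^ j)⁻¹) ^ 2 * s k := by
    rw [Finset.mul_sum]
    refine Finset.sum_le_sum fun j _ => ?_
    have := mul_le_mul_of_nonneg_left (hbD ((2 : ℝ) ^ j)⁻¹) (by positivity : (0 : ℝ) ≤ 2 ^ j)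
    linarith
  have h5 : ∑ k ∈ T, (k : ℝ) * b k ≤ D * ∑' k, Ω k * s k := by
    rw [h3.tsum_eq]
    refine le_trans ?_ h4
    refine le_trans (Finset.sum_le_sum fun k hk => mul_le_mul_of_nonneg_right (h1 k hk) (hb k)) ?_
    exact sum_le_hasSum T (fun k _ => mul_nonneg (hΩ0 k) (hb k)) h2
  have h6 : ∑' k, Ω k * s k ≤ 2 * π ^ 2 * ((2 : ℝ) ^ J)⁻¹ * (K₀ + 1) * (2 * E) +
      4 * π ^ 2 * (η / (2 * (D * (4 * π ^ 2) + 1))) := by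
    refine h3.summable.tsum_le_of_sum_le fun A => ?_
    have c1 : ∀ k : ℤ, Ω k * s k ≤ 2 * π ^ 2 * ((2 : ℝ) ^ J)⁻¹ * (K₀ + 1) * (|(k : ℝ)| * s k) +
        4 * π ^ 2 * (if (K₀ : ℤ) ≤ k then (k : ℝ) * s k else 0) := by
      intro k
      have hsk := hs.nonneg k
      split_ifs with h
      · have h' : (0 : ℝ) ≤ k := by exact_mod_cast le_trans (by positivity) h
        have := sum_two_pow_mul_sin_sq_le k J (N + 1)
        rw [abs_of_nonneg h'] at this
        have h9 := mul_le_mul_of_nonneg_right this hsk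
        have : 0 ≤ 2 * π ^ 2 * ((2 : ℝ) ^ J)⁻¹ * (K₀ + 1) * (|(k : ℝ)| * s k) := by positivity
        linarith
      · rcases lt_or_ge k (-1) with hk | hk
        · simp [hs.eq_zero k (by omega)]
        rw [mul_zero, add_zero, ← mul_assoc]
        refine mul_le_mul_of_nonneg_right ?_ hsk
        refine (Finset.sum_le_sum fun j _ => two_pow_mul_sin_sq_le k j).trans ?_
        rw [← Finset.mul_sum]
        refine (mul_le_mul_of_nonneg_left (sum_inv_two_pow_le J (N + 1)) (by positivity)).trans ?_
        have hk2 : |(k : ℝ)| ≤ K₀ + 1 := by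
          rw [abs_le]
          push Not at h
          constructor
          · have : (-1 : ℝ) ≤ k := by exact_mod_cast hk
            have : (0 : ℝ) ≤ K₀ := by positivity
            linarith
          · have : (k : ℝ) < K₀ := by exact_mod_cast h
            linarith
        rw [← sq_abs (k : ℝ)]
        have : 0 ≤ 2 * π ^ 2 * ((2 : ℝ) ^ J)⁻¹ * |(k : ℝ)| := by positivity
        nlinarith [mul_le_mul_of_nonneg_left hk2 this]
    refine (Finset.sum_le_sum fun k _ => c1 k).trans ?_
    rw [Finset.sum_add_distrib, ← Finset.mul_sum, ← Finset.mul_sum, ← Finset.sum_filter]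
    have c2 : ∑ k ∈ A, |(k : ℝ)| * s k ≤ 2 * E := by
      have := hs.summable_abs.sum_le_tsum A fun k _ => mul_nonneg (abs_nonneg _) (hs.nonneg k)
      rw [hs.tsum_abs hC] at this
      linarith
    have c3 := hK₀ s hs hsE (A.filter fun k => (K₀ : ℤ) ≤ k) fun k hk => (Finset.mem_filter.1 hk).2
    gcongr
  refine h5.trans ?_
  refine (mul_le_mul_of_nonneg_left h6 hD).trans ?_
  have h7 : D * (2 * π ^ 2 * ((2 : ℝ) ^ J)⁻¹ * (K₀ + 1) * (2 * E)) ≤ η / 2 := by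
    rw [div_lt_iff₀ hη] at hJ
    have e : D * (2 * π ^ 2 * ((2 : ℝ) ^ J)⁻¹ * (K₀ + 1) * (2 * E)) =
        (8 * D * π ^ 2 * (K₀ + 1) * E) / 2 / 2 ^ J := by field_simp; ring
    rw [e, div_le_iff₀ (by positivity)]
    linarith
  have h8 : D * (4 * π ^ 2 * (η / (2 * (D * (4 * π ^ 2) + 1)))) ≤ η / 2 := by
    have e : D * (4 * π ^ 2 * (η / (2 * (D * (4 * π ^ 2) + 1)))) =
        (D * (4 * π ^ 2)) / (D * (4 * π ^ 2) + 1) * (η / 2) := by field_simp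
    rw [e]
    refine mul_le_of_le_one_left (by positivity) ?_
    rw [div_le_one (by positivity)]
    linarith
  rw [mul_add]
  linarith

end EnergySeq
end Sequences

section Conj
variable {κ : Type*} [Fintype κ]

local notation "V" => EuclideanSpace ℂ κ
local notation "E" => EuclideanSpace ℝ κ

/-- Coordinatewise complex conjugation. -/
def conjV : V →ₗᵢ[ℝ] V where
  toFun v := WithLp.toLp 2 fun i => (starRingEnd ℂ) (v i)
  map_add' v w := by ext i; simp
  map_smul' c v := by ext i; simp
  norm_map' v := by simp [EuclideanSpace.norm_eq]

@[simp] theorem conjV_apply (v : V) (i : κ) : conjV v i = (starRingEnd ℂ) (v i) := rfl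

/-- Coordinatewise inclusion of the real vectors. -/
def ofRealV : E →ₗᵢ[ℝ] V where
  toFun v := WithLp.toLp 2 fun i => (v i : ℂ)
  map_add' v w := by ext i; simp
  map_smul' c v := by ext i; simp
  norm_map' v := by simp [EuclideanSpace.norm_eq]

@[simp] theorem ofRealV_apply (v : E) (i : κ) : ofRealV v i = (v i : ℂ) := rfl

/-- Coordinatewise real part. -/
def reV : V →L[ℝ] E :=
  (EuclideanSpace.equiv κ ℝ).symm.toContinuousLinearMap ∘L
    ContinuousLinearMap.pi fun i => Complex.reCLM ∘L
      (EuclideanSpace.proj i : V →L[ℂ] ℂ).restrictScalars ℝ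

@[simp] theorem reV_apply (v : V) (i : κ) : reV v i = (v i).re := rfl

theorem ofRealV_two_smul_reV (v : V) : ofRealV ((2 : ℝ) • reV v) = v + conjV v := by
  ext i
  simp [Complex.add_conj]

@[simp] theorem conjV_conjV (v : V) : conjV (conjV v) = v := by
  ext i; simp

theorem conjV_smul (c : ℂ) (v : V) : conjV (c • v) = (starRingEnd ℂ) c • conjV v := by
  ext i; simp

theorem conjV_ofRealV (v : E) : conjV (ofRealV v) = ofRealV v := by
  ext i; simp

/-- Pointwise complex conjugation on `L²`. -/
def conjL2 : L2 V →L[ℝ] L2 V := conjV.toContinuousLinearMap.compLpL 2 haarAddCircle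

theorem coeFn_conjL2 (f : L2 V) : conjL2 f =ᵐ[haarAddCircle] fun t => conjV (f t) :=
  ContinuousLinearMap.coeFn_compLpL _ f

theorem norm_conjL2 (f : L2 V) : ‖conjL2 f‖ = ‖f‖ := by
  rw [Lp.norm_def, Lp.norm_def]
  congr 1
  refine eLpNorm_congr_norm_ae ?_
  filter_upwards [coeFn_conjL2 f] with t ht
  rw [ht, LinearIsometry.norm_map]

theorem coef_conjL2 (k : ℤ) (f : L2 V) : coef k (conjL2 f) = conjV (coef (-k) f) := by
  rw [coef_apply, coef_apply, fourierCoeff, fourierCoeff]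
  have h : ∀ g : Circ → V, conjV (∫ t, g t ∂haarAddCircle) = ∫ t, conjV (g t) ∂haarAddCircle :=
    fun g => (conjV.integral_comp_comm g).symm
  rw [h]
  refine integral_congr_ae ?_
  filter_upwards [coeFn_conjL2 f] with t ht
  rw [ht, conjV_smul, neg_neg, fourier_neg]

theorem toL2_conj (f g : C(Circ, V)) (h : ∀ t, g t = conjV (f t)) : toL2 g = conjL2 (toL2 f) := by
  refine Lp.ext ?_
  filter_upwards [coeFn_toL2 g, coeFn_toL2 f, coeFn_conjL2 (toL2 f)] with t h1 h2 h3
  rw [h1, h3, h2, h]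

theorem inner_toL2 (f g : C(Circ, V)) :
    inner ℂ (toL2 f) (toL2 g) = ∫ t, inner ℂ (f t) (g t) ∂haarAddCircle := by
  rw [L2.inner_def]
  refine integral_congr_ae ?_
  filter_upwards [coeFn_toL2 f, coeFn_toL2 g] with t h1 h2
  rw [h1, h2]

theorem norm_sq_toL2 (f : C(Circ, V)) : ‖toL2 f‖ ^ 2 = ∫ t, ‖f t‖ ^ 2 ∂haarAddCircle := by
  have h := inner_toL2 f f
  have h2 : ∀ t, inner ℂ (f t) (f t) = ((‖f t‖ ^ 2 : ℝ) : ℂ) := fun t => by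
    rw [inner_self_eq_norm_sq_to_K]; norm_cast
  simp only [h2] at h
  rw [integral_complex_ofReal, inner_self_eq_norm_sq_to_K] at h
  have h3 : ((‖toL2 f‖ ^ 2 : ℝ) : ℂ) = ((∫ t, ‖f t‖ ^ 2 ∂haarAddCircle : ℝ) : ℂ) := by
    rw [← h]; push_cast; rfl
  exact Complex.ofReal_injective h3

/-- Translation by `ε`. -/
def transl (ε : Circ) (f : C(Circ, V)) : C(Circ, V) := f.comp (ContinuousMap.addRight ε)

@[simp] theorem transl_apply (ε : Circ) (f : C(Circ, V)) (t : Circ) : transl ε f t = f (t + ε) := rfl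

theorem fourierCoeff_transl (ε : Circ) (f : C(Circ, V)) (k : ℤ) :
    fourierCoeff (transl ε f) k = fourier k ε • fourierCoeff f k := by
  rw [fourierCoeff, fourierCoeff, ← integral_smul]
  rw [← integral_add_right_eq_self (fun t => fourier k ε • fourier (-k) t • f t) ε]
  refine integral_congr_ae (Filter.Eventually.of_forall fun t => ?_)
  simp only [transl_apply, smul_smul]
  congr 1
  have h1 : fourier (-k) (t + ε) = fourier (-k) t * fourier (-k) ε := by
    simp [fourier_apply, toCircle_add]
  have h2 : fourier k ε * fourier (-k) ε = 1 := by
    rw [← fourier_add]; simp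
  rw [h1, mul_left_comm, h2, mul_one]

theorem fourier_coe_re_im (k : ℤ) (ε : ℝ) :
    (fourier k (ε : Circ) : ℂ).re = cos (2 * π * k * ε) ∧
      (fourier k (ε : Circ) : ℂ).im = sin (2 * π * k * ε) := by
  rw [fourier_coe_apply]
  have : 2 * (π : ℂ) * Complex.I * k * ε / (1 : ℝ) = ((2 * π * k * ε : ℝ) : ℂ) * Complex.I := by
    push_cast; ring
  rw [this, Complex.exp_ofReal_mul_I_re, Complex.exp_ofReal_mul_I_im]
  exact ⟨rfl, rfl⟩

theorem hasSum_im_inner_transl (ε : ℝ) (f : C(Circ, V)) :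
    HasSum (fun k : ℤ => sin (2 * π * k * ε) * ‖fourierCoeff f k‖ ^ 2)
      (∫ t, (inner ℂ (f t) (f (t + (ε : Circ)))).im ∂haarAddCircle) := by
  classical
  have h := hasSum_inner_coef (toL2 f) (toL2 (transl ε f))
  rw [inner_toL2] at h
  have h2 := Complex.imCLM.hasSum h
  have h3 : Complex.imCLM (∫ t, inner ℂ (f t) (transl ε f t) ∂haarAddCircle) =
      ∫ t, (inner ℂ (f t) (f (t + (ε : Circ)))).im ∂haarAddCircle := by
    rw [← ContinuousLinearMap.integral_comp_comm]
    · rfl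
    · exact (Continuous.inner f.continuous (transl ε f).continuous).integrable_of_hasCompactSupport
        (HasCompactSupport.of_compactSpace _)
  rw [h3] at h2
  have e : (fun k : ℤ => Complex.imCLM (inner ℂ (coef k (toL2 f)) (coef k (toL2 (transl ε f))))) =
      fun k : ℤ => sin (2 * π * k * ε) * ‖fourierCoeff f k‖ ^ 2 := by
    ext1 k
    rw [coef_toL2, coef_toL2, fourierCoeff_transl, inner_smul_right, inner_self_eq_norm_sq_to_K]
    have h4 : ((‖fourierCoeff f k‖ : ℂ)) ^ 2 = ((‖fourierCoeff f k‖ ^ 2 : ℝ) : ℂ) := by push_cast; rfl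
    rw [Complex.imCLM_apply]
    refine (congrArg (fun z => (fourier k (ε : Circ) * z : ℂ).im) h4).trans ?_
    rw [Complex.im_mul_ofReal, (fourier_coe_re_im k ε).2]
  exact e ▸ h2

theorem hasSum_norm_transl_sub (ε : ℝ) (f : C(Circ, V)) :
    HasSum (fun k : ℤ => 4 * sin (π * k * ε) ^ 2 * ‖fourierCoeff f k‖ ^ 2)
      (∫ t, ‖f (t + (ε : Circ)) - f t‖ ^ 2 ∂haarAddCircle) := by
  classical
  have h := hasSum_norm_sq_coef (toL2 (transl ε f - f))
  rw [norm_sq_toL2] at h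
  have e : (fun k : ℤ => ‖coef k (toL2 (transl ε f - f))‖ ^ 2) =
      fun k : ℤ => 4 * sin (π * k * ε) ^ 2 * ‖fourierCoeff f k‖ ^ 2 := by
    ext1 k
    rw [map_sub, map_sub, coef_toL2, coef_toL2, fourierCoeff_transl]
    have h1 : fourier k (ε : Circ) • fourierCoeff f k - fourierCoeff f k =
      (fourier k (ε : Circ) - 1) • fourierCoeff f k := by rw [sub_smul, one_smul]
    rw [h1, norm_smul, mul_pow]
    congr 1
    rw [← Complex.normSq_eq_norm_sq, Complex.normSq_apply]
    obtain ⟨h2, h3⟩ := fourier_coe_re_im k ε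
    simp only [Complex.sub_re, Complex.sub_im, h2, h3, Complex.one_re, Complex.one_im, sub_zero]
    have e : 2 * π * k * ε = 2 * (π * k * ε) := by ring
    have h4 := sin_sq_eq_half_sub (π * k * ε)
    have h5 := sin_sq_add_cos_sq (2 * π * k * ε)
    rw [← e] at h4
    rw [h4]
    nlinarith
  rw [e] at h
  exact h

end Conj

section ChainRule
variable {κ : Type*} [Fintype κ]

local notation "V" => EuclideanSpace ℂ κ
local notation "E" => EuclideanSpace ℝ κ

/-- The loop based at `θ₀` with derivative twice the real part of `f`, for `f` of mean zero. -/
def loop [DecidableEq κ] (θ₀ : E) (f : L2 V) : C(Circ, E) :=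
  ⟨fun t => θ₀ + (2 : ℝ) • reV (prim f t), by fun_prop⟩

/-- Twice the real part of `f`, as a complex-valued function. -/
def twoRe (f : L2 V) : L2 V := f + conjL2 f

theorem continuous_twoRe : Continuous (twoRe : L2 V → L2 V) :=
  continuous_id.add conjL2.continuous

theorem norm_twoRe_le (f : L2 V) : ‖twoRe f‖ ≤ 2 * ‖f‖ := by
  refine (norm_add_le _ _).trans ?_
  rw [norm_conjL2]; linarith

/-- Twice the real part of a continuous function. -/
def twoReC (f : C(Circ, V)) : C(Circ, V) :=
  ⟨fun t => f t + conjV (f t), by have := conjV (κ := κ).continuous; fun_prop⟩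

theorem toL2_twoReC (f : C(Circ, V)) : toL2 (twoReC f) = twoRe (toL2 f) := by
  let g : C(Circ, V) := ⟨fun t => conjV (f t), by have := conjV (κ := κ).continuous; fun_prop⟩
  have h : twoReC f = f + g := rfl
  rw [h, map_add, toL2_conj f g (fun _ => rfl), twoRe]

theorem continuous_loop [DecidableEq κ] (θ₀ : E) : Continuous (loop θ₀ : L2 V → C(Circ, E)) := by
  let T : C(V, E) := ⟨fun v => θ₀ + (2 : ℝ) • reV v, by fun_prop⟩
  exact (ContinuousMap.continuous_postcomp T).comp prim.continuous

theorem loop_zero_right [DecidableEq κ] (θ₀ : E) (f : L2 V) : loop θ₀ f 0 = θ₀ := by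
  simp [loop, prim_apply_zero]

theorem hasDerivAt_loop [DecidableEq κ] (θ₀ : E) (f : L2 V) (hf : coef 0 f = 0)
    (s : Finset (ℤ × κ)) (t : ℝ) :
    HasDerivAt (fun x : ℝ => loop θ₀ (toL2 (partialSum s f)) (x : Circ))
      ((2 : ℝ) • reV (partialSum s f (t : Circ))) t :=
  ((reV.hasFDerivAt.comp_hasDerivAt t (hasDerivAt_prim_partialSum f hf s t)).const_smul
    (2 : ℝ)).const_add θ₀

theorem hasDerivAt_fourier_neg_smul {w w' : ℝ → V} (k : ℤ) (x : ℝ) (h : HasDerivAt w (w' x) x) :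
    HasDerivAt (fun x : ℝ => (fourier (-k) (x : Circ) : ℂ) • w x)
      ((fourier (-k) (x : Circ) : ℂ) • w' x -
        (2 * π * Complex.I * k : ℂ) • (fourier (-k) (x : Circ) : ℂ) • w x) x := by
  have h2 : HasDerivAt (fun x : ℝ => (fourier (-k) (x : Circ) : ℂ)) _ x :=
    hasDerivAt_fourier (1 : ℝ) (-k) x
  refine (h2.smul h).congr_deriv ?_
  rw [sub_eq_add_neg, ← neg_smul, smul_smul]
  congr 2
  push_cast
  ring

theorem fourierCoeff_of_hasDerivAt {w w' : C(Circ, V)}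
    (h : ∀ x : ℝ, HasDerivAt (fun x : ℝ => w (x : Circ)) (w' (x : Circ)) x) (k : ℤ) :
    fourierCoeff w' k = (2 * π * Complex.I * k : ℂ) • fourierCoeff w k := by
  rw [fourierCoeff_eq_intervalIntegral _ _ 0, fourierCoeff_eq_intervalIntegral _ _ 0]
  simp only [one_div, inv_one, one_smul, zero_add]
  have h1 := fun x : ℝ => hasDerivAt_fourier_neg_smul (w' := fun x : ℝ => w' (x : Circ)) k x (h x)
  have hc : Continuous fun x : ℝ => (x : Circ) := AddCircle.continuous_mk' 1
  have hf : Continuous fun x : ℝ => (fourier (-k) (x : Circ) : ℂ) :=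
    (fourier (-k)).continuous.comp hc
  have c1 : Continuous fun x : ℝ => (fourier (-k) (x : Circ) : ℂ) • w' (x : Circ) :=
    hf.smul (w'.continuous.comp hc)
  have c2 : Continuous fun x : ℝ => (fourier (-k) (x : Circ) : ℂ) • w (x : Circ) :=
    hf.smul (w.continuous.comp hc)
  have c3 : Continuous fun x : ℝ => (2 * π * Complex.I * k : ℂ) •
      (fourier (-k) (x : Circ) : ℂ) • w (x : Circ) := c2.const_smul (2 * π * Complex.I * k : ℂ)
  have h3 := intervalIntegral.integral_eq_sub_of_hasDerivAt (a := 0) (b := 1) (fun x _ => h1 x)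
    ((c1.sub c3).intervalIntegrable _ _)
  rw [intervalIntegral.integral_sub (c1.intervalIntegrable _ _)
    (c3.intervalIntegrable _ _), intervalIntegral.integral_smul] at h3
  have h4 : ((1 : ℝ) : Circ) = ((0 : ℝ) : Circ) := by simpa using AddCircle.coe_period (1 : ℝ)
  rw [h4, sub_self, sub_eq_zero] at h3
  exact h3

variable [DecidableEq κ]

/-- The derivative of `W` at the points of `O` is the restriction of `A` to real vectors. -/
def IsRealDeriv (O : Set E) (W : C(E, V)) (A : C(E, V →L[ℂ] V)) : Prop :=
  ∀ θ ∈ O, HasFDerivAt W (((A θ).restrictScalars ℝ).comp ofRealV.toContinuousLinearMap) θ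

theorem hasDerivAt_comp_loop {O : Set E} {W : C(E, V)} {A : C(E, V →L[ℂ] V)}
    (hW : IsRealDeriv O W A) (θ₀ : E) (f : L2 V) (hf : coef 0 f = 0) (s : Finset (ℤ × κ)) (x : ℝ)
    (hO : loop θ₀ (toL2 (partialSum s f)) (x : Circ) ∈ O) :
    HasDerivAt (fun x : ℝ => W (loop θ₀ (toL2 (partialSum s f)) (x : Circ)))
      (mulC (A.comp (loop θ₀ (toL2 (partialSum s f)))) (twoReC (partialSum s f)) (x : Circ)) x := by
  have h := (hW _ hO).comp_hasDerivAt x (hasDerivAt_loop θ₀ f hf s x)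
  refine h.congr_deriv ?_
  change A _ (ofRealV _) = A _ _
  rw [ofRealV_two_smul_reV]
  rfl

theorem tendsto_clm_apply {ι X Y : Type*} [NormedAddCommGroup X] [NormedSpace ℂ X]
    [NormedAddCommGroup Y] [NormedSpace ℂ Y] {l : Filter ι} {T : ι → X →L[ℂ] Y} {x : ι → X}
    {T₀ : X →L[ℂ] Y} {x₀ : X} (hT : Filter.Tendsto T l (nhds T₀)) (hx : Filter.Tendsto x l (nhds x₀)) :
    Filter.Tendsto (fun i => T i (x i)) l (nhds (T₀ x₀)) :=
  ((isBoundedBilinearMap_apply.continuous : Continuous fun p : (X →L[ℂ] Y) × X => p.1 p.2).tendsto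
    (T₀, x₀)).comp
    (hT.prodMk_nhds hx)

theorem coef_mulOp_loop {O : Set E} {W : C(E, V)} {A : C(E, V →L[ℂ] V)}
    (hW : IsRealDeriv O W A) (hO : IsOpen O) (θ₀ : E) (f : L2 V) (hf : coef 0 f = 0)
    (hθ : ∀ t, loop θ₀ f t ∈ O) (k : ℤ) :
    coef k (mulOp (A.comp (loop θ₀ f)) (twoRe f)) =
      (2 * π * Complex.I * k : ℂ) • fourierCoeff (W.comp (loop θ₀ f)) k := by
  have h1 := tendsto_partialSum f
  have h2 := ((continuous_loop θ₀).tendsto f).comp h1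
  have h3 : ∀ᶠ s in Filter.atTop, ∀ t, loop θ₀ (toL2 (partialSum s f)) t ∈ O := by
    have := h2.eventually ((ContinuousMap.isOpen_setOfPred_mapsTo isCompact_univ hO).mem_nhds
      (fun t _ => hθ t))
    exact this.mono fun s hs t => hs (mem_univ t)
  have h4 : ∀ᶠ s in Filter.atTop, coef k (mulOp (A.comp (loop θ₀ (toL2 (partialSum s f))))
      (twoRe (toL2 (partialSum s f)))) = (2 * π * Complex.I * k : ℂ) •
        coef k (toL2 (W.comp (loop θ₀ (toL2 (partialSum s f))))) := by
    filter_upwards [h3] with s hs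
    rw [← toL2_twoReC, mulOp_toL2, coef_toL2, coef_toL2]
    exact fourierCoeff_of_hasDerivAt (fun x => hasDerivAt_comp_loop hW θ₀ f hf s x (hs _)) k
  have h5 : Filter.Tendsto (fun s => coef k (mulOp (A.comp (loop θ₀ (toL2 (partialSum s f))))
      (twoRe (toL2 (partialSum s f))))) Filter.atTop
      (nhds (coef k (mulOp (A.comp (loop θ₀ f)) (twoRe f)))) := by
    have c1 := (((ContinuousMap.continuous_postcomp A).tendsto _).comp h2)
    have c2 := ((mulOp (κ := κ)).continuous.tendsto _).comp c1
    exact ((coef k).continuous.tendsto _).comp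
      (tendsto_clm_apply c2 ((continuous_twoRe.tendsto f).comp h1))
  have h6 : Filter.Tendsto (fun s => (2 * π * Complex.I * k : ℂ) •
        coef k (toL2 (W.comp (loop θ₀ (toL2 (partialSum s f)))))) Filter.atTop
      (nhds ((2 * π * Complex.I * k : ℂ) • coef k (toL2 (W.comp (loop θ₀ f))))) := by
    have c1 := (((ContinuousMap.continuous_postcomp W).tendsto _).comp h2)
    exact (((coef k).continuous.tendsto _).comp ((toL2.continuous.tendsto _).comp c1)).const_smul _
  rw [← coef_toL2]
  exact tendsto_nhds_unique (h5.congr' h4) h6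

theorem norm_comp_loop_sub_le {O : Set E} (A : C(E, V →L[ℂ] V)) (hO : IsOpen O) {F : Type*} [NormedAddCommGroup F] [NormedSpace ℝ F]
    {Φ : E → F} {Φ' : E → E →L[ℝ] F} {c : ℝ} (hc : 0 ≤ c) (hΦ : ∀ θ ∈ O, HasFDerivAt Φ (Φ' θ) θ)
    (hΦ' : ∀ θ ∈ O, ∀ v, ‖Φ' θ v‖ ≤ c * ‖A θ (ofRealV v)‖)
    (θ₀ : E) (f : L2 V) (hf : coef 0 f = 0) (hθ : ∀ t, loop θ₀ f t ∈ O) (t : Circ) :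
    ‖Φ (loop θ₀ f t) - Φ θ₀‖ ≤ c * ‖mulOp (A.comp (loop θ₀ f)) (twoRe f)‖ := by
  have h1 := tendsto_partialSum f
  have h2 := ((continuous_loop θ₀).tendsto f).comp h1
  have h3 : ∀ᶠ s in Filter.atTop, ∀ t, loop θ₀ (toL2 (partialSum s f)) t ∈ O := by
    have := h2.eventually ((ContinuousMap.isOpen_setOfPred_mapsTo isCompact_univ hO).mem_nhds
      (fun t _ => hθ t))
    exact this.mono fun s hs t => hs (mem_univ t)
  have h4 : ∀ᶠ s in Filter.atTop, ‖Φ (loop θ₀ (toL2 (partialSum s f)) t) - Φ θ₀‖ ≤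
      c * ‖mulOp (A.comp (loop θ₀ (toL2 (partialSum s f)))) (twoRe (toL2 (partialSum s f)))‖ := by
    filter_upwards [h3] with s hs
    set θ := loop θ₀ (toL2 (partialSum s f)) with hθs
    set y : C(Circ, V) := mulC (A.comp θ) (twoReC (partialSum s f)) with hy
    rw [← toL2_twoReC, mulOp_toL2, ← hy]
    have hcc : Continuous fun x : ℝ => (x : Circ) := AddCircle.continuous_mk' 1
    have hyc : Continuous fun x : ℝ => ‖y (x : Circ)‖ := by fun_prop
    have d1 : ∀ x : ℝ, HasDerivAt (fun x : ℝ => Φ (θ (x : Circ)))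
        (Φ' (θ (x : Circ)) ((2 : ℝ) • reV (partialSum s f (x : Circ)))) x := fun x =>
      (hΦ _ (hs _)).comp_hasDerivAt x (hasDerivAt_loop θ₀ f hf s x)
    have d2 : ∀ x : ℝ, HasDerivAt (fun x : ℝ => c * ∫ τ in (0 : ℝ)..x, ‖y (τ : Circ)‖)
        (c * ‖y (x : Circ)‖) x := fun x =>
      (intervalIntegral.integral_hasDerivAt_right (hyc.intervalIntegrable _ _)
        (hyc.stronglyMeasurableAtFilter _ _) hyc.continuousAt).const_mul c
    obtain ⟨x, hx, rfl⟩ : ∃ x ∈ Icc (0 : ℝ) 1, (x : Circ) = t := by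
      obtain ⟨x, hx, h⟩ := AddCircle.coe_image_Icc_eq (1 : ℝ) 0 ▸ mem_univ t
      exact ⟨x, by simpa using hx, h⟩
    have d3 := image_norm_le_of_norm_deriv_right_le_deriv_boundary
      (f := fun x : ℝ => Φ (θ (x : Circ)) - Φ θ₀) (a := 0) (b := 1)
      (B := fun x : ℝ => c * ∫ τ in (0 : ℝ)..x, ‖y (τ : Circ)‖)
      (fun x _ => ((d1 x).sub_const _).continuousAt.continuousWithinAt)
      (fun x _ => ((d1 x).sub_const _).hasDerivWithinAt) (by simp [hθs, loop_zero_right]) d2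
      (fun x _ => by
        refine (hΦ' _ (hs _) _).trans (le_of_eq ?_)
        rw [ofRealV_two_smul_reV]
        rfl) hx
    refine d3.trans (mul_le_mul_of_nonneg_left ?_ hc)
    calc ∫ τ in (0 : ℝ)..x, ‖y (τ : Circ)‖ ≤ ∫ τ in (0 : ℝ)..1, ‖y (τ : Circ)‖ := by
          refine intervalIntegral.integral_mono_interval le_rfl hx.1 hx.2
            (Filter.Eventually.of_forall fun _ => norm_nonneg _) (hyc.intervalIntegrable _ _)
      _ = ∫ t, ‖y t‖ ∂haarAddCircle := by
          rw [integral_haarAddCircle, inv_one, one_smul]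
          have := AddCircle.intervalIntegral_preimage (1 : ℝ) 0 (fun t : Circ => ‖y t‖)
          simpa using this
      _ = ∫ t, ‖toL2 y t‖ ∂haarAddCircle := by
          refine integral_congr_ae ?_
          filter_upwards [coeFn_toL2 y] with t ht
          rw [ht]
      _ ≤ _ := L2.integral_norm_le _
  have h5 : Filter.Tendsto (fun s => c * ‖mulOp (A.comp (loop θ₀ (toL2 (partialSum s f))))
      (twoRe (toL2 (partialSum s f)))‖) Filter.atTop
      (nhds (c * ‖mulOp (A.comp (loop θ₀ f)) (twoRe f)‖)) := by
    have c1 := (((ContinuousMap.continuous_postcomp A).tendsto _).comp h2)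
    have c2 := ((mulOp (κ := κ)).continuous.tendsto _).comp c1
    exact (tendsto_clm_apply c2 ((continuous_twoRe.tendsto f).comp h1)).norm.const_mul c
  have h6 : Filter.Tendsto (fun s => ‖Φ (loop θ₀ (toL2 (partialSum s f)) t) - Φ θ₀‖) Filter.atTop
      (nhds ‖Φ (loop θ₀ f t) - Φ θ₀‖) := by
    have c1 := ((continuous_eval_const (F := C(Circ, E)) t).tendsto (loop θ₀ f)).comp h2
    exact (((hΦ _ (hθ t)).continuousAt.tendsto.comp c1).sub_const _).norm
  exact le_of_tendsto_of_tendsto h6 h5 h4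

end ChainRule

section Apriori
variable {κ : Type*} [Fintype κ] [DecidableEq κ]

local notation "V" => EuclideanSpace ℂ κ
local notation "E" => EuclideanSpace ℝ κ

theorem norm_sq_proj_Ioc_le (y : L2 V) (w : C(Circ, V)) {C : ℝ}
    (hs : EnergySeq C fun k => ‖fourierCoeff w k‖ ^ 2)
    (hy : ∀ k, coef k y = (2 * π * Complex.I * k : ℂ) • fourierCoeff w k) (K : ℕ) (hC : 0 ≤ C) :
    ‖proj (Ioc 0 (K : ℤ)) y‖ ^ 2 ≤ 4 * π ^ 2 * K * ‖fourierCoeff w (-1)‖ ^ 2 := by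
  classical
  have h1 := hasSum_norm_sq_coef (proj (Ioc 0 (K : ℤ)) y)
  have h2 : HasSum (fun k => ‖coef k (proj (Ioc 0 (K : ℤ)) y)‖ ^ 2)
      (∑ k ∈ Finset.Ioc 0 (K : ℤ), ‖coef k (proj (Ioc 0 (K : ℤ)) y)‖ ^ 2) := by
    refine hasSum_sum_of_ne_finset_zero fun k hk => ?_
    rw [coef_proj, if_neg (by simpa using hk)]; simp
  rw [h1.unique h2]
  have h3 := hs.sum_le hC (Finset.Ioc 0 (K : ℤ)) (fun k hk => (Finset.mem_Ioc.1 hk).1)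
  calc ∑ k ∈ Finset.Ioc 0 (K : ℤ), ‖coef k (proj (Ioc 0 (K : ℤ)) y)‖ ^ 2
      ≤ ∑ k ∈ Finset.Ioc 0 (K : ℤ), 4 * π ^ 2 * K * (k * ‖fourierCoeff w k‖ ^ 2) := by
        refine Finset.sum_le_sum fun k hk => ?_
        rw [Finset.mem_Ioc] at hk
        rw [coef_proj, if_pos (by simpa using hk), hy, norm_smul]
        have e : ‖(2 * π * Complex.I * k : ℂ)‖ = 2 * π * k := by
          simp [abs_of_pos pi_pos]
          exact_mod_cast hk.1.le
        rw [e]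
        have hk1 : (0 : ℝ) < k := by exact_mod_cast hk.1
        have hk2 : (k : ℝ) ≤ K := by exact_mod_cast hk.2
        have : 0 ≤ 4 * π ^ 2 * (k * ‖fourierCoeff w k‖ ^ 2) := by positivity
        nlinarith [mul_le_mul_of_nonneg_left hk2 this]
    _ = 4 * π ^ 2 * K * ∑ k ∈ Finset.Ioc 0 (K : ℤ), k * ‖fourierCoeff w k‖ ^ 2 := by
        rw [Finset.mul_sum]
    _ ≤ _ := by gcongr

/-- Translation estimate for the columns of a matrix-valued function. -/
theorem tsum_sin_sq_colCoef_le (M : MatFun κ) (w : C(Circ, V)) {L : ℝ}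
    (hML : ∀ t t', ‖M t - M t'‖ ≤ L * ‖w t - w t'‖) (ε : ℝ) :
    ∑' k : ℤ, sin (π * k * ε) ^ 2 * colCoef M k ≤
      Fintype.card κ * L ^ 2 * ∑' k : ℤ, sin (π * k * ε) ^ 2 * ‖fourierCoeff w k‖ ^ 2 := by
  have h1 := hasSum_norm_transl_sub ε w
  have h2 : HasSum (fun k : ℤ => 4 * (sin (π * k * ε) ^ 2 * colCoef M k))
      (∑ j, ∫ t, ‖mulC M (monom 0 (EuclideanSpace.single j 1)) (t + (ε : Circ)) -
        mulC M (monom 0 (EuclideanSpace.single j 1)) t‖ ^ 2 ∂haarAddCircle) := by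
    have := hasSum_sum (s := Finset.univ) fun (j : κ) _ =>
      hasSum_norm_transl_sub ε (mulC M (monom 0 (EuclideanSpace.single j 1)))
    refine this.congr_fun ?_
    intro k
    rw [colCoef, Finset.mul_sum, Finset.mul_sum]
    exact Finset.sum_congr rfl fun j _ => by ring
  have h3 : ∀ j : κ, ∫ t, ‖mulC M (monom 0 (EuclideanSpace.single j 1)) (t + (ε : Circ)) -
        mulC M (monom 0 (EuclideanSpace.single j 1)) t‖ ^ 2 ∂haarAddCircle ≤
      L ^ 2 * ∫ t, ‖w (t + (ε : Circ)) - w t‖ ^ 2 ∂haarAddCircle := by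
    intro j
    rw [← integral_const_mul]
    refine integral_mono ?_ ?_ fun t => ?_
    · exact (by fun_prop : Continuous _).integrable_of_hasCompactSupport
        (HasCompactSupport.of_compactSpace _)
    · exact (by fun_prop : Continuous _).integrable_of_hasCompactSupport
        (HasCompactSupport.of_compactSpace _)
    · have e : mulC M (monom 0 (EuclideanSpace.single j 1)) (t + (ε : Circ)) -
        mulC M (monom 0 (EuclideanSpace.single j 1)) t =
          (M (t + ε) - M t) (EuclideanSpace.single j 1) := by
        simp [mulC]
      simp only
      rw [e, ← mul_pow]
      gcongr
      refine ((M (t + ε) - M t).le_opNorm _).trans ?_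
      simpa using hML (t + ε) t
  have h4 : 4 * ∑' k : ℤ, sin (π * k * ε) ^ 2 * colCoef M k ≤
      Fintype.card κ * (L ^ 2 * (4 * ∑' k : ℤ, sin (π * k * ε) ^ 2 * ‖fourierCoeff w k‖ ^ 2)) := by
    have h1' : ∫ t, ‖w (t + (ε : Circ)) - w t‖ ^ 2 ∂haarAddCircle =
        4 * ∑' k : ℤ, sin (π * k * ε) ^ 2 * ‖fourierCoeff w k‖ ^ 2 := by
      rw [← h1.tsum_eq, ← tsum_mul_left]
      exact tsum_congr fun k => by ring
    rw [← tsum_mul_left, h2.tsum_eq, ← h1']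
    refine (Finset.sum_le_sum fun j _ => h3 j).trans (le_of_eq ?_)
    simp
  linarith

/-- A priori bound: the energy of a loop is controlled by its negative modes. -/
theorem exists_apriori_bound {C CB L c : ℝ} (hC : 0 ≤ C) (hCB : 0 ≤ CB) (hc : 0 ≤ c) :
    ∃ Y : ℝ, 0 ≤ Y ∧ ∀ (w : C(Circ, V)) (y : L2 V) (M : MatFun κ) (τ : ℝ) (c₀ : V),
      0 ≤ τ → τ ≤ 1 → ‖c₀‖ ≤ c →
      (∀ k, coef k y = (2 * π * Complex.I * k : ℂ) • fourierCoeff w k) →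
      (∀ k < 0, coef k y = if k = -1 then (τ : ℂ) • c₀ else 0) →
      (∀ ε : ℝ, |∫ t, (inner ℂ (w t) (w (t + (ε : Circ)))).im ∂haarAddCircle| ≤
        C * ∫ t, ‖w (t + (ε : Circ)) - w t‖ ^ 2 ∂haarAddCircle) →
      (∀ t, ‖M t‖ ≤ CB) → (∀ t t', ‖M t - M t'‖ ≤ L * ‖w t - w t'‖) →
      mulOp M (conjL2 y) = y → ‖y‖ ≤ Y * τ := by
  classical
  have hpi := Real.pi_pos
  obtain ⟨K, hK⟩ := EnergySeq.exists_tail_le_of_le hC (D := Fintype.card κ * L ^ 2)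
    (by positivity) (c ^ 2) (η := 1 / 4) (by norm_num)
  refine ⟨2 * (CB * c + √K * c) + c, by positivity, ?_⟩
  intro w y M τ c₀ hτ0 hτ1 hc₀ hy hneg hen hM hML hMy
  have hw : ∀ k, ‖coef k y‖ ^ 2 = 4 * π ^ 2 * ((k : ℝ) ^ 2 * ‖fourierCoeff w k‖ ^ 2) := by
    intro k
    rw [hy, norm_smul, mul_pow]
    have e : ‖(2 * π * Complex.I * k : ℂ)‖ = 2 * π * |(k : ℝ)| := by
      simp [abs_of_pos pi_pos]
    rw [e, mul_pow, sq_abs]; ring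
  have hs : EnergySeq C fun k => ‖fourierCoeff w k‖ ^ 2 := by
    refine ⟨fun k => by positivity, ?_, ?_, ?_, ?_⟩
    · simp only [← coef_toL2]
      exact (hasSum_norm_sq_coef _).summable
    · have h := (hasSum_norm_sq_coef y).summable
      simp only [hw] at h
      exact (summable_mul_left_iff (by positivity)).1 h
    · intro k hk
      have h1 := hneg k (by omega)
      rw [if_neg (by omega), hy, smul_eq_zero] at h1
      have h2 : (2 * π * Complex.I * k : ℂ) ≠ 0 := by
        have : (k : ℂ) ≠ 0 := by exact_mod_cast (by omega : k ≠ 0)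
        simp [this, hpi.ne']
      rw [h1.resolve_left h2]; simp
    · intro ε
      rw [(hasSum_im_inner_transl ε w).tsum_eq, (hasSum_norm_transl_sub ε w).tsum_eq]
      exact hen ε
  have hs1 : 4 * π ^ 2 * ‖fourierCoeff w (-1)‖ ^ 2 = τ ^ 2 * ‖c₀‖ ^ 2 := by
    have h := hw (-1)
    rw [hneg _ (by omega), if_pos rfl, norm_smul, mul_pow] at h
    simp at h
    linarith
  have hτc : τ * ‖c₀‖ ≤ τ * c := by gcongr
  have hs2 : ‖fourierCoeff w (-1)‖ ^ 2 ≤ c ^ 2 := by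
    have h1 : τ * ‖c₀‖ ≤ c := hτc.trans (by nlinarith)
    have h2 : (τ * ‖c₀‖) ^ 2 ≤ c ^ 2 := by gcongr
    have h3 : (1 : ℝ) ≤ 4 * π ^ 2 := by nlinarith [Real.pi_gt_three]
    nlinarith [sq_nonneg ‖fourierCoeff w (-1)‖]
  have htail := hK _ (colCoef M) hs (by exact_mod_cast hs2) (colCoef_nonneg M) (summable_colCoef M)
    (tsum_sin_sq_colCoef_le M w hML)
  set yp := proj (Ioi 0) y with hyp
  set z : L2 V := toL2 (monom (-1) ((τ : ℂ) • c₀)) with hz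
  have hzn : ‖z‖ ≤ τ * c := by
    have h := (hasSum_norm_sq_coef z)
    have h2 : HasSum (fun k => ‖coef k z‖ ^ 2) (‖(τ : ℂ) • c₀‖ ^ 2) := by
      have := hasSum_ite_eq (-1 : ℤ) (‖(τ : ℂ) • c₀‖ ^ 2)
      refine this.congr_fun fun k => ?_
      rw [hz, coef_monom]; split_ifs <;> simp
    have h3 : ‖z‖ = ‖(τ : ℂ) • c₀‖ := by
      have := h.unique h2
      exact (pow_left_inj₀ (norm_nonneg _) (norm_nonneg _) two_ne_zero).1 this
    rw [h3, norm_smul]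
    simpa [abs_of_nonneg hτ0] using hτc
  have hdec : y = yp + z := by
    refine coef_ext fun k => ?_
    rw [map_add, hyp, coef_proj, hz, coef_monom]
    rcases lt_trichotomy k 0 with h | h | h
    · rw [hneg k h, if_neg (show k ∉ Ioi (0 : ℤ) by simpa using h.le)]; simp
    · subst h; rw [hy]; simp
    · rw [if_pos (by simpa using h), if_neg (by omega), add_zero]
  have hhigh : ‖proj (Ioi (K : ℤ)) y‖ ≤ 1 / 2 * ‖yp‖ + CB * (τ * c) := by
    have e : proj (Ioi (K : ℤ)) y = proj (Ioi (K : ℤ)) (mulOp M (conjL2 yp)) +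
        proj (Ioi (K : ℤ)) (mulOp M (conjL2 z)) := by
      rw [← map_add, ← map_add, ← map_add, ← hdec, hMy]
    rw [e]
    refine (norm_add_le _ _).trans (add_le_add ?_ ?_)
    · have h1 := norm_hankel_le M (f := conjL2 yp) (fun k hk => by
        rw [coef_conjL2, hyp, coef_proj, if_neg (by simpa using hk), map_zero])
        (Int.natCast_nonneg K) htail
      rw [norm_conjL2] at h1
      refine abs_le_of_sq_le_sq' ?_ (by positivity) |>.2
      calc _ ≤ _ := h1
        _ = _ := by ring
    · refine (norm_proj_le _ _).trans ((norm_mulOp_le hM _).trans ?_)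
      rw [norm_conjL2]
      gcongr
  have hlow : ‖proj (Ioc 0 (K : ℤ)) y‖ ≤ √K * (τ * c) := by
    have h := norm_sq_proj_Ioc_le y w hs hy K hC
    refine abs_le_of_sq_le_sq' ?_ (by positivity) |>.2
    calc _ ≤ _ := h
      _ = K * (4 * π ^ 2 * ‖fourierCoeff w (-1)‖ ^ 2) := by ring
      _ = K * (τ * ‖c₀‖) ^ 2 := by rw [hs1]; ring
      _ ≤ K * (τ * c) ^ 2 := by gcongr
      _ = _ := by rw [mul_pow (√K), Real.sq_sqrt (Nat.cast_nonneg K)]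
  have hyp2 : yp = proj (Ioi (K : ℤ)) y + proj (Ioc 0 (K : ℤ)) y := by
    refine coef_ext fun k => ?_
    rw [map_add, hyp, coef_proj, coef_proj, coef_proj]
    have hK0 := Int.natCast_nonneg K
    by_cases h1 : 0 < k
    · by_cases h2 : (K : ℤ) < k
      · simp [h1, h2, h2.not_ge]
      · simp [h1, h2, not_lt.1 h2]
    · have h2 : ¬ (K : ℤ) < k := by omega
      simp [h1, h2]
  have h5 : ‖yp‖ ≤ 2 * (CB * (τ * c) + √K * (τ * c)) := by
    have := norm_add_le (proj (Ioi (K : ℤ)) y) (proj (Ioc 0 (K : ℤ)) y)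
    rw [← hyp2] at this
    linarith
  calc ‖y‖ ≤ ‖yp‖ + ‖z‖ := by rw [hdec]; exact norm_add_le _ _
    _ ≤ 2 * (CB * (τ * c) + √K * (τ * c)) + τ * c := add_le_add h5 hzn
    _ = _ := by ring

end Apriori

section Regular
variable {κ : Type*} [Fintype κ] [DecidableEq κ]

local notation "V" => EuclideanSpace ℂ κ
local notation "E" => EuclideanSpace ℝ κ

/-- The defect of `S` as a left inverse of the truncated multiplication operator by `A`. -/
def defect (A : C(E, V →L[ℂ] V)) (S : C(Circ, E) → L2 V →L[ℂ] L2 V) (θ : C(Circ, E)) :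
    L2 V →L[ℂ] L2 V :=
  S θ ∘L proj (Iio 0) ∘L mulOp (A.comp θ) - proj (Iio 0)

/-- `S` is a continuous family of left regularizers of the truncated multiplication operators
by `A`, along loops in `Q`. -/
structure IsRegularizer (Q : Set E) (A : C(E, V →L[ℂ] V))
    (S : C(Circ, E) → L2 V →L[ℂ] L2 V) : Prop where
  cont : Continuous S
  mem : ∀ θ f, S θ f ∈ modes (Iio 0)
  inj : ∀ θ : C(Circ, E), (∀ t, θ t ∈ Q) → ∀ f ∈ (modes (Iio 0) : Submodule ℂ (L2 V)),
    S θ f = 0 → f = 0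
  cpt : ∀ θ : C(Circ, E), (∀ t, θ t ∈ Q) → IsCompactOperator (defect A S θ)
  const : ∀ a ∈ Q, defect A S (ContinuousMap.const _ a) = 0

theorem proj_eq_self {S : Set ℤ} {f : L2 V} (hf : f ∈ (modes S : Submodule ℂ (L2 V))) :
    proj S f = f := by
  classical
  refine coef_ext fun k => ?_
  rw [coef_proj]
  split_ifs with h
  · rfl
  · exact (mem_modes.1 hf k h).symm

theorem proj_Iio_add_proj_Ici (f : L2 V) : proj (Iio 0) f + proj (Ici 0) f = f := by
  classical
  refine coef_ext fun k => ?_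
  rw [map_add, coef_proj, coef_proj]
  by_cases h : k < 0
  · simp [h, h.not_ge]
  · simp [h, not_lt.1 h]

theorem coef_mulOp_const (c : V →L[ℂ] V) (f : L2 V) (k : ℤ) :
    coef k (mulOp (ContinuousMap.const _ c) f) = c (coef k f) := by
  have h := coef_mulOp_monomMat 0 c f k
  have e : monomMat 0 c = ContinuousMap.const _ c := by ext1 t; simp [monomMat]
  rw [e, sub_zero] at h
  exact h

theorem proj_mulOp_const (c : V →L[ℂ] V) (S : Set ℤ) (f : L2 V) :
    proj S (mulOp (ContinuousMap.const _ c) f) = mulOp (ContinuousMap.const _ c) (proj S f) := by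
  classical
  refine coef_ext fun k => ?_
  rw [coef_proj, coef_mulOp_const, coef_mulOp_const, coef_proj]
  split_ifs <;> simp

theorem isRegularizer_one {Q : Set E} {A : C(E, V →L[ℂ] V)} (hA : ∀ θ ∈ Q, A θ = 1) :
    IsRegularizer Q A fun _ => proj (Iio 0) := by
  have h0 : ∀ θ : C(Circ, E), (∀ t, θ t ∈ Q) → defect A (fun _ => proj (Iio 0)) θ = 0 := by
    intro θ hθ
    have e : A.comp θ = 1 := by ext1 t; exact hA _ (hθ t)
    ext1 f
    change proj (Iio 0) (proj (Iio 0) (mulOp (A.comp θ) f)) - proj (Iio 0) f = 0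
    rw [e, mulOp_one, proj_eq_self (proj_mem (Iio 0) f), sub_self]
  refine ⟨continuous_const, fun θ f => proj_mem _ _, fun θ _ f hf h => ?_, fun θ hθ => ?_,
    fun a ha => h0 _ fun _ => ha⟩
  · rwa [proj_eq_self hf] at h
  · rw [h0 θ hθ]; exact isCompactOperator_zero

/-- Pointwise product of matrix-valued functions. -/
def mulFam (N A : C(E, V →L[ℂ] V)) : C(E, V →L[ℂ] V) := ⟨fun θ => N θ * A θ, by fun_prop⟩

theorem norm_sub_mulOp_le {M : MatFun κ} {c : ℝ} (h : ∀ t, ‖M t - 1‖ ≤ c) (f : L2 V) :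
    ‖f - mulOp M f‖ ≤ c * ‖f‖ := by
  refine Lp.norm_le_mul_norm_of_ae_le_mul ?_
  filter_upwards [coeFn_mulOp M f, Lp.coeFn_sub f (mulOp M f)] with t ht ht2
  rw [ht2, Pi.sub_apply, ht, norm_sub_rev]
  exact (M t - 1).le_of_opNorm_le (h t) _

theorem defect_mul_apply (A N : C(E, V →L[ℂ] V)) (S : C(Circ, E) → L2 V →L[ℂ] L2 V)
    (θ : C(Circ, E)) (f : L2 V) :
    defect A (fun θ => S θ ∘L proj (Iio 0) ∘L mulOp (N.comp θ)) θ f =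
      defect (mulFam N A) S θ f -
        S θ (proj (Iio 0) (mulOp (N.comp θ) (proj (Ici 0) (mulOp (A.comp θ) f)))) := by
  have e0 : (mulFam N A).comp θ = (N.comp θ : MatFun κ) * A.comp θ := rfl
  have e : mulOp ((mulFam N A).comp θ) f = mulOp (N.comp θ) (mulOp (A.comp θ) f) := by
    rw [e0]; exact mulOp_mul _ _ f
  have e2 := proj_Iio_add_proj_Ici (mulOp (A.comp θ) f)
  have e3 : S θ (proj (Iio 0) (mulOp (N.comp θ) (proj (Iio 0) (mulOp (A.comp θ) f)))) +
      S θ (proj (Iio 0) (mulOp (N.comp θ) (proj (Ici 0) (mulOp (A.comp θ) f)))) =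
        S θ (proj (Iio 0) (mulOp ((mulFam N A).comp θ) f)) := by
    rw [← map_add, ← map_add, ← map_add, e2, e]
  have e4 : ∀ a b c : L2 V, a - c = a + b - c - b := fun a b c => by abel
  have e5 := e4 (S θ (proj (Iio 0) (mulOp (N.comp θ) (proj (Iio 0) (mulOp (A.comp θ) f)))))
    (S θ (proj (Iio 0) (mulOp (N.comp θ) (proj (Ici 0) (mulOp (A.comp θ) f))))) (proj (Iio 0) f)
  rw [e3] at e5
  exact e5

theorem IsRegularizer.of_mul {Q : Set E} {A N : C(E, V →L[ℂ] V)}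
    {S : C(Circ, E) → L2 V →L[ℂ] L2 V} (h : IsRegularizer Q (mulFam N A) S)
    (hN : ∀ θ ∈ Q, ‖N θ - 1‖ ≤ 1 / 2) :
    IsRegularizer Q A fun θ => S θ ∘L proj (Iio 0) ∘L mulOp (N.comp θ) := by
  have hNc : Continuous fun θ : C(Circ, E) => mulOp (N.comp θ) :=
    (mulOp (κ := κ)).continuous.comp (ContinuousMap.continuous_postcomp N)
  refine ⟨?_, fun θ f => h.mem _ _, ?_, ?_, ?_⟩
  · exact h.cont.clm_comp (continuous_const.clm_comp hNc)
  · intro θ hθ f hf h0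
    have h1 := h.inj θ hθ _ (proj_mem _ _) h0
    have h2 : f = proj (Iio 0) (f - mulOp (N.comp θ) f) := by
      rw [map_sub, proj_eq_self hf]
      exact (sub_eq_self.2 h1).symm
    have h3 := norm_sub_mulOp_le (M := N.comp θ) (fun t => hN _ (hθ t)) f
    have h4 : ‖f‖ ≤ 1 / 2 * ‖f‖ := by
      conv_lhs => rw [h2]
      exact (norm_proj_le _ _).trans h3
    exact norm_eq_zero.1 (by linarith [norm_nonneg f])
  · intro θ hθ
    have e : defect A (fun θ => S θ ∘L proj (Iio 0) ∘L mulOp (N.comp θ)) θ = defect (mulFam N A) S θ -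
        S θ ∘L (proj (Iio 0) ∘L mulOp (N.comp θ) ∘L proj (Ici 0)) ∘L mulOp (A.comp θ) := by
      ext1 f; exact defect_mul_apply A N S θ f
    rw [e]
    exact (h.cpt θ hθ).sub (((isCompactOperator_hankel (N.comp θ)).comp_clm _).clm_comp _)
  · intro a ha
    ext1 f
    have e1 : ∀ B : C(E, V →L[ℂ] V), B.comp (ContinuousMap.const Circ a) =
      ContinuousMap.const _ (B a) := fun B => rfl
    have e2 : proj (Iio 0) (proj (Ici 0) f) = 0 := by
      have := proj_Iio_add_proj_Ici (proj (Ici 0) f)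
      rw [proj_eq_self (proj_mem (Ici 0) f)] at this
      simpa using this
    rw [defect_mul_apply, h.const a ha, e1, e1, proj_mulOp_const, proj_mulOp_const, proj_mulOp_const, e2,
      map_zero, map_zero, map_zero, sub_zero]

theorem exists_isRegularizer (Q : Set E) (l : List C(E, V →L[ℂ] V))
    (hl : ∀ N ∈ l, ∀ θ ∈ Q, ‖N θ - 1‖ ≤ 1 / 2) :
    ∀ A : C(E, V →L[ℂ] V), (∀ θ ∈ Q, (l.map fun N => N θ).prod * A θ = 1) → ∃ S, IsRegularizer Q A S := by
  induction l using List.reverseRecOn with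
  | nil => exact fun A hA => ⟨_, isRegularizer_one fun θ hθ => by simpa using hA θ hθ⟩
  | append_singleton l N ih =>
    intro A hA
    obtain ⟨S, hS⟩ := ih (fun N hN => hl N (by simp [hN])) (mulFam N A) fun θ hθ => by
      have := hA θ hθ
      rw [List.map_append, List.prod_append, mul_assoc] at this
      simpa [mulFam] using this
    exact ⟨_, hS.of_mul (hl N (by simp))⟩

end Regular

section CompactFamily

/-- A norm-continuous family of compact operators parametrized by a compact set maps bounded sets
into a common compact set. -/
theorem isCompact_closure_image_of_compact_family {Θ X Y : Type*} [TopologicalSpace Θ]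
    [NormedAddCommGroup X] [NormedSpace ℂ X] [NormedAddCommGroup Y] [NormedSpace ℂ Y]
    [CompleteSpace Y] {T : Θ → X →L[ℂ] Y} (hT : Continuous T) {s : Set Θ} (hs : IsCompact s)
    (hc : ∀ θ ∈ s, IsCompactOperator (T θ)) (ρ : ℝ) :
    IsCompact (closure {y | ∃ θ ∈ s, ∃ x, ‖x‖ ≤ ρ ∧ T θ x = y}) := by
  refine TotallyBounded.isCompact_of_isClosed ?_ isClosed_closure
  refine TotallyBounded.closure ?_
  rw [Metric.totallyBounded_iff]
  intro ε hε
  have h1 : ∀ θ ∈ s, ∃ U ∈ nhdsWithin θ s, ∀ θ' ∈ U, ‖T θ' - T θ‖ * (|ρ| + 1) < ε / 2 := by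
    intro θ hθ
    have hcont : Continuous fun θ' => ‖T θ' - T θ‖ * (|ρ| + 1) := by fun_prop
    have := hcont.continuousAt.eventually_lt (continuousAt_const (x := θ) (y := ε / 2))
      (by simpa using half_pos hε)
    exact ⟨_, mem_nhdsWithin_of_mem_nhds this, fun θ' h => h⟩
  obtain ⟨F, hFs, hF⟩ : ∃ F : Finset Θ, (∀ θ ∈ F, θ ∈ s) ∧
      ∀ θ ∈ s, ∃ θ' ∈ F, ‖T θ - T θ'‖ * (|ρ| + 1) < ε / 2 := by
    choose! U hU hU' using h1
    obtain ⟨F, hF, hFs⟩ := hs.elim_nhdsWithin_subcover U hU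
    refine ⟨F, hF, fun θ hθ => ?_⟩
    obtain ⟨θ', h1, h2⟩ := mem_iUnion₂.1 (hFs hθ)
    exact ⟨θ', h1, hU' θ' (hF θ' h1) θ h2⟩
  have h2 : TotallyBounded (⋃ θ ∈ F, T θ '' Metric.closedBall 0 ρ) := by
    refine (totallyBounded_biUnion F.finite_toSet).2 fun θ hθ => ?_
    have := (hc θ (hFs θ hθ)).isCompact_closure_image_closedBall (𝕜₁ := ℂ) (f := (T θ : X →ₗ[ℂ] Y)) ρ
    exact this.totallyBounded.subset subset_closure
  obtain ⟨t, ht, htc⟩ := Metric.totallyBounded_iff.1 h2 (ε / 2) (half_pos hε)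
  refine ⟨t, ht, ?_⟩
  rintro y ⟨θ, hθ, x, hx, rfl⟩
  obtain ⟨θ', hθ', hlt⟩ := hF θ hθ
  have h3 : T θ' x ∈ ⋃ θ ∈ F, T θ '' Metric.closedBall 0 ρ :=
    mem_iUnion₂.2 ⟨θ', hθ', mem_image_of_mem _ (by simpa using hx)⟩
  obtain ⟨z, hz, hzd⟩ := mem_iUnion₂.1 (htc h3)
  refine mem_iUnion₂.2 ⟨z, hz, ?_⟩
  rw [Metric.mem_ball] at hzd ⊢
  have h4 : dist (T θ x) (T θ' x) < ε / 2 := by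
    rw [dist_eq_norm, ← sub_apply]
    refine (((T θ - T θ').le_opNorm x).trans ?_).trans_lt hlt
    gcongr
    exact hx.trans ((le_abs_self ρ).trans (by linarith))
  linarith [dist_triangle (T θ x) (T θ' x) z]

end CompactFamily

section CompactFamily

theorem exists_fixedPoint_of_compact_family {X Θ : Type*} [NormedAddCommGroup X] [NormedSpace ℂ X]
    [CompleteSpace X] [TopologicalSpace Θ] {ℓ : X → Θ} (hℓ : Continuous ℓ) {D S : Θ → X →L[ℂ] X}
    (hD : Continuous D) (hS : Continuous S) {N : X → X} (hN : Continuous N)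
    (hN2 : ∀ u, ‖N u‖ ≤ 2 * ‖u‖) (e : X) {Ω : Set X} (hΩ : IsOpen Ω) (h0 : (0 : X) ∈ Ω) {ρ : ℝ}
    (hρ : ∀ u ∈ closure Ω, ‖u‖ ≤ ρ) {Θ₀ : Set Θ} (hΘ : IsCompact Θ₀) (hℓΘ : ∀ u ∈ closure Ω, ℓ u ∈ Θ₀)
    (hcpt : ∀ θ ∈ Θ₀, IsCompactOperator (D θ)) (hD0 : D (ℓ 0) = 0) {c : ℝ}
    (hbd : ∀ (τ : ℝ) u, 0 ≤ τ → τ ≤ 1 → u ∈ closure Ω →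
      -D (ℓ u) (N u) + (τ : ℂ) • S (ℓ u) e = u → ‖u‖ ≤ c * τ ∧ u ∈ Ω) :
    ∃ u ∈ Ω, -D (ℓ u) (N u) + S (ℓ u) e = u := by
  set K : ℝ × X → X := fun z => -D (ℓ z.2) (N z.2) + (z.1 : ℂ) • S (ℓ z.2) e with hK
  obtain ⟨b, hb, hbD⟩ : ∃ b > 0, ∀ u : X, ‖u‖ ≤ b → ‖D (ℓ u)‖ ≤ 1 / 4 := by
    have h1 : ContinuousAt (fun u => ‖D (ℓ u)‖) 0 := (hD.comp hℓ).norm.continuousAt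
    have h2 := h1.eventually_lt (continuousAt_const (y := (1 / 4 : ℝ))) (by
      rw [hD0, norm_zero]; norm_num)
    obtain ⟨b, hb, h3⟩ := Metric.eventually_nhds_iff.1 h2
    exact ⟨b / 2, by positivity, fun u hu => (h3 (by rw [dist_zero_right]; linarith)).le⟩
  have hC1 := isCompact_closure_image_of_compact_family hD hΘ hcpt (2 * ρ)
  have hC2 : IsCompact ((fun z : ℝ × Θ => (z.1 : ℂ) • S z.2 e) '' (Icc 0 1 ×ˢ Θ₀)) := by
    refine (isCompact_Icc.prod hΘ).image ?_
    have h1 : Continuous fun z : ℝ × Θ => S z.2 e :=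
      (hS.comp continuous_snd).clm_apply continuous_const
    exact (Complex.continuous_ofReal.comp continuous_fst).smul h1
  have hC := (hC1.prod hC2).image (f := fun z : X × X => -z.1 + z.2) (by fun_prop)
  have hKc : Continuous K := by
    have h1 : Continuous fun z : ℝ × X => D (ℓ z.2) (N z.2) :=
      (hD.comp (hℓ.comp continuous_snd)).clm_apply (hN.comp continuous_snd)
    have h2 : Continuous fun z : ℝ × X => S (ℓ z.2) e :=
      (hS.comp (hℓ.comp continuous_snd)).clm_apply continuous_const
    exact h1.neg.add ((Complex.continuous_ofReal.comp continuous_fst).smul h2)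
  let _ : NormedSpace ℝ X := NormedSpace.restrictScalars ℝ ℂ X
  obtain ⟨u, huΩ, hu⟩ := exists_fixedPoint_of_homotopy Ω hΩ h0 b hb K hKc.continuousOn _ hC
    (by
      rintro ⟨τ, u⟩ ⟨hτ, hu⟩
      exact ⟨(D (ℓ u) (N u), (τ : ℂ) • S (ℓ u) e), ⟨subset_closure ⟨ℓ u, hℓΘ u hu, _,
        (hN2 u).trans (by linarith [hρ u hu]), rfl⟩, ⟨(τ, ℓ u), ⟨hτ, hℓΘ u hu⟩, rfl⟩⟩, rfl⟩)
    (fun τ hτ u hu hfu => (hbd τ u hτ.1 hτ.2 hu hfu).2)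
    (fun u hu hfu => by simpa using (hbd 0 u le_rfl zero_le_one hu hfu).1)
    (fun u _ hu => by
      have h1 : K (0, u) = -D (ℓ u) (N u) := by simp [hK]
      rw [h1, norm_neg]
      refine ((D (ℓ u)).le_of_opNorm_le (hbD u hu) _).trans ?_
      linarith [hN2 u])
  refine ⟨u, huΩ, ?_⟩
  simpa [hK] using hu

end CompactFamily

section Continuation
variable {κ : Type*} [Fintype κ] [DecidableEq κ]

local notation "V" => EuclideanSpace ℂ κ
local notation "E" => EuclideanSpace ℝ κ

theorem monom_mem_modes {k : ℤ} {S : Set ℤ} (h : k ∈ S) (c : V) :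
    toL2 (monom k c) ∈ (modes S : Submodule ℂ (L2 V)) := by
  rw [mem_modes]
  intro l hl
  rw [coef_monom, if_neg (fun e : l = k => hl (e ▸ h))]

theorem proj_twoRe {u : L2 V} (hu : u ∈ (modes (Iio 0) : Submodule ℂ (L2 V))) :
    proj (Iio 0) (twoRe u) = u := by
  classical
  refine coef_ext fun k => ?_
  rw [coef_proj, twoRe, map_add, coef_conjL2]
  split_ifs with h
  · rw [mem_modes.1 hu (-k) (by simp at h ⊢; omega)]; simp
  · exact (mem_modes.1 hu k h).symm

theorem norm_le_norm_twoRe {u : L2 V} (hu : u ∈ (modes (Iio 0) : Submodule ℂ (L2 V))) :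
    ‖u‖ ≤ ‖twoRe u‖ := by
  conv_lhs => rw [← proj_twoRe hu]
  exact norm_proj_le _ _

theorem norm_le_mul_norm_mulOp {M : MatFun κ} {c : ℝ} (h : ∀ t v, ‖v‖ ≤ c * ‖M t v‖) (f : L2 V) :
    ‖f‖ ≤ c * ‖mulOp M f‖ := by
  refine Lp.norm_le_mul_norm_of_ae_le_mul ?_
  filter_upwards [coeFn_mulOp M f] with t ht
  rw [ht]
  exact h t _

theorem loop_zero (θ₀ : E) : loop θ₀ (0 : L2 V) = ContinuousMap.const _ θ₀ := by
  ext1 t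
  simp [loop]

theorem isCompact_loop (θ₀ : E) (ρ : ℝ) {Q : Set E} (hQ : IsClosed Q) :
    ∃ Θ : Set C(Circ, E), IsCompact Θ ∧ (∀ θ ∈ Θ, ∀ t, θ t ∈ Q) ∧
      ∀ u : L2 V, ‖u‖ ≤ ρ → (∀ t, loop θ₀ u t ∈ Q) → loop θ₀ u ∈ Θ := by
  let T : C(V, E) := ⟨fun v => θ₀ + (2 : ℝ) • reV v, by fun_prop⟩
  have h1 : IsCompact (closure ((prim (κ := κ)) '' Metric.closedBall 0 ρ)) :=
    isCompactOperator_prim.isCompact_closure_image_closedBall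
      (𝕜₁ := ℂ) (f := (prim (κ := κ) : L2 V →ₗ[ℂ] C(Circ, V))) ρ
  have h2 : IsClosed {θ : C(Circ, E) | ∀ t, θ t ∈ Q} := by
    rw [ofPred_forall]
    exact isClosed_iInter fun t => hQ.preimage (continuous_eval_const (F := C(Circ, E)) t)
  refine ⟨_, (h1.image (ContinuousMap.continuous_postcomp T)).inter_right h2, fun θ hθ => hθ.2,
    fun u hu hQu => ⟨⟨prim u, subset_closure ⟨u, by simpa using hu, rfl⟩, rfl⟩, hQu⟩⟩

/-- Continuation of the constant loop to a solution of the inhomogeneous Riemann–Hilbert problem,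
under an a priori estimate. -/
theorem exists_loop_of_apriori {Q : Set E} (hQ : IsCompact Q) {θ₀ : E} (hθ₀ : θ₀ ∈ interior Q)
    {A : C(E, V →L[ℂ] V)} {S : C(Circ, E) → L2 V →L[ℂ] L2 V} (hS : IsRegularizer Q A S)
    {cA : ℝ} (hcA : 0 ≤ cA) (hA : ∀ θ ∈ Q, ∀ v, ‖v‖ ≤ cA * ‖A θ v‖) {Y : ℝ} (hY : 0 ≤ Y) (c₀ : V)
    (hap : ∀ (f : L2 V) (τ : ℝ), f ∈ (modes (Iio 0) : Submodule ℂ (L2 V)) → 0 ≤ τ → τ ≤ 1 →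
      (∀ t, loop θ₀ f t ∈ Q) →
      proj (Iio 0) (mulOp (A.comp (loop θ₀ f)) (twoRe f)) = (τ : ℂ) • toL2 (monom (-1) c₀) →
      ‖mulOp (A.comp (loop θ₀ f)) (twoRe f)‖ ≤ Y * τ ∧ ∀ t, loop θ₀ f t ∈ interior Q) :
    ∃ f ∈ (modes (Iio 0) : Submodule ℂ (L2 V)), (∀ t, loop θ₀ f t ∈ Q) ∧
      proj (Iio 0) (mulOp (A.comp (loop θ₀ f)) (twoRe f)) = toL2 (monom (-1) c₀) := by
  set e : L2 V := toL2 (monom (-1) c₀) with he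
  have hem : e ∈ (modes (Iio 0) : Submodule ℂ (L2 V)) := monom_mem_modes (by simp) c₀
  set P : L2 V →L[ℂ] L2 V := proj (Iio 0) with hP
  set ℓ : L2 V → C(Circ, E) := fun u => loop θ₀ (P u) with hℓ
  have hℓc : Continuous ℓ := (continuous_loop θ₀).comp P.continuous
  set D : C(Circ, E) → L2 V →L[ℂ] L2 V := defect A S with hD
  have hDc : Continuous D := by
    have hAc : Continuous fun θ : C(Circ, E) => mulOp (A.comp θ) :=
      (mulOp (κ := κ)).continuous.comp (ContinuousMap.continuous_postcomp A)
    exact (hS.cont.clm_comp (continuous_const.clm_comp hAc)).sub continuous_const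
  set ρ : ℝ := cA * Y + 1 with hρ
  have hρ0 : 0 < ρ := by positivity
  set Ω : Set (L2 V) := {u | ‖u‖ < ρ ∧ ∀ t, ℓ u t ∈ interior Q} with hΩdef
  have hΩ : IsOpen Ω := by
    refine (isOpen_lt continuous_norm continuous_const).inter ?_
    have := (ContinuousMap.isOpen_setOfPred_mapsTo (isCompact_univ (X := Circ))
      (isOpen_interior (s := Q))).preimage hℓc
    have e : {u : L2 V | ∀ t, ℓ u t ∈ interior Q} = ℓ ⁻¹' {f | MapsTo f univ (interior Q)} := by
      ext u; simp [MapsTo]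
    change IsOpen {u : L2 V | ∀ t, ℓ u t ∈ interior Q}
    rw [e]; exact this
  have hcl : ∀ u ∈ closure Ω, ‖u‖ ≤ ρ ∧ ∀ t, ℓ u t ∈ Q := by
    have hc : IsClosed {u : L2 V | ‖u‖ ≤ ρ ∧ ∀ t, ℓ u t ∈ Q} := by
      refine (isClosed_le continuous_norm continuous_const).inter ?_
      change IsClosed {u : L2 V | ∀ t, ℓ u t ∈ Q}
      rw [ofPred_forall]
      exact isClosed_iInter fun t => hQ.isClosed.preimage
        ((continuous_eval_const (F := C(Circ, E)) t).comp hℓc)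
    have hsub : Ω ⊆ {u : L2 V | ‖u‖ ≤ ρ ∧ ∀ t, ℓ u t ∈ Q} :=
      fun u hu => ⟨hu.1.le, fun t => interior_subset (hu.2 t)⟩
    exact fun u hu => closure_minimal hsub hc hu
  have hℓ0 : ℓ 0 = ContinuousMap.const _ θ₀ := by simp only [hℓ, map_zero]; exact loop_zero θ₀
  have hD0 : D (ℓ 0) = 0 := by rw [hℓ0]; exact hS.const θ₀ (interior_subset hθ₀)
  have hPn : ∀ u, ‖P u‖ ≤ ‖u‖ := norm_proj_le _
  have hDmem : ∀ θ g, D θ g ∈ (modes (Iio 0) : Submodule ℂ (L2 V)) := fun θ g =>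
    Submodule.sub_mem _ (hS.mem _ _) (proj_mem _ _)
  -- fixed points solve the Riemann–Hilbert problem
  have hfix : ∀ (τ : ℝ) u, (∀ t, ℓ u t ∈ Q) → -D (ℓ u) (twoRe (P u)) + (τ : ℂ) • S (ℓ u) e = u →
      u ∈ (modes (Iio 0) : Submodule ℂ (L2 V)) ∧
        P (mulOp (A.comp (ℓ u)) (twoRe u)) = (τ : ℂ) • e := by
    intro τ u huQ hu
    have hum : u ∈ (modes (Iio 0) : Submodule ℂ (L2 V)) := by
      rw [← hu]
      exact Submodule.add_mem _ (Submodule.neg_mem _ (hDmem _ _))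
        (Submodule.smul_mem _ _ (hS.mem _ _))
    refine ⟨hum, ?_⟩
    have hPu : P u = u := proj_eq_self hum
    have h1 : D (ℓ u) (twoRe u) = S (ℓ u) (P (mulOp (A.comp (ℓ u)) (twoRe u))) - u := by
      change S (ℓ u) (P (mulOp (A.comp (ℓ u)) (twoRe u))) - P (twoRe u) = _
      rw [hP, proj_twoRe hum]
    have h2 := hu
    rw [hPu, h1] at h2
    have h3 : S (ℓ u) (P (mulOp (A.comp (ℓ u)) (twoRe u)) - (τ : ℂ) • e) = 0 := by
      rw [map_sub, map_smul]
      have := sub_eq_zero.2 h2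
      rw [← neg_eq_zero, ← this]
      abel
    exact sub_eq_zero.1 (hS.inj _ huQ _ (Submodule.sub_mem _ (proj_mem _ _)
      (Submodule.smul_mem _ _ hem)) h3)
  have hℓm : ∀ u, u ∈ (modes (Iio 0) : Submodule ℂ (L2 V)) → ℓ u = loop θ₀ u := fun u hu => by
    simp only [hℓ]; rw [hP, proj_eq_self hu]
  have hest : ∀ (τ : ℝ) u, 0 ≤ τ → τ ≤ 1 → (∀ t, ℓ u t ∈ Q) → -D (ℓ u) (twoRe (P u)) + (τ : ℂ) • S (ℓ u) e = u →
      ‖u‖ ≤ cA * (Y * τ) ∧ ∀ t, ℓ u t ∈ interior Q := by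
    intro τ u h0 h1 huQ hu
    obtain ⟨hum, hPy⟩ := hfix τ u huQ hu
    rw [hℓm u hum] at huQ hPy ⊢
    obtain ⟨h2, h3⟩ := hap u τ hum h0 h1 huQ hPy
    refine ⟨?_, h3⟩
    calc ‖u‖ ≤ ‖twoRe u‖ := norm_le_norm_twoRe hum
      _ ≤ cA * ‖mulOp (A.comp (loop θ₀ u)) (twoRe u)‖ :=
        norm_le_mul_norm_mulOp (M := A.comp (loop θ₀ u)) (fun t v => hA _ (huQ t) v) _
      _ ≤ _ := by gcongr
  obtain ⟨Θ, hΘ, hΘQ, hΘm⟩ := isCompact_loop θ₀ ρ hQ.isClosed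
  obtain ⟨u, huΩ, hu⟩ := exists_fixedPoint_of_compact_family hℓc hDc hS.cont
    (continuous_twoRe.comp P.continuous)
    (fun u => (norm_twoRe_le _).trans (mul_le_mul_of_nonneg_left (hPn u) zero_le_two)) e hΩ
    ⟨by simpa using hρ0, fun t => by rw [hℓ0]; exact hθ₀⟩ (fun u hu => (hcl u hu).1) hΘ
    (fun u hu => hΘm _ ((hPn u).trans (hcl u hu).1) (hcl u hu).2) (fun θ hθ => hS.cpt θ (hΘQ θ hθ))
    hD0 (c := cA * Y) (fun τ u h0 h1 hu hfu => by
      obtain ⟨h2, h3⟩ := hest τ u h0 h1 (hcl u hu).2 hfu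
      rw [← mul_assoc] at h2
      have : cA * Y * τ ≤ cA * Y := mul_le_of_le_one_right (by positivity) h1
      exact ⟨h2, by linarith, h3⟩)
  have huQ := (hcl u (subset_closure huΩ)).2
  obtain ⟨hum, hPy⟩ := hfix 1 u huQ (by simpa using hu)
  rw [hℓm u hum] at huQ hPy
  exact ⟨u, hum, huQ, by rw [hPy]; simp⟩

end Continuation

section Obstruction
variable {κ : Type*} [Fintype κ] [DecidableEq κ]

local notation "V" => EuclideanSpace ℂ κ
local notation "E" => EuclideanSpace ℝ κ

/-- A continuous function on a compact set extends to the whole space. -/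
theorem exists_extension_of_isCompact {F : Type*} [NormedAddCommGroup F] [NormedSpace ℝ F]
    [FiniteDimensional ℝ F] {Q : Set E} (hQ : IsCompact Q) {f : E → F} (hf : ContinuousOn f Q) :
    ∃ g : C(E, F), ∀ θ ∈ Q, g θ = f θ := by
  have : TietzeExtension F := TietzeExtension.of_tvs ℝ
  obtain ⟨g, hg⟩ := ContinuousMap.exists_restrict_eq hQ.isClosed ⟨Q.restrict f, hf.restrict⟩
  exact ⟨g, fun θ hθ => DFunLike.congr_fun hg ⟨θ, hθ⟩⟩

theorem integral_energy_le {w : C(Circ, V)} {η : Circ → ℝ} (hη : Continuous η) {C : ℝ}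
    (h : ∀ t t', |η t' - η t - (inner ℂ (w t) (w t')).im| ≤ C * ‖w t' - w t‖ ^ 2) (ε : ℝ) :
    |∫ t, (inner ℂ (w t) (w (t + (ε : Circ)))).im ∂haarAddCircle| ≤
      C * ∫ t, ‖w (t + (ε : Circ)) - w t‖ ^ 2 ∂haarAddCircle := by
  have int : ∀ {f : Circ → ℝ}, Continuous f → Integrable f (haarAddCircle (T := (1 : ℝ))) :=
    fun hf => hf.integrable_of_hasCompactSupport (HasCompactSupport.of_compactSpace _)
  have c1 : Continuous fun t => η (t + (ε : Circ)) := by fun_prop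
  have c2 : Continuous fun t => (inner ℂ (w t) (w (t + (ε : Circ)))).im :=
    Complex.continuous_im.comp (by fun_prop)
  have h0 : ∫ t, (η (t + (ε : Circ)) - η t - (inner ℂ (w t) (w (t + (ε : Circ)))).im)
      ∂haarAddCircle = -∫ t, (inner ℂ (w t) (w (t + (ε : Circ)))).im ∂haarAddCircle := by
    have i1 : Integrable (fun t => η (t + (ε : Circ)) - η t) haarAddCircle := int (c1.sub hη)
    rw [integral_sub i1 (int c2), integral_sub (int c1) (int hη),
      integral_add_right_eq_self η (ε : Circ), sub_self, zero_sub]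
  rw [← abs_neg, ← h0, ← integral_const_mul]
  refine abs_integral_le_integral_abs.trans (integral_mono ?_ ?_ fun t => h t (t + ε))
  · exact int ((c1.sub hη).sub c2).abs
  · exact int (by fun_prop)

/-- A complex-linear operator `A θ` is determined along loops by its real values. -/
theorem mulOp_conj_eq {M A : MatFun κ}
    (h : ∀ t v, M t (conjV (A t (ofRealV v))) = A t (ofRealV v)) (f : L2 V) :
    mulOp M (conjL2 (mulOp A (twoRe f))) = mulOp A (twoRe f) := by
  refine Lp.ext ?_
  filter_upwards [coeFn_mulOp M (conjL2 (mulOp A (twoRe f))), coeFn_conjL2 (mulOp A (twoRe f)),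
    coeFn_mulOp A (twoRe f), Lp.coeFn_add f (conjL2 f), coeFn_conjL2 f] with t h1 h2 h3 h4 h5
  have h6 : twoRe f t = ofRealV ((2 : ℝ) • reV (f t)) := by
    rw [ofRealV_two_smul_reV, ← h5]; exact h4
  rw [h1, h2, h3, h6, h]

/-- There is no exact Lagrangian immersion with controlled geometry and one bounded coordinate. -/
theorem no_exact_lagrangian {F : Type*} [NormedAddCommGroup F] [NormedSpace ℝ F]
    {U : Set E} (hU : IsOpen U) {θ₀ : E} (hθ₀ : θ₀ ∈ U) {W : E → V} {A B : E → V →L[ℂ] V}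
    (hW : ∀ θ ∈ U, HasFDerivAt W (((A θ).restrictScalars ℝ).comp ofRealV.toContinuousLinearMap) θ)
    (hA : ContinuousOn A U)
    (hN : ∀ Q ⊆ U, IsCompact Q → ∃ l : List (E → V →L[ℂ] V), (∀ N ∈ l, ContinuousOn N U) ∧
      (∀ N ∈ l, ∀ θ ∈ Q, ‖N θ - 1‖ ≤ 1 / 2) ∧ ∀ θ ∈ Q, (l.map fun N => N θ).prod * A θ = 1)
    {Φ : E → F} {Φ' : E → E →L[ℝ] F} {CΦ : ℝ} (hCΦ : 0 ≤ CΦ)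
    (hΦ : ∀ θ ∈ U, HasFDerivAt Φ (Φ' θ) θ)
    (hΦA : ∀ θ ∈ U, ∀ v, ‖Φ' θ v‖ ≤ CΦ * ‖A θ (ofRealV v)‖)
    (hΦc : ∀ R, ∃ Q ⊆ U, IsCompact Q ∧ ∀ θ ∈ U, ‖Φ θ - Φ θ₀‖ ≤ R → θ ∈ Q)
    {η : E → ℝ} (hη : ContinuousOn η U) {C : ℝ} (hC : 0 ≤ C)
    (hηW : ∀ θ ∈ U, ∀ θ' ∈ U, |η θ' - η θ - (inner ℂ (W θ) (W θ')).im| ≤ C * ‖W θ' - W θ‖ ^ 2)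
    {CB L : ℝ} (hCB : 0 ≤ CB) (hB : ∀ θ ∈ U, ‖B θ‖ ≤ CB)
    (hBL : ∀ θ ∈ U, ∀ θ' ∈ U, ‖B θ - B θ'‖ ≤ L * ‖W θ - W θ'‖)
    (hBA : ∀ θ ∈ U, ∀ v, B θ (conjV (A θ (ofRealV v))) = A θ (ofRealV v))
    (i₀ : κ) {ρ : ℝ} (hρ : ∀ θ ∈ U, ‖W θ i₀‖ ≤ ρ) : False := by
  classical
  have hpi := Real.pi_pos
  have hρ0 : 0 ≤ ρ := (norm_nonneg _).trans (hρ θ₀ hθ₀)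
  have hWc : ContinuousOn W U := fun θ hθ => (hW θ hθ).continuousAt.continuousWithinAt
  have hBc : ContinuousOn B U := by
    intro θ hθ
    have h1 : Filter.Tendsto (fun θ' => L * ‖W θ' - W θ‖) (nhdsWithin θ U) (nhds 0) := by
      have : Filter.Tendsto (fun θ' => L * ‖W θ' - W θ‖) (nhdsWithin θ U)
          (nhds (L * ‖W θ - W θ‖)) := (((hWc θ hθ).sub tendsto_const_nhds).norm).const_mul L
      simpa using this
    rw [ContinuousWithinAt, tendsto_iff_norm_sub_tendsto_zero]
    refine squeeze_zero' (Filter.Eventually.of_forall fun _ => norm_nonneg _) ?_ h1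
    filter_upwards [self_mem_nhdsWithin] with θ' hθ'
    exact hBL θ' hθ' θ hθ
  set c : ℝ := 2 * π * (ρ + 1) with hc
  have hc0 : 0 ≤ c := by positivity
  set c₀ : V := EuclideanSpace.single i₀ (c : ℂ) with hc₀
  have hc₀n : ‖c₀‖ = c := by simp [hc₀, abs_of_nonneg hc0]
  obtain ⟨Y, hY, hapY⟩ := exists_apriori_bound (κ := κ) (L := L) hC hCB hc0
  obtain ⟨Q₀, hQ₀U, hQ₀, hΦQ⟩ := hΦc (CΦ * Y)
  obtain ⟨Q, hQ, hQ₀Q, hQU⟩ := exists_compact_between hQ₀ hU hQ₀U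
  obtain ⟨Q₂, hQ₂, hQQ₂, hQ₂U⟩ := exists_compact_between hQ hU hQU
  have hQU' : Q ⊆ U := hQU
  obtain ⟨W₂, hW₂⟩ := exists_extension_of_isCompact hQ₂ (hWc.mono hQ₂U)
  obtain ⟨A₂, hA₂⟩ := exists_extension_of_isCompact hQ₂ (hA.mono hQ₂U)
  obtain ⟨B₂, hB₂⟩ := exists_extension_of_isCompact hQ₂ (hBc.mono hQ₂U)
  have hQ₂' : ∀ θ ∈ Q, θ ∈ Q₂ := fun θ hθ => interior_subset (hQQ₂ hθ)
  have hO := isOpen_interior (s := Q₂)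
  have hWO : IsRealDeriv (interior Q₂) W₂ A₂ := by
    intro θ hθ
    rw [hA₂ θ (interior_subset hθ)]
    refine (hW θ (hQ₂U (interior_subset hθ))).congr_of_eventuallyEq ?_
    filter_upwards [hO.mem_nhds hθ] with θ' hθ'
    exact hW₂ θ' (interior_subset hθ')
  obtain ⟨l, hlc, hlN, hlA⟩ := hN Q hQU' hQ
  have hl2 : ∀ l : List (E → V →L[ℂ] V), (∀ N ∈ l, ContinuousOn N U) →
      ∃ l' : List C(E, V →L[ℂ] V), List.Forall₂ (fun N N' => ∀ θ ∈ Q, N' θ = N θ) l l' := by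
    intro l
    induction l with
    | nil => exact fun _ => ⟨[], .nil⟩
    | cons N l ih =>
      intro h
      obtain ⟨l', hl'⟩ := ih fun N hN => h N (by simp [hN])
      obtain ⟨N', hN'⟩ := exists_extension_of_isCompact hQ ((h N (by simp)).mono hQU')
      exact ⟨N' :: l', .cons hN' hl'⟩
  obtain ⟨l', hl'⟩ := hl2 l hlc
  have hmap : ∀ θ ∈ Q, (l'.map fun N => N θ) = l.map fun N => N θ := by
    intro θ hθ
    clear hlc hlN hlA hl2
    induction hl' with
    | nil => rfl
    | cons h _ ih => simp [h θ hθ, ih]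
  obtain ⟨S, hS⟩ := exists_isRegularizer Q l' (by
      clear hlc hlA hl2 hmap
      induction hl' with
      | nil => simp
      | cons h _ ih =>
        intro N hN θ hθ
        rcases List.mem_cons.1 hN with rfl | hN
        · rw [h θ hθ]; exact hlN _ (by simp) θ hθ
        · exact ih (fun N hN => hlN N (by simp [hN])) N hN θ hθ) A₂ (fun θ hθ => by
      rw [hmap θ hθ, hA₂ θ (hQ₂' θ hθ)]; exact hlA θ hθ)
  obtain ⟨cA, hcA, hAb⟩ : ∃ cA : ℝ, 0 ≤ cA ∧ ∀ θ ∈ Q, ∀ v, ‖v‖ ≤ cA * ‖A₂ θ v‖ := by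
    have hb : ∀ l : List (E → V →L[ℂ] V), (∀ N ∈ l, ContinuousOn N U) →
        ContinuousOn (fun θ => (l.map fun N => N θ).prod) U := by
      intro l hl
      exact continuousOn_list_prod l hl
    obtain ⟨cA, hcA⟩ := hQ.exists_bound_of_continuousOn ((hb l hlc).mono hQU')
    refine ⟨|cA|, abs_nonneg _, fun θ hθ v => ?_⟩
    have h1 := congrArg (fun T : V →L[ℂ] V => T v) (hlA θ hθ)
    rw [← hA₂ θ (hQ₂' θ hθ)] at h1
    calc ‖v‖ = ‖(l.map fun N => N θ).prod (A₂ θ v)‖ := (congrArg norm h1).symm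
      _ ≤ _ := ContinuousLinearMap.le_of_opNorm_le _ ((hcA θ hθ).trans (le_abs_self _)) _
  have hin : ∀ θ : C(Circ, E), (∀ t, θ t ∈ Q) → ∀ t, θ t ∈ interior Q₂ := fun θ h t => hQQ₂ (h t)
  have hθ₀Q : θ₀ ∈ interior Q := hQ₀Q (hΦQ θ₀ hθ₀ (by simp; positivity))
  have hcoef : ∀ f ∈ (modes (Iio 0) : Submodule ℂ (L2 V)), (∀ t, loop θ₀ f t ∈ Q) → ∀ k,
      coef k (mulOp (A₂.comp (loop θ₀ f)) (twoRe f)) =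
        (2 * π * Complex.I * k : ℂ) • fourierCoeff (W₂.comp (loop θ₀ f)) k := fun f hf hfQ k =>
    coef_mulOp_loop hWO hO θ₀ f (mem_modes.1 hf 0 (by simp)) (hin _ hfQ) k
  obtain ⟨f, hf, hfQ, hPf⟩ := exists_loop_of_apriori hQ hθ₀Q hS hcA hAb hY c₀ (by
    intro f τ hf h0 h1 hfQ hPf
    have hf0 : coef 0 f = 0 := mem_modes.1 hf 0 (by simp)
    have hWθ : ∀ t, W₂ (loop θ₀ f t) = W (loop θ₀ f t) := fun t => hW₂ _ (hQ₂' _ (hfQ t))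
    have hBθ : ∀ t, B₂ (loop θ₀ f t) = B (loop θ₀ f t) := fun t => hB₂ _ (hQ₂' _ (hfQ t))
    have hAθ : ∀ t, A₂ (loop θ₀ f t) = A (loop θ₀ f t) := fun t => hA₂ _ (hQ₂' _ (hfQ t))
    have hUθ : ∀ t, loop θ₀ f t ∈ U := fun t => hQU' (hfQ t)
    have hy := hapY (W₂.comp (loop θ₀ f)) (mulOp (A₂.comp (loop θ₀ f)) (twoRe f))
      (B₂.comp (loop θ₀ f)) τ c₀ h0 h1 hc₀n.le (hcoef f hf hfQ)
      (by
        intro k hk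
        have h2 := congrArg (coef k) hPf
        rw [coef_proj, if_pos (by simpa using hk), map_smul, coef_monom] at h2
        rw [h2]; split_ifs <;> simp)
      (integral_energy_le (η := fun t => η (loop θ₀ f t))
        (continuousOn_univ.1 (hη.comp (loop θ₀ f).continuous.continuousOn fun t _ => hUθ t))
        (by
          intro t t'
          simp only [ContinuousMap.comp_apply, hWθ]
          exact hηW _ (hUθ t) _ (hUθ t')))
      (by
        intro t
        simp only [ContinuousMap.comp_apply, hBθ]
        exact hB _ (hUθ t))
      (by
        intro t t'
        simp only [ContinuousMap.comp_apply, hBθ, hWθ]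
        exact hBL _ (hUθ t) _ (hUθ t'))
      (mulOp_conj_eq (M := B₂.comp (loop θ₀ f)) (A := A₂.comp (loop θ₀ f)) (by
        intro t v
        simp only [ContinuousMap.comp_apply, hBθ, hAθ]
        exact hBA _ (hUθ t) v) f)
    refine ⟨hy, fun t => hQ₀Q (hΦQ _ (hUθ t) ?_)⟩
    refine (norm_comp_loop_sub_le A₂ hO (Φ' := Φ') hCΦ
      (fun θ hθ => hΦ θ (hQ₂U (interior_subset hθ))) (fun θ hθ v => ?_) θ₀ f hf0
      (hin _ hfQ) t).trans ?_
    · rw [hA₂ θ (interior_subset hθ)]; exact hΦA θ (hQ₂U (interior_subset hθ)) v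
    · gcongr
      exact hy.trans (mul_le_of_le_one_right hY h1))
  have h1 := congrArg (coef (-1)) hPf
  rw [coef_proj, if_pos (by simp), hcoef f hf hfQ, coef_monom, if_pos rfl] at h1
  have h2 : ‖fourierCoeff (W₂.comp (loop θ₀ f)) (-1) i₀‖ ≤ ρ := by
    have h3 : fourierCoeff (W₂.comp (loop θ₀ f)) (-1) i₀ =
        ∫ t, (fourier (-(-1)) t • W₂ (loop θ₀ f t) : V) i₀ ∂haarAddCircle := by
      have hint : Integrable (fun t => (fourier (-(-1)) t • W₂ (loop θ₀ f t) : V))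
          haarAddCircle := (by fun_prop : Continuous _).integrable_of_hasCompactSupport
        (HasCompactSupport.of_compactSpace _)
      exact ((EuclideanSpace.proj (𝕜 := ℂ) i₀ : V →L[ℂ] ℂ).integral_comp_comm hint).symm
    rw [h3]
    refine (norm_integral_le_of_norm_le_const (C := ρ) (Filter.Eventually.of_forall fun t => ?_)).trans ?_
    · rw [PiLp.smul_apply, norm_smul, fourier_apply, Circle.norm_coe, one_mul,
        hW₂ _ (hQ₂' _ (hfQ t))]
      exact hρ _ (hQU' (hfQ t))
    · simp
  have h4 := congrArg (fun v : V => ‖v i₀‖) h1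
  simp only [PiLp.smul_apply, norm_smul, hc₀, PiLp.single_apply, if_pos] at h4
  simp [abs_of_pos hpi, abs_of_nonneg hc0] at h4
  have h5 : 2 * π * ‖fourierCoeff (W₂.comp (loop θ₀ f)) (-1) i₀‖ ≤ 2 * π * ρ := by gcongr
  have h6 : 2 * π * ‖fourierCoeff (W₂.comp (loop θ₀ f)) (-1) i₀‖ = c := by
    rw [← h4]; rfl
  rw [h6, hc] at h5
  nlinarith

end Obstruction

section GlobalFlow

open Manifold in
/-- A `C¹` vector field whose integral curves exist for a uniform time has global integral
curves. -/
theorem exists_integralCurve_of_uniform_time {F : Type*} [NormedAddCommGroup F]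
    [NormedSpace ℝ F] [CompleteSpace F] {f : F → F} (hf : ContDiff ℝ 1 f) {ε : ℝ} (hε : 0 < ε)
    (h : ∀ x, ∃ γ : ℝ → F, γ 0 = x ∧ ∀ t ∈ Ioo (-ε) ε, HasDerivAt γ (f (γ t)) t) (x : F) :
    ∃ γ : ℝ → F, γ 0 = x ∧ ∀ t, HasDerivAt γ (f (γ t)) t := by
  have hv : ContMDiff 𝓘(ℝ, F) (𝓘(ℝ, F).prod 𝓘(ℝ, F)) 1
      (fun x => (⟨x, f x⟩ : TangentBundle 𝓘(ℝ, F) F)) :=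
    contMDiff_vectorSpace_iff_contDiff.2 hf
  obtain ⟨γ, h0, hγ⟩ := exists_isMIntegralCurve_of_isMIntegralCurveOn hv hε (fun x => by
    obtain ⟨γ, h0, hγ⟩ := h x
    refine ⟨γ, h0, fun t ht => ?_⟩
    exact ((hγ t ht).hasFDerivAt.hasMFDerivAt).hasMFDerivWithinAt) x
  refine ⟨γ, h0, fun t => ?_⟩
  have h1 : HasFDerivAt γ (ContinuousLinearMap.smulRight (1 : ℝ →L[ℝ] ℝ) (f (γ t))) t :=
    hasMFDerivAt_iff_hasFDerivAt.1 (hγ t)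
  simpa using h1.hasDerivAt

theorem gronwallBound_le {δ K ε x : ℝ} (hK : 0 ≤ K) (hε : 0 ≤ ε) (hx : 0 ≤ x) :
    gronwallBound δ K ε x ≤ (δ + ε * x) * exp (K * x) := by
  rcases hK.eq_or_lt with rfl | hK
  · simp [gronwallBound_K0]
  · rw [gronwallBound_of_K_ne_0 hK.ne']
    have h1 : exp (K * x) - 1 ≤ K * x * exp (K * x) := by
      have h2 := Real.add_one_le_exp (-(K * x))
      have h3 : exp (-(K * x)) * exp (K * x) = 1 := by rw [← exp_add]; simp
      nlinarith [exp_pos (K * x)]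
    have h4 : ε / K * (exp (K * x) - 1) ≤ ε / K * (K * x * exp (K * x)) := by gcongr
    have h5 : ε / K * (K * x * exp (K * x)) = ε * x * exp (K * x) := by field_simp
    linarith

theorem norm_le_of_norm_deriv_le {F : Type*} [NormedAddCommGroup F] [NormedSpace ℝ F]
    {f f' : ℝ → F} (hf : ∀ t, HasDerivAt f (f' t) t) {K ε T : ℝ} (hK : 0 ≤ K) (hε : 0 ≤ ε)
    (hb : ∀ t, |t| ≤ T → ‖f' t‖ ≤ K * ‖f t‖ + ε) {t : ℝ} (ht : |t| ≤ T) :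
    ‖f t‖ ≤ (‖f 0‖ + ε * T) * exp (K * T) := by
  have hT : 0 ≤ T := (abs_nonneg t).trans ht
  have key : ∀ (g g' : ℝ → F), (∀ t, HasDerivAt g (g' t) t) → g 0 = f 0 →
      (∀ t, |t| ≤ T → ‖g' t‖ ≤ K * ‖g t‖ + ε) → ∀ t, 0 ≤ t → t ≤ T →
      ‖g t‖ ≤ (‖f 0‖ + ε * T) * exp (K * T) := by
    intro g g' hg h0 hb t h1 h2
    have := norm_le_gronwallBound_of_norm_deriv_right_le (f := g) (f' := g') (δ := ‖f 0‖) (K := K)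
      (ε := ε) (a := 0) (b := T) (fun t _ => (hg t).continuousAt.continuousWithinAt)
      (fun t _ => (hg t).hasDerivWithinAt) (by rw [h0])
      (fun t ht => hb t (by rw [abs_of_nonneg ht.1]; exact ht.2.le)) t ⟨h1, h2⟩
    rw [sub_zero] at this
    refine this.trans ((gronwallBound_le hK hε h1).trans ?_)
    gcongr
  rcases le_total 0 t with h | h
  · exact key f f' hf rfl hb t h (by rwa [abs_of_nonneg h] at ht)
  · have := key (fun s => f (-s)) (fun s => -f' (-s)) (fun s => by
      have h1 := (hf (-s)).scomp s (hasDerivAt_neg s)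
      rw [neg_one_smul] at h1
      exact h1) (by simp)
      (fun s hs => by rw [norm_neg]; exact hb (-s) (by rwa [abs_neg])) (-t) (by linarith)
      (by rwa [abs_of_nonpos h] at ht)
    simpa using this

/-- A vector field with bounded values, bounded first derivative, and a `C¹`, Lipschitz first
derivative. -/
structure IsTameField {F : Type*} [NormedAddCommGroup F] [NormedSpace ℝ F] (X : F → F)
    (DX : F → F →L[ℝ] F) (M K L : ℝ) : Prop where
  hasFDerivAt : ∀ x, HasFDerivAt X (DX x) x
  contDiff : ContDiff ℝ 1 DX
  norm_le : ∀ x, ‖X x‖ ≤ M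
  norm_deriv_le : ∀ x, ‖DX x‖ ≤ K
  norm_deriv_sub_le : ∀ x y, ‖DX x - DX y‖ ≤ L * ‖x - y‖

/-- `φ` is the flow of `X` and `Ξ` solves the linearized equation along `φ`. -/
structure IsFlow {F : Type*} [NormedAddCommGroup F] [NormedSpace ℝ F] (X : F → F)
    (DX : F → F →L[ℝ] F) (φ : ℝ → F → F) (Ξ : ℝ → F → F →L[ℝ] F) : Prop where
  zero : ∀ x, φ 0 x = x
  deriv_zero : ∀ x, Ξ 0 x = 1
  hasDerivAt : ∀ x t, HasDerivAt (fun s => φ s x) (X (φ t x)) t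
  hasDerivAt_deriv : ∀ x t, HasDerivAt (fun s => Ξ s x) ((DX (φ t x)).comp (Ξ t x)) t

variable {F : Type*} [NormedAddCommGroup F] [NormedSpace ℝ F]
  {X : F → F} {DX : F → F →L[ℝ] F} {M K L : ℝ} {φ : ℝ → F → F} {Ξ : ℝ → F → F →L[ℝ] F}

namespace IsTameField

theorem nonneg (h : IsTameField X DX M K L) : 0 ≤ M ∧ 0 ≤ K :=
  ⟨(norm_nonneg _).trans (h.norm_le 0), (norm_nonneg _).trans (h.norm_deriv_le 0)⟩

theorem norm_sub_le (h : IsTameField X DX M K L) (x y : F) : ‖X x - X y‖ ≤ K * ‖x - y‖ :=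
  Convex.norm_image_sub_le_of_norm_hasFDerivWithin_le (s := univ) (f := X)
    (fun x _ => (h.hasFDerivAt x).hasFDerivWithinAt) (fun x _ => h.norm_deriv_le x) convex_univ
    (mem_univ _) (mem_univ _)

theorem lipschitzWith (h : IsTameField X DX M K L) : LipschitzWith K.toNNReal X :=
  LipschitzWith.of_dist_le_mul fun x y => by
    rw [dist_eq_norm, dist_eq_norm, Real.coe_toNNReal _ h.nonneg.2]; exact h.norm_sub_le x y

/-- Quadratic Taylor estimate. -/
theorem norm_taylor_le (h : IsTameField X DX M K L) (hL : 0 ≤ L) (x y : F) :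
    ‖X y - X x - DX x (y - x)‖ ≤ L * ‖y - x‖ ^ 2 := by
  have h1 : ∀ z ∈ segment ℝ x y, ‖DX z - DX x‖ ≤ L * ‖y - x‖ := by
    intro z hz
    refine (h.norm_deriv_sub_le z x).trans ?_
    gcongr
    obtain ⟨a, b, ha, hb, hab, rfl⟩ := hz
    have : a • x + b • y - x = b • (y - x) := by
      rw [smul_sub, ← eq_sub_iff_add_eq] at *; subst hab; module
    rw [this, norm_smul, Real.norm_of_nonneg hb]
    exact mul_le_of_le_one_left (norm_nonneg _) (by linarith)
  have h2 := Convex.norm_image_sub_le_of_norm_hasFDerivWithin_le (s := segment ℝ x y)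
    (f := fun z => X z - DX x z) (f' := fun z => DX z - DX x)
    (fun z _ => ((h.hasFDerivAt z).sub (DX x).hasFDerivAt).hasFDerivWithinAt) h1
    (convex_segment x y) (left_mem_segment ℝ x y) (right_mem_segment ℝ x y)
  calc _ = ‖X y - DX x y - (X x - DX x x)‖ := by rw [map_sub]; congr 1; abel
    _ ≤ _ := h2
    _ = _ := by ring

theorem exists_flow [CompleteSpace F] (h : IsTameField X DX M K L) (hL : 0 ≤ L) :
    ∃ φ Ξ, IsFlow X DX φ Ξ := by
  obtain ⟨hM, hK⟩ := h.nonneg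
  let f : F × (F →L[ℝ] F) → F × (F →L[ℝ] F) := fun z => (X z.1, (DX z.1).comp z.2)
  have hX : ContDiff ℝ 1 X := contDiff_one_iff_hasFDerivAt.2 ⟨DX, h.contDiff.continuous, h.hasFDerivAt⟩
  have hf : ContDiff ℝ 1 f :=
    (hX.comp contDiff_fst).prodMk ((h.contDiff.comp contDiff_fst).clm_comp contDiff_snd)
  have hε : 0 < 1 / (2 * (K + 1)) := by positivity
  have key : ∀ z : F × (F →L[ℝ] F), ∃ γ : ℝ → F × (F →L[ℝ] F), γ 0 = z ∧
      ∀ t, HasDerivAt γ (f (γ t)) t := by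
    refine exists_integralCurve_of_uniform_time hf hε fun z => ?_
    set ε := 1 / (2 * (K + 1)) with hεd
    set a : ℝ := ‖z.2‖ + M with ha
    have ha0 : 0 ≤ a := by positivity
    have hz2 : ∀ w ∈ Metric.closedBall z a, ‖w.2‖ ≤ ‖z.2‖ + a := by
      intro w hw
      have h1 : ‖w.2 - z.2‖ ≤ a := (norm_snd_le (w - z)).trans (by simpa [dist_eq_norm] using hw)
      linarith [norm_le_insert' w.2 z.2]
    have hmax : 0 ≤ max M (K * (‖z.2‖ + a)) := le_max_of_le_left hM
    have hpl : IsPicardLindelof (fun _ => f) (tmin := -ε) (tmax := ε)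
        ⟨0, by constructor <;> linarith⟩ z a.toNNReal 0
        (max M (K * (‖z.2‖ + a))).toNNReal (K + L * (‖z.2‖ + a)).toNNReal := by
      refine .of_time_independent ?_ ?_ ?_
      · intro w hw
        rw [Real.coe_toNNReal _ ha0] at hw
        rw [Real.coe_toNNReal _ hmax]
        refine max_le_max (h.norm_le _) ?_
        refine (ContinuousLinearMap.opNorm_comp_le _ _).trans ?_
        gcongr
        · exact h.norm_deriv_le _
        · exact hz2 w hw
      · refine LipschitzOnWith.of_dist_le_mul fun w hw w' hw' => ?_
        rw [Real.coe_toNNReal _ ha0] at hw hw'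
        rw [Real.coe_toNNReal _ (by positivity), dist_eq_norm, dist_eq_norm]
        have e1 : ‖w.1 - w'.1‖ ≤ ‖w - w'‖ := norm_fst_le (w - w')
        have e2 : ‖w.2 - w'.2‖ ≤ ‖w - w'‖ := norm_snd_le (w - w')
        refine max_le ?_ ?_
        · refine (h.norm_sub_le _ _).trans ?_
          have : 0 ≤ L * (‖z.2‖ + a) * ‖w - w'‖ := by positivity
          calc K * ‖w.1 - w'.1‖ ≤ K * ‖w - w'‖ := by gcongr
            _ ≤ _ := by linarith
        · have e3 : (f w - f w').2 = (DX w.1).comp (w.2 - w'.2) + (DX w.1 - DX w'.1).comp w'.2 := by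
            ext v; simp [f]
          rw [e3]
          refine (norm_add_le _ _).trans ?_
          have e4 := ContinuousLinearMap.opNorm_comp_le (DX w.1) (w.2 - w'.2)
          have e5 := ContinuousLinearMap.opNorm_comp_le (DX w.1 - DX w'.1) w'.2
          have e6 : ‖DX w.1‖ * ‖w.2 - w'.2‖ ≤ K * ‖w - w'‖ := by
            gcongr; exact h.norm_deriv_le _
          have e7 : ‖DX w.1 - DX w'.1‖ * ‖w'.2‖ ≤ (L * ‖w - w'‖) * (‖z.2‖ + a) := by
            gcongr
            · exact (h.norm_deriv_sub_le _ _).trans (by gcongr)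
            · exact hz2 w' hw'
          linarith
      · rw [Real.coe_toNNReal _ ha0, Real.coe_toNNReal _ hmax]
        have e1 : K * ε ≤ 1 / 2 := by
          rw [hεd, mul_one_div, div_le_div_iff₀ (by positivity) (by norm_num)]; linarith
        have e2 : ε ≤ 1 / 2 := by
          rw [hεd, div_le_div_iff₀ (by positivity) (by norm_num)]; linarith
        have e3 : max M (K * (‖z.2‖ + a)) * ε ≤ a := by
          rw [max_mul_of_nonneg _ _ hε.le]
          refine max_le ?_ ?_
          · have := mul_le_mul_of_nonneg_left e2 hM
            linarith [norm_nonneg z.2]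
          · have := mul_le_mul_of_nonneg_right e1 (show 0 ≤ ‖z.2‖ + a by positivity)
            linarith
        simpa using e3
    obtain ⟨γ, h0, hγ⟩ := hpl.exists_eq_forall_mem_Icc_hasDerivWithinAt₀
    refine ⟨γ, h0, fun t ht => ?_⟩
    exact (hγ t (Ioo_subset_Icc_self ht)).hasDerivAt (Icc_mem_nhds ht.1 ht.2)
  choose γ h0 hγ using fun x : F => key (x, 1)
  refine ⟨fun t x => (γ x t).1, fun t x => (γ x t).2, fun x => by simp [h0], fun x => by simp [h0],
    fun x t => ?_, fun x t => ?_⟩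
  · exact (ContinuousLinearMap.fst ℝ F (F →L[ℝ] F)).hasFDerivAt.comp_hasDerivAt t (hγ x t)
  · exact (ContinuousLinearMap.snd ℝ F (F →L[ℝ] F)).hasFDerivAt.comp_hasDerivAt t (hγ x t)

end IsTameField

namespace IsFlow

theorem eq_of_hasDerivAt (hφ : IsFlow X DX φ Ξ) (h : IsTameField X DX M K L) {γ : ℝ → F}
    (hγ : ∀ t, HasDerivAt γ (X (γ t)) t) (t : ℝ) : γ t = φ t (γ 0) :=
  congrFun (ODE_solution_unique_univ (v := fun _ => X) (s := fun _ => univ) (t₀ := 0)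
    (K := K.toNNReal) (fun _ => h.lipschitzWith.lipschitzOnWith) (fun t => ⟨hγ t, mem_univ _⟩)
    (fun t => ⟨hφ.hasDerivAt (γ 0) t, mem_univ _⟩) (hφ.zero (γ 0)).symm) t

theorem add (hφ : IsFlow X DX φ Ξ) (h : IsTameField X DX M K L) (s t : ℝ) (x : F) :
    φ (s + t) x = φ s (φ t x) := by
  have := hφ.eq_of_hasDerivAt h (γ := fun s => φ (s + t) x)
    (fun s => (hφ.hasDerivAt x (s + t)).comp_add_const s t) s
  simpa using this

theorem neg_apply (hφ : IsFlow X DX φ Ξ) (h : IsTameField X DX M K L) (t : ℝ) (x : F) :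
    φ (-t) (φ t x) = x := by
  rw [← hφ.add h, neg_add_cancel, hφ.zero]

theorem eq_self (hφ : IsFlow X DX φ Ξ) (h : IsTameField X DX M K L) {x : F} (hx : X x = 0)
    (t : ℝ) : φ t x = x :=
  (hφ.eq_of_hasDerivAt h (γ := fun _ => x) (fun t => by rw [hx]; exact hasDerivAt_const t x) t).symm

theorem norm_sub_le (hφ : IsFlow X DX φ Ξ) (h : IsTameField X DX M K L) {T t : ℝ} (ht : |t| ≤ T)
    (x y : F) : ‖φ t x - φ t y‖ ≤ ‖x - y‖ * exp (K * T) := by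
  have := norm_le_of_norm_deriv_le (f := fun t => φ t x - φ t y)
    (fun t => (hφ.hasDerivAt x t).sub (hφ.hasDerivAt y t)) h.nonneg.2 le_rfl
    (fun t _ => by rw [add_zero]; exact h.norm_sub_le _ _) ht
  simpa [hφ.zero] using this

theorem le_norm_sub (hφ : IsFlow X DX φ Ξ) (h : IsTameField X DX M K L) {T t : ℝ} (ht : |t| ≤ T)
    (x y : F) : ‖x - y‖ ≤ ‖φ t x - φ t y‖ * exp (K * T) := by
  have := hφ.norm_sub_le h (T := T) (t := -t) (by rwa [abs_neg]) (φ t x) (φ t y)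
  rwa [hφ.neg_apply h, hφ.neg_apply h] at this

theorem norm_sub_self_le (hφ : IsFlow X DX φ Ξ) (h : IsTameField X DX M K L) (t : ℝ) (x : F) :
    ‖φ t x - x‖ ≤ M * |t| := by
  have := Convex.norm_image_sub_le_of_norm_hasDerivWithin_le (s := univ) (f := fun s => φ s x)
    (fun s _ => (hφ.hasDerivAt x s).hasDerivWithinAt) (fun s _ => h.norm_le _) convex_univ
    (mem_univ 0) (mem_univ t)
  simpa [hφ.zero] using this

theorem norm_deriv_le (hφ : IsFlow X DX φ Ξ) (h : IsTameField X DX M K L) {T t : ℝ} (ht : |t| ≤ T)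
    (x : F) : ‖Ξ t x‖ ≤ exp (K * T) := by
  have := norm_le_of_norm_deriv_le (f := fun t => Ξ t x)
    (fun t => hφ.hasDerivAt_deriv x t) h.nonneg.2 le_rfl
    (fun t _ => by
      rw [add_zero]
      refine (ContinuousLinearMap.opNorm_comp_le _ _).trans ?_
      gcongr
      exact h.norm_deriv_le _) ht
  rw [hφ.deriv_zero, zero_mul, add_zero] at this
  exact this.trans (mul_le_of_le_one_left (exp_pos _).le ContinuousLinearMap.norm_id_le)

theorem norm_deriv_sub_le (hφ : IsFlow X DX φ Ξ) (h : IsTameField X DX M K L) (hL : 0 ≤ L)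
    {T t : ℝ} (ht : |t| ≤ T) (x y : F) :
    ‖Ξ t x - Ξ t y‖ ≤ L * exp (K * T) * exp (K * T) * T * exp (K * T) * ‖x - y‖ := by
  have := norm_le_of_norm_deriv_le (f := fun t => Ξ t x - Ξ t y)
    (fun t => (hφ.hasDerivAt_deriv x t).sub (hφ.hasDerivAt_deriv y t)) h.nonneg.2
    (ε := L * (‖x - y‖ * exp (K * T)) * exp (K * T)) (by positivity)
    (fun t ht => by
      have e : (DX (φ t x)).comp (Ξ t x) - (DX (φ t y)).comp (Ξ t y) =
          (DX (φ t x)).comp (Ξ t x - Ξ t y) + (DX (φ t x) - DX (φ t y)).comp (Ξ t y) := by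
        ext v; simp
      rw [e]
      refine (norm_add_le _ _).trans (add_le_add ?_ ?_)
      · refine (ContinuousLinearMap.opNorm_comp_le _ _).trans ?_
        gcongr
        exact h.norm_deriv_le _
      · refine (ContinuousLinearMap.opNorm_comp_le _ _).trans ?_
        gcongr
        · exact (h.norm_deriv_sub_le _ _).trans (by gcongr; exact hφ.norm_sub_le h ht x y)
        · exact hφ.norm_deriv_le h ht y) ht
  rw [hφ.deriv_zero, hφ.deriv_zero, sub_self, norm_zero, zero_add] at this
  refine this.trans (le_of_eq (by ring))

theorem hasFDerivAt (hφ : IsFlow X DX φ Ξ) (h : IsTameField X DX M K L) (hL : 0 ≤ L) (t : ℝ)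
    (x : F) : HasFDerivAt (φ t) (Ξ t x) x := by
  have key : ∀ y, ‖φ t y - φ t x - Ξ t x (y - x)‖ ≤
      L * exp (K * |t|) ^ 2 * |t| * exp (K * |t|) * ‖y - x‖ ^ 2 := by
    intro y
    have := norm_le_of_norm_deriv_le (f := fun t => φ t y - φ t x - Ξ t x (y - x)) (T := |t|)
      (fun t => ((hφ.hasDerivAt y t).sub (hφ.hasDerivAt x t)).sub
        (((ContinuousLinearMap.apply ℝ F (y - x)).hasFDerivAt.comp_hasDerivAt t
          (hφ.hasDerivAt_deriv x t)))) h.nonneg.2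
      (ε := L * (‖y - x‖ * exp (K * |t|)) ^ 2) (by positivity)
      (fun s hs => by
        have e : X (φ s y) - X (φ s x) - (ContinuousLinearMap.apply ℝ F (y - x))
              ((DX (φ s x)).comp (Ξ s x)) =
            DX (φ s x) (φ s y - φ s x - Ξ s x (y - x)) +
              (X (φ s y) - X (φ s x) - DX (φ s x) (φ s y - φ s x)) := by
          rw [map_sub (DX (φ s x)) (φ s y - φ s x), show ContinuousLinearMap.apply ℝ F (y - x)
            ((DX (φ s x)).comp (Ξ s x)) = DX (φ s x) (Ξ s x (y - x)) from rfl]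
          abel
        rw [e]
        refine (norm_add_le _ _).trans (add_le_add ?_ ?_)
        · exact ContinuousLinearMap.le_of_opNorm_le _ (h.norm_deriv_le _) _
        · refine (h.norm_taylor_le hL _ _).trans ?_
          gcongr
          exact hφ.norm_sub_le h hs y x) (t := t) le_rfl
    simp only [hφ.zero, hφ.deriv_zero, one_apply_eq_self, sub_self, norm_zero,
      zero_add] at this
    exact this.trans (le_of_eq (by ring))
  rw [hasFDerivAt_iff_isLittleO_nhds_zero]
  have hO : (fun v => φ t (x + v) - φ t x - Ξ t x v) =O[nhds 0] fun v : F => ‖v‖ ^ 2 :=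
    Asymptotics.IsBigO.of_bound _ (Filter.Eventually.of_forall fun v => by
      simpa using key (x + v))
  refine hO.trans_isLittleO ?_
  simpa using Asymptotics.isLittleO_norm_pow_id (E' := F) (n := 2) one_lt_two

theorem le_norm_deriv (hφ : IsFlow X DX φ Ξ) (h : IsTameField X DX M K L) (hL : 0 ≤ L) {T t : ℝ}
    (ht : |t| ≤ T) (x v : F) : ‖v‖ ≤ exp (K * T) * ‖Ξ t x v‖ := by
  have h1 := (hφ.hasFDerivAt h hL (-t) (φ t x)).comp x (hφ.hasFDerivAt h hL t x)
  have h2 : φ (-t) ∘ φ t = id := funext fun x => hφ.neg_apply h t x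
  rw [h2] at h1
  have h3 := DFunLike.congr_fun (h1.unique (hasFDerivAt_id x)) v
  have h4 : Ξ (-t) (φ t x) (Ξ t x v) = v := h3
  calc ‖v‖ = ‖Ξ (-t) (φ t x) (Ξ t x v)‖ := by rw [h4]
    _ ≤ _ := ContinuousLinearMap.le_of_opNorm_le _ (hφ.norm_deriv_le h (by rwa [abs_neg]) _) _

theorem deriv_eq_one (hφ : IsFlow X DX φ Ξ) (h : IsTameField X DX M K L) (hL : 0 ≤ L) {x : F}
    (hx : ∀ᶠ y in nhds x, X y = 0) (t : ℝ) : Ξ t x = 1 := by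
  refine (hφ.hasFDerivAt h hL t x).unique ((hasFDerivAt_id x).congr_of_eventuallyEq ?_)
  filter_upwards [hx] with y hy
  exact hφ.eq_self h hy t

theorem continuous_deriv (hφ : IsFlow X DX φ Ξ) (h : IsTameField X DX M K L) (hL : 0 ≤ L) :
    Continuous fun p : ℝ × F => Ξ p.1 p.2 := by
  rw [continuous_iff_continuousAt]
  rintro ⟨t₀, x₀⟩
  obtain ⟨c, hc⟩ : ∃ c, ∀ t, |t| ≤ |t₀| + 1 → ∀ x, ‖Ξ t x - Ξ t x₀‖ ≤ c * ‖x - x₀‖ :=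
    ⟨_, fun t ht x => hφ.norm_deriv_sub_le h hL ht x x₀⟩
  have h1 : Filter.Tendsto (fun p : ℝ × F => c * ‖p.2 - x₀‖ + ‖Ξ p.1 x₀ - Ξ t₀ x₀‖)
      (nhds (t₀, x₀)) (nhds 0) := by
    have hΞ : Continuous fun t => Ξ t x₀ :=
      continuous_iff_continuousAt.2 fun t => (hφ.hasDerivAt_deriv x₀ t).continuousAt
    have : Continuous fun p : ℝ × F => c * ‖p.2 - x₀‖ + ‖Ξ p.1 x₀ - Ξ t₀ x₀‖ := by fun_prop
    simpa using this.tendsto (t₀, x₀)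
  rw [ContinuousAt, tendsto_iff_norm_sub_tendsto_zero]
  refine squeeze_zero' (Filter.Eventually.of_forall fun _ => norm_nonneg _) ?_ h1
  have h2 : ∀ᶠ p : ℝ × F in nhds (t₀, x₀), |p.1| ≤ |t₀| + 1 := by
    have : Continuous fun p : ℝ × F => |p.1| := by fun_prop
    exact (this.tendsto (t₀, x₀)).eventually_le_const (by simp)
  filter_upwards [h2] with p hp
  calc ‖Ξ p.1 p.2 - Ξ t₀ x₀‖ ≤ ‖Ξ p.1 p.2 - Ξ p.1 x₀‖ + ‖Ξ p.1 x₀ - Ξ t₀ x₀‖ :=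
        norm_sub_le_norm_sub_add_norm_sub _ _ _
    _ ≤ _ := by gcongr; exact hc _ hp _

end IsFlow

end GlobalFlow

section Hamiltonian
variable {κ : Type*} [Fintype κ] 

local notation "V" => EuclideanSpace ℂ κ
local notation "E" => EuclideanSpace ℝ κ

/-- The standard symplectic form on `ℂ^κ`, normalised so that `sympl (p + iq) (p' + iq')` equals
`p q' - q p'`. -/
def sympl (u v : V) : ℝ := (inner ℂ u v).im

theorem sympl_add_left (u v w : V) : sympl (u + v) w = sympl u w + sympl v w := by
  simp [sympl, inner_add_left]

theorem sympl_add_right (u v w : V) : sympl u (v + w) = sympl u v + sympl u w := by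
  simp [sympl, inner_add_right]

theorem sympl_sub_left (u v w : V) : sympl (u - v) w = sympl u w - sympl v w := by
  simp [sympl, inner_sub_left]

theorem sympl_sub_right (u v w : V) : sympl u (v - w) = sympl u v - sympl u w := by
  simp [sympl, inner_sub_right]

theorem sympl_comm (u v : V) : sympl u v = -sympl v u := by
  rw [sympl, sympl, ← inner_conj_symm, Complex.conj_im]

theorem sympl_self (u : V) : sympl u u = 0 := by linarith [sympl_comm u u]

theorem abs_sympl_le (u v : V) : |sympl u v| ≤ ‖u‖ * ‖v‖ :=
  (Complex.abs_im_le_norm _).trans (norm_inner_le_norm u v)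

theorem HasDerivAt.sympl {f g : ℝ → V} {f' g' : V} {t : ℝ} (hf : HasDerivAt f f' t)
    (hg : HasDerivAt g g' t) :
    HasDerivAt (fun s => _root_.sympl (f s) (g s)) (_root_.sympl f' (g t) + _root_.sympl (f t) g') t := by
  have h1 := Complex.imCLM.hasFDerivAt.comp_hasDerivAt t (hf.inner ℂ hg)
  refine h1.congr_deriv ?_
  simp [_root_.sympl, add_comm]

/-- `K` is a bounded Hamiltonian function whose Hamiltonian vector field `X` is tame. -/
structure IsTameHamiltonian (K : V → ℝ) (X : V → V) (DX : V → V →L[ℝ] V) (M c L : ℝ) : Prop where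
  tame : IsTameField X DX M c L
  nonneg : 0 ≤ L
  abs_le : ∀ x, |K x| ≤ M
  differentiable : Differentiable ℝ K
  fderiv_apply : ∀ x v, fderiv ℝ K x v = sympl v (X x)
  symm : ∀ x u v, sympl u (DX x v) = sympl v (DX x u)

/-- The symplectic action `∫ (Im⟨x, dx⟩ - 2 K dt)` along the flow. -/
def action (K : V → ℝ) (X : V → V) (φ : ℝ → V → V) (t : ℝ) (x : V) : ℝ :=
  ∫ s in (0 : ℝ)..t, (sympl (φ s x) (X (φ s x)) - 2 * K (φ s x))

variable {K : EuclideanSpace ℂ κ → ℝ} {X : EuclideanSpace ℂ κ → EuclideanSpace ℂ κ}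
  {DX : EuclideanSpace ℂ κ → EuclideanSpace ℂ κ →L[ℝ] EuclideanSpace ℂ κ} {M c L : ℝ}
  {φ : ℝ → EuclideanSpace ℂ κ → EuclideanSpace ℂ κ}
  {Ξ : ℝ → EuclideanSpace ℂ κ → EuclideanSpace ℂ κ →L[ℝ] EuclideanSpace ℂ κ}

namespace IsTameHamiltonian

theorem sympl_deriv_flow (h : IsTameHamiltonian K X DX M c L) (hφ : IsFlow X DX φ Ξ) (t : ℝ)
    (x u v : V) : sympl (Ξ t x u) (Ξ t x v) = sympl u v := by
  have hd : ∀ w s, HasDerivAt (fun s => Ξ s x w) (DX (φ s x) (Ξ s x w)) s := fun w s =>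
    (ContinuousLinearMap.apply ℝ V w).hasFDerivAt.comp_hasDerivAt s (hφ.hasDerivAt_deriv x s)
  have h1 : ∀ s, HasDerivAt (fun s => sympl (Ξ s x u) (Ξ s x v)) 0 s := by
    intro s
    refine ((hd u s).sympl (hd v s)).congr_deriv ?_
    rw [h.symm (φ s x) (Ξ s x u) (Ξ s x v), sympl_comm]
    ring
  have h2 := is_const_of_deriv_eq_zero (fun s => (h1 s).differentiableAt)
    (fun s => (h1 s).deriv) t 0
  rw [h2]
  simp [hφ.deriv_zero]

theorem abs_sub_sub_le (h : IsTameHamiltonian K X DX M c L) (x y : V) :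
    |K y - K x - sympl (y - x) (X x)| ≤ c * ‖y - x‖ ^ 2 := by
  let ℓ : V →L[ℝ] ℝ := fderiv ℝ K x
  have h1 : ∀ z : V, z ∈ segment ℝ x y → ‖(fderiv ℝ K z - ℓ : V →L[ℝ] ℝ)‖ ≤ c * ‖y - x‖ := by
    intro z hz
    have hzx : ‖(z - x : V)‖ ≤ ‖y - x‖ := by
      obtain ⟨a, b, ha, hb, hab, rfl⟩ := hz
      have e : a • x + b • y - x = b • (y - x) := by
        rw [← eq_sub_iff_add_eq] at hab
        rw [hab]; module
      rw [e, norm_smul, Real.norm_eq_abs, abs_of_nonneg hb]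
      exact mul_le_of_le_one_left (norm_nonneg _) (by linarith)
    refine ContinuousLinearMap.opNorm_le_bound _ (mul_nonneg h.tame.nonneg.2 (norm_nonneg _))
      fun v => ?_
    have e0 : (fderiv ℝ K z - ℓ) v = sympl v (X z - X x) := by
      rw [sympl_sub_right, ← h.fderiv_apply, ← h.fderiv_apply]; rfl
    rw [e0, Real.norm_eq_abs]
    refine (abs_sympl_le _ _).trans ?_
    rw [mul_comm]
    gcongr
    exact (h.tame.norm_sub_le z x).trans
      (mul_le_mul_of_nonneg_left hzx h.tame.nonneg.2)
  have h2 := Convex.norm_image_sub_le_of_norm_hasFDerivWithin_le (s := segment ℝ x y)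
    (f := fun z : V => K z - ℓ z) (f' := fun z => fderiv ℝ K z - ℓ)
    (fun z _ => ((h.differentiable z).hasFDerivAt.sub ℓ.hasFDerivAt).hasFDerivWithinAt) h1
    (convex_segment x y) (left_mem_segment ℝ x y) (right_mem_segment ℝ x y)
  have h3 : K y - K x - sympl (y - x) (X x) = K y - ℓ y - (K x - ℓ x) := by
    rw [← h.fderiv_apply, map_sub]; ring
  rw [h3, ← Real.norm_eq_abs]
  exact h2.trans (le_of_eq (by ring))

/-- Trapezoidal rule for the increments of a Hamiltonian. -/
theorem abs_trapezoid_le (h : IsTameHamiltonian K X DX M c L) (x y : V) :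
    |2 * (K y - K x) - sympl (y - x) (X x + X y)| ≤ 2 * c * ‖y - x‖ ^ 2 := by
  have h1 := h.abs_sub_sub_le x y
  have h2 := h.abs_sub_sub_le y x
  rw [norm_sub_rev] at h2
  have e : 2 * (K y - K x) - sympl (y - x) (X x + X y) =
      (K y - K x - sympl (y - x) (X x)) - (K x - K y - sympl (x - y) (X y)) := by
    rw [sympl_add_right]; simp only [sympl_sub_left]; ring
  rw [e]
  refine (abs_sub _ _).trans ?_
  linarith

theorem continuous_flow (hφ : IsFlow X DX φ Ξ) (x : V) : Continuous fun s => φ s x :=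
  continuous_iff_continuousAt.2 fun t => (hφ.hasDerivAt x t).continuousAt

theorem hasDerivAt_action (h : IsTameHamiltonian K X DX M c L) (hφ : IsFlow X DX φ Ξ) (x : V)
    (t : ℝ) : HasDerivAt (fun t => action K X φ t x)
      (sympl (φ t x) (X (φ t x)) - 2 * K (φ t x)) t := by
  have hc : Continuous fun s => sympl (φ s x) (X (φ s x)) - 2 * K (φ s x) := by
    have h1 := continuous_flow hφ x
    have h2 : Continuous fun s => X (φ s x) := h.tame.lipschitzWith.continuous.comp h1
    have h3 : Continuous fun s => K (φ s x) := h.differentiable.continuous.comp h1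
    exact (Complex.continuous_im.comp (h1.inner h2)).sub (h3.const_mul 2)
  exact intervalIntegral.integral_hasDerivAt_right (hc.intervalIntegrable _ _)
    hc.stronglyMeasurable.stronglyMeasurableAtFilter hc.continuousAt

theorem action_zero (K : V → ℝ) (X : V → V) (φ : ℝ → V → V) (x : V) : action K X φ 0 x = 0 := by simp [action]

theorem abs_action_sub_le (h : IsTameHamiltonian K X DX M c L) (hφ : IsFlow X DX φ Ξ) {T t : ℝ}
    (ht : |t| ≤ T) (x y : V) :
    |action K X φ t y - action K X φ t x - sympl (φ t x) (φ t y) + sympl x y| ≤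
      2 * c * exp (c * T) ^ 2 * T * ‖y - x‖ ^ 2 := by
  have hT := (abs_nonneg t).trans ht
  have hc := h.tame.nonneg.2
  have hd : ∀ s, HasDerivAt (fun s => action K X φ s y - action K X φ s x -
      sympl (φ s x) (φ s y) + sympl x y) (-(2 * (K (φ s y) - K (φ s x)) -
        sympl (φ s y - φ s x) (X (φ s x) + X (φ s y)))) s := by
    intro s
    refine ((((h.hasDerivAt_action hφ y s).sub (h.hasDerivAt_action hφ x s)).sub
      ((hφ.hasDerivAt x s).sympl (hφ.hasDerivAt y s))).add_const _).congr_deriv ?_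
    rw [sympl_comm (X (φ s x)) (φ s y)]
    simp only [sympl_sub_left, sympl_add_right]
    ring
  have := norm_le_of_norm_deriv_le hd (K := 0) (T := T) le_rfl
    (ε := 2 * c * (‖y - x‖ * exp (c * T)) ^ 2) (by positivity) (fun s hs => by
      rw [norm_neg, Real.norm_eq_abs, zero_mul, zero_add]
      refine (h.abs_trapezoid_le _ _).trans ?_
      gcongr
      exact hφ.norm_sub_le h.tame hs y x) ht
  simp only [action_zero, hφ.zero, Real.norm_eq_abs] at this
  simp only [sub_self, zero_sub, neg_add_cancel, abs_zero, zero_add, zero_mul, exp_zero,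
    mul_one] at this
  exact this.trans (le_of_eq (by ring))

theorem abs_action_add_le (h : IsTameHamiltonian K X DX M c L) (hφ : IsFlow X DX φ Ξ) {T t : ℝ}
    (ht : |t| ≤ T) (x y : V) :
    |action K X φ t x + sympl (φ t x) y - sympl x y| ≤
      ((‖y - x‖ + M * T) * M + 2 * M) * T := by
  have hT := (abs_nonneg t).trans ht
  have hM := h.tame.nonneg.1
  have hd : ∀ s, HasDerivAt (fun s => action K X φ s x + sympl (φ s x) y - sympl x y)
      (-sympl (y - φ s x) (X (φ s x)) - 2 * K (φ s x)) s := by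
    intro s
    refine (((h.hasDerivAt_action hφ x s).add
      ((hφ.hasDerivAt x s).sympl (hasDerivAt_const s y))).sub_const _).congr_deriv ?_
    rw [sympl_comm (X (φ s x)) y]
    simp [sympl_sub_left, sympl]
    ring
  have := norm_le_of_norm_deriv_le hd (K := 0) (T := T) le_rfl
    (ε := (‖y - x‖ + M * T) * M + 2 * M) (by positivity) (fun s hs => by
      rw [zero_mul, zero_add, Real.norm_eq_abs]
      refine (abs_sub _ _).trans (add_le_add ?_ ?_)
      · rw [abs_neg]
        refine (abs_sympl_le _ _).trans ?_
        gcongr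
        · calc ‖y - φ s x‖ = ‖(y - x) - (φ s x - x)‖ := by congr 1; abel
            _ ≤ ‖y - x‖ + ‖φ s x - x‖ := norm_sub_le _ _
            _ ≤ _ := by
              gcongr
              exact (hφ.norm_sub_self_le h.tame s x).trans (by gcongr)
        · exact h.tame.norm_le _
      · rw [abs_mul, abs_two]; gcongr; exact h.abs_le _) ht
  simp only [action_zero, hφ.zero, Real.norm_eq_abs] at this
  simpa using this

theorem action_eq_of_field_eq_zero (h : IsTameHamiltonian K X DX M c L) (hφ : IsFlow X DX φ Ξ)
    {x : V} (hx : X x = 0) (t : ℝ) : action K X φ t x = -2 * t * K x := by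
  simp only [action, hφ.eq_self h.tame hx, hx]
  simp [sympl]
  ring

end IsTameHamiltonian

end Hamiltonian

/-- A continuous path of continuous families of units, over a compact set, factors into
small steps. -/
theorem exists_list_prod_of_homotopy {Y R : Type*} [MetricSpace Y] [NormedRing R]
    [CompleteSpace R] {U Q : Set Y} (hQ : IsCompact Q) (hQU : Q ⊆ U) {A : ℝ → Y → R}
    (hA : ContinuousOn (fun p : ℝ × Y => A p.1 p.2) (Icc 0 1 ×ˢ U))
    (hu : ∀ s ∈ Icc (0 : ℝ) 1, ∀ y ∈ U, IsUnit (A s y)) :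
    ∃ l : List (Y → R), (∀ N ∈ l, ContinuousOn N U) ∧
      (∀ N ∈ l, ∀ y ∈ Q, ‖N y - 1‖ ≤ 1 / 2) ∧
      ∀ y ∈ U, (l.map fun N => N y).prod * A 1 y = A 0 y := by
  have hinv : ContinuousOn (fun p : ℝ × Y => Ring.inverse (A p.1 p.2)) (Icc 0 1 ×ˢ U) := by
    intro p hp
    obtain ⟨u, hu'⟩ := hu p.1 hp.1 p.2 hp.2
    have h1 := NormedRing.inverse_continuousAt u
    rw [hu'] at h1
    exact h1.comp_continuousWithinAt (f := fun p : ℝ × Y => A p.1 p.2) (hA p hp)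
  have hf : ContinuousOn (fun p : ℝ × ℝ × Y => A p.1 p.2.2 * Ring.inverse (A p.2.1 p.2.2))
      (Icc 0 1 ×ˢ Icc 0 1 ×ˢ U) := by
    refine ContinuousOn.mul (hA.comp (f := fun p : ℝ × ℝ × Y => (p.1, p.2.2)) (by fun_prop)
      fun p hp => ⟨hp.1, hp.2.2⟩) (hinv.comp (f := fun p : ℝ × ℝ × Y => (p.2.1, p.2.2))
      (by fun_prop) fun p hp => ⟨hp.2.1, hp.2.2⟩)
  have huc := (isCompact_Icc.prod (isCompact_Icc.prod hQ)).uniformContinuousOn_of_continuous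
    (hf.mono (prod_mono le_rfl (prod_mono le_rfl hQU)))
  obtain ⟨d, hd, hdf⟩ := Metric.uniformContinuousOn_iff_le.1 huc (1 / 2) (by norm_num)
  obtain ⟨n, hn⟩ := exists_nat_one_div_lt hd
  set s : ℕ → ℝ := fun i => i / (n + 1) with hs
  have hs1 : ∀ i ≤ n + 1, s i ∈ Icc (0 : ℝ) 1 := by
    intro i hi
    refine ⟨by positivity, ?_⟩
    rw [hs, div_le_one (by positivity)]
    exact_mod_cast hi
  refine ⟨(List.range (n + 1)).map fun i y => A (s i) y * Ring.inverse (A (s (i + 1)) y),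
    ?_, ?_, ?_⟩
  · intro N hN
    obtain ⟨i, hi, rfl⟩ := List.mem_map.1 hN
    have hi := List.mem_range.1 hi
    exact hf.comp (f := fun y => (s i, s (i + 1), y)) (by fun_prop)
      fun y hy => ⟨hs1 i (by omega), hs1 (i + 1) (by omega), hy⟩
  · intro N hN y hy
    obtain ⟨i, hi, rfl⟩ := List.mem_map.1 hN
    have hi := List.mem_range.1 hi
    have h1 := hdf (s i, s (i + 1), y) ⟨hs1 i (by omega), hs1 (i + 1) (by omega), hy⟩
      (s (i + 1), s (i + 1), y) ⟨hs1 (i + 1) (by omega), hs1 (i + 1) (by omega), hy⟩ (by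
        rw [Prod.dist_eq, dist_self, max_eq_left dist_nonneg, Real.dist_eq]
        have : s i - s (i + 1) = -(1 / ((n : ℝ) + 1)) := by
          simp only [hs]; push_cast; field_simp; ring
        rw [this, abs_neg, abs_of_nonneg (by positivity)]
        exact hn.le)
    rwa [dist_eq_norm, Ring.mul_inverse_cancel _ (hu _ (hs1 (i + 1) (by omega)) y (hQU hy))]
      at h1
  · intro y hy
    have key : ∀ j ≤ n + 1, (((List.range j).map fun i y =>
        A (s i) y * Ring.inverse (A (s (i + 1)) y)).map fun N => N y).prod * A (s j) y =
        A 0 y := by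
      intro j
      induction j with
      | zero => intro _; simp [hs]
      | succ j ih =>
        intro hj
        rw [← ih (by omega), List.range_succ, List.map_append, List.map_append, List.prod_append]
        simp only [List.map_cons, List.map_nil, List.prod_cons, List.prod_nil, mul_one]
        rw [mul_assoc, mul_assoc, Ring.inverse_mul_cancel _ (hu _ (hs1 _ hj) y hy), mul_one]
    have h1 := key (n + 1) le_rfl
    have h2 : s (n + 1) = 1 := by simp only [hs]; push_cast; field_simp
    rwa [h2] at h1

section Complexify
variable {κ : Type*} [Fintype κ]

local notation "V" => EuclideanSpace ℂ κ
local notation "E" => EuclideanSpace ℝ κ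

/-- Coordinatewise imaginary part. -/
def imV : V →L[ℝ] E :=
  (EuclideanSpace.equiv κ ℝ).symm.toContinuousLinearMap ∘L
    ContinuousLinearMap.pi fun i => Complex.imCLM ∘L
      (EuclideanSpace.proj i : V →L[ℂ] ℂ).restrictScalars ℝ

@[simp] theorem imV_apply (v : V) (i : κ) : imV v i = (v i).im := rfl

theorem reV_smul (a : ℂ) (v : V) : reV (a • v) = a.re • reV v - a.im • imV v := by
  ext i; simp

theorem imV_smul (a : ℂ) (v : V) : imV (a • v) = a.re • imV v + a.im • reV v := by
  ext i; simp

theorem norm_reV_le (v : V) : ‖reV v‖ ≤ ‖v‖ := by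
  rw [EuclideanSpace.norm_eq, EuclideanSpace.norm_eq]
  refine Real.sqrt_le_sqrt (Finset.sum_le_sum fun i _ => ?_)
  rw [reV_apply, Real.norm_eq_abs]
  gcongr
  exact Complex.abs_re_le_norm _

theorem norm_imV_le (v : V) : ‖imV v‖ ≤ ‖v‖ := by
  rw [EuclideanSpace.norm_eq, EuclideanSpace.norm_eq]
  refine Real.sqrt_le_sqrt (Finset.sum_le_sum fun i _ => ?_)
  rw [imV_apply, Real.norm_eq_abs]
  gcongr
  exact Complex.abs_im_le_norm _

@[simp] theorem reV_ofRealV (v : E) : reV (ofRealV v) = v := by ext i; simp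

@[simp] theorem imV_ofRealV (v : E) : imV (ofRealV v) = 0 := by ext i; simp

theorem reV_conjV (v : V) : reV (conjV v) = reV v := by ext i; simp

theorem imV_conjV (v : V) : imV (conjV v) = -imV v := by ext i; simp

/-- The complex linear extension of a real linear map defined on the real vectors. -/
def cplx (D : E →L[ℝ] V) : V →L[ℂ] V :=
  LinearMap.toContinuousLinearMap
    { toFun := fun v => D (reV v) + Complex.I • D (imV v)
      map_add' := fun v w => by simp only [map_add, smul_add]; abel
      map_smul' := fun a v => by
        have h : ∀ (r : ℝ) (z : V), r • z = (r : ℂ) • z := fun r z => rfl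
        simp only [reV_smul, imV_smul, map_add, map_sub, map_smul, h, RingHom.id_apply]
        have ha : a = a.re + a.im * Complex.I := (Complex.re_add_im a).symm
        have e1 : a • (D (reV v) + Complex.I • D (imV v)) =
            ((a.re : ℂ) + a.im * Complex.I) • (D (reV v) + Complex.I • D (imV v)) := by rw [← ha]
        rw [e1]
        simp only [smul_add, add_smul, smul_smul, sub_eq_add_neg]
        have e2 : (a.im : ℂ) * Complex.I * Complex.I = -a.im := by
          rw [mul_assoc, Complex.I_mul_I]; ring
        rw [add_mul, e2, add_smul, neg_smul, mul_comm Complex.I (a.re : ℂ), mul_comm Complex.I (a.im : ℂ)]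
        abel }

theorem cplx_apply (D : E →L[ℝ] V) (v : V) :
    cplx D v = D (reV v) + Complex.I • D (imV v) := rfl

@[simp] theorem cplx_ofRealV (D : E →L[ℝ] V) (v : E) : cplx D (ofRealV v) = D v := by
  simp [cplx_apply]

theorem cplx_sub (D D' : E →L[ℝ] V) : cplx (D - D') = cplx D - cplx D' := by
  ext1 v
  show D (reV v) - D' (reV v) + Complex.I • (D (imV v) - D' (imV v)) =
    D (reV v) + Complex.I • D (imV v) - (D' (reV v) + Complex.I • D' (imV v))
  rw [smul_sub]; abel

theorem norm_cplx_le (D : E →L[ℝ] V) : ‖cplx D‖ ≤ 2 * ‖D‖ := by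
  refine ContinuousLinearMap.opNorm_le_bound _ (by positivity) fun v => ?_
  rw [cplx_apply]
  refine (norm_add_le _ _).trans ?_
  rw [norm_smul, Complex.norm_I, one_mul]
  have h1 : ‖D (reV v)‖ ≤ ‖D‖ * ‖v‖ :=
    (D.le_opNorm _).trans (by gcongr; exact norm_reV_le v)
  have h2 : ‖D (imV v)‖ ≤ ‖D‖ * ‖v‖ :=
    (D.le_opNorm _).trans (by gcongr; exact norm_imV_le v)
  linarith

theorem continuous_cplx : Continuous (cplx : (E →L[ℝ] V) → V →L[ℂ] V) := by
  refine (LipschitzWith.of_dist_le_mul (K := 2) fun D D' => ?_).continuous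
  rw [dist_eq_norm, dist_eq_norm, ← cplx_sub]
  exact norm_cplx_le _

/-- The restriction of a complex linear map to the real vectors. -/
def onReal (A : V →L[ℂ] V) : E →L[ℝ] V :=
  (A.restrictScalars ℝ).comp ofRealV.toContinuousLinearMap

@[simp] theorem onReal_apply (A : V →L[ℂ] V) (v : E) : onReal A v = A (ofRealV v) := rfl

theorem onReal_cplx (D : E →L[ℝ] V) : onReal (cplx D) = D := by ext1 v; simp

theorem cplx_onReal (A : V →L[ℂ] V) : cplx (onReal A) = A := by
  ext1 v
  rw [cplx_apply, onReal_apply, onReal_apply, ← map_smul, ← map_add]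
  congr 1
  ext i
  simp [mul_comm Complex.I, Complex.re_add_im]

theorem norm_onReal_le (A : V →L[ℂ] V) : ‖onReal A‖ ≤ ‖A‖ :=
  ContinuousLinearMap.opNorm_le_bound _ (norm_nonneg _) fun v => by
    rw [onReal_apply]
    exact (A.le_opNorm _).trans_eq (by rw [LinearIsometry.norm_map])

theorem onReal_sub (A A' : V →L[ℂ] V) : onReal (A - A') = onReal A - onReal A' := rfl

theorem continuous_onReal : Continuous (onReal : (V →L[ℂ] V) → E →L[ℝ] V) := by
  refine (LipschitzWith.of_dist_le_mul (K := 1) fun A A' => ?_).continuous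
  rw [dist_eq_norm, dist_eq_norm, ← onReal_sub, NNReal.coe_one, one_mul]
  exact norm_onReal_le _

/-- A uniformly injective real linear map onto a Lagrangian subspace. -/
structure IsLagrangianFrame (D : E →L[ℝ] V) (c : ℝ) : Prop where
  pos : 0 < c
  sympl_eq : ∀ u v, sympl (D u) (D v) = 0
  le_norm : ∀ v, c * ‖v‖ ≤ ‖D v‖

theorem isLagrangianFrame_ofRealV :
    IsLagrangianFrame (κ := κ) ofRealV.toContinuousLinearMap 1 where
  pos := one_pos
  sympl_eq u v := by
    show (inner ℂ (ofRealV u) (ofRealV v)).im = 0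
    simp [PiLp.inner_apply, ← Complex.ofReal_mul, ← Complex.ofReal_sum]
  le_norm v := by
    show 1 * ‖v‖ ≤ ‖ofRealV v‖
    rw [LinearIsometry.norm_map, one_mul]

namespace IsLagrangianFrame
variable {D D' : EuclideanSpace ℝ κ →L[ℝ] EuclideanSpace ℂ κ} {c c' : ℝ}

theorem norm_cplx_sq (h : IsLagrangianFrame D c) (v : V) :
    ‖cplx D v‖ ^ 2 = ‖D (reV v)‖ ^ 2 + ‖D (imV v)‖ ^ 2 := by
  have h1 := norm_add_sq (𝕜 := ℂ) (D (reV v)) (Complex.I • D (imV v))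
  have h2 : RCLike.re (inner ℂ (D (reV v)) (Complex.I • D (imV v))) = 0 := by
    rw [inner_smul_right]
    have := h.sympl_eq (reV v) (imV v)
    rw [sympl] at this
    show (Complex.I * inner ℂ (D (reV v)) (D (imV v))).re = 0
    simp [this]
  rw [cplx_apply, h1, h2, norm_smul, Complex.norm_I]
  ring

theorem le_norm_cplx (h : IsLagrangianFrame D c) (v : V) : c * ‖v‖ ≤ ‖cplx D v‖ := by
  have hc := h.pos
  refine le_of_sq_le_sq ?_ (norm_nonneg _)
  have e : ‖v‖ ^ 2 = ‖reV v‖ ^ 2 + ‖imV v‖ ^ 2 := by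
    have h1 := isLagrangianFrame_ofRealV.norm_cplx_sq v
    have h2 : cplx ofRealV.toContinuousLinearMap v = v := by
      ext i
      rw [cplx_apply]
      simp [mul_comm Complex.I, Complex.re_add_im]
    rw [h2] at h1
    simpa using h1
  rw [h.norm_cplx_sq, mul_pow, e, mul_add, ← mul_pow, ← mul_pow]
  gcongr <;> exact h.le_norm _

end IsLagrangianFrame

theorem isUnit_of_le_norm {M : V →L[ℂ] V} {c : ℝ} (hc : 0 < c) (h : ∀ v, c * ‖v‖ ≤ ‖M v‖) :
    IsUnit M := by
  have hinj : Function.Injective M := by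
    refine (injective_iff_map_eq_zero M).2 fun v hv => ?_
    have := h v
    rw [hv, norm_zero] at this
    exact norm_le_zero_iff.1 (nonpos_of_mul_nonpos_right this hc)
  rw [ContinuousLinearMap.isUnit_iff_bijective]
  exact ⟨hinj, (LinearMap.injective_iff_surjective (f := M.toLinearMap)).1 hinj⟩

theorem IsLagrangianFrame.isUnit_cplx {D : E →L[ℝ] V} {c : ℝ} (h : IsLagrangianFrame D c) :
    IsUnit (cplx D) :=
  isUnit_of_le_norm h.pos h.le_norm_cplx

/-- The complex conjugate of an operator. -/
def barOp (M : V →L[ℂ] V) : V →L[ℂ] V :=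
  LinearMap.toContinuousLinearMap
    { toFun := fun v => conjV (M (conjV v))
      map_add' := fun v w => by simp
      map_smul' := fun a v => by simp [conjV_smul] }

theorem barOp_apply (M : V →L[ℂ] V) (v : V) : barOp M v = conjV (M (conjV v)) := rfl

theorem norm_barOp_sub_apply_le (M M' : V →L[ℂ] V) (v : V) :
    ‖barOp M v - barOp M' v‖ ≤ ‖M - M'‖ * ‖v‖ := by
  rw [barOp_apply, barOp_apply, ← map_sub, LinearIsometry.norm_map]
  exact ((M - M').le_opNorm (conjV v)).trans_eq (by rw [LinearIsometry.norm_map])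

/-- The unitary operator determined by a Lagrangian frame `D`: it maps the conjugate of `D v`
to `D v`. -/
def reflOp (D : E →L[ℝ] V) : V →L[ℂ] V := cplx D * Ring.inverse (barOp (cplx D))

namespace IsLagrangianFrame
variable {D D' : EuclideanSpace ℝ κ →L[ℝ] EuclideanSpace ℂ κ} {c c' : ℝ}

theorem le_norm_barOp (h : IsLagrangianFrame D c) (v : V) : c * ‖v‖ ≤ ‖barOp (cplx D) v‖ := by
  rw [barOp_apply, LinearIsometry.norm_map, ← conjV.norm_map v]
  exact h.le_norm_cplx _

theorem reflOp_barOp (h : IsLagrangianFrame D c) (v : V) :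
    reflOp D (barOp (cplx D) v) = cplx D v := by
  show (cplx D * Ring.inverse (barOp (cplx D)) * barOp (cplx D)) v = cplx D v
  rw [mul_assoc, Ring.inverse_mul_cancel _ (isUnit_of_le_norm h.pos h.le_norm_barOp), mul_one]

theorem surjective_barOp (h : IsLagrangianFrame D c) : Function.Surjective (barOp (cplx D)) :=
  (ContinuousLinearMap.isUnit_iff_bijective.1 (isUnit_of_le_norm h.pos h.le_norm_barOp)).2

theorem reflOp_conjV (h : IsLagrangianFrame D c) (v : E) : reflOp D (conjV (D v)) = D v := by
  have h1 := h.reflOp_barOp (ofRealV v)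
  rwa [barOp_apply, conjV_ofRealV, cplx_ofRealV] at h1

theorem norm_reflOp_le (h : IsLagrangianFrame D c) : ‖reflOp D‖ ≤ 1 := by
  refine ContinuousLinearMap.opNorm_le_bound _ zero_le_one fun v => ?_
  obtain ⟨u, rfl⟩ := h.surjective_barOp v
  rw [h.reflOp_barOp, one_mul, barOp_apply, LinearIsometry.norm_map]
  refine le_of_sq_le_sq (le_of_eq ?_) (norm_nonneg _)
  rw [h.norm_cplx_sq, h.norm_cplx_sq, reV_conjV, imV_conjV, map_neg, norm_neg]

theorem norm_reflOp_sub_le (h : IsLagrangianFrame D c) (h' : IsLagrangianFrame D' c') :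
    ‖reflOp D - reflOp D'‖ ≤ 4 / c * ‖D - D'‖ := by
  have hc := h.pos
  refine ContinuousLinearMap.opNorm_le_bound _ (by positivity) fun v => ?_
  obtain ⟨u, rfl⟩ := h.surjective_barOp v
  have e : (reflOp D - reflOp D') (barOp (cplx D) u) = (cplx D - cplx D') u -
      reflOp D' (barOp (cplx D) u - barOp (cplx D') u) := by
    rw [map_sub, h'.reflOp_barOp]
    show reflOp D _ - reflOp D' _ = cplx D u - cplx D' u - _
    rw [h.reflOp_barOp]
    abel
  have h1 : ‖cplx D - cplx D'‖ ≤ 2 * ‖D - D'‖ := by rw [← cplx_sub]; exact norm_cplx_le _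
  rw [e]
  calc _ ≤ ‖cplx D - cplx D'‖ * ‖u‖ + 1 * (‖cplx D - cplx D'‖ * ‖u‖) := by
        refine (norm_sub_le _ _).trans (add_le_add (ContinuousLinearMap.le_opNorm _ _) ?_)
        refine ((reflOp D').le_opNorm _).trans ?_
        gcongr
        · exact h'.norm_reflOp_le
        · exact norm_barOp_sub_apply_le _ _ _
    _ ≤ 4 * ‖D - D'‖ * ‖u‖ := by nlinarith [norm_nonneg u]
    _ = 4 / c * ‖D - D'‖ * (c * ‖u‖) := by field_simp
    _ ≤ _ := by gcongr; exact h.le_norm_barOp u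

end IsLagrangianFrame

end Complexify

section Frames
variable {κ : Type*} [Fintype κ]

local notation "V" => EuclideanSpace ℂ κ
local notation "E" => EuclideanSpace ℝ κ

/-- The coordinate projection onto the coordinates in `S`. -/
def coordProj (𝕜 : Type*) [RCLike 𝕜] (S : Set κ) : EuclideanSpace 𝕜 κ →L[𝕜] EuclideanSpace 𝕜 κ :=
  LinearMap.toContinuousLinearMap
    { toFun := fun v => WithLp.toLp 2 (S.indicator fun i => v i)
      map_add' := fun v w => by
        ext i; by_cases hi : i ∈ S <;> simp [hi]
      map_smul' := fun a v => by
        ext i; by_cases hi : i ∈ S <;> simp [hi] }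

theorem coordProj_apply {𝕜 : Type*} [RCLike 𝕜] (S : Set κ) (v : EuclideanSpace 𝕜 κ) (i : κ) :
    coordProj 𝕜 S v i = S.indicator (fun i => v i) i := rfl

theorem norm_coordProj_apply_le {𝕜 : Type*} [RCLike 𝕜] (S : Set κ) (v : EuclideanSpace 𝕜 κ) :
    ‖coordProj 𝕜 S v‖ ≤ ‖v‖ := by
  rw [EuclideanSpace.norm_eq, EuclideanSpace.norm_eq]
  refine Real.sqrt_le_sqrt (Finset.sum_le_sum fun i _ => ?_)
  rw [coordProj_apply]
  by_cases hi : i ∈ S <;> simp [hi]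

theorem norm_coordProj_le {𝕜 : Type*} [RCLike 𝕜] (S : Set κ) :
    ‖coordProj 𝕜 S‖ ≤ 1 :=
  ContinuousLinearMap.opNorm_le_bound _ zero_le_one fun v => by
    rw [one_mul]; exact norm_coordProj_apply_le S v

theorem coordProj_idem {𝕜 : Type*} [RCLike 𝕜] (S : Set κ) (v : EuclideanSpace 𝕜 κ) :
    coordProj 𝕜 S (coordProj 𝕜 S v) = coordProj 𝕜 S v := by
  ext i; by_cases hi : i ∈ S <;> simp [coordProj_apply, hi]

theorem coordProj_compl_coordProj {𝕜 : Type*} [RCLike 𝕜] (S : Set κ) (v : EuclideanSpace 𝕜 κ) :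
    coordProj 𝕜 Sᶜ (coordProj 𝕜 S v) = 0 := by
  ext i; by_cases hi : i ∈ S <;> simp [coordProj_apply, hi]

theorem coordProj_coordProj_compl {𝕜 : Type*} [RCLike 𝕜] (S : Set κ) (v : EuclideanSpace 𝕜 κ) :
    coordProj 𝕜 S (coordProj 𝕜 Sᶜ v) = 0 := by
  ext i; by_cases hi : i ∈ S <;> simp [coordProj_apply, hi]

theorem coordProj_add_compl {𝕜 : Type*} [RCLike 𝕜] (S : Set κ) (v : EuclideanSpace 𝕜 κ) :
    coordProj 𝕜 S v + coordProj 𝕜 Sᶜ v = v := by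
  ext i; by_cases hi : i ∈ S <;> simp [coordProj_apply, hi]

theorem inner_coordProj {𝕜 : Type*} [RCLike 𝕜] (S : Set κ) (u v : EuclideanSpace 𝕜 κ) :
    inner 𝕜 (coordProj 𝕜 S u) v = inner 𝕜 u (coordProj 𝕜 S v) := by
  simp only [PiLp.inner_apply, coordProj_apply]
  refine Finset.sum_congr rfl fun i _ => ?_
  by_cases hi : i ∈ S <;> simp [hi]

theorem coordProj_ofRealV (S : Set κ) (v : E) :
    coordProj ℂ S (ofRealV v) = ofRealV (coordProj ℝ S v) := by
  ext i; by_cases hi : i ∈ S <;> simp [coordProj_apply, hi]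

theorem reV_coordProj (S : Set κ) (v : V) : reV (coordProj ℂ S v) = coordProj ℝ S (reV v) := by
  ext i; by_cases hi : i ∈ S <;> simp [coordProj_apply, hi]

theorem imV_coordProj (S : Set κ) (v : V) : imV (coordProj ℂ S v) = coordProj ℝ S (imV v) := by
  ext i; by_cases hi : i ∈ S <;> simp [coordProj_apply, hi]

theorem inner_ofRealV (u v : E) : inner ℂ (ofRealV u) (ofRealV v) = ((inner ℝ u v : ℝ) : ℂ) := by
  simp [PiLp.inner_apply]

/-- `e` is a unit vector with coordinates supported in `S`. -/
structure IsDir (S : Set κ) (e : E) : Prop where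
  norm_eq : ‖e‖ = 1
  proj_eq : coordProj ℝ S e = e

/-- The operator `v ↦ ⟪e, v⟫ e`. -/
def rankOne (e : E) : V →L[ℂ] V := (innerSL ℂ (ofRealV e)).smulRight (ofRealV e)

theorem rankOne_apply (e : E) (v : V) : rankOne e v = inner ℂ (ofRealV e) v • ofRealV e := rfl

theorem norm_rankOne_sub_apply_le {S : Set κ} {e e' : E} (he : IsDir S e) (he' : IsDir S e')
    (v : V) : ‖rankOne e v - rankOne e' v‖ ≤ 2 * ‖e - e'‖ * ‖v‖ := by
  have e1 : rankOne e v - rankOne e' v = inner ℂ (ofRealV e) v • ofRealV (e - e') +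
      inner ℂ (ofRealV (e - e')) v • ofRealV e' := by
    rw [rankOne_apply, rankOne_apply, map_sub, inner_sub_left, smul_sub, sub_smul]
    abel
  rw [e1]
  refine (norm_add_le _ _).trans ?_
  rw [norm_smul, norm_smul, LinearIsometry.norm_map, LinearIsometry.norm_map, he'.norm_eq]
  have h1 := norm_inner_le_norm (𝕜 := ℂ) (ofRealV e) v
  have h2 := norm_inner_le_norm (𝕜 := ℂ) (ofRealV (e - e')) v
  rw [LinearIsometry.norm_map] at h1 h2
  rw [he.norm_eq] at h1
  nlinarith [norm_nonneg (e - e')]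

theorem continuous_rankOne : Continuous (rankOne : E → V →L[ℂ] V) := by
  have h : Continuous fun e : E => (ofRealV e : V) := ofRealV.continuous
  have h1 : Continuous fun e : E => innerSL ℂ (ofRealV e : V) := (innerSL ℂ).continuous.comp h
  exact ((ContinuousLinearMap.smulRightL ℂ V V).continuous.comp h1).clm_apply h

/-- The operator acting by `c₂` on the line of `e`, by `c₁` on its complement in the coordinate
subspace of `S`, and by `c₃` on the coordinate subspace of `Sᶜ`. -/
def frameOp (S : Set κ) (e : E) (c₁ c₂ c₃ : ℂ) : V →L[ℂ] V :=
  c₁ • coordProj ℂ S + (c₂ - c₁) • rankOne e + c₃ • coordProj ℂ Sᶜ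

theorem frameOp_apply (S : Set κ) (e : E) (c₁ c₂ c₃ : ℂ) (v : V) :
    frameOp S e c₁ c₂ c₃ v = c₁ • coordProj ℂ S v +
      ((c₂ - c₁) * inner ℂ (ofRealV e) v) • ofRealV e + c₃ • coordProj ℂ Sᶜ v := by
  rw [mul_smul]; rfl

theorem continuous_frameOp (S : Set κ) :
    Continuous fun p : E × ℂ × ℂ × ℂ => frameOp S p.1 p.2.1 p.2.2.1 p.2.2.2 := by
  have h1 : Continuous fun p : E × ℂ × ℂ × ℂ => (rankOne p.1 : V →L[ℂ] V) :=
    continuous_rankOne.comp continuous_fst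
  have h2 : Continuous fun p : E × ℂ × ℂ × ℂ => p.2.1 := by fun_prop
  have h3 : Continuous fun p : E × ℂ × ℂ × ℂ => p.2.2.1 := by fun_prop
  have h4 : Continuous fun p : E × ℂ × ℂ × ℂ => p.2.2.2 := by fun_prop
  exact ((h2.smul continuous_const).add ((h3.sub h2).smul h1)).add (h4.smul continuous_const)

namespace IsDir
variable {S : Set κ} {e e' : EuclideanSpace ℝ κ}

theorem coordProj_ofRealV_eq (he : IsDir S e) : coordProj ℂ S (ofRealV e) = ofRealV e := by
  rw [coordProj_ofRealV, he.proj_eq]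

theorem coordProj_compl_ofRealV (he : IsDir S e) : coordProj ℂ Sᶜ (ofRealV e) = 0 := by
  rw [← he.coordProj_ofRealV_eq, coordProj_compl_coordProj]

theorem inner_self_eq (he : IsDir S e) : inner ℂ (ofRealV e) (ofRealV e) = (1 : ℂ) := by
  rw [inner_ofRealV, real_inner_self_eq_norm_sq, he.norm_eq]; simp

theorem inner_coordProj_right (he : IsDir S e) (v : V) :
    inner ℂ (ofRealV e) (coordProj ℂ S v) = inner ℂ (ofRealV e) v := by
  rw [← inner_coordProj, he.coordProj_ofRealV_eq]

theorem inner_coordProj_compl_right (he : IsDir S e) (v : V) :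
    inner ℂ (ofRealV e) (coordProj ℂ Sᶜ v) = 0 := by
  rw [← inner_coordProj, he.coordProj_compl_ofRealV, inner_zero_left]

theorem inner_frameOp (he : IsDir S e) (c₁ c₂ c₃ : ℂ) (v : V) :
    inner ℂ (ofRealV e) (frameOp S e c₁ c₂ c₃ v) = c₂ * inner ℂ (ofRealV e) v := by
  rw [frameOp_apply, inner_add_right, inner_add_right, inner_smul_right, inner_smul_right,
    inner_smul_right, he.inner_self_eq, he.inner_coordProj_right, he.inner_coordProj_compl_right]
  ring

theorem coordProj_frameOp (he : IsDir S e) (c₁ c₂ c₃ : ℂ) (v : V) :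
    coordProj ℂ S (frameOp S e c₁ c₂ c₃ v) = c₁ • coordProj ℂ S v +
      ((c₂ - c₁) * inner ℂ (ofRealV e) v) • ofRealV e := by
  rw [frameOp_apply, map_add, map_add, map_smul, map_smul, map_smul, coordProj_idem,
    he.coordProj_ofRealV_eq, coordProj_coordProj_compl, smul_zero, add_zero]

theorem coordProj_compl_frameOp (he : IsDir S e) (c₁ c₂ c₃ : ℂ) (v : V) :
    coordProj ℂ Sᶜ (frameOp S e c₁ c₂ c₃ v) = c₃ • coordProj ℂ Sᶜ v := by
  rw [frameOp_apply, map_add, map_add, map_smul, map_smul, map_smul, coordProj_idem,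
    he.coordProj_compl_ofRealV, coordProj_compl_coordProj, smul_zero, smul_zero, zero_add, zero_add]

theorem frameOp_frameOp (he : IsDir S e) (c₁ c₂ c₃ d₁ d₂ d₃ : ℂ) (v : V) :
    frameOp S e c₁ c₂ c₃ (frameOp S e d₁ d₂ d₃ v) =
      frameOp S e (c₁ * d₁) (c₂ * d₂) (c₃ * d₃) v := by
  rw [frameOp_apply S e c₁ c₂ c₃ (frameOp S e d₁ d₂ d₃ v), he.inner_frameOp, he.coordProj_frameOp,
    he.coordProj_compl_frameOp, frameOp_apply]
  module

theorem frameOp_one (v : V) : frameOp S e 1 1 1 v = v := by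
  rw [frameOp_apply, sub_self, zero_mul, zero_smul, add_zero, one_smul, one_smul,
    coordProj_add_compl]

theorem norm_rankOne_apply_le (he : IsDir S e) (v : V) : ‖rankOne e v‖ ≤ ‖v‖ := by
  rw [rankOne_apply, norm_smul, LinearIsometry.norm_map, he.norm_eq, mul_one]
  refine (norm_inner_le_norm _ _).trans_eq ?_
  rw [LinearIsometry.norm_map, he.norm_eq, one_mul]

theorem norm_frameOp_apply_le (he : IsDir S e) (c₁ c₂ c₃ : ℂ) (v : V) :
    ‖frameOp S e c₁ c₂ c₃ v‖ ≤ (2 * ‖c₁‖ + ‖c₂‖ + ‖c₃‖) * ‖v‖ := by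
  rw [frameOp_apply, mul_smul, ← rankOne_apply]
  have h1 : ‖c₁ • coordProj ℂ S v‖ ≤ ‖c₁‖ * ‖v‖ := by
    rw [norm_smul]; gcongr; exact norm_coordProj_apply_le S v
  have h2 : ‖(c₂ - c₁) • rankOne e v‖ ≤ (‖c₂‖ + ‖c₁‖) * ‖v‖ := by
    rw [norm_smul]; gcongr
    · exact norm_sub_le _ _
    · exact he.norm_rankOne_apply_le v
  have h3 : ‖c₃ • coordProj ℂ Sᶜ v‖ ≤ ‖c₃‖ * ‖v‖ := by
    rw [norm_smul]; gcongr; exact norm_coordProj_apply_le _ v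
  have := norm_add₃_le (a := c₁ • coordProj ℂ S v) (b := (c₂ - c₁) • rankOne e v)
    (c := c₃ • coordProj ℂ Sᶜ v)
  nlinarith

theorem norm_frameOp_le (he : IsDir S e) (c₁ c₂ c₃ : ℂ) :
    ‖frameOp S e c₁ c₂ c₃‖ ≤ 2 * ‖c₁‖ + ‖c₂‖ + ‖c₃‖ :=
  ContinuousLinearMap.opNorm_le_bound _ (by positivity) (he.norm_frameOp_apply_le _ _ _)

theorem norm_frameOp_sub_le (he : IsDir S e) (he' : IsDir S e') (c₁ c₂ c₃ d₁ d₂ d₃ : ℂ) :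
    ‖frameOp S e c₁ c₂ c₃ - frameOp S e' d₁ d₂ d₃‖ ≤
      2 * ‖c₁ - d₁‖ + ‖c₂ - d₂‖ + ‖c₃ - d₃‖ + ‖d₂ - d₁‖ * (2 * ‖e - e'‖) := by
  refine ContinuousLinearMap.opNorm_le_bound _ (by positivity) fun v => ?_
  have e1 : (frameOp S e c₁ c₂ c₃ - frameOp S e' d₁ d₂ d₃) v =
      frameOp S e (c₁ - d₁) (c₂ - d₂) (c₃ - d₃) v + (d₂ - d₁) • (rankOne e v - rankOne e' v) := by
    show frameOp S e c₁ c₂ c₃ v - frameOp S e' d₁ d₂ d₃ v = _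
    simp only [frameOp_apply, rankOne_apply]
    module
  rw [e1, add_mul]
  refine (norm_add_le _ _).trans (add_le_add (he.norm_frameOp_apply_le _ _ _ v) ?_)
  rw [norm_smul, mul_assoc]
  gcongr
  exact norm_rankOne_sub_apply_le he he' v

theorem le_norm_frameOp (he : IsDir S e) {c₁ c₂ c₃ : ℂ} {δ : ℝ} (hδ : 0 < δ) (h₁ : δ ≤ ‖c₁‖)
    (h₂ : δ ≤ ‖c₂‖) (h₃ : δ ≤ ‖c₃‖) (v : V) : δ / 4 * ‖v‖ ≤ ‖frameOp S e c₁ c₂ c₃ v‖ := by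
  have n₁ : c₁ ≠ 0 := norm_pos_iff.1 (hδ.trans_le h₁)
  have n₂ : c₂ ≠ 0 := norm_pos_iff.1 (hδ.trans_le h₂)
  have n₃ : c₃ ≠ 0 := norm_pos_iff.1 (hδ.trans_le h₃)
  have h := he.norm_frameOp_apply_le c₁⁻¹ c₂⁻¹ c₃⁻¹ (frameOp S e c₁ c₂ c₃ v)
  rw [he.frameOp_frameOp, inv_mul_cancel₀ n₁, inv_mul_cancel₀ n₂, inv_mul_cancel₀ n₃,
    frameOp_one, norm_inv, norm_inv, norm_inv] at h
  have i₁ := inv_anti₀ hδ h₁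
  have i₂ := inv_anti₀ hδ h₂
  have i₃ := inv_anti₀ hδ h₃
  have h4 : ‖v‖ ≤ 4 * δ⁻¹ * ‖frameOp S e c₁ c₂ c₃ v‖ :=
    h.trans (mul_le_mul_of_nonneg_right (by linarith) (norm_nonneg _))
  calc δ / 4 * ‖v‖ ≤ δ / 4 * (4 * δ⁻¹ * ‖frameOp S e c₁ c₂ c₃ v‖) := by gcongr
    _ = _ := by field_simp

theorem isUnit_frameOp (he : IsDir S e) {c₁ c₂ c₃ : ℂ} (h₁ : c₁ ≠ 0) (h₂ : c₂ ≠ 0)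
    (h₃ : c₃ ≠ 0) : IsUnit (frameOp S e c₁ c₂ c₃) := by
  have hδ : 0 < min ‖c₁‖ (min ‖c₂‖ ‖c₃‖) := by simp [h₁, h₂, h₃]
  refine isUnit_of_le_norm (div_pos hδ four_pos) (he.le_norm_frameOp hδ (min_le_left _ _) ?_ ?_)
  · exact (min_le_right _ _).trans (min_le_left _ _)
  · exact (min_le_right _ _).trans (min_le_right _ _)

theorem frameOp_real (e : E) (a₁ a₂ a₃ : ℝ) (v : E) :
    frameOp S e a₁ a₂ a₃ (ofRealV v) = ofRealV (a₁ • coordProj ℝ S v +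
      ((a₂ - a₁) * inner ℝ e v) • e + a₃ • coordProj ℝ Sᶜ v) := by
  rw [frameOp_apply, coordProj_ofRealV, coordProj_ofRealV, inner_ofRealV]
  simp only [map_add, map_smul]
  have h : ∀ (r : ℝ) (z : V), r • z = (r : ℂ) • z := fun r z => rfl
  simp only [h]
  push_cast
  rfl

theorem inner_frameOp_left (c₁ c₂ c₃ : ℂ) (u v : V) :
    inner ℂ (frameOp S e c₁ c₂ c₃ u) v = inner ℂ u (frameOp S e (starRingEnd ℂ c₁)
      (starRingEnd ℂ c₂) (starRingEnd ℂ c₃) v) := by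
  rw [frameOp_apply, frameOp_apply, inner_add_left, inner_add_left, inner_add_right,
    inner_add_right, inner_smul_left, inner_smul_left, inner_smul_left, inner_smul_right,
    inner_smul_right, inner_smul_right, inner_coordProj, inner_coordProj, map_mul, map_sub,
    inner_conj_symm]
  ring

theorem isLagrangianFrame_frameOp (he : IsDir S e) {c₁ c₂ c₃ : ℂ} {δ : ℝ} (hδ : 0 < δ)
    (h₁ : δ ≤ ‖c₁‖) (h₂ : δ ≤ ‖c₂‖) (h₃ : δ ≤ ‖c₃‖) :
    IsLagrangianFrame (onReal (frameOp S e c₁ c₂ c₃)) (δ / 4) where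
  pos := by positivity
  sympl_eq u v := by
    rw [sympl, onReal_apply, onReal_apply, inner_frameOp_left, he.frameOp_frameOp,
      ← Complex.normSq_eq_conj_mul_self, ← Complex.normSq_eq_conj_mul_self,
      ← Complex.normSq_eq_conj_mul_self, frameOp_real, inner_ofRealV, Complex.ofReal_im]
  le_norm v := by
    rw [onReal_apply, ← ofRealV.norm_map v]
    exact he.le_norm_frameOp hδ h₁ h₂ h₃ _

end IsDir

end Frames

/-- `R` is an increasing profile with derivative `R'`. -/
structure IsProfile (R R' : ℝ → ℝ) (r₀ r₁ m M L : ℝ) : Prop where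
  hasDerivAt : ∀ u, HasDerivAt R (R' u) u
  pos : 0 < r₀
  mem : ∀ u, R u ∈ Icc r₀ r₁
  m_pos : 0 < m
  le_deriv : ∀ u ∈ Icc (-1 : ℝ) 1, m ≤ R' u
  abs_deriv_le : ∀ u, |R' u| ≤ M
  abs_deriv_sub_le : ∀ u v, |R' u - R' v| ≤ L * |u - v|

/-- The closed curve `R(cos a) + i b (1 + sin a)`. -/
def prof (R : ℝ → ℝ) (b a : ℝ) : ℂ := (R (cos a) : ℂ) + ((b * (1 + sin a) : ℝ) : ℂ) * Complex.I

/-- The derivative of `prof`. -/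
def profDeriv (R' : ℝ → ℝ) (b a : ℝ) : ℂ :=
  ((-(R' (cos a) * sin a) : ℝ) : ℂ) + ((b * cos a : ℝ) : ℂ) * Complex.I

@[simp] theorem prof_re (R : ℝ → ℝ) (b a : ℝ) : (prof R b a).re = R (cos a) := by simp [prof]

@[simp] theorem prof_im (R : ℝ → ℝ) (b a : ℝ) : (prof R b a).im = b * (1 + sin a) := by
  rw [prof, Complex.add_im, Complex.ofReal_im, Complex.mul_I_im, Complex.ofReal_re, zero_add]

theorem norm_add_mul_I_le (x y : ℝ) : ‖(x : ℂ) + (y : ℂ) * Complex.I‖ ≤ |x| + |y| := by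
  refine (norm_add_le _ _).trans (by simp)

namespace IsProfile
variable {R R' : ℝ → ℝ} {r₀ r₁ m M L b : ℝ}

theorem M_nonneg (h : IsProfile R R' r₀ r₁ m M L) : 0 ≤ M :=
  (abs_nonneg _).trans (h.abs_deriv_le 0)

theorem L_nonneg (h : IsProfile R R' r₀ r₁ m M L) : 0 ≤ L := by
  have := (abs_nonneg _).trans (h.abs_deriv_sub_le 0 1)
  simpa using this

theorem r₁_pos (h : IsProfile R R' r₀ r₁ m M L) : 0 < r₁ :=
  h.pos.trans_le ((h.mem 0).1.trans (h.mem 0).2)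

theorem continuous (h : IsProfile R R' r₀ r₁ m M L) : Continuous R :=
  continuous_iff_continuousAt.2 fun u => (h.hasDerivAt u).continuousAt

theorem continuous_deriv (h : IsProfile R R' r₀ r₁ m M L) : Continuous R' := by
  refine (LipschitzWith.of_dist_le_mul (K := ⟨L, h.L_nonneg⟩) fun u v => ?_).continuous
  exact h.abs_deriv_sub_le u v

theorem abs_sub_le (h : IsProfile R R' r₀ r₁ m M L) (u v : ℝ) : |R u - R v| ≤ M * |u - v| :=
  Convex.norm_image_sub_le_of_norm_hasDerivWithin_le (s := univ)
    (fun x _ => (h.hasDerivAt x).hasDerivWithinAt) (fun x _ => h.abs_deriv_le x) convex_univ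
    (mem_univ v) (mem_univ u)

theorem le_abs_sub (h : IsProfile R R' r₀ r₁ m M L) {u v : ℝ} (hu : u ∈ Icc (-1 : ℝ) 1)
    (hv : v ∈ Icc (-1 : ℝ) 1) : m * |u - v| ≤ |R u - R v| := by
  wlog huv : v ≤ u generalizing u v
  · rw [abs_sub_comm, abs_sub_comm (R u)]
    exact this hv hu (le_of_not_ge huv)
  have h1 := Convex.mul_sub_le_image_sub_of_le_deriv (convex_Icc (-1 : ℝ) 1)
    h.continuous.continuousOn (fun x _ => (h.hasDerivAt x).differentiableAt.differentiableWithinAt)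
    (C := m) (fun x hx => by
      rw [(h.hasDerivAt x).deriv]; exact h.le_deriv x (interior_subset hx)) v hv u hu huv
  rw [abs_of_nonneg (sub_nonneg.2 huv)]
  exact h1.trans (le_abs_self _)

theorem continuous_prof (h : IsProfile R R' r₀ r₁ m M L) : Continuous (prof R b) := by
  have := h.continuous
  unfold prof
  fun_prop

theorem continuous_profDeriv (h : IsProfile R R' r₀ r₁ m M L) : Continuous (profDeriv R' b) := by
  have := h.continuous_deriv
  unfold profDeriv
  fun_prop

theorem hasDerivAt_prof (h : IsProfile R R' r₀ r₁ m M L) (a : ℝ) :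
    HasDerivAt (prof R b) (profDeriv R' b a) a := by
  have h1 := ((h.hasDerivAt (cos a)).comp a (hasDerivAt_cos a)).ofReal_comp
  have h2 := ((((hasDerivAt_sin a).const_add 1).const_mul b).ofReal_comp).mul_const Complex.I
  refine (h1.add h2).congr_deriv ?_
  rw [profDeriv, mul_neg]

theorem le_norm_prof (h : IsProfile R R' r₀ r₁ m M L) (a : ℝ) : r₀ ≤ ‖prof R b a‖ := by
  refine (h.mem (cos a)).1.trans ?_
  have := Complex.abs_re_le_norm (prof R b a)
  rw [prof_re] at this
  exact (le_abs_self _).trans this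

theorem norm_prof_le (h : IsProfile R R' r₀ r₁ m M L) (hb : 0 < b) (a : ℝ) :
    ‖prof R b a‖ ≤ r₁ + 2 * b := by
  refine (norm_add_mul_I_le _ _).trans (add_le_add ?_ ?_)
  · rw [abs_of_nonneg (h.pos.le.trans (h.mem _).1)]; exact (h.mem _).2
  · rw [abs_of_nonneg (mul_nonneg hb.le (by linarith [neg_one_le_sin a]))]
    nlinarith [sin_le_one a]

theorem le_norm_profDeriv (h : IsProfile R R' r₀ r₁ m M L) (hb : 0 < b) (a : ℝ) :
    min m b ≤ ‖profDeriv R' b a‖ := by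
  have hμ : 0 < min m b := lt_min h.m_pos hb
  refine le_of_sq_le_sq ?_ (norm_nonneg _)
  rw [Complex.sq_norm, profDeriv, Complex.normSq_add_mul_I]
  have h1 : min m b ^ 2 ≤ R' (cos a) ^ 2 :=
    pow_le_pow_left₀ hμ.le ((min_le_left _ _).trans (h.le_deriv _ (cos_mem_Icc a))) 2
  have h2 : min m b ^ 2 ≤ b ^ 2 := pow_le_pow_left₀ hμ.le (min_le_right _ _) 2
  have h3 := sin_sq_add_cos_sq a
  calc min m b ^ 2 = min m b ^ 2 * sin a ^ 2 + min m b ^ 2 * cos a ^ 2 := by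
        rw [← mul_add, h3, mul_one]
    _ ≤ R' (cos a) ^ 2 * sin a ^ 2 + b ^ 2 * cos a ^ 2 := by gcongr
    _ = _ := by ring

theorem norm_profDeriv_le (h : IsProfile R R' r₀ r₁ m M L) (hb : 0 < b) (a : ℝ) :
    ‖profDeriv R' b a‖ ≤ M + b := by
  refine (norm_add_mul_I_le _ _).trans (add_le_add ?_ ?_)
  · rw [abs_neg, abs_mul]
    exact (mul_le_mul (h.abs_deriv_le _) (abs_sin_le_one a) (abs_nonneg _) h.M_nonneg).trans_eq
      (mul_one M)
  · rw [abs_mul, abs_of_pos hb]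
    exact mul_le_of_le_one_right hb.le (abs_cos_le_one a)

theorem norm_prof_sub_le (h : IsProfile R R' r₀ r₁ m M L) (hb : 0 < b) (a a' : ℝ) :
    ‖prof R b a - prof R b a'‖ ≤ M * |cos a - cos a'| + b * |sin a - sin a'| := by
  have e : prof R b a - prof R b a' = ((R (cos a) - R (cos a') : ℝ) : ℂ) +
      ((b * (sin a - sin a') : ℝ) : ℂ) * Complex.I := by
    simp only [prof]; push_cast; ring
  rw [e]
  refine (norm_add_mul_I_le _ _).trans (add_le_add (h.abs_sub_le _ _) ?_)
  rw [abs_mul, abs_of_pos hb]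

theorem norm_profDeriv_sub_le (h : IsProfile R R' r₀ r₁ m M L) (hb : 0 < b) (a a' : ℝ) :
    ‖profDeriv R' b a - profDeriv R' b a'‖ ≤
      (L + b) * |cos a - cos a'| + M * |sin a - sin a'| := by
  have e : profDeriv R' b a - profDeriv R' b a' =
      ((-((R' (cos a) - R' (cos a')) * sin a + R' (cos a') * (sin a - sin a')) : ℝ) : ℂ) +
      ((b * (cos a - cos a') : ℝ) : ℂ) * Complex.I := by
    simp only [profDeriv]; push_cast; ring
  rw [e]
  refine (norm_add_mul_I_le _ _).trans ?_
  rw [abs_neg, abs_mul b, abs_of_pos hb]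
  have h1 : |(R' (cos a) - R' (cos a')) * sin a| ≤ L * |cos a - cos a'| := by
    rw [abs_mul]
    exact (mul_le_of_le_one_right (abs_nonneg _) (abs_sin_le_one a)).trans
      (h.abs_deriv_sub_le _ _)
  have h2 : |R' (cos a') * (sin a - sin a')| ≤ M * |sin a - sin a'| := by
    rw [abs_mul]; gcongr; exact h.abs_deriv_le _
  have h3 := abs_add_le ((R' (cos a) - R' (cos a')) * sin a) (R' (cos a') * (sin a - sin a'))
  linarith

end IsProfile

section Tube
variable {κ : Type*} [Fintype κ]

local notation "V" => EuclideanSpace ℂ κ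
local notation "E" => EuclideanSpace ℝ κ

/-- A point of the tube over the curve `prof R b`. -/
def tubePt (R : ℝ → ℝ) (b a : ℝ) (e y : E) : V :=
  prof R b a • ofRealV e + Complex.I • ofRealV y

theorem reV_tubePt (R : ℝ → ℝ) (b a : ℝ) (e y : E) : reV (tubePt R b a e y) = R (cos a) • e := by
  simp [tubePt, reV_smul]

theorem imV_tubePt (R : ℝ → ℝ) (b a : ℝ) (e y : E) :
    imV (tubePt R b a e y) = (b * (1 + sin a)) • e + y := by
  simp [tubePt, imV_smul]

theorem continuous_tubePt {R : ℝ → ℝ} (hR : Continuous R) (b : ℝ) :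
    Continuous fun p : ℝ × E × E => tubePt R b p.1 p.2.1 p.2.2 := by
  have h : Continuous fun v : E => (ofRealV v : V) := ofRealV.continuous
  have h1 : Continuous fun p : ℝ × E × E => prof R b p.1 := by unfold prof; fun_prop
  exact (h1.smul (h.comp (continuous_fst.comp continuous_snd))).add
    ((h.comp (continuous_snd.comp continuous_snd)).const_smul Complex.I)

theorem abs_norm_smul_sub_le {S : Set κ} {e e' : E} (he : IsDir S e) (he' : IsDir S e') {x x' : ℝ}
    (hx : 0 ≤ x) (hx' : 0 ≤ x') : |x - x'| ≤ ‖x • e - x' • e'‖ := by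
  have := abs_norm_sub_norm_le (x • e) (x' • e')
  rwa [norm_smul, norm_smul, he.norm_eq, he'.norm_eq, mul_one, mul_one, Real.norm_of_nonneg hx,
    Real.norm_of_nonneg hx'] at this

namespace IsProfile
variable {R R' : ℝ → ℝ} {r₀ r₁ m M L b : ℝ} {S : Set κ} {e e' y y' : EuclideanSpace ℝ κ}

theorem abs_radius_sub_le (h : IsProfile R R' r₀ r₁ m M L) (he : IsDir S e)
    (he' : IsDir S e') (a a' : ℝ) :
    |R (cos a) - R (cos a')| ≤ ‖tubePt R b a e y - tubePt R b a' e' y'‖ := by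
  refine (abs_norm_smul_sub_le he he' (h.pos.le.trans (h.mem _).1)
    (h.pos.le.trans (h.mem _).1)).trans ?_
  rw [← reV_tubePt R b a e y, ← reV_tubePt R b a' e' y', ← map_sub]
  exact norm_reV_le _

theorem mul_abs_cos_sub_le (h : IsProfile R R' r₀ r₁ m M L) (he : IsDir S e)
    (he' : IsDir S e') (a a' : ℝ) :
    m * |cos a - cos a'| ≤ ‖tubePt R b a e y - tubePt R b a' e' y'‖ :=
  (h.le_abs_sub (cos_mem_Icc a) (cos_mem_Icc a')).trans (h.abs_radius_sub_le he he' a a')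

theorem mul_norm_dir_sub_le (h : IsProfile R R' r₀ r₁ m M L) (he : IsDir S e)
    (he' : IsDir S e') (a a' : ℝ) :
    r₀ * ‖e - e'‖ ≤ 2 * ‖tubePt R b a e y - tubePt R b a' e' y'‖ := by
  have h1 := h.abs_radius_sub_le (b := b) (y := y) (y' := y') he he' a a'
  have h2 : ‖R (cos a) • e - R (cos a') • e'‖ ≤ ‖tubePt R b a e y - tubePt R b a' e' y'‖ := by
    rw [← reV_tubePt R b a e y, ← reV_tubePt R b a' e' y', ← map_sub]
    exact norm_reV_le _
  have e1 : R (cos a) • (e - e') =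
      R (cos a) • e - R (cos a') • e' - (R (cos a) - R (cos a')) • e' := by module
  have h3 : ‖R (cos a) • (e - e')‖ ≤ 2 * ‖tubePt R b a e y - tubePt R b a' e' y'‖ := by
    rw [e1]
    refine (norm_sub_le _ _).trans ?_
    rw [norm_smul _ e', he'.norm_eq, mul_one, Real.norm_eq_abs]
    linarith
  rw [norm_smul, Real.norm_of_nonneg (h.pos.le.trans (h.mem _).1)] at h3
  exact (mul_le_mul_of_nonneg_right (h.mem _).1 (norm_nonneg _)).trans h3

end IsProfile

theorem mul_abs_sin_sub_le {R : ℝ → ℝ} {b : ℝ} {S : Set κ} {e e' y y' : E} (hb : 0 < b)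
    (he : IsDir S e) (he' : IsDir S e') (hy : coordProj ℝ S y = 0) (hy' : coordProj ℝ S y' = 0)
    (a a' : ℝ) : b * |sin a - sin a'| ≤ ‖tubePt R b a e y - tubePt R b a' e' y'‖ := by
  have h0 : ∀ a, 0 ≤ b * (1 + sin a) := fun a => mul_nonneg hb.le (by linarith [neg_one_le_sin a])
  have h1 := abs_norm_smul_sub_le he he' (h0 a) (h0 a')
  have e1 : (b * (1 + sin a)) • e - (b * (1 + sin a')) • e' =
      coordProj ℝ S (imV (tubePt R b a e y - tubePt R b a' e' y')) := by
    rw [map_sub, imV_tubePt, imV_tubePt, map_sub, map_add, map_add, hy, hy', map_smul, map_smul,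
      he.proj_eq, he'.proj_eq, add_zero, add_zero]
  rw [e1] at h1
  have h2 := h1.trans ((norm_coordProj_apply_le S _).trans (norm_imV_le _))
  have e2 : b * (1 + sin a) - b * (1 + sin a') = b * (sin a - sin a') := by ring
  rwa [e2, abs_mul, abs_of_pos hb] at h2

theorem inner_dir_eq_zero {S : Set κ} {e y : E} (he : IsDir S e) (hy : coordProj ℝ S y = 0) :
    inner ℝ e y = 0 := by
  rw [← he.proj_eq, inner_coordProj, hy, inner_zero_right]

theorem sympl_tubePt {R : ℝ → ℝ} {b : ℝ} {S : Set κ} {e e' y y' : E} (he : IsDir S e)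
    (he' : IsDir S e') (hy : coordProj ℝ S y = 0) (hy' : coordProj ℝ S y' = 0) (a a' : ℝ) :
    sympl (tubePt R b a e y) (tubePt R b a' e' y') =
      (R (cos a) * (b * (1 + sin a')) - b * (1 + sin a) * R (cos a')) *
        (1 - ‖e - e'‖ ^ 2 / 2) := by
  have h1 : inner ℝ e e' = 1 - ‖e - e'‖ ^ 2 / 2 := by
    rw [norm_sub_sq_real, he.norm_eq, he'.norm_eq]; ring
  have h2 := inner_dir_eq_zero he hy'
  have h3 := inner_dir_eq_zero he' hy
  rw [real_inner_comm] at h3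
  rw [← h1, sympl, tubePt, tubePt, inner_add_left, inner_add_right, inner_add_right]
  simp only [inner_smul_left, inner_smul_right, inner_ofRealV, h2, h3]
  simp only [Complex.add_im, Complex.mul_im, Complex.mul_re, Complex.conj_re, Complex.conj_im,
    Complex.ofReal_re, Complex.ofReal_im, prof_re, prof_im, Complex.ofReal_zero, mul_zero,
    add_zero, Complex.I_re, Complex.I_im, Complex.zero_im]
  ring

/-- The logarithm of the norm of the `S`-coordinates. -/
def logRad (S : Set κ) (θ : E) : ℝ := Real.log ‖coordProj ℝ S θ‖

/-- The direction of the `S`-coordinates. -/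
def dir (S : Set κ) (θ : E) : E := ‖coordProj ℝ S θ‖⁻¹ • coordProj ℝ S θ

variable {S : Set κ} {θ : EuclideanSpace ℝ κ}

theorem isDir_dir (hθ : coordProj ℝ S θ ≠ 0) : IsDir S (dir S θ) where
  norm_eq := by rw [dir, norm_smul, norm_inv, norm_norm, inv_mul_cancel₀ (norm_ne_zero_iff.2 hθ)]
  proj_eq := by rw [dir, map_smul, coordProj_idem]

theorem exp_logRad (hθ : coordProj ℝ S θ ≠ 0) : exp (logRad S θ) = ‖coordProj ℝ S θ‖ :=
  Real.exp_log (norm_pos_iff.2 hθ)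

theorem dir_eq (hθ : coordProj ℝ S θ ≠ 0) : dir S θ = exp (-logRad S θ) • coordProj ℝ S θ := by
  rw [Real.exp_neg, exp_logRad hθ, dir]

theorem hasFDerivAt_logRad (hθ : coordProj ℝ S θ ≠ 0) :
    HasFDerivAt (logRad S) (exp (-logRad S θ) • innerSL ℝ (dir S θ)) θ := by
  have hn : ‖coordProj ℝ S θ‖ ≠ 0 := norm_ne_zero_iff.2 hθ
  have h1 := ((coordProj ℝ S).hasFDerivAt (x := θ)).norm_sq
  have h2 := (h1.log (pow_ne_zero 2 hn)).const_mul (1 / 2 : ℝ)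
  have e1 : (fun x => 1 / 2 * Real.log (‖coordProj ℝ S x‖ ^ 2)) = logRad S := by
    ext x; rw [Real.log_pow, logRad]; push_cast; ring
  rw [e1] at h2
  refine h2.congr_fderiv ?_
  ext1 v
  have e2 : inner ℝ (coordProj ℝ S θ) (coordProj ℝ S v) = inner ℝ (coordProj ℝ S θ) v := by
    rw [← inner_coordProj, coordProj_idem]
  simp only [ContinuousLinearMap.smul_apply, ContinuousLinearMap.comp_apply, innerSL_apply_apply,
    smul_eq_mul, nsmul_eq_mul, dir, real_inner_smul_left, e2]
  rw [Real.exp_neg, exp_logRad hθ]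
  push_cast
  field_simp

theorem hasFDerivAt_dir (hθ : coordProj ℝ S θ ≠ 0) :
    HasFDerivAt (dir S) (exp (-logRad S θ) • (coordProj ℝ S -
      (innerSL ℝ (dir S θ)).smulRight (dir S θ))) θ := by
  have h1 := ((hasFDerivAt_logRad hθ).neg.exp).smul ((coordProj ℝ S).hasFDerivAt (x := θ))
  have ho : ∀ᶠ x in nhds θ, coordProj ℝ S x ≠ 0 :=
    (coordProj ℝ S).continuous.continuousAt.eventually_ne hθ
  refine (h1.congr_of_eventuallyEq (ho.mono fun x hx => dir_eq hx)).congr_fderiv ?_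
  ext1 v
  have e3 : coordProj ℝ S θ = exp (logRad S θ) • dir S θ := by
    rw [dir_eq hθ, smul_smul, ← Real.exp_add, add_neg_cancel, Real.exp_zero, one_smul]
  simp only [ContinuousLinearMap.smul_apply, ContinuousLinearMap.add_apply,
    ContinuousLinearMap.smulRight_apply, ContinuousLinearMap.neg_apply, innerSL_apply_apply,
    show ∀ A B : E →L[ℝ] E, (A - B) v = A v - B v from fun _ _ => rfl, e3, smul_smul, smul_sub,
    smul_eq_mul]
  rw [sub_eq_add_neg, ← neg_smul]
  congr 2
  have : exp (-logRad S θ) * exp (logRad S θ) = 1 := by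
    rw [← Real.exp_add, neg_add_cancel, Real.exp_zero]
  linear_combination (-(exp (-logRad S θ) * inner ℝ (dir S θ) v)) * this

/-- The immersion of the punctured space onto the tube over the curve `prof R b`. -/
def tube (R : ℝ → ℝ) (b : ℝ) (S : Set κ) (θ : E) : V :=
  tubePt R b (logRad S θ) (dir S θ) (coordProj ℝ Sᶜ θ)

theorem IsProfile.hasFDerivAt_tube {R R' : ℝ → ℝ} {r₀ r₁ m M L b : ℝ}
    (h : IsProfile R R' r₀ r₁ m M L) (hθ : coordProj ℝ S θ ≠ 0) :
    HasFDerivAt (tube R b S) (onReal (frameOp S (dir S θ)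
      (prof R b (logRad S θ) * exp (-logRad S θ))
      (profDeriv R' b (logRad S θ) * exp (-logRad S θ)) Complex.I)) θ := by
  have h1 := (h.hasDerivAt_prof (b := b) (logRad S θ)).hasFDerivAt.comp θ (hasFDerivAt_logRad hθ)
  have h2 := (ofRealV (κ := κ)).toContinuousLinearMap.hasFDerivAt.comp θ (hasFDerivAt_dir hθ)
  have h3 := ((ofRealV (κ := κ)).toContinuousLinearMap.hasFDerivAt.comp θ
    ((coordProj ℝ Sᶜ).hasFDerivAt (x := θ))).const_smul Complex.I
  refine ((h1.smul h2).add h3).congr_fderiv ?_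
  ext1 v
  rw [onReal_apply, frameOp_apply, coordProj_ofRealV, coordProj_ofRealV, inner_ofRealV]
  change prof R b (logRad S θ) • ofRealV (exp (-logRad S θ) • (coordProj ℝ S v -
      (inner ℝ (dir S θ) v) • dir S θ)) +
    ((exp (-logRad S θ) * inner ℝ (dir S θ) v) • profDeriv R' b (logRad S θ)) •
      ofRealV (dir S θ) + Complex.I • ofRealV (coordProj ℝ Sᶜ v) = _
  rw [map_smul, map_sub, map_smul]
  simp only [Complex.real_smul, ← Complex.coe_smul]
  push_cast
  module

end Tube

theorem abs_sub_le_of_abs_le {u v : ℝ} (h : |u - v| ≤ 3 * π / 2) :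
    |u - v| ≤ 3 * π / 2 * (|cos u - cos v| + |sin u - sin v|) := by
  have hpi := Real.pi_pos
  have key : ∀ x ∈ Icc 0 (3 * π / 4), 2 / (3 * π) * x ≤ sin x := by
    intro x hx
    rcases le_total x (π / 2) with h1 | h1
    · refine le_trans ?_ (mul_le_sin hx.1 h1)
      gcongr ?_ * x
      · exact hx.1
      · exact div_le_div_of_nonneg_left zero_le_two hpi (by linarith)
    · have h2 : 1 / 2 ≤ sin (π - x) := by
        refine le_trans ?_ (mul_le_sin (by linarith [hx.2]) (by linarith))
        rw [div_mul_eq_mul_div, le_div_iff₀ hpi]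
        linarith [hx.2]
      rw [sin_pi_sub] at h2
      refine le_trans ?_ h2
      rw [div_mul_eq_mul_div, div_le_iff₀ (by positivity)]
      linarith [hx.2]
  set d := |u - v| with hd
  have h1 := key (d / 2) ⟨by positivity, by linarith⟩
  have h2 : (cos u - cos v) ^ 2 + (sin u - sin v) ^ 2 = (2 * sin (d / 2)) ^ 2 := by
    have e1 : sin (d / 2) ^ 2 = sin ((u - v) / 2) ^ 2 := by
      rcases abs_choice (u - v) with h | h <;> rw [hd, h]
      rw [neg_div, sin_neg, neg_sq]
    rw [cos_sub_cos, sin_sub_sin, mul_pow 2, e1]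
    linear_combination (4 * sin ((u - v) / 2) ^ 2) * sin_sq_add_cos_sq ((u + v) / 2)
  have h3 : 2 * sin (d / 2) ≤ |cos u - cos v| + |sin u - sin v| := by
    refine le_of_sq_le_sq ?_ (by positivity)
    rw [← h2, add_sq, sq_abs, sq_abs]
    nlinarith [mul_nonneg (abs_nonneg (cos u - cos v)) (abs_nonneg (sin u - sin v))]
  calc d = 3 * π / 2 * (2 * (2 / (3 * π) * (d / 2))) := by field_simp
    _ ≤ _ := by gcongr; linarith

/-- The area swept by the curve `prof R b`. -/
def areaFun (R : ℝ → ℝ) (b x : ℝ) : ℝ := ∫ s in (0 : ℝ)..x, R (cos s) * (b * cos s)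

/-- The primitive of `p dq - q dp` along the curve `prof R b`. -/
def primFun (R : ℝ → ℝ) (b x : ℝ) : ℝ := 2 * areaFun R b x - R (cos x) * (b * (1 + sin x))

theorem areaFun_add_two_pi {R : ℝ → ℝ} (hR : Continuous R) (b x : ℝ) :
    areaFun R b (x + 2 * π) = areaFun R b x + areaFun R b (2 * π) := by
  have hc : Continuous fun s => R (cos s) * (b * cos s) := by fun_prop
  have hp : Function.Periodic (fun s => R (cos s) * (b * cos s)) (2 * π) := fun s => by
    simp only [cos_add_two_pi]
  have h1 := hp.intervalIntegral_add_eq x 0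
  rw [zero_add] at h1
  rw [areaFun, areaFun, areaFun, ← h1, intervalIntegral.integral_add_adjacent_intervals] <;>
    exact hc.intervalIntegrable _ _

theorem primFun_add_two_pi {R : ℝ → ℝ} (hR : Continuous R) (b x : ℝ) :
    primFun R b (x + 2 * π) = primFun R b x + 2 * areaFun R b (2 * π) := by
  rw [primFun, primFun, areaFun_add_two_pi hR, cos_add_two_pi, sin_add_two_pi]; ring

namespace IsProfile
variable {R R' : ℝ → ℝ} {r₀ r₁ m M L b : ℝ}

theorem abs_area_sub_le (h : IsProfile R R' r₀ r₁ m M L) (hb : 0 < b) (x y : ℝ) :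
    |areaFun R b y - areaFun R b x - R (cos x) * (b * (1 + sin y) - b * (1 + sin x))| ≤
      M * b * |y - x| ^ 2 := by
  have hR := h.continuous
  have hc : Continuous fun s => R (cos s) * (b * cos s) := by fun_prop
  have hd : ∀ s, HasDerivAt (fun s => areaFun R b s - R (cos x) * (b * (1 + sin s)))
      ((R (cos s) - R (cos x)) * (b * cos s)) s := fun s => by
    refine ((intervalIntegral.integral_hasDerivAt_right (hc.intervalIntegrable _ _)
      hc.stronglyMeasurable.stronglyMeasurableAtFilter hc.continuousAt).sub
      ((((hasDerivAt_sin s).const_add 1).const_mul b).const_mul (R (cos x)))).congr_deriv ?_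
    ring
  have h1 := (convex_uIcc x y).norm_image_sub_le_of_norm_hasDerivWithin_le
    (C := M * b * |y - x|) (fun s _ => (hd s).hasDerivWithinAt) (fun s hs => by
      rw [Real.norm_eq_abs, abs_mul, abs_mul, abs_of_pos hb]
      have h2 : |R (cos s) - R (cos x)| ≤ M * |y - x| := by
        refine (h.abs_sub_le _ _).trans (mul_le_mul_of_nonneg_left ?_ h.M_nonneg)
        exact (abs_cos_sub_cos_le s x).trans (abs_sub_left_of_mem_uIcc hs)
      have h3 : b * |cos s| ≤ b := mul_le_of_le_one_right hb.le (abs_cos_le_one s)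
      calc _ ≤ M * |y - x| * b := mul_le_mul h2 h3 (by positivity)
            (mul_nonneg h.M_nonneg (abs_nonneg _))
        _ = _ := by ring) left_mem_uIcc right_mem_uIcc
  rw [Real.norm_eq_abs, Real.norm_eq_abs] at h1
  refine (le_of_eq ?_).trans (h1.trans_eq (by ring))
  congr 1; ring

theorem abs_prim_sub_le (h : IsProfile R R' r₀ r₁ m M L) (hb : 0 < b) (x y : ℝ) :
    |primFun R b y - primFun R b x -
      (R (cos x) * (b * (1 + sin y)) - b * (1 + sin x) * R (cos y))| ≤ 2 * M * b * |y - x| ^ 2 := by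
  have h1 := h.abs_area_sub_le hb x y
  have h2 := h.abs_area_sub_le hb y x
  rw [abs_sub_comm x y] at h2
  have e : primFun R b y - primFun R b x -
      (R (cos x) * (b * (1 + sin y)) - b * (1 + sin x) * R (cos y)) =
      (areaFun R b y - areaFun R b x - R (cos x) * (b * (1 + sin y) - b * (1 + sin x))) -
      (areaFun R b x - areaFun R b y - R (cos y) * (b * (1 + sin x) - b * (1 + sin y))) := by
    rw [primFun, primFun]; ring
  rw [e]
  exact (abs_sub _ _).trans (by linarith)

theorem exists_abs_prim_sub_sympl_le {κ : Type*} [Fintype κ] (S : Set κ)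
    (h : IsProfile R R' r₀ r₁ m M L) (hb : 0 < b) : ∃ C, 0 ≤ C ∧ ∀ (x x' : ℝ)
    (e e' y y' : EuclideanSpace ℝ κ), IsDir S e → IsDir S e' → coordProj ℝ S y = 0 →
    coordProj ℝ S y' = 0 → |x - x'| ≤ 3 * π / 2 →
    |primFun R b x' - primFun R b x - sympl (tubePt R b x e y) (tubePt R b x' e' y')| ≤
      C * ‖tubePt R b x' e' y' - tubePt R b x e y‖ ^ 2 := by
  have hm := h.m_pos
  have hr := h.pos
  have hr₁ := h.r₁_pos
  have hM := h.M_nonneg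
  refine ⟨2 * M * b * (3 * π / 2 * (1 / m + 1 / b)) ^ 2 + 4 * r₁ * b * (2 / r₀) ^ 2 / 2,
    by positivity, fun x x' e e' y y' he he' hy hy' hx => ?_⟩
  set d := ‖tubePt R b x' e' y' - tubePt R b x e y‖ with hd
  rw [norm_sub_rev] at hd
  have hd0 : 0 ≤ d := by rw [hd]; exact norm_nonneg _
  have h1 : |cos x - cos x'| ≤ 1 / m * d := by
    rw [one_div_mul_eq_div, le_div_iff₀ hm, mul_comm, hd]
    exact h.mul_abs_cos_sub_le he he' x x'
  have h2 : |sin x - sin x'| ≤ 1 / b * d := by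
    rw [one_div_mul_eq_div, le_div_iff₀ hb, mul_comm, hd]
    exact mul_abs_sin_sub_le hb he he' hy hy' x x'
  have h3 : ‖e - e'‖ ≤ 2 / r₀ * d := by
    rw [div_mul_eq_mul_div, le_div_iff₀ hr, mul_comm, hd]
    exact h.mul_norm_dir_sub_le he he' x x'
  have h4 : |x' - x| ≤ 3 * π / 2 * (1 / m + 1 / b) * d := by
    rw [abs_sub_comm]
    refine (abs_sub_le_of_abs_le hx).trans ?_
    rw [mul_assoc]
    refine mul_le_mul_of_nonneg_left ?_ (by positivity)
    rw [add_mul]; exact add_le_add h1 h2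
  have h5 := h.abs_prim_sub_le hb x x'
  have hR : ∀ x, |R (cos x)| ≤ r₁ := fun x => by
    rw [abs_of_nonneg (hr.le.trans (h.mem _).1)]; exact (h.mem _).2
  have hs : ∀ x, |b * (1 + sin x)| ≤ 2 * b := fun x => by
    rw [abs_of_nonneg (mul_nonneg hb.le (by linarith [neg_one_le_sin x]))]
    nlinarith [sin_le_one x]
  have h6 : |R (cos x) * (b * (1 + sin x')) - b * (1 + sin x) * R (cos x')| ≤ 4 * r₁ * b := by
    refine (abs_sub _ _).trans ?_
    rw [abs_mul, abs_mul (b * (1 + sin x))]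
    have i1 := mul_le_mul (hR x) (hs x') (abs_nonneg _) hr₁.le
    have i2 := mul_le_mul (hs x) (hR x') (abs_nonneg _) (by positivity)
    linarith
  rw [sympl_tubePt he he' hy hy']
  set Q := R (cos x) * (b * (1 + sin x')) - b * (1 + sin x) * R (cos x')
  have e1 : primFun R b x' - primFun R b x - Q * (1 - ‖e - e'‖ ^ 2 / 2) =
      (primFun R b x' - primFun R b x - Q) + Q * ‖e - e'‖ ^ 2 / 2 := by ring
  rw [e1]
  refine (abs_add_le _ _).trans ?_
  rw [add_mul]
  refine add_le_add (h5.trans ?_) ?_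
  · calc 2 * M * b * |x' - x| ^ 2 ≤ 2 * M * b * (3 * π / 2 * (1 / m + 1 / b) * d) ^ 2 := by gcongr
      _ = _ := by ring
  · rw [abs_div, abs_mul, abs_two, abs_of_nonneg (sq_nonneg ‖e - e'‖)]
    calc |Q| * ‖e - e'‖ ^ 2 / 2 ≤ 4 * r₁ * b * (2 / r₀ * d) ^ 2 / 2 := by gcongr
      _ = _ := by ring

end IsProfile

section Channel
variable {κ : Type*} [Fintype κ]

local notation "V" => EuclideanSpace ℂ κ
local notation "E" => EuclideanSpace ℝ κ

/-- The integer translation by `n` in the imaginary coordinates outside of `S`. -/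
def latticeVec (S : Set κ) (n : κ → ℤ) : E := coordProj ℝ Sᶜ (WithLp.toLp 2 fun i => (n i : ℝ))

/-- A tame Hamiltonian flow which is trivial near the walls of the tube over `prof R b` and
admits no chord from the part of the tube with `cos a < 0` to the part with `0 < cos a`. -/
structure IsChannel (S : Set κ) (K : EuclideanSpace ℂ κ → ℝ)
    (X : EuclideanSpace ℂ κ → EuclideanSpace ℂ κ)
    (DX : EuclideanSpace ℂ κ → EuclideanSpace ℂ κ →L[ℝ] EuclideanSpace ℂ κ)
    (φ : ℝ → EuclideanSpace ℂ κ → EuclideanSpace ℂ κ)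
    (Ξ : ℝ → EuclideanSpace ℂ κ → EuclideanSpace ℂ κ →L[ℝ] EuclideanSpace ℂ κ)
    (R R' : ℝ → ℝ) (M c L r₀ r₁ m MR LR b Δ ε t : ℝ) : Prop where
  ham : IsTameHamiltonian K X DX M c L
  flow : IsFlow X DX φ Ξ
  profile : IsProfile R R' r₀ r₁ m MR LR
  b_pos : 0 < b
  ε_pos : 0 < ε
  ε_le : ε ≤ 1 / 2
  periodic : ∀ z (n : κ → ℤ), X (z + Complex.I • ofRealV (latticeVec S n)) = X z
  zone : ∀ a e y, IsDir S e → coordProj ℝ S y = 0 → |cos a| < ε →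
    ∀ᶠ z in nhds (tubePt R b a e y), X z = 0
  eq_high : ∀ a e y, IsDir S e → coordProj ℝ S y = 0 → |cos a| < ε → sin a < 0 →
    K (tubePt R b a e y) = Δ
  eq_low : ∀ a e y, IsDir S e → coordProj ℝ S y = 0 → |cos a| < ε → 0 < sin a →
    K (tubePt R b a e y) = 0
  time : t * Δ = areaFun R b (2 * π)
  no_chord : ∀ a e y a' e' y', IsDir S e → coordProj ℝ S y = 0 → IsDir S e' →
    coordProj ℝ S y' = 0 → cos a < 0 → 0 < cos a' →
    φ t (tubePt R b a e y) ≠ tubePt R b a' e' y'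

theorem tubePt_add (R : ℝ → ℝ) (b a : ℝ) (e y n : E) :
    tubePt R b a e (y + n) = tubePt R b a e y + Complex.I • ofRealV n := by
  rw [tubePt, tubePt, map_add, smul_add, add_assoc]

theorem tubePt_congr (R : ℝ → ℝ) (b : ℝ) {a a' : ℝ} (hc : cos a = cos a') (hs : sin a = sin a')
    (e y : E) : tubePt R b a e y = tubePt R b a' e y := by
  rw [tubePt, tubePt, prof, prof, hc, hs]

theorem norm_le_norm_tubePt (R : ℝ → ℝ) {b : ℝ} (hb : 0 < b) {S : Set κ} (a : ℝ) {e : E}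
    (he : IsDir S e) (y : E) : ‖y‖ ≤ ‖tubePt R b a e y‖ + 2 * b := by
  have h1 : y = imV (tubePt R b a e y) - (b * (1 + sin a)) • e := by
    rw [imV_tubePt]; abel
  have h2 : ‖(b * (1 + sin a)) • e‖ ≤ 2 * b := by
    rw [norm_smul, he.norm_eq, mul_one, Real.norm_eq_abs,
      abs_of_nonneg (mul_nonneg hb.le (by linarith [neg_one_le_sin a]))]
    nlinarith [sin_le_one a]
  calc ‖y‖ = ‖imV (tubePt R b a e y) - (b * (1 + sin a)) • e‖ := by rw [← h1]
    _ ≤ _ := (norm_sub_le _ _).trans (add_le_add (norm_imV_le _) h2)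

namespace IsChannel
variable {S : Set κ} {K : EuclideanSpace ℂ κ → ℝ} {X : EuclideanSpace ℂ κ → EuclideanSpace ℂ κ}
  {DX : EuclideanSpace ℂ κ → EuclideanSpace ℂ κ →L[ℝ] EuclideanSpace ℂ κ}
  {φ : ℝ → EuclideanSpace ℂ κ → EuclideanSpace ℂ κ}
  {Ξ : ℝ → EuclideanSpace ℂ κ → EuclideanSpace ℂ κ →L[ℝ] EuclideanSpace ℂ κ}
  {R R' : ℝ → ℝ} {M c L r₀ r₁ m MR LR b Δ ε t : ℝ}

theorem flow_add (h : IsChannel S K X DX φ Ξ R R' M c L r₀ r₁ m MR LR b Δ ε t) (s : ℝ) (z : V)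
    (n : κ → ℤ) : φ s (z + Complex.I • ofRealV (latticeVec S n)) =
      φ s z + Complex.I • ofRealV (latticeVec S n) := by
  have := h.flow.eq_of_hasDerivAt h.ham.tame
    (γ := fun s => φ s z + Complex.I • ofRealV (latticeVec S n))
    (fun s => by rw [h.periodic]; exact (h.flow.hasDerivAt z s).add_const _) s
  rw [h.flow.zero] at this
  exact this.symm

theorem isCompact_isDir (S : Set κ) : IsCompact {e : E | IsDir S e} := by
  have h1 : {e : E | IsDir S e} = Metric.sphere 0 1 ∩ {e | coordProj ℝ S e = e} := by
    ext e
    simp only [mem_setOf_eq, mem_inter_iff, mem_sphere_zero_iff_norm]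
    exact ⟨fun he => ⟨he.norm_eq, he.proj_eq⟩, fun he => ⟨he.1, he.2⟩⟩
  rw [h1]
  exact (isCompact_sphere _ _).inter_right (isClosed_eq (coordProj ℝ S).continuous continuous_id)

theorem continuous_flow (h : IsChannel S K X DX φ Ξ R R' M c L r₀ r₁ m MR LR b Δ ε t) (s : ℝ) :
    Continuous (φ s) :=
  continuous_iff_continuousAt.2 fun x => (h.flow.hasFDerivAt h.ham.tame h.ham.nonneg s x).continuousAt

theorem exists_le_norm_sub (h : IsChannel S K X DX φ Ξ R R' M c L r₀ r₁ m MR LR b Δ ε t) :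
    ∃ c₀, 0 < c₀ ∧ ∀ a e y a' e' y', IsDir S e → coordProj ℝ S y = 0 → IsDir S e' →
      coordProj ℝ S y' = 0 → cos a ≤ -ε → ε ≤ cos a' →
      c₀ ≤ ‖φ t (tubePt R b a e y) - tubePt R b a' e' y'‖ := by
  have hpi := Real.two_pi_pos
  have hε := h.ε_pos
  have hRc := h.profile.continuous
  have hb := h.b_pos
  have hr₁ := h.profile.r₁_pos
  have hM := h.ham.tame.nonneg.1
  set N := Real.sqrt (Fintype.card κ)
  set B : ℝ := 1 + (r₁ + 2 * b + N + M * |t|) + 2 * b with hB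
  let f : (ℝ × E × E) × (ℝ × E × E) → ℝ := fun p =>
    ‖φ t (tubePt R b p.1.1 p.1.2.1 p.1.2.2) - tubePt R b p.2.1 p.2.2.1 p.2.2.2‖
  have hf : Continuous f := by
    have h1 := continuous_tubePt (κ := κ) hRc b
    exact (((h.continuous_flow t).comp (h1.comp continuous_fst)).sub (h1.comp continuous_snd)).norm
  have hcoord : IsCompact (Icc (0 : ℝ) (2 * π) ×ˢ ({e : E | IsDir S e} ×ˢ
      (Metric.closedBall (0 : E) B ∩ {y | coordProj ℝ S y = 0}))) :=
    isCompact_Icc.prod ((isCompact_isDir S).prod ((isCompact_closedBall _ _).inter_right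
      (isClosed_eq (coordProj ℝ S).continuous continuous_const)))
  set P := Icc (0 : ℝ) (2 * π) ×ˢ ({e : E | IsDir S e} ×ˢ
      (Metric.closedBall (0 : E) B ∩ {y | coordProj ℝ S y = 0}))
  have hP : IsCompact ((P ∩ {p | cos p.1 ≤ -ε}) ×ˢ (P ∩ {p | ε ≤ cos p.1})) :=
    (hcoord.inter_right (isClosed_le (by fun_prop) (by fun_prop))).prod
      (hcoord.inter_right (isClosed_le (by fun_prop) (by fun_prop)))
  obtain ⟨c₁, hc₁, hc₁'⟩ := hP.exists_forall_le' hf.continuousOn (a := 0) (by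
    rintro ⟨⟨a, e, y⟩, ⟨a', e', y'⟩⟩ ⟨⟨⟨_, he, _, hy⟩, ha⟩, ⟨⟨_, he', _, hy'⟩, ha'⟩⟩
    refine norm_pos_iff.2 (sub_ne_zero.2 (h.no_chord a e y a' e' y' he hy he' hy' ?_ ?_))
    · exact lt_of_le_of_lt ha (by linarith)
    · exact lt_of_lt_of_le hε ha')
  refine ⟨min c₁ 1, lt_min hc₁ one_pos, fun a e y a' e' y' he hy he' hy' ha ha' => ?_⟩
  have hmod : ∀ a, ∃ x ∈ Icc (0 : ℝ) (2 * π), cos x = cos a ∧ sin x = sin a := fun a => by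
    refine ⟨toIcoMod hpi 0 a, ?_, ?_, ?_⟩
    · have := toIcoMod_mem_Ico hpi 0 a
      rw [zero_add] at this
      exact ⟨this.1, this.2.le⟩
    · rw [toIcoMod, zsmul_eq_mul, cos_sub_int_mul_two_pi]
    · rw [toIcoMod, zsmul_eq_mul, sin_sub_int_mul_two_pi]
  obtain ⟨x, hx, hxc, hxs⟩ := hmod a
  obtain ⟨x', hx', hxc', hxs'⟩ := hmod a'
  set n : κ → ℤ := fun i => ⌊y i⌋ with hn
  set g : E := coordProj ℝ Sᶜ (WithLp.toLp 2 fun i => Int.fract (y i)) with hg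
  have hyg : y = g + latticeVec S n := by
    rw [hg, latticeVec, ← map_add]
    have e1 : (WithLp.toLp 2 (fun i => Int.fract (y i)) + WithLp.toLp 2 fun i => (n i : ℝ)) = y := by
      ext i; simp [hn, Int.fract_add_floor]
    rw [e1]
    have := coordProj_add_compl S y
    rwa [hy, zero_add, eq_comm] at this
  have hgS : coordProj ℝ S g = 0 := coordProj_coordProj_compl _ _
  have hgN : ‖g‖ ≤ N := by
    refine (norm_coordProj_apply_le _ _).trans ?_
    rw [EuclideanSpace.norm_eq]
    refine Real.sqrt_le_sqrt ?_
    refine (Finset.sum_le_card_nsmul _ _ 1 fun i _ => ?_).trans (by simp)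
    have h1 := Int.fract_nonneg (y i)
    have h2 := (Int.fract_lt_one (y i)).le
    rw [Real.norm_eq_abs, abs_of_nonneg h1]
    exact pow_le_one₀ h1 h2
  set y'' := y' - latticeVec S n with hy''
  have hyS : coordProj ℝ S y'' = 0 := by
    rw [hy'', map_sub, hy', latticeVec, coordProj_coordProj_compl, sub_zero]
  have hy''' : y' = y'' + latticeVec S n := by rw [hy'']; abel
  have e2 : φ t (tubePt R b a e y) - tubePt R b a' e' y' =
      φ t (tubePt R b x e g) - tubePt R b x' e' y'' := by
    rw [hyg, hy''', tubePt_add, tubePt_add, h.flow_add, tubePt_congr R b hxc hxs,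
      tubePt_congr R b hxc' hxs']
    abel
  rw [e2]
  rcases le_or_gt 1 ‖φ t (tubePt R b x e g) - tubePt R b x' e' y''‖ with h1 | h1
  · exact (min_le_right _ _).trans h1
  refine (min_le_left _ _).trans ?_
  have hz : ‖tubePt R b x e g‖ ≤ r₁ + 2 * b + N := by
    refine (norm_add_le _ _).trans ?_
    rw [norm_smul, norm_smul, LinearIsometry.norm_map, LinearIsometry.norm_map, he.norm_eq,
      Complex.norm_I, mul_one, one_mul]
    exact add_le_add (h.profile.norm_prof_le hb x) hgN
  have hflow := h.flow.norm_sub_self_le h.ham.tame t (tubePt R b x e g)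
  have hz' : ‖tubePt R b x' e' y''‖ ≤ 1 + (r₁ + 2 * b + N + M * |t|) := by
    have i1 := norm_sub_norm_le (tubePt R b x' e' y'') (φ t (tubePt R b x e g))
    have i2 := norm_sub_norm_le (φ t (tubePt R b x e g)) (tubePt R b x e g)
    rw [norm_sub_rev] at i1
    linarith
  have hBg : N ≤ B := by
    rw [hB]; nlinarith [mul_nonneg hM (abs_nonneg t)]
  refine hc₁' ((x, e, g), (x', e', y'')) ⟨⟨⟨hx, he, ?_, hgS⟩, ?_⟩, ⟨⟨hx', he', ?_, hyS⟩, ?_⟩⟩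
  · exact mem_closedBall_zero_iff.2 (hgN.trans hBg)
  · show cos x ≤ -ε; rwa [hxc]
  · refine mem_closedBall_zero_iff.2 ((norm_le_norm_tubePt R hb x' he' y'').trans ?_)
    rw [hB]; linarith
  · show ε ≤ cos x'; rwa [hxc']

end IsChannel
end Channel

theorem abs_le_of_cos_gt {x : ℝ} (hx : |x| ≤ π) (h : -(1 / 2) < cos x) : |x| ≤ 3 * π / 4 := by
  have hpi := Real.pi_pos
  by_contra hlt
  rw [not_le] at hlt
  have h1 : cos |x| ≤ cos (π - π / 3) :=
    cos_le_cos_of_nonneg_of_le_pi (by linarith) hx (by linarith)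
  rw [cos_abs, cos_pi_sub, cos_pi_div_three] at h1
  linarith

/-- The representative of the angle `a` in the period centered at `π` or `0`. -/
def angleRep (σ : Bool) (a : ℝ) : ℝ := toIcoMod Real.two_pi_pos (cond σ 0 (-π)) a

theorem cos_angleRep (σ : Bool) (a : ℝ) : cos (angleRep σ a) = cos a := by
  rw [angleRep, toIcoMod, zsmul_eq_mul, cos_sub_int_mul_two_pi]

theorem sin_angleRep (σ : Bool) (a : ℝ) : sin (angleRep σ a) = sin a := by
  rw [angleRep, toIcoMod, zsmul_eq_mul, sin_sub_int_mul_two_pi]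

/-- The angles belonging to the side `σ` up to a margin `ε`. -/
def OnSide (ε : ℝ) (σ : Bool) (a : ℝ) : Prop := cond σ (cos a < ε) (-ε < cos a)

theorem abs_angleRep_sub_le {ε : ℝ} (hε : ε ≤ 1 / 2) {σ : Bool} {a a' : ℝ} (h : OnSide ε σ a)
    (h' : OnSide ε σ a') : |angleRep σ a - angleRep σ a'| ≤ 3 * π / 2 := by
  have key : ∀ a, OnSide ε σ a → |angleRep σ a - cond σ π 0| ≤ 3 * π / 4 := by
    intro a ha
    have h1 := toIcoMod_mem_Ico Real.two_pi_pos (cond σ 0 (-π)) a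
    have h2 := cos_angleRep σ a
    cases σ
    · simp only [OnSide, cond_false] at ha h1 ⊢
      rw [sub_zero]
      refine abs_le_of_cos_gt (abs_le.2 ⟨h1.1, ?_⟩) ?_
      · have := h1.2; rw [angleRep]; simp only [cond_false]; linarith
      · rw [h2]; linarith
    · simp only [OnSide, cond_true] at ha h1 ⊢
      rw [zero_add] at h1
      refine abs_le_of_cos_gt (abs_le.2 ?_) ?_
      · rw [angleRep]; simp only [cond_true]; constructor <;> linarith [h1.1, h1.2]
      · rw [cos_sub_pi, h2]; linarith
  have h1 := key a h
  have h2 := key a' h'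
  have e : angleRep σ a - angleRep σ a' =
      (angleRep σ a - cond σ π 0) - (angleRep σ a' - cond σ π 0) := by ring
  rw [e]
  exact (abs_sub _ _).trans (by linarith)

theorem angleRep_true_of_sin_pos {a : ℝ} (h : 0 < sin a) : angleRep true a = angleRep false a := by
  have h1 := toIcoMod_mem_Ico Real.two_pi_pos (-π) a
  have h2 : 0 < sin (angleRep false a) := by rwa [sin_angleRep]
  have h3 : 0 ≤ angleRep false a := by
    by_contra hlt
    exact absurd (sin_nonpos_of_nonpos_of_neg_pi_le (not_le.1 hlt).le h1.1) (not_le.2 h2)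
  have h4 : angleRep false a < 2 * π := by
    have := h1.2; rw [angleRep]; simp only [cond_false]; linarith [Real.pi_pos]
  refine (toIcoMod_eq_iff Real.two_pi_pos).2 ⟨⟨h3, by rwa [cond_true, zero_add]⟩,
    toIcoDiv Real.two_pi_pos (-π) a, ?_⟩
  exact (toIcoMod_add_toIcoDiv_zsmul Real.two_pi_pos (-π) a).symm

theorem angleRep_true_of_sin_neg {a : ℝ} (h : sin a < 0) :
    angleRep true a = angleRep false a + 2 * π := by
  have hpi := Real.pi_pos
  have h1 := toIcoMod_mem_Ico Real.two_pi_pos (-π) a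
  have h2 : sin (angleRep false a) < 0 := by rwa [sin_angleRep]
  have h5 : angleRep false a < π := by
    have := h1.2; rw [angleRep]; simp only [cond_false]; linarith
  have h3 : angleRep false a < 0 := by
    by_contra hlt
    exact absurd (sin_nonneg_of_nonneg_of_le_pi (not_lt.1 hlt) h5.le) (not_le.2 h2)
  have h4 : -π ≤ angleRep false a := h1.1
  refine (toIcoMod_eq_iff Real.two_pi_pos).2 ⟨⟨?_, ?_⟩,
    toIcoDiv Real.two_pi_pos (-π) a - 1, ?_⟩
  · rw [cond_true]; linarith
  · rw [cond_true]; linarith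
  · have := toIcoMod_add_toIcoDiv_zsmul Real.two_pi_pos (-π) a
    rw [sub_smul, one_smul]
    calc a = toIcoMod Real.two_pi_pos (-π) a + toIcoDiv Real.two_pi_pos (-π) a • (2 * π) := this.symm
      _ = _ := by rw [angleRep]; simp only [cond_false]; ring

theorem sin_ne_zero_of_abs_cos_lt {a : ℝ} (h : |cos a| < 1 / 2) : sin a ≠ 0 := by
  intro hs
  have h1 := sin_sq_add_cos_sq a
  rw [hs, ← sq_abs (cos a)] at h1
  nlinarith [abs_nonneg (cos a)]

section Channel
variable {κ : Type*} [Fintype κ]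

local notation "V" => EuclideanSpace ℂ κ
local notation "E" => EuclideanSpace ℝ κ

theorem IsDir.complProj (S : Set κ) (θ : E) : coordProj ℝ S (coordProj ℝ Sᶜ θ) = 0 :=
  coordProj_coordProj_compl S θ

/-- The frame of the tube over the curve `prof R b`. -/
def tubeFrame (R R' : ℝ → ℝ) (b : ℝ) (S : Set κ) (θ : E) : V →L[ℂ] V :=
  frameOp S (dir S θ) (prof R b (logRad S θ)) (profDeriv R' b (logRad S θ)) Complex.I

namespace IsChannel
variable {S : Set κ} {K : EuclideanSpace ℂ κ → ℝ} {X : EuclideanSpace ℂ κ → EuclideanSpace ℂ κ}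
  {DX : EuclideanSpace ℂ κ → EuclideanSpace ℂ κ →L[ℝ] EuclideanSpace ℂ κ}
  {φ : ℝ → EuclideanSpace ℂ κ → EuclideanSpace ℂ κ}
  {Ξ : ℝ → EuclideanSpace ℂ κ → EuclideanSpace ℂ κ →L[ℝ] EuclideanSpace ℂ κ}
  {R R' : ℝ → ℝ} {M c L r₀ r₁ m MR LR b Δ ε t : ℝ} {θ θ' : EuclideanSpace ℝ κ}

theorem zone_tube (h : IsChannel S K X DX φ Ξ R R' M c L r₀ r₁ m MR LR b Δ ε t)
    (hθ : coordProj ℝ S θ ≠ 0) (hz : |cos (logRad S θ)| < ε) :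
    ∀ᶠ z in nhds (tube R b S θ), X z = 0 :=
  h.zone _ _ _ (isDir_dir hθ) (coordProj_coordProj_compl S θ) hz

theorem flow_of_zone (h : IsChannel S K X DX φ Ξ R R' M c L r₀ r₁ m MR LR b Δ ε t)
    (hθ : coordProj ℝ S θ ≠ 0) (hz : |cos (logRad S θ)| < ε) (s : ℝ) :
    φ s (tube R b S θ) = tube R b S θ :=
  h.flow.eq_self h.ham.tame (h.zone_tube hθ hz).self_of_nhds s

theorem deriv_of_zone (h : IsChannel S K X DX φ Ξ R R' M c L r₀ r₁ m MR LR b Δ ε t)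
    (hθ : coordProj ℝ S θ ≠ 0) (hz : |cos (logRad S θ)| < ε) (s : ℝ) :
    Ξ s (tube R b S θ) = 1 :=
  h.flow.deriv_eq_one h.ham.tame h.ham.nonneg (h.zone_tube hθ hz) s

/-- The primitive on the side `σ`. -/
def sidePrim (K : V → ℝ) (X : V → V) (φ : ℝ → V → V) (R : ℝ → ℝ) (b t : ℝ) (S : Set κ) (σ : Bool)
    (θ : E) : ℝ :=
  primFun R b (angleRep σ (logRad S θ)) + action K X φ (cond σ t 0) (tube R b S θ)

theorem sidePrim_eq (h : IsChannel S K X DX φ Ξ R R' M c L r₀ r₁ m MR LR b Δ ε t)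
    (hθ : coordProj ℝ S θ ≠ 0) (hz : |cos (logRad S θ)| < ε) :
    sidePrim K X φ R b t S true θ = sidePrim K X φ R b t S false θ := by
  have hX := (h.zone_tube hθ hz).self_of_nhds
  have he := isDir_dir hθ
  have hy := coordProj_coordProj_compl S θ
  rw [sidePrim, sidePrim, cond_true, cond_false, h.ham.action_eq_of_field_eq_zero h.flow hX,
    IsTameHamiltonian.action_zero]
  rcases lt_or_gt_of_ne (sin_ne_zero_of_abs_cos_lt (hz.trans_le h.ε_le)) with hs | hs
  · rw [angleRep_true_of_sin_neg hs, primFun_add_two_pi h.profile.continuous, tube,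
      h.eq_high _ _ _ he hy hz hs, ← h.time]
    ring
  · rw [angleRep_true_of_sin_pos hs, tube, h.eq_low _ _ _ he hy hz hs]
    ring

/-- The side of a point of the tube. -/
def sideOf (S : Set κ) (θ : E) : Bool := decide (cos (logRad S θ) ≤ 0)

theorem onSide_sideOf (h : IsChannel S K X DX φ Ξ R R' M c L r₀ r₁ m MR LR b Δ ε t) (θ : E) :
    OnSide ε (sideOf S θ) (logRad S θ) := by
  have := h.ε_pos
  by_cases hc : cos (logRad S θ) ≤ 0
  · have e : sideOf S θ = true := decide_eq_true hc
    rw [e]; show cos _ < ε; linarith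
  · have e : sideOf S θ = false := decide_eq_false hc
    rw [e]; show -ε < cos _; linarith

theorem eq_sideOf_or (h : IsChannel S K X DX φ Ξ R R' M c L r₀ r₁ m MR LR b Δ ε t) {σ : Bool}
    (hσ : OnSide ε σ (logRad S θ)) : σ = sideOf S θ ∨ |cos (logRad S θ)| < ε := by
  have := h.ε_pos
  by_cases hc : cos (logRad S θ) ≤ 0
  · have e : sideOf S θ = true := decide_eq_true hc
    cases σ
    · right
      have h1 : -ε < cos (logRad S θ) := hσ
      exact abs_lt.2 ⟨h1, by linarith⟩
    · left; rw [e]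
  · have e : sideOf S θ = false := decide_eq_false hc
    cases σ
    · left; rw [e]
    · right
      have h1 : cos (logRad S θ) < ε := hσ
      exact abs_lt.2 ⟨by linarith, h1⟩

theorem flow_sideOf (h : IsChannel S K X DX φ Ξ R R' M c L r₀ r₁ m MR LR b Δ ε t) {σ : Bool}
    (hθ : coordProj ℝ S θ ≠ 0) (hσ : OnSide ε σ (logRad S θ)) :
    φ (cond (sideOf S θ) t 0) (tube R b S θ) = φ (cond σ t 0) (tube R b S θ) ∧
    Ξ (cond (sideOf S θ) t 0) (tube R b S θ) = Ξ (cond σ t 0) (tube R b S θ) ∧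
    sidePrim K X φ R b t S (sideOf S θ) θ = sidePrim K X φ R b t S σ θ := by
  rcases h.eq_sideOf_or hσ with rfl | hz
  · exact ⟨rfl, rfl, rfl⟩
  · refine ⟨by rw [h.flow_of_zone hθ hz, h.flow_of_zone hθ hz],
      by rw [h.deriv_of_zone hθ hz, h.deriv_of_zone hθ hz], ?_⟩
    have := h.sidePrim_eq hθ hz
    cases sideOf S θ <;> cases σ <;> simp [this]

theorem abs_cond_le (σ : Bool) (t : ℝ) : |cond σ t 0| ≤ |t| := by cases σ <;> simp

theorem exists_sidePrim_sub_le (h : IsChannel S K X DX φ Ξ R R' M c L r₀ r₁ m MR LR b Δ ε t) :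
    ∃ C, 0 ≤ C ∧ ∀ σ θ θ', coordProj ℝ S θ ≠ 0 → coordProj ℝ S θ' ≠ 0 →
    OnSide ε σ (logRad S θ) → OnSide ε σ (logRad S θ') →
    |sidePrim K X φ R b t S σ θ' - sidePrim K X φ R b t S σ θ -
      sympl (φ (cond σ t 0) (tube R b S θ)) (φ (cond σ t 0) (tube R b S θ'))| ≤
      C * ‖φ (cond σ t 0) (tube R b S θ') - φ (cond σ t 0) (tube R b S θ)‖ ^ 2 := by
  obtain ⟨C, hC, hC'⟩ := h.profile.exists_abs_prim_sub_sympl_le S h.b_pos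
  have hc := h.ham.tame.nonneg.2
  refine ⟨(C + 2 * c * exp (c * |t|) ^ 2 * |t|) * exp (c * |t|) ^ 2, by positivity,
    fun σ θ θ' hθ hθ' hσ hσ' => ?_⟩
  have h1 := hC' (angleRep σ (logRad S θ)) (angleRep σ (logRad S θ')) (dir S θ) (dir S θ')
    (coordProj ℝ Sᶜ θ) (coordProj ℝ Sᶜ θ') (isDir_dir hθ) (isDir_dir hθ')
    (coordProj_coordProj_compl S θ) (coordProj_coordProj_compl S θ')
    (abs_angleRep_sub_le h.ε_le hσ hσ')
  rw [tubePt_congr R b (cos_angleRep σ _) (sin_angleRep σ _),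
    tubePt_congr R b (cos_angleRep σ (logRad S θ')) (sin_angleRep σ _)] at h1
  change |_ - sympl (tube R b S θ) (tube R b S θ')| ≤ C * ‖tube R b S θ' - tube R b S θ‖ ^ 2 at h1
  have h2 := h.ham.abs_action_sub_le h.flow (abs_cond_le σ t) (tube R b S θ) (tube R b S θ')
  have h3 := h.flow.le_norm_sub h.ham.tame (abs_cond_le σ t) (tube R b S θ') (tube R b S θ)
  set z := tube R b S θ
  set z' := tube R b S θ'
  set w := φ (cond σ t 0) z
  set w' := φ (cond σ t 0) z'
  have e : sidePrim K X φ R b t S σ θ' - sidePrim K X φ R b t S σ θ - sympl w w' =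
      (primFun R b (angleRep σ (logRad S θ')) - primFun R b (angleRep σ (logRad S θ)) -
        sympl z z') + (action K X φ (cond σ t 0) z' - action K X φ (cond σ t 0) z - sympl w w' +
        sympl z z') := by
    rw [sidePrim, sidePrim]; ring
  rw [e]
  calc _ ≤ C * ‖z' - z‖ ^ 2 + 2 * c * exp (c * |t|) ^ 2 * |t| * ‖z' - z‖ ^ 2 :=
        (abs_add_le _ _).trans (add_le_add h1 h2)
    _ = (C + 2 * c * exp (c * |t|) ^ 2 * |t|) * ‖z' - z‖ ^ 2 := by ring
    _ ≤ (C + 2 * c * exp (c * |t|) ^ 2 * |t|) * (‖w' - w‖ * exp (c * |t|)) ^ 2 := by gcongr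
    _ = _ := by ring

end IsChannel
end Channel

section Channel
variable {κ : Type*} [Fintype κ]

local notation "V" => EuclideanSpace ℂ κ
local notation "E" => EuclideanSpace ℝ κ

theorem IsLagrangianFrame.comp_deriv_flow {K : V → ℝ} {X : V → V} {DX : V → V →L[ℝ] V}
    {M c L : ℝ} (h : IsTameHamiltonian K X DX M c L) {φ : ℝ → V → V} {Ξ : ℝ → V → V →L[ℝ] V}
    (hφ : IsFlow X DX φ Ξ) {D : E →L[ℝ] V} {δ : ℝ} (hD : IsLagrangianFrame D δ) {T t : ℝ}
    (ht : |t| ≤ T) (x : V) : IsLagrangianFrame ((Ξ t x).comp D) (δ * exp (-(c * T))) where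
  pos := mul_pos hD.pos (exp_pos _)
  sympl_eq u v := by
    rw [ContinuousLinearMap.comp_apply, ContinuousLinearMap.comp_apply, h.sympl_deriv_flow hφ]
    exact hD.sympl_eq u v
  le_norm v := by
    have h1 := hφ.le_norm_deriv h.tame h.nonneg ht x (D v)
    have h2 := hD.le_norm v
    have h3 : exp (-(c * T)) * exp (c * T) = 1 := by rw [← exp_add]; simp
    have h4 := exp_pos (-(c * T))
    rw [ContinuousLinearMap.comp_apply]
    calc δ * exp (-(c * T)) * ‖v‖ = exp (-(c * T)) * (δ * ‖v‖) := by ring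
      _ ≤ exp (-(c * T)) * (exp (c * T) * ‖Ξ t x (D v)‖) := by exact mul_le_mul_of_nonneg_left (h2.trans h1) h4.le
      _ = _ := by rw [← mul_assoc, h3, one_mul]

theorem continuousAt_logRad {S : Set κ} {θ : E} (hθ : coordProj ℝ S θ ≠ 0) :
    ContinuousAt (logRad S) θ := (hasFDerivAt_logRad hθ).continuousAt

theorem continuousAt_dir {S : Set κ} {θ : E} (hθ : coordProj ℝ S θ ≠ 0) :
    ContinuousAt (dir S) θ := (hasFDerivAt_dir hθ).continuousAt

theorem isOpen_coordProj_ne (S : Set κ) : IsOpen {θ : E | coordProj ℝ S θ ≠ 0} :=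
  isOpen_ne_fun (coordProj ℝ S).continuous continuous_const

/-- The time for which a point of the tube is moved. -/
def endTime (t : ℝ) (S : Set κ) (θ : E) : ℝ := cond (IsChannel.sideOf S θ) t 0

/-- The derivative of the tube. -/
def tubeDeriv (R R' : ℝ → ℝ) (b : ℝ) (S : Set κ) (θ : E) : V →L[ℂ] V :=
  frameOp S (dir S θ) (prof R b (logRad S θ) * exp (-logRad S θ))
    (profDeriv R' b (logRad S θ) * exp (-logRad S θ)) Complex.I

/-- The Lagrangian submanifold swept out by the flow of the half of the tube with `cos a ≤ 0`
together with the other half. -/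
def sweepMap (φ : ℝ → V → V) (R : ℝ → ℝ) (b t : ℝ) (S : Set κ) (θ : E) : V :=
  φ (endTime t S θ) (tube R b S θ)

/-- The derivative of `sweepMap`. -/
def sweepDeriv (Ξ : ℝ → V → V →L[ℝ] V) (R R' : ℝ → ℝ) (b t : ℝ) (S : Set κ) (θ : E) :
    V →L[ℂ] V :=
  cplx ((Ξ (endTime t S θ) (tube R b S θ)).comp (onReal (tubeDeriv R R' b S θ)))

/-- The tangent frame of `sweepMap`. -/
def sweepFrame (Ξ : ℝ → V → V →L[ℝ] V) (R R' : ℝ → ℝ) (b t : ℝ) (S : Set κ) (θ : E) :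
    E →L[ℝ] V :=
  (Ξ (endTime t S θ) (tube R b S θ)).comp (onReal (tubeFrame R R' b S θ))

theorem continuousOn_frameOp (f₁ f₂ f₃ : ℝ × E → ℂ) {s : Set (ℝ × E)} (S : Set κ)
    (hs : ∀ p ∈ s, coordProj ℝ S p.2 ≠ 0) (h₁ : ContinuousOn f₁ s) (h₂ : ContinuousOn f₂ s)
    (h₃ : ContinuousOn f₃ s) :
    ContinuousOn (fun p : ℝ × E => frameOp S (dir S p.2) (f₁ p) (f₂ p) (f₃ p)) s := by
  have hd : ContinuousOn (fun p : ℝ × E => dir S p.2) s := fun p hp =>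
    (ContinuousAt.comp (x := p) (g := dir S) (continuousAt_dir (hs p hp))
      continuousAt_snd).continuousWithinAt
  have hp : ContinuousOn (fun p : ℝ × E => (dir S p.2, f₁ p, f₂ p, f₃ p)) s :=
    hd.prodMk (h₁.prodMk (h₂.prodMk h₃))
  exact Continuous.comp_continuousOn' (f := fun p : ℝ × E => (dir S p.2, f₁ p, f₂ p, f₃ p))
    (continuous_frameOp S) hp

namespace IsChannel
variable {S : Set κ} {K : EuclideanSpace ℂ κ → ℝ} {X : EuclideanSpace ℂ κ → EuclideanSpace ℂ κ}
  {DX : EuclideanSpace ℂ κ → EuclideanSpace ℂ κ →L[ℝ] EuclideanSpace ℂ κ}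
  {φ : ℝ → EuclideanSpace ℂ κ → EuclideanSpace ℂ κ}
  {Ξ : ℝ → EuclideanSpace ℂ κ → EuclideanSpace ℂ κ →L[ℝ] EuclideanSpace ℂ κ}
  {R R' : ℝ → ℝ} {M c L r₀ r₁ m MR LR b Δ ε t : ℝ} {θ θ' : EuclideanSpace ℝ κ}

theorem continuousAt_tube (h : IsChannel S K X DX φ Ξ R R' M c L r₀ r₁ m MR LR b Δ ε t)
    (hθ : coordProj ℝ S θ ≠ 0) : ContinuousAt (tube R b S) θ :=
  (h.profile.hasFDerivAt_tube hθ).continuousAt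

theorem eventually_flow_eq (h : IsChannel S K X DX φ Ξ R R' M c L r₀ r₁ m MR LR b Δ ε t)
    (hθ : coordProj ℝ S θ ≠ 0) : ∀ᶠ θ' in nhds θ, ∀ s : ℝ,
      φ (s * endTime t S θ') (tube R b S θ') = φ (s * endTime t S θ) (tube R b S θ') ∧
      Ξ (s * endTime t S θ') (tube R b S θ') = Ξ (s * endTime t S θ) (tube R b S θ') := by
  have hc : ContinuousAt (fun θ => cos (logRad S θ)) θ :=
    (Real.continuous_cos.continuousAt).comp (continuousAt_logRad hθ)
  rcases lt_trichotomy (cos (logRad S θ)) 0 with h1 | h1 | h1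
  · filter_upwards [hc.eventually (gt_mem_nhds h1)] with θ' hθ' s
    have e : endTime t S θ' = endTime t S θ := by
      rw [endTime, endTime, sideOf, sideOf, decide_eq_true hθ'.le, decide_eq_true h1.le]
    rw [e]; exact ⟨rfl, rfl⟩
  · have h2 : ∀ᶠ θ' in nhds θ, |cos (logRad S θ')| < ε :=
      hc.abs.eventually (gt_mem_nhds (by simpa [h1] using h.ε_pos))
    filter_upwards [h2, (isOpen_coordProj_ne S).mem_nhds hθ] with θ' h3 h4 s
    rw [h.flow_of_zone h4 h3, h.flow_of_zone h4 h3, h.deriv_of_zone h4 h3, h.deriv_of_zone h4 h3]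
    exact ⟨rfl, rfl⟩
  · filter_upwards [hc.eventually (lt_mem_nhds h1)] with θ' hθ' s
    have e : endTime t S θ' = endTime t S θ := by
      rw [endTime, endTime, sideOf, sideOf, decide_eq_false (not_le.2 hθ'),
        decide_eq_false (not_le.2 h1)]
    rw [e]; exact ⟨rfl, rfl⟩

theorem hasFDerivAt_sweepMap (h : IsChannel S K X DX φ Ξ R R' M c L r₀ r₁ m MR LR b Δ ε t)
    (hθ : coordProj ℝ S θ ≠ 0) :
    HasFDerivAt (sweepMap φ R b t S) (onReal (sweepDeriv Ξ R R' b t S θ)) θ := by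
  rw [sweepDeriv, onReal_cplx]
  refine ((h.flow.hasFDerivAt h.ham.tame h.ham.nonneg (endTime t S θ) (tube R b S θ)).comp θ
    (h.profile.hasFDerivAt_tube hθ)).congr_of_eventuallyEq ?_
  filter_upwards [h.eventually_flow_eq hθ] with θ' hθ'
  have := (hθ' 1).1
  rwa [one_mul, one_mul] at this

theorem continuousOn_deriv (h : IsChannel S K X DX φ Ξ R R' M c L r₀ r₁ m MR LR b Δ ε t) :
    ContinuousOn (fun p : ℝ × E => Ξ (p.1 * endTime t S p.2) (tube R b S p.2))
      (univ ×ˢ {θ | coordProj ℝ S θ ≠ 0}) := by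
  rintro ⟨s, θ⟩ ⟨-, hθ⟩
  have hθ : coordProj ℝ S θ ≠ 0 := hθ
  refine ContinuousAt.continuousWithinAt ?_
  have h1 : ContinuousAt (fun p : ℝ × E => Ξ (p.1 * endTime t S θ) (tube R b S p.2)) (s, θ) := by
    have h2 : ContinuousAt (fun p : ℝ × E => (p.1 * endTime t S θ, tube R b S p.2)) (s, θ) :=
      (continuousAt_fst.mul continuousAt_const).prodMk
        (ContinuousAt.comp (x := (s, θ)) (g := tube R b S) (h.continuousAt_tube hθ) continuousAt_snd)
    exact (h.flow.continuous_deriv h.ham.tame h.ham.nonneg).continuousAt.comp h2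
  refine h1.congr ?_
  filter_upwards [continuousAt_snd.eventually (h.eventually_flow_eq hθ)] with p hp
  exact (hp p.1).2.symm

end IsChannel
end Channel

section Channel
variable {κ : Type*} [Fintype κ]

local notation "V" => EuclideanSpace ℂ κ
local notation "E" => EuclideanSpace ℝ κ

namespace IsChannel
variable {S : Set κ} {K : EuclideanSpace ℂ κ → ℝ} {X : EuclideanSpace ℂ κ → EuclideanSpace ℂ κ}
  {DX : EuclideanSpace ℂ κ → EuclideanSpace ℂ κ →L[ℝ] EuclideanSpace ℂ κ}
  {φ : ℝ → EuclideanSpace ℂ κ → EuclideanSpace ℂ κ}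
  {Ξ : ℝ → EuclideanSpace ℂ κ → EuclideanSpace ℂ κ →L[ℝ] EuclideanSpace ℂ κ}
  {R R' : ℝ → ℝ} {M c L r₀ r₁ m MR LR b Δ ε t : ℝ} {θ θ' : EuclideanSpace ℝ κ}

theorem prof_ne_zero (h : IsChannel S K X DX φ Ξ R R' M c L r₀ r₁ m MR LR b Δ ε t) (a : ℝ) :
    prof R b a ≠ 0 := by
  have := h.profile.le_norm_prof (b := b) a
  exact norm_pos_iff.1 (h.profile.pos.trans_le this)

theorem profDeriv_ne_zero (h : IsChannel S K X DX φ Ξ R R' M c L r₀ r₁ m MR LR b Δ ε t) (a : ℝ) :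
    profDeriv R' b a ≠ 0 := by
  have := h.profile.le_norm_profDeriv h.b_pos a
  exact norm_pos_iff.1 ((lt_min h.profile.m_pos h.b_pos).trans_le this)

theorem tubeDeriv_eq (hθ : coordProj ℝ S θ ≠ 0) (v : V) :
    tubeDeriv R R' b S θ v = tubeFrame R R' b S θ (frameOp S (dir S θ)
      (exp (-logRad S θ) : ℝ) (exp (-logRad S θ) : ℝ) (1 : ℝ) v) := by
  rw [tubeDeriv, tubeFrame, (isDir_dir hθ).frameOp_frameOp]
  simp

theorem exists_list_prod (h : IsChannel S K X DX φ Ξ R R' M c L r₀ r₁ m MR LR b Δ ε t)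
    {Q : Set E} (hQU : Q ⊆ {θ | coordProj ℝ S θ ≠ 0}) (hQ : IsCompact Q) :
    ∃ l : List (E → V →L[ℂ] V), (∀ N ∈ l, ContinuousOn N {θ | coordProj ℝ S θ ≠ 0}) ∧
      (∀ N ∈ l, ∀ θ ∈ Q, ‖N θ - 1‖ ≤ 1 / 2) ∧
      ∀ θ ∈ Q, (l.map fun N => N θ).prod * sweepDeriv Ξ R R' b t S θ = 1 := by
  set U : Set E := {θ | coordProj ℝ S θ ≠ 0} with hU
  have hlog : ContinuousOn (fun p : ℝ × E => logRad S p.2) (Icc 0 1 ×ˢ U) := fun p hp =>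
    (ContinuousAt.comp (x := p) (g := logRad S) (continuousAt_logRad hp.2)
      continuousAt_snd).continuousWithinAt
  have hfst : ContinuousOn (fun p : ℝ × E => p.1) (Icc 0 1 ×ˢ U) := continuous_fst.continuousOn
  have hexp : ContinuousOn (fun p : ℝ × E => ((exp (-logRad S p.2) : ℝ) : ℂ)) (Icc 0 1 ×ˢ U) :=
    Complex.continuous_ofReal.comp_continuousOn (Real.continuous_exp.comp_continuousOn hlog.neg)
  have hprof : ContinuousOn (fun p : ℝ × E => prof R b (logRad S p.2)) (Icc 0 1 ×ˢ U) :=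
    h.profile.continuous_prof.comp_continuousOn hlog
  have hTD : ContinuousOn (fun p : ℝ × E => tubeDeriv R R' b S p.2) (Icc 0 1 ×ˢ U) :=
    continuousOn_frameOp _ _ _ S (fun p hp => hp.2) (hprof.mul hexp)
      ((h.profile.continuous_profDeriv.comp_continuousOn hlog).mul hexp) continuousOn_const
  have hexp0 : ∀ x : ℝ, ((exp x : ℝ) : ℂ) ≠ 0 := fun x => Complex.ofReal_ne_zero.2 (exp_pos x).ne'
  obtain ⟨l₁, a₁, b₁, c₁⟩ := exists_list_prod_of_homotopy hQ hQU
    (A := fun s θ => cplx ((Ξ (s * endTime t S θ) (tube R b S θ)).comp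
      (onReal (tubeDeriv R R' b S θ))))
    (by
      refine continuous_cplx.comp_continuousOn (ContinuousOn.clm_comp ?_
        (continuous_onReal.comp_continuousOn hTD))
      exact h.continuousOn_deriv.mono (prod_mono (subset_univ _) subset_rfl))
    (by
      intro s _ θ hθ
      have he : 0 < exp (-logRad S θ) := exp_pos _
      have hr := h.profile.pos
      have hmin := lt_min h.profile.m_pos h.b_pos
      have hδ : 0 < min (min (r₀ * exp (-logRad S θ)) (min m b * exp (-logRad S θ))) 1 :=
        lt_min (lt_min (mul_pos hr he) (mul_pos hmin he)) one_pos
      refine (IsLagrangianFrame.comp_deriv_flow h.ham h.flow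
        ((isDir_dir hθ).isLagrangianFrame_frameOp hδ ?_ ?_ ?_) (le_refl |s * endTime t S θ|)
        (tube R b S θ)).isUnit_cplx
      · rw [norm_mul, Complex.norm_real, Real.norm_eq_abs, abs_of_pos he]
        refine ((min_le_left _ _).trans (min_le_left _ _)).trans ?_
        exact mul_le_mul_of_nonneg_right (h.profile.le_norm_prof _) he.le
      · rw [norm_mul, Complex.norm_real, Real.norm_eq_abs, abs_of_pos he]
        refine ((min_le_left _ _).trans (min_le_right _ _)).trans ?_
        exact mul_le_mul_of_nonneg_right (h.profile.le_norm_profDeriv h.b_pos _) he.le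
      · rw [Complex.norm_I]; exact min_le_right _ _)
  obtain ⟨l₂, a₂, b₂, c₂⟩ := exists_list_prod_of_homotopy hQ hQU
    (A := fun s θ => frameOp S (dir S θ) (prof R b (logRad S θ) * (exp (-logRad S θ) : ℝ))
      (profDeriv R' b (s * logRad S θ) * (exp (-(s * logRad S θ)) : ℝ)) Complex.I)
    (continuousOn_frameOp _ _ _ S (fun p hp => hp.2) (hprof.mul hexp)
      ((h.profile.continuous_profDeriv.comp_continuousOn (hfst.mul hlog)).mul
        (Complex.continuous_ofReal.comp_continuousOn
          (Real.continuous_exp.comp_continuousOn (hfst.mul hlog).neg))) continuousOn_const)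
    (fun s _ θ hθ => (isDir_dir hθ).isUnit_frameOp (mul_ne_zero (h.prof_ne_zero _) (hexp0 _))
      (mul_ne_zero (h.profDeriv_ne_zero _) (hexp0 _)) Complex.I_ne_zero)
  have hs : ContinuousOn (fun p : ℝ × E => (p.1 : ℂ)) (Icc 0 1 ×ˢ U) :=
    Complex.continuous_ofReal.comp_continuousOn hfst
  have him : ∀ s : ℝ, ∀ z : ℂ, z.re = 0 → z ≠ 0 → (1 - (s : ℂ)) + s * z ≠ 0 := by
    intro s z hz hz0 h0
    have h1 := congrArg Complex.re h0
    simp [hz] at h1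
    have h2 : s = 1 := by linarith
    rw [h2] at h0
    simp at h0
    exact hz0 h0
  obtain ⟨l₃, a₃, b₃, c₃⟩ := exists_list_prod_of_homotopy hQ hQU
    (A := fun s θ => frameOp S (dir S θ)
      ((1 - (s : ℂ)) + s * (prof R b (logRad S θ) * (exp (-logRad S θ) : ℝ)))
      ((1 - (s : ℂ)) + s * profDeriv R' b 0) ((1 - (s : ℂ)) + s * Complex.I))
    (continuousOn_frameOp _ _ _ S (fun p hp => hp.2)
      ((continuousOn_const.sub hs).add (hs.mul (hprof.mul hexp)))
      ((continuousOn_const.sub hs).add (hs.mul continuousOn_const))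
      ((continuousOn_const.sub hs).add (hs.mul continuousOn_const)))
    (fun s hs θ hθ => (isDir_dir hθ).isUnit_frameOp (by
        intro h0
        have h1 := congrArg Complex.re h0
        have h2 : 0 < (prof R b (logRad S θ) * (exp (-logRad S θ) : ℝ)).re := by
          rw [Complex.re_mul_ofReal]
          refine mul_pos ?_ (exp_pos _)
          have : (prof R b (logRad S θ)).re = R (cos (logRad S θ)) := by simp [prof]
          rw [this]
          exact h.profile.pos.trans_le (h.profile.mem _).1
        rw [Complex.add_re, Complex.re_ofReal_mul] at h1
        simp only [Complex.sub_re, Complex.one_re, Complex.ofReal_re, Complex.zero_re] at h1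
        rcases hs.1.eq_or_lt with h3 | h3
        · rw [← h3] at h1; simp at h1
        · nlinarith [mul_pos h3 h2, hs.2])
      (him _ _ (by simp [profDeriv]) (h.profDeriv_ne_zero _))
      (him _ _ Complex.I_re Complex.I_ne_zero))
  refine ⟨l₃ ++ l₂ ++ l₁, ?_, ?_, ?_⟩
  · intro N hN
    simp only [List.mem_append] at hN
    rcases hN with (hN | hN) | hN
    exacts [a₃ N hN, a₂ N hN, a₁ N hN]
  · intro N hN
    simp only [List.mem_append] at hN
    rcases hN with (hN | hN) | hN
    exacts [b₃ N hN, b₂ N hN, b₁ N hN]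
  · intro θ hθ
    have d₁ := c₁ θ (hQU hθ)
    have d₂ := c₂ θ (hQU hθ)
    have d₃ := c₃ θ (hQU hθ)
    simp only [one_mul, zero_mul] at d₁
    simp only [one_mul, zero_mul, neg_zero, exp_zero, Complex.ofReal_one, mul_one] at d₂
    simp only [one_mul, zero_mul, Complex.ofReal_one, Complex.ofReal_zero, sub_self, sub_zero,
      zero_add, add_zero] at d₃
    rw [h.flow.deriv_zero] at d₁
    have e₁ : cplx ((1 : V →L[ℝ] V).comp (onReal (tubeDeriv R R' b S θ))) =
        tubeDeriv R R' b S θ := by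
      have e : (1 : V →L[ℝ] V).comp (onReal (tubeDeriv R R' b S θ)) =
          onReal (tubeDeriv R R' b S θ) := ContinuousLinearMap.id_comp _
      rw [e, cplx_onReal]
    rw [e₁] at d₁
    have e₃ : frameOp S (dir S θ) 1 1 1 = 1 := by
      ext1 v; exact IsDir.frameOp_one v
    rw [e₃] at d₃
    rw [List.map_append, List.map_append, List.prod_append, List.prod_append, mul_assoc]
    have e₀ : (l₁.map fun N => N θ).prod * sweepDeriv Ξ R R' b t S θ =
        tubeDeriv R R' b S θ := d₁
    rw [e₀, mul_assoc]
    have e₂ : (l₂.map fun N => N θ).prod * tubeDeriv R R' b S θ = _ := d₂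
    rw [e₂, d₃]

end IsChannel
end Channel

section Channel
variable {κ : Type*} [Fintype κ]

local notation "V" => EuclideanSpace ℂ κ
local notation "E" => EuclideanSpace ℝ κ

namespace IsProfile
variable {R R' : ℝ → ℝ} {r₀ r₁ m M L b : ℝ}

theorem abs_primFun_le (h : IsProfile R R' r₀ r₁ m M L) (hb : 0 < b) (x : ℝ) :
    |primFun R b x| ≤ 2 * (r₁ * b * |x|) + r₁ * (b * 2) := by
  have hR : ∀ u, |R u| ≤ r₁ := fun u =>
    abs_le.2 ⟨by linarith [(h.mem u).1, h.pos, h.r₁_pos], (h.mem u).2⟩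
  have h1 : |areaFun R b x| ≤ r₁ * b * |x| := by
    have := intervalIntegral.norm_integral_le_of_norm_le_const (a := 0) (b := x) (C := r₁ * b)
      (f := fun s => R (cos s) * (b * cos s)) (fun s _ => by
        rw [Real.norm_eq_abs, abs_mul, abs_mul, abs_of_pos hb]
        have := abs_cos_le_one s
        have h2 := h.r₁_pos
        calc |R (cos s)| * (b * |cos s|) ≤ r₁ * (b * 1) := by
              gcongr; exact hR _
          _ = _ := by ring)
    simpa [areaFun] using this
  have h2 : |R (cos x) * (b * (1 + sin x))| ≤ r₁ * (b * 2) := by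
    have h3 : |1 + sin x| ≤ 2 := abs_le.2 ⟨by linarith [neg_one_le_sin x], by linarith [sin_le_one x]⟩
    have h4 := h.r₁_pos
    rw [abs_mul, abs_mul, abs_of_pos hb]
    gcongr
    exact hR _
  calc |primFun R b x| ≤ |2 * areaFun R b x| + |R (cos x) * (b * (1 + sin x))| := abs_sub _ _
    _ ≤ _ := by rw [abs_mul, abs_two]; gcongr

theorem abs_sympl_tubePt_le (h : IsProfile R R' r₀ r₁ m M L) (hb : 0 < b) {S : Set κ}
    {e e' y y' : E} (he : IsDir S e) (he' : IsDir S e') (hy : coordProj ℝ S y = 0)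
    (hy' : coordProj ℝ S y' = 0) (a a' : ℝ) :
    |sympl (tubePt R b a e y) (tubePt R b a' e' y')| ≤ 4 * r₁ * b := by
  rw [sympl_tubePt he he' hy hy']
  have h0 := h.r₁_pos
  have h1 : |1 - ‖e - e'‖ ^ 2 / 2| ≤ 1 := by
    have := norm_sub_le e e'
    rw [he.norm_eq, he'.norm_eq] at this
    exact abs_le.2 ⟨by nlinarith [norm_nonneg (e - e')], by linarith [sq_nonneg ‖e - e'‖]⟩
  have h2 : ∀ a a', |R (cos a) * (b * (1 + sin a'))| ≤ r₁ * (b * 2) := by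
    intro a a'
    have h3 : |1 + sin a'| ≤ 2 :=
      abs_le.2 ⟨by linarith [neg_one_le_sin a'], by linarith [sin_le_one a']⟩
    rw [abs_mul, abs_mul, abs_of_pos hb]
    gcongr
    exact abs_le.2 ⟨by linarith [(h.mem (cos a)).1, h.pos], (h.mem _).2⟩
  have h3 : |R (cos a) * (b * (1 + sin a')) - b * (1 + sin a) * R (cos a')| ≤
      r₁ * (b * 2) + r₁ * (b * 2) := by
    rw [mul_comm (b * (1 + sin a))]
    exact (abs_sub _ _).trans (add_le_add (h2 a a') (h2 a' a))
  rw [abs_mul]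
  calc _ ≤ (r₁ * (b * 2) + r₁ * (b * 2)) * 1 := by gcongr
    _ = _ := by ring

theorem norm_tubeFrame_le (h : IsProfile R R' r₀ r₁ m M L) (hb : 0 < b) {S : Set κ} {θ : E}
    (hθ : coordProj ℝ S θ ≠ 0) :
    ‖tubeFrame R R' b S θ‖ ≤ 2 * (r₁ + 2 * b) + (M + b) + 1 := by
  refine ((isDir_dir hθ).norm_frameOp_le _ _ _).trans ?_
  rw [Complex.norm_I]
  have := h.norm_prof_le hb (logRad S θ)
  have := h.norm_profDeriv_le hb (logRad S θ)
  linarith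

theorem exists_norm_tubeFrame_sub_le (h : IsProfile R R' r₀ r₁ m M L) (hb : 0 < b) (S : Set κ) :
    ∃ C, 0 ≤ C ∧ ∀ θ θ' : E, coordProj ℝ S θ ≠ 0 → coordProj ℝ S θ' ≠ 0 →
      ‖tubeFrame R R' b S θ - tubeFrame R R' b S θ'‖ ≤ C * ‖tube R b S θ - tube R b S θ'‖ := by
  have hm := h.m_pos
  have hM := h.M_nonneg
  have hL := h.L_nonneg
  have hr := h.pos
  have hr₁ := h.r₁_pos
  refine ⟨2 * (M * (1 / m) + b * (1 / b)) + ((L + b) * (1 / m) + M * (1 / b)) +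
    ((M + b) + (r₁ + 2 * b)) * (2 * (2 / r₀)), by positivity, fun θ θ' hθ hθ' => ?_⟩
  have he := isDir_dir hθ
  have he' := isDir_dir hθ'
  have hy := coordProj_coordProj_compl S θ
  have hy' := coordProj_coordProj_compl S θ'
  have h1 := h.mul_abs_cos_sub_le (b := b) (y := coordProj ℝ Sᶜ θ) (y' := coordProj ℝ Sᶜ θ') he he'
    (logRad S θ) (logRad S θ')
  have h2 := h.mul_norm_dir_sub_le (b := b) (y := coordProj ℝ Sᶜ θ) (y' := coordProj ℝ Sᶜ θ') he
    he' (logRad S θ) (logRad S θ')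
  have h3 := mul_abs_sin_sub_le (R := R) hb he he' hy hy' (logRad S θ) (logRad S θ')
  change _ ≤ ‖tube R b S θ - tube R b S θ'‖ at h1
  change _ ≤ 2 * ‖tube R b S θ - tube R b S θ'‖ at h2
  change _ ≤ ‖tube R b S θ - tube R b S θ'‖ at h3
  set d := ‖tube R b S θ - tube R b S θ'‖
  have g1 : |cos (logRad S θ) - cos (logRad S θ')| ≤ 1 / m * d := by
    rw [one_div, inv_mul_eq_div, le_div_iff₀ hm]; linarith
  have g2 : ‖dir S θ - dir S θ'‖ ≤ 2 / r₀ * d := by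
    rw [div_mul_eq_mul_div, le_div_iff₀ hr]; linarith
  have g3 : |sin (logRad S θ) - sin (logRad S θ')| ≤ 1 / b * d := by
    rw [one_div, inv_mul_eq_div, le_div_iff₀ hb]; linarith
  have g4 : ‖profDeriv R' b (logRad S θ') - prof R b (logRad S θ')‖ ≤ (M + b) + (r₁ + 2 * b) :=
    (norm_sub_le _ _).trans (add_le_add (h.norm_profDeriv_le hb _) (h.norm_prof_le hb _))
  have hd : 0 ≤ d := norm_nonneg _
  refine (he.norm_frameOp_sub_le he' _ _ _ _ _ _).trans ?_
  rw [sub_self, norm_zero, add_zero]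
  have k1 := h.norm_prof_sub_le hb (logRad S θ) (logRad S θ')
  have k2 := h.norm_profDeriv_sub_le hb (logRad S θ) (logRad S θ')
  calc _ ≤ 2 * (M * (1 / m * d) + b * (1 / b * d)) + ((L + b) * (1 / m * d) + M * (1 / b * d)) +
      ((M + b) + (r₁ + 2 * b)) * (2 * (2 / r₀ * d)) := by
        refine add_le_add (add_le_add ?_ ?_) ?_
        · refine mul_le_mul_of_nonneg_left (k1.trans ?_) zero_le_two
          gcongr
        · refine k2.trans ?_
          gcongr
        · gcongr
    _ = _ := by ring

end IsProfile

theorem abs_angleRep_le (σ : Bool) (a : ℝ) : |angleRep σ a| ≤ 2 * π := by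
  have hpi := Real.pi_pos
  have h1 := toIcoMod_mem_Ico Real.two_pi_pos (cond σ 0 (-π)) a
  rw [angleRep]
  cases σ
  · simp only [cond_false] at h1 ⊢
    exact abs_le.2 ⟨by linarith [h1.1], by linarith [h1.2]⟩
  · simp only [cond_true] at h1 ⊢
    exact abs_le.2 ⟨by linarith [h1.1], by linarith [h1.2]⟩

theorem add_mul_le_of_le {α β x c₀ : ℝ} (hα : 0 ≤ α) (hβ : 0 ≤ β) (hc : 0 < c₀) (hx : c₀ ≤ x) :
    α + β * x ≤ (α / c₀ ^ 2 + β / c₀) * x ^ 2 := by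
  have h1 : 1 ≤ x / c₀ := (one_le_div hc).2 hx
  have hx0 : 0 < x := hc.trans_le hx
  have e : (α / c₀ ^ 2 + β / c₀) * x ^ 2 = α * (x / c₀) ^ 2 + β * x * (x / c₀) := by
    field_simp
  rw [e]
  have h2 : (1 : ℝ) ≤ (x / c₀) ^ 2 := one_le_pow₀ h1
  nlinarith [mul_nonneg hβ hx0.le]

namespace IsChannel
variable {S : Set κ} {K : EuclideanSpace ℂ κ → ℝ} {X : EuclideanSpace ℂ κ → EuclideanSpace ℂ κ}
  {DX : EuclideanSpace ℂ κ → EuclideanSpace ℂ κ →L[ℝ] EuclideanSpace ℂ κ}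
  {φ : ℝ → EuclideanSpace ℂ κ → EuclideanSpace ℂ κ}
  {Ξ : ℝ → EuclideanSpace ℂ κ → EuclideanSpace ℂ κ →L[ℝ] EuclideanSpace ℂ κ}
  {R R' : ℝ → ℝ} {M c L r₀ r₁ m MR LR b Δ ε t : ℝ} {θ θ' : EuclideanSpace ℝ κ}

theorem exists_onSide_or {ε : ℝ} (hε : 0 < ε) (a a' : ℝ) : (∃ σ, OnSide ε σ a ∧ OnSide ε σ a') ∨
    (cos a ≤ -ε ∧ ε ≤ cos a') ∨ (cos a' ≤ -ε ∧ ε ≤ cos a) := by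
  rcases lt_or_ge (cos a) ε with h1 | h1 <;> rcases lt_or_ge (cos a') ε with h2 | h2 <;>
    rcases lt_or_ge (-ε) (cos a) with h3 | h3 <;> rcases lt_or_ge (-ε) (cos a') with h4 | h4
  all_goals first
    | exact Or.inl ⟨true, h1, h2⟩
    | exact Or.inl ⟨false, h3, h4⟩
    | exact Or.inr (Or.inl ⟨h3, h2⟩)
    | exact Or.inr (Or.inr ⟨h4, h1⟩)
    | (exfalso; linarith)

theorem endTime_of_le (h : IsChannel S K X DX φ Ξ R R' M c L r₀ r₁ m MR LR b Δ ε t)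
    (ha : cos (logRad S θ) ≤ -ε) : endTime t S θ = t := by
  rw [endTime, sideOf, decide_eq_true (ha.trans (by linarith [h.ε_pos])), cond_true]

theorem endTime_of_ge (h : IsChannel S K X DX φ Ξ R R' M c L r₀ r₁ m MR LR b Δ ε t)
    (ha : ε ≤ cos (logRad S θ)) : endTime t S θ = 0 := by
  rw [endTime, sideOf, decide_eq_false (not_le.2 (h.ε_pos.trans_le ha)), cond_false]

/-- The primitive on `sweepMap`. -/
def sweepPrim (K : V → ℝ) (X : V → V) (φ : ℝ → V → V) (R : ℝ → ℝ) (b t : ℝ) (S : Set κ)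
    (θ : E) : ℝ := sidePrim K X φ R b t S (sideOf S θ) θ

theorem exists_sweepPrim_sub_le (h : IsChannel S K X DX φ Ξ R R' M c L r₀ r₁ m MR LR b Δ ε t) :
    ∃ C, 0 ≤ C ∧ ∀ θ θ', coordProj ℝ S θ ≠ 0 → coordProj ℝ S θ' ≠ 0 →
    |sweepPrim K X φ R b t S θ' - sweepPrim K X φ R b t S θ -
      sympl (sweepMap φ R b t S θ) (sweepMap φ R b t S θ')| ≤
      C * ‖sweepMap φ R b t S θ' - sweepMap φ R b t S θ‖ ^ 2 := by
  obtain ⟨C, hC, hC'⟩ := h.exists_sidePrim_sub_le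
  obtain ⟨c₀, hc₀, hc₀'⟩ := h.exists_le_norm_sub
  have hM := h.ham.tame.nonneg.1
  have hb := h.b_pos
  have hr := h.profile.r₁_pos
  have hpi := Real.pi_pos
  set P : ℝ := 2 * (2 * (r₁ * b * (2 * π)) + r₁ * (b * 2)) + 4 * r₁ * b with hP
  set α : ℝ := P + ((M * |t| + M * |t|) * M + 2 * M) * |t| with hα
  set β : ℝ := M * |t| with hβ
  have hP0 : 0 ≤ P := by positivity
  have hα0 : 0 ≤ α := by positivity
  have hβ0 : 0 ≤ β := by positivity
  have hCC : 0 ≤ α / c₀ ^ 2 + β / c₀ := by positivity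
  have far : ∀ θ θ', coordProj ℝ S θ ≠ 0 → coordProj ℝ S θ' ≠ 0 → cos (logRad S θ) ≤ -ε →
      ε ≤ cos (logRad S θ') →
      |sweepPrim K X φ R b t S θ' - sweepPrim K X φ R b t S θ -
      sympl (sweepMap φ R b t S θ) (sweepMap φ R b t S θ')| ≤
      (α / c₀ ^ 2 + β / c₀) * ‖sweepMap φ R b t S θ' - sweepMap φ R b t S θ‖ ^ 2 := by
    intro θ θ' hθ hθ' ha ha'
    have e1 := h.endTime_of_le ha
    have e2 := h.endTime_of_ge ha'
    rw [endTime] at e1 e2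
    have s1 : sweepPrim K X φ R b t S θ = primFun R b (angleRep (sideOf S θ) (logRad S θ)) +
        action K X φ t (tube R b S θ) := by rw [sweepPrim, sidePrim, e1]
    have s2 : sweepPrim K X φ R b t S θ' =
        primFun R b (angleRep (sideOf S θ') (logRad S θ')) := by
      rw [sweepPrim, sidePrim, e2, IsTameHamiltonian.action_zero, add_zero]
    have s3 : sweepMap φ R b t S θ = φ t (tube R b S θ) := by rw [sweepMap, endTime, e1]
    have s4 : sweepMap φ R b t S θ' = tube R b S θ' := by
      rw [sweepMap, endTime, e2, h.flow.zero]
    have g1 := hc₀' _ _ _ _ _ _ (isDir_dir hθ) (coordProj_coordProj_compl S θ) (isDir_dir hθ')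
      (coordProj_coordProj_compl S θ') ha ha'
    change c₀ ≤ ‖φ t (tube R b S θ) - tube R b S θ'‖ at g1
    rw [norm_sub_rev] at g1
    have g2 := h.ham.abs_action_add_le h.flow (le_refl |t|) (tube R b S θ) (tube R b S θ')
    have g3 := h.flow.norm_sub_self_le h.ham.tame t (tube R b S θ)
    have g4 := h.profile.abs_sympl_tubePt_le h.b_pos (isDir_dir hθ) (isDir_dir hθ')
      (coordProj_coordProj_compl S θ) (coordProj_coordProj_compl S θ') (logRad S θ) (logRad S θ')
    change |sympl (tube R b S θ) (tube R b S θ')| ≤ _ at g4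
    have g5 : ∀ σ a, |primFun R b (angleRep σ a)| ≤ 2 * (r₁ * b * (2 * π)) + r₁ * (b * 2) :=
      fun σ a => (h.profile.abs_primFun_le hb _).trans (by
        have := abs_angleRep_le σ a
        gcongr)
    have g6 := g5 (sideOf S θ) (logRad S θ)
    have g7 := g5 (sideOf S θ') (logRad S θ')
    rw [s1, s2, s3, s4]
    set z := tube R b S θ
    set z' := tube R b S θ'
    set p := primFun R b (angleRep (sideOf S θ) (logRad S θ))
    set p' := primFun R b (angleRep (sideOf S θ') (logRad S θ'))
    have e : p' - (p + action K X φ t z) - sympl (φ t z) z' =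
        (p' - p - sympl z z') - (action K X φ t z + sympl (φ t z) z' - sympl z z') := by ring
    have g8 : ‖z' - z‖ ≤ ‖z' - φ t z‖ + M * |t| := by
      have : z' - z = (z' - φ t z) + (φ t z - z) := by abel
      rw [this]; exact (norm_add_le _ _).trans (by linarith)
    have g9 : |p' - p - sympl z z'| ≤ P := by
      refine (abs_sub _ _).trans ?_
      have := abs_sub p' p
      rw [hP]; linarith
    rw [e]
    refine (abs_sub _ _).trans (le_trans ?_ (add_mul_le_of_le hα0 hβ0 hc₀ g1))
    have g10 : ((‖z' - z‖ + M * |t|) * M + 2 * M) * |t| ≤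
        ((‖z' - φ t z‖ + M * |t| + M * |t|) * M + 2 * M) * |t| := by gcongr
    have g11 : ((‖z' - φ t z‖ + M * |t| + M * |t|) * M + 2 * M) * |t| =
        ((M * |t| + M * |t|) * M + 2 * M) * |t| + M * |t| * ‖z' - φ t z‖ := by ring
    rw [hα, hβ]
    linarith
  refine ⟨C + (α / c₀ ^ 2 + β / c₀), by positivity, fun θ θ' hθ hθ' => ?_⟩
  rcases exists_onSide_or h.ε_pos (logRad S θ) (logRad S θ') with ⟨σ, h1, h2⟩ | ⟨h1, h2⟩ | ⟨h1, h2⟩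
  · obtain ⟨f1, -, f2⟩ := h.flow_sideOf hθ h1
    obtain ⟨f3, -, f4⟩ := h.flow_sideOf hθ' h2
    rw [sweepPrim, sweepPrim, sweepMap, sweepMap, endTime, endTime, f1, f2, f3, f4]
    refine (hC' σ θ θ' hθ hθ' h1 h2).trans ?_
    exact mul_le_mul_of_nonneg_right (by linarith) (sq_nonneg _)
  · refine (far θ θ' hθ hθ' h1 h2).trans ?_
    exact mul_le_mul_of_nonneg_right (by linarith) (sq_nonneg _)
  · have := far θ' θ hθ' hθ h1 h2
    rw [norm_sub_rev, sympl_comm] at this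
    rw [← abs_neg]
    have e : ∀ x y w : ℝ, -(x - y - w) = y - x - -w := fun x y w => by ring
    rw [e]
    refine this.trans ?_
    exact mul_le_mul_of_nonneg_right (by linarith) (sq_nonneg _)

end IsChannel
end Channel

section Channel
variable {κ : Type*} [Fintype κ]

local notation "V" => EuclideanSpace ℂ κ
local notation "E" => EuclideanSpace ℝ κ

namespace IsChannel
variable {S : Set κ} {K : EuclideanSpace ℂ κ → ℝ} {X : EuclideanSpace ℂ κ → EuclideanSpace ℂ κ}
  {DX : EuclideanSpace ℂ κ → EuclideanSpace ℂ κ →L[ℝ] EuclideanSpace ℂ κ}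
  {φ : ℝ → EuclideanSpace ℂ κ → EuclideanSpace ℂ κ}
  {Ξ : ℝ → EuclideanSpace ℂ κ → EuclideanSpace ℂ κ →L[ℝ] EuclideanSpace ℂ κ}
  {R R' : ℝ → ℝ} {M c L r₀ r₁ m MR LR b Δ ε t : ℝ} {θ θ' : EuclideanSpace ℝ κ}

theorem norm_comp_sub_comp_le (P P' : V →L[ℝ] V) (A A' : E →L[ℝ] V) :
    ‖P.comp A - P'.comp A'‖ ≤ ‖P - P'‖ * ‖A‖ + ‖P'‖ * ‖A - A'‖ := by
  have e : P.comp A - P'.comp A' = (P - P').comp A + P'.comp (A - A') := by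
    rw [ContinuousLinearMap.sub_comp, ContinuousLinearMap.comp_sub]; abel
  rw [e]
  exact (norm_add_le _ _).trans (add_le_add (ContinuousLinearMap.opNorm_comp_le _ _)
    (ContinuousLinearMap.opNorm_comp_le _ _))

theorem exists_sweepFrame_sub_le (h : IsChannel S K X DX φ Ξ R R' M c L r₀ r₁ m MR LR b Δ ε t) :
    ∃ C, 0 ≤ C ∧ ∀ θ θ', coordProj ℝ S θ ≠ 0 → coordProj ℝ S θ' ≠ 0 →
    ‖sweepFrame Ξ R R' b t S θ - sweepFrame Ξ R R' b t S θ'‖ ≤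
      C * ‖sweepMap φ R b t S θ - sweepMap φ R b t S θ'‖ := by
  obtain ⟨C, hC, hC'⟩ := h.profile.exists_norm_tubeFrame_sub_le h.b_pos S
  obtain ⟨c₀, hc₀, hc₀'⟩ := h.exists_le_norm_sub
  have hL := h.ham.nonneg
  have hb := h.b_pos
  have hr := h.profile.r₁_pos
  have hMR := h.profile.M_nonneg
  set P : ℝ := 2 * (r₁ + 2 * b) + (MR + b) + 1 with hP
  have hP0 : 0 ≤ P := by positivity
  have hF : ∀ θ, coordProj ℝ S θ ≠ 0 → ‖onReal (tubeFrame R R' b S θ)‖ ≤ P := fun θ hθ =>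
    (norm_onReal_le _).trans (h.profile.norm_tubeFrame_le hb hθ)
  have hFF : ∀ θ θ', coordProj ℝ S θ ≠ 0 → coordProj ℝ S θ' ≠ 0 →
      ‖onReal (tubeFrame R R' b S θ) - onReal (tubeFrame R R' b S θ')‖ ≤
        C * ‖tube R b S θ - tube R b S θ'‖ := fun θ θ' hθ hθ' => by
    rw [← onReal_sub]
    exact (norm_onReal_le _).trans (hC' θ θ' hθ hθ')
  set e₀ := exp (c * |t|) with he₀
  have he₀' : 0 < e₀ := exp_pos _
  set Q : ℝ := L * e₀ * e₀ * |t| * e₀ with hQ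
  have hQ0 : 0 ≤ Q := by positivity
  have hbd : ∀ θ, coordProj ℝ S θ ≠ 0 → ‖sweepFrame Ξ R R' b t S θ‖ ≤ e₀ * P := fun θ hθ => by
    refine (ContinuousLinearMap.opNorm_comp_le _ _).trans ?_
    exact mul_le_mul (h.flow.norm_deriv_le h.ham.tame (abs_cond_le (sideOf S θ) t)
      (tube R b S θ)) (hF θ hθ) (norm_nonneg _) he₀'.le
  have far : ∀ θ θ', coordProj ℝ S θ ≠ 0 → coordProj ℝ S θ' ≠ 0 → cos (logRad S θ) ≤ -ε →
      ε ≤ cos (logRad S θ') →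
      ‖sweepFrame Ξ R R' b t S θ - sweepFrame Ξ R R' b t S θ'‖ ≤
      (2 * (e₀ * P) / c₀) * ‖sweepMap φ R b t S θ - sweepMap φ R b t S θ'‖ := by
    intro θ θ' hθ hθ' ha ha'
    have g1 := hc₀' _ _ _ _ _ _ (isDir_dir hθ) (coordProj_coordProj_compl S θ) (isDir_dir hθ')
      (coordProj_coordProj_compl S θ') ha ha'
    change c₀ ≤ ‖φ t (tube R b S θ) - tube R b S θ'‖ at g1
    have s3 : sweepMap φ R b t S θ = φ t (tube R b S θ) := by
      rw [sweepMap, h.endTime_of_le ha]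
    have s4 : sweepMap φ R b t S θ' = tube R b S θ' := by
      rw [sweepMap, h.endTime_of_ge ha', h.flow.zero]
    rw [s3, s4]
    calc _ ≤ 2 * (e₀ * P) := (norm_sub_le _ _).trans (by linarith [hbd θ hθ, hbd θ' hθ'])
      _ = (2 * (e₀ * P) / c₀) * c₀ := by field_simp
      _ ≤ _ := by gcongr
  refine ⟨(Q * P + e₀ * C) * e₀ + 2 * (e₀ * P) / c₀, by positivity, fun θ θ' hθ hθ' => ?_⟩
  rcases exists_onSide_or h.ε_pos (logRad S θ) (logRad S θ') with ⟨σ, h1, h2⟩ | ⟨h1, h2⟩ | ⟨h1, h2⟩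
  · obtain ⟨f1, f2, -⟩ := h.flow_sideOf hθ h1
    obtain ⟨f3, f4, -⟩ := h.flow_sideOf hθ' h2
    rw [sweepFrame, sweepFrame, sweepMap, sweepMap, endTime, endTime, f1, f2, f3, f4]
    refine (norm_comp_sub_comp_le _ _ _ _).trans ?_
    have k1 := h.flow.norm_deriv_sub_le h.ham.tame hL (abs_cond_le σ t) (tube R b S θ)
      (tube R b S θ')
    have k2 := h.flow.norm_deriv_le h.ham.tame (abs_cond_le σ t) (tube R b S θ')
    have k3 := h.flow.le_norm_sub h.ham.tame (abs_cond_le σ t) (tube R b S θ) (tube R b S θ')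
    have k4 := hF θ hθ
    have k5 := hFF θ θ' hθ hθ'
    set d := ‖tube R b S θ - tube R b S θ'‖
    set w := ‖φ (cond σ t 0) (tube R b S θ) - φ (cond σ t 0) (tube R b S θ')‖
    have hw : 0 ≤ w := norm_nonneg _
    have hd : 0 ≤ d := norm_nonneg _
    calc _ ≤ (Q * d) * P + e₀ * (C * d) := by gcongr
      _ = (Q * P + e₀ * C) * d := by ring
      _ ≤ (Q * P + e₀ * C) * (w * e₀) := by gcongr
      _ = (Q * P + e₀ * C) * e₀ * w := by ring
      _ ≤ _ := mul_le_mul_of_nonneg_right (le_add_of_nonneg_right (by positivity)) hw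
  · exact (far θ θ' hθ hθ' h1 h2).trans (mul_le_mul_of_nonneg_right
      (le_add_of_nonneg_left (by positivity)) (norm_nonneg _))
  · have := far θ' θ hθ' hθ h1 h2
    rw [norm_sub_rev, norm_sub_rev (sweepMap φ R b t S θ')] at this
    exact this.trans (mul_le_mul_of_nonneg_right
      (le_add_of_nonneg_left (by positivity)) (norm_nonneg _))

theorem isLagrangianFrame_sweepFrame
    (h : IsChannel S K X DX φ Ξ R R' M c L r₀ r₁ m MR LR b Δ ε t) (hθ : coordProj ℝ S θ ≠ 0) :
    IsLagrangianFrame (sweepFrame Ξ R R' b t S θ)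
      (min (min r₀ (min m b)) 1 / 4 * exp (-(c * |t|))) := by
  refine IsLagrangianFrame.comp_deriv_flow h.ham h.flow
    ((isDir_dir hθ).isLagrangianFrame_frameOp ?_ ?_ ?_ ?_) (abs_cond_le _ _) _
  · exact lt_min (lt_min h.profile.pos (lt_min h.profile.m_pos h.b_pos)) one_pos
  · exact ((min_le_left _ _).trans (min_le_left _ _)).trans (h.profile.le_norm_prof _)
  · exact ((min_le_left _ _).trans (min_le_right _ _)).trans
      (h.profile.le_norm_profDeriv h.b_pos _)
  · rw [Complex.norm_I]; exact min_le_right _ _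

theorem sweepDeriv_ofRealV (hθ : coordProj ℝ S θ ≠ 0) (v : E) :
    sweepDeriv Ξ R R' b t S θ (ofRealV v) = Ξ (endTime t S θ) (tube R b S θ)
      (tubeDeriv R R' b S θ (ofRealV v)) := by
  rw [sweepDeriv, cplx_ofRealV]; rfl

theorem exists_sweepDeriv_eq (hθ : coordProj ℝ S θ ≠ 0) (v : E) : ∃ v',
    sweepDeriv Ξ R R' b t S θ (ofRealV v) = sweepFrame Ξ R R' b t S θ v' := by
  rw [sweepDeriv_ofRealV hθ, tubeDeriv_eq hθ, IsDir.frameOp_real]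
  exact ⟨_, rfl⟩

theorem norm_deriv_rad_le (h : IsChannel S K X DX φ Ξ R R' M c L r₀ r₁ m MR LR b Δ ε t)
    (hθ : coordProj ℝ S θ ≠ 0) (v : E) :
    ‖(exp (-logRad S θ) • innerSL ℝ (dir S θ)) v‖ ≤
      exp (c * |t|) * (1 / min m b + 1) * ‖sweepDeriv Ξ R R' b t S θ (ofRealV v)‖ ∧
    ‖coordProj ℝ Sᶜ v‖ ≤
      exp (c * |t|) * (1 / min m b + 1) * ‖sweepDeriv Ξ R R' b t S θ (ofRealV v)‖ := by
  have hmb := lt_min h.profile.m_pos h.b_pos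
  have he := isDir_dir hθ
  have h1 := h.flow.le_norm_deriv h.ham.tame h.ham.nonneg (abs_cond_le (sideOf S θ) t)
    (tube R b S θ) (tubeDeriv R R' b S θ (ofRealV v))
  rw [sweepDeriv_ofRealV hθ]
  change _ ≤ _ * ‖Ξ (endTime t S θ) (tube R b S θ) (tubeDeriv R R' b S θ (ofRealV v))‖ at h1
  set w := tubeDeriv R R' b S θ (ofRealV v) with hw
  have hexp : 0 < exp (-logRad S θ) := exp_pos _
  have h2 : min m b * ‖(exp (-logRad S θ) • innerSL ℝ (dir S θ)) v‖ ≤ ‖w‖ := by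
    have e1 : inner ℂ (ofRealV (dir S θ)) w = profDeriv R' b (logRad S θ) *
        (exp (-logRad S θ) : ℝ) * ((inner ℝ (dir S θ) v : ℝ) : ℂ) := by
      rw [hw, tubeDeriv, he.inner_frameOp, inner_ofRealV]
    have e2 : ‖inner ℂ (ofRealV (dir S θ)) w‖ ≤ ‖w‖ := by
      refine (norm_inner_le_norm _ _).trans ?_
      rw [LinearIsometry.norm_map, he.norm_eq, one_mul]
    rw [e1, norm_mul, norm_mul, Complex.norm_real, Complex.norm_real] at e2
    refine le_trans ?_ e2
    rw [ContinuousLinearMap.smul_apply, innerSL_apply_apply, norm_smul, ← mul_assoc]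
    gcongr
    exact h.profile.le_norm_profDeriv h.b_pos _
  have h3 : ‖coordProj ℝ Sᶜ v‖ ≤ ‖w‖ := by
    have e1 : coordProj ℂ Sᶜ w = Complex.I • ofRealV (coordProj ℝ Sᶜ v) := by
      rw [hw, tubeDeriv, he.coordProj_compl_frameOp, coordProj_ofRealV]
    have e2 := norm_coordProj_apply_le Sᶜ w
    rwa [e1, norm_smul, Complex.norm_I, one_mul, LinearIsometry.norm_map] at e2
  have hew := exp_pos (c * |t|)
  have h4 : ‖w‖ ≤ exp (c * |t|) * ‖Ξ (endTime t S θ) (tube R b S θ) w‖ := h1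
  set Y := ‖Ξ (endTime t S θ) (tube R b S θ) w‖
  have hY : 0 ≤ Y := norm_nonneg _
  constructor
  · have h5 : ‖(exp (-logRad S θ) • innerSL ℝ (dir S θ)) v‖ ≤ 1 / min m b * ‖w‖ := by
      rw [one_div, inv_mul_eq_div, le_div_iff₀ hmb, mul_comm]; exact h2
    calc _ ≤ 1 / min m b * ‖w‖ := h5
      _ ≤ (1 / min m b + 1) * (exp (c * |t|) * Y) := by gcongr; linarith
      _ = _ := by ring
  · calc _ ≤ 1 * ‖w‖ := by rw [one_mul]; exact h3
      _ ≤ (1 / min m b + 1) * (exp (c * |t|) * Y) := by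
        gcongr
        exact le_add_of_nonneg_left (by positivity)
      _ = _ := by ring

theorem continuousOn_tubeDeriv (h : IsProfile R R' r₀ r₁ m MR LR) :
    ContinuousOn (fun p : ℝ × E => tubeDeriv R R' b S p.2)
      (univ ×ˢ {θ : E | coordProj ℝ S θ ≠ 0}) := by
  have hl : ContinuousOn (logRad S) {θ : E | coordProj ℝ S θ ≠ 0} :=
    fun θ hθ => (continuousAt_logRad hθ).continuousWithinAt
  have hs : ContinuousOn (fun p : ℝ × E => logRad S p.2)
      (univ ×ˢ {θ : E | coordProj ℝ S θ ≠ 0}) :=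
    hl.comp continuous_snd.continuousOn fun p hp => hp.2
  have hexp : ContinuousOn (fun p : ℝ × E => ((exp (-logRad S p.2) : ℝ) : ℂ))
      (univ ×ˢ {θ : E | coordProj ℝ S θ ≠ 0}) :=
    Complex.continuous_ofReal.comp_continuousOn (Real.continuous_exp.comp_continuousOn hs.neg)
  have h1 := (h.continuous_prof (b := b)).comp_continuousOn hs
  have h2 := (h.continuous_profDeriv (b := b)).comp_continuousOn hs
  exact continuousOn_frameOp _ _ _ S (fun p hp => hp.2) (h1.mul hexp) (h2.mul hexp)
    continuousOn_const

theorem continuousOn_sweepDeriv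
    (h : IsChannel S K X DX φ Ξ R R' M c L r₀ r₁ m MR LR b Δ ε t) :
    ContinuousOn (sweepDeriv Ξ R R' b t S) {θ : E | coordProj ℝ S θ ≠ 0} := by
  have h1 : ContinuousOn (fun θ : E => ((1 : ℝ), θ)) {θ : E | coordProj ℝ S θ ≠ 0} := by fun_prop
  have h2 := h.continuousOn_deriv.comp h1 (fun θ hθ => ⟨mem_univ _, hθ⟩)
  have h3 := (continuousOn_tubeDeriv (S := S) (b := b) h.profile).comp h1
    (fun θ hθ => ⟨mem_univ _, hθ⟩)
  refine continuous_cplx.comp_continuousOn (ContinuousOn.clm_comp ?_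
    (continuous_onReal.comp_continuousOn h3))
  refine h2.congr fun θ _ => ?_
  simp only [Function.comp_apply, one_mul]

theorem exists_isCompact_logRad {θ₀ : E} (ρ : ℝ) : ∃ Q ⊆ {θ : E | coordProj ℝ S θ ≠ 0},
    IsCompact Q ∧ ∀ θ, coordProj ℝ S θ ≠ 0 →
      ‖(logRad S θ, coordProj ℝ Sᶜ θ) - (logRad S θ₀, coordProj ℝ Sᶜ θ₀)‖ ≤ ρ → θ ∈ Q := by
  set a₀ := |logRad S θ₀| + |ρ|
  have hsub : {θ : E | exp (-a₀) ≤ ‖coordProj ℝ S θ‖} ⊆ {θ : E | coordProj ℝ S θ ≠ 0} := fun θ hθ h0 => by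
    have : exp (-a₀) ≤ ‖coordProj ℝ S θ‖ := hθ
    rw [h0, norm_zero] at this
    exact absurd this (not_le.2 (exp_pos _))
  set B : ℝ := exp a₀ + (‖coordProj ℝ Sᶜ θ₀‖ + |ρ|)
  refine ⟨Metric.closedBall 0 B ∩ {θ : E | exp (-a₀) ≤ ‖coordProj ℝ S θ‖},
    inter_subset_right.trans hsub, (isCompact_closedBall _ _).inter_right
      (isClosed_le continuous_const (coordProj ℝ S).continuous.norm), fun θ hθ hle => ?_⟩
  have hle1 : ‖logRad S θ - logRad S θ₀‖ ≤ ρ := (le_max_left _ _).trans hle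
  have hle2 : ‖coordProj ℝ Sᶜ θ - coordProj ℝ Sᶜ θ₀‖ ≤ ρ := (le_max_right _ _).trans hle
  have hρ := le_abs_self ρ
  rw [Real.norm_eq_abs] at hle1
  have h5 := abs_le.1 hle1
  have h6 := neg_abs_le (logRad S θ₀)
  have h7 := le_abs_self (logRad S θ₀)
  refine ⟨mem_closedBall_zero_iff.2 ?_, ?_⟩
  · have e := coordProj_add_compl S θ
    calc ‖θ‖ = ‖coordProj ℝ S θ + coordProj ℝ Sᶜ θ‖ := by rw [e]
      _ ≤ ‖coordProj ℝ S θ‖ + ‖coordProj ℝ Sᶜ θ‖ := norm_add_le _ _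
      _ ≤ _ := by
        refine add_le_add ?_ ?_
        · rw [← exp_logRad hθ]
          exact exp_le_exp.2 (by linarith [h5.2])
        · have := norm_sub_norm_le (coordProj ℝ Sᶜ θ) (coordProj ℝ Sᶜ θ₀)
          linarith
  · show exp (-a₀) ≤ ‖coordProj ℝ S θ‖
    rw [← exp_logRad hθ]
    exact exp_le_exp.2 (by linarith [h5.1])

theorem continuousOn_sweepPrim
    (h : IsChannel S K X DX φ Ξ R R' M c L r₀ r₁ m MR LR b Δ ε t) :
    ContinuousOn (sweepPrim K X φ R b t S) {θ : E | coordProj ℝ S θ ≠ 0} := by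
  obtain ⟨C, hC, hC'⟩ := h.exists_sweepPrim_sub_le
  intro θ hθ
  have hWc : ContinuousAt (sweepMap φ R b t S) θ :=
    (h.hasFDerivAt_sweepMap hθ).continuousAt
  rw [ContinuousWithinAt, tendsto_iff_norm_sub_tendsto_zero]
  have h1 : Filter.Tendsto (fun θ' => |sympl (sweepMap φ R b t S θ) (sweepMap φ R b t S θ')| +
      C * ‖sweepMap φ R b t S θ' - sweepMap φ R b t S θ‖ ^ 2) (nhdsWithin θ {θ | coordProj ℝ S θ ≠ 0}) (nhds 0) := by
    have hs : Continuous fun w => sympl (sweepMap φ R b t S θ) w := by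
      unfold sympl; fun_prop
    have h2 : Filter.Tendsto (fun θ' =>
        |sympl (sweepMap φ R b t S θ) (sweepMap φ R b t S θ')| +
        C * ‖sweepMap φ R b t S θ' - sweepMap φ R b t S θ‖ ^ 2) (nhds θ) (nhds
        (|sympl (sweepMap φ R b t S θ) (sweepMap φ R b t S θ)| +
        C * ‖sweepMap φ R b t S θ - sweepMap φ R b t S θ‖ ^ 2)) :=
      ((hs.continuousAt.comp hWc).abs).add
        ((((hWc.tendsto).sub_const _).norm.pow 2).const_mul C)
    rw [sympl_self, sub_self, norm_zero] at h2
    simp only [abs_zero, ne_eq, OfNat.ofNat_ne_zero, not_false_eq_true, zero_pow, mul_zero,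
      add_zero] at h2
    exact h2.mono_left nhdsWithin_le_nhds
  refine squeeze_zero' (Filter.Eventually.of_forall fun _ => norm_nonneg _) ?_ h1
  filter_upwards [self_mem_nhdsWithin] with θ' hθ'
  have h3 := hC' θ θ' hθ hθ'
  rw [Real.norm_eq_abs]
  have h4 := abs_sub_abs_le_abs_sub (sweepPrim K X φ R b t S θ' - sweepPrim K X φ R b t S θ)
    (sympl (sweepMap φ R b t S θ) (sweepMap φ R b t S θ'))
  linarith

theorem norm_sweepMap_apply_le
    (h : IsChannel S K X DX φ Ξ R R' M c L r₀ r₁ m MR LR b Δ ε t) (hθ : coordProj ℝ S θ ≠ 0)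
    {i₀ : κ} (hi₀ : i₀ ∈ S) : ‖sweepMap φ R b t S θ i₀‖ ≤ r₁ + 2 * b + M * |t| := by
  have hM := h.ham.tame.nonneg.1
  have h1 := h.flow.norm_sub_self_le h.ham.tame (endTime t S θ) (tube R b S θ)
  have h2 : |endTime t S θ| ≤ |t| := abs_cond_le _ _
  have h3 : ‖tube R b S θ i₀‖ ≤ r₁ + 2 * b := by
    have e1 : tube R b S θ i₀ = prof R b (logRad S θ) * (dir S θ i₀ : ℂ) := by
      rw [tube, tubePt]
      simp [coordProj_apply, hi₀]
    rw [e1, norm_mul, Complex.norm_real]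
    have h4 := h.profile.norm_prof_le h.b_pos (logRad S θ)
    have h5 := PiLp.norm_apply_le (dir S θ) i₀
    rw [(isDir_dir hθ).norm_eq] at h5
    calc _ ≤ (r₁ + 2 * b) * 1 := by
          refine mul_le_mul h4 h5 (norm_nonneg _) ((norm_nonneg _).trans h4)
      _ = _ := mul_one _
  have h4 := PiLp.norm_apply_le (sweepMap φ R b t S θ - tube R b S θ) i₀
  have h5 : ‖sweepMap φ R b t S θ - tube R b S θ‖ ≤ M * |t| :=
    h1.trans (mul_le_mul_of_nonneg_left h2 hM)
  have h6 := norm_sub_norm_le (sweepMap φ R b t S θ i₀) (tube R b S θ i₀)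
  have e : (sweepMap φ R b t S θ - tube R b S θ) i₀ =
      sweepMap φ R b t S θ i₀ - tube R b S θ i₀ := rfl
  rw [e] at h4
  linarith

theorem false_of_nonempty [DecidableEq κ]
    (h : IsChannel S K X DX φ Ξ R R' M c L r₀ r₁ m MR LR b Δ ε t)
    (hS : S.Nonempty) : False := by
  obtain ⟨i₀, hi₀⟩ := hS
  set U : Set E := {θ | coordProj ℝ S θ ≠ 0} with hU
  have hM := h.ham.tame.nonneg.1
  have hmb := lt_min h.profile.m_pos h.b_pos
  have hθ₀ : EuclideanSpace.single i₀ (1 : ℝ) ∈ U := by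
    intro h0
    have := congrArg (fun v : E => v i₀) h0
    simp [coordProj_apply, hi₀] at this
  obtain ⟨C, hC, hC'⟩ := h.exists_sweepPrim_sub_le
  obtain ⟨C₂, hC₂, hC₂'⟩ := h.exists_sweepFrame_sub_le
  have hWd : ∀ θ ∈ U, HasFDerivAt (sweepMap φ R b t S) (onReal (sweepDeriv Ξ R R' b t S θ)) θ :=
    fun θ hθ => h.hasFDerivAt_sweepMap hθ
  refine no_exact_lagrangian (isOpen_coordProj_ne S) hθ₀ (W := sweepMap φ R b t S)
    (A := sweepDeriv Ξ R R' b t S) (B := fun θ => reflOp (sweepFrame Ξ R R' b t S θ))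
    hWd ?_ (fun Q hQ hQ' => h.exists_list_prod hQ hQ')
    (Φ := fun θ => (logRad S θ, coordProj ℝ Sᶜ θ))
    (Φ' := fun θ => (exp (-logRad S θ) • innerSL ℝ (dir S θ)).prod (coordProj ℝ Sᶜ))
    (CΦ := exp (c * |t|) * (1 / min m b + 1)) (by positivity)
    (fun θ hθ => (hasFDerivAt_logRad hθ).prodMk (coordProj ℝ Sᶜ).hasFDerivAt)
    (fun θ hθ v => ?_) (fun ρ => ?_) (η := sweepPrim K X φ R b t S) ?_ hC
    (fun θ hθ θ' hθ' => hC' θ θ' hθ hθ') zero_le_one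
    (fun θ hθ => (h.isLagrangianFrame_sweepFrame hθ).norm_reflOp_le)
    (L := 4 / (min (min r₀ (min m b)) 1 / 4 * exp (-(c * |t|))) * C₂)
    (fun θ hθ θ' hθ' => ?_) (fun θ hθ v => ?_) i₀ (ρ := r₁ + 2 * b + M * |t|) (fun θ hθ => ?_)
  · exact h.continuousOn_sweepDeriv
  · exact max_le (h.norm_deriv_rad_le hθ v).1 (h.norm_deriv_rad_le hθ v).2
  · exact exists_isCompact_logRad ρ
  · exact h.continuousOn_sweepPrim
  · refine ((h.isLagrangianFrame_sweepFrame hθ).norm_reflOp_sub_le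
      (h.isLagrangianFrame_sweepFrame hθ')).trans ?_
    have h0 := (h.isLagrangianFrame_sweepFrame hθ).pos
    rw [mul_assoc]
    exact mul_le_mul_of_nonneg_left (hC₂' θ θ' hθ hθ') (by positivity)
  · obtain ⟨v', hv'⟩ := exists_sweepDeriv_eq (Ξ := Ξ) (R := R) (R' := R') (b := b) (t := t) hθ v
    rw [hv']
    exact (h.isLagrangianFrame_sweepFrame hθ).reflOp_conjV v'
  · exact h.norm_sweepMap_apply_le hθ hi₀

end IsChannel
end Channel

section Ham
variable {κ : Type*} [Fintype κ]

local notation "V" => EuclideanSpace ℂ κ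
local notation "E" => EuclideanSpace ℝ κ

/-- The vector of integers `n`. -/
def intVec (n : κ → ℤ) : E := WithLp.toLp 2 fun i => (n i : ℝ)

/-- `f` is `1`-periodic in the imaginary directions and vanishes where the real part is large. -/
structure IsCut {F : Type*} [Zero F] (B : ℝ) (f : EuclideanSpace ℂ κ → F) : Prop where
  periodic : ∀ z n, f (z + Complex.I • ofRealV (intVec n)) = f z
  eq_zero : ∀ z, B < ‖reV z‖ → f z = 0

theorem exists_unit_imV (z : V) : ∃ n : κ → ℤ,
    ∀ i, imV (z + Complex.I • ofRealV (intVec n)) i ∈ Icc (0 : ℝ) 1 :=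
  ⟨fun i => -⌊(z i).im⌋, fun i => by
    have h1 := Int.floor_le (z i).im
    have h2 := Int.lt_floor_add_one (z i).im
    simp only [imV_apply, PiLp.add_apply, PiLp.smul_apply, ofRealV_apply, intVec, smul_eq_mul,
      Complex.add_im, Complex.mul_im, Complex.I_re, Complex.I_im, Complex.ofReal_im,
      Complex.ofReal_re, Int.cast_neg, mem_Icc]
    constructor <;> linarith⟩

theorem norm_le_of_forall_mem {v : E} (h : ∀ i, v i ∈ Icc (0 : ℝ) 1) :
    ‖v‖ ≤ √(Fintype.card κ) := by
  rw [EuclideanSpace.norm_eq]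
  refine sqrt_le_sqrt ((Finset.sum_le_sum fun i _ => ?_).trans_eq (by simp : ∑ _ : κ, (1 : ℝ) = _))
  rw [Real.norm_eq_abs, sq_abs]
  exact pow_le_one₀ (h i).1 (h i).2

theorem norm_le_norm_reV_add (z : V) : ‖z‖ ≤ ‖reV z‖ + ‖imV z‖ := by
  have e : z = ofRealV (reV z) + Complex.I • ofRealV (imV z) := by
    ext i
    simp only [PiLp.add_apply, PiLp.smul_apply, ofRealV_apply, reV_apply, imV_apply, smul_eq_mul]
    rw [mul_comm]; exact (Complex.re_add_im (z i)).symm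
  calc ‖z‖ = _ := congrArg norm e
    _ ≤ _ := norm_add_le _ _
    _ = _ := by rw [norm_smul, Complex.norm_I, one_mul, LinearIsometry.norm_map, LinearIsometry.norm_map]

namespace IsCut
variable {F : Type*} [NormedAddCommGroup F] [NormedSpace ℝ F] {B : ℝ}
  {f : EuclideanSpace ℂ κ → F}

theorem exists_norm_le (h : IsCut B f) (hf : Continuous f) : ∃ M, ∀ z, ‖f z‖ ≤ M := by
  obtain ⟨M, hM⟩ := (isCompact_closedBall (0 : V) (B + √(Fintype.card κ))).exists_bound_of_continuousOn
    hf.continuousOn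
  refine ⟨max M 0, fun z => ?_⟩
  rcases le_or_gt ‖reV z‖ B with hz | hz
  · obtain ⟨n, hn⟩ := exists_unit_imV z
    rw [← h.periodic z n]
    refine (hM _ (mem_closedBall_zero_iff.2 ?_)).trans (le_max_left _ _)
    refine (norm_le_norm_reV_add _).trans (add_le_add ?_ (norm_le_of_forall_mem hn))
    rwa [map_add, reV_smul, imV_ofRealV, Complex.I_re, zero_smul, smul_zero, sub_zero, add_zero]
  · rw [h.eq_zero z hz, norm_zero]; exact le_max_right _ _

theorem fderiv_cut (h : IsCut B f) : IsCut B (fderiv ℝ f) where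
  periodic z n := by
    rw [← fderiv_comp_add_right]
    congr 1
    exact funext fun z => h.periodic z n
  eq_zero z hz := by
    have : f =ᶠ[nhds z] fun _ => 0 :=
      Filter.mem_of_superset ((isOpen_lt continuous_const reV.continuous.norm).mem_nhds hz) h.eq_zero
    rw [this.fderiv_eq]; simp

end IsCut

variable [DecidableEq κ]

/-- The vector representing a linear form with respect to `sympl`. -/
def hamOp : (V →L[ℝ] ℝ) →L[ℝ] V :=
  LinearMap.toContinuousLinearMap
    { toFun := fun ℓ => WithLp.toLp 2 fun i => ⟨-ℓ (Complex.I • EuclideanSpace.single i 1),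
        ℓ (EuclideanSpace.single i 1)⟩
      map_add' := fun ℓ ℓ' => by ext i; apply Complex.ext <;> simp [add_comm]
      map_smul' := fun a ℓ => by ext i; apply Complex.ext <;> simp }

theorem sympl_hamOp (ℓ : V →L[ℝ] ℝ) (v : V) : sympl v (hamOp ℓ) = ℓ v := by
  have e : v = ∑ i, ((v i).re • EuclideanSpace.single i (1 : ℂ) +
      (v i).im • (Complex.I • EuclideanSpace.single i (1 : ℂ))) := by
    ext j
    simp only [WithLp.ofLp_sum, Finset.sum_apply, PiLp.add_apply, PiLp.smul_apply,
      PiLp.single_apply, smul_eq_mul]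
    rw [Finset.sum_eq_single j (fun i _ hi => by simp [hi.symm]) (by simp)]
    simp [Complex.re_add_im]
  conv_rhs => rw [e]
  simp only [map_sum, map_add, map_smul, smul_eq_mul, sympl, hamOp, PiLp.inner_apply, Complex.im_sum,
    RCLike.inner_apply, Complex.mul_im, LinearMap.coe_toContinuousLinearMap', LinearMap.coe_mk,
    AddHom.coe_mk, Complex.conj_im, Complex.conj_re]
  exact Finset.sum_congr rfl fun i _ => by ring

/-- The Hamiltonian vector field of `K`. -/
def hamField (K : V → ℝ) (z : V) : V := hamOp (fderiv ℝ K z)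

theorem contDiff_hamField {K : V → ℝ} (hK : ContDiff ℝ (⊤ : ℕ∞) K) :
    ContDiff ℝ (⊤ : ℕ∞) (hamField K) :=
  (hamOp (κ := κ)).contDiff.comp (hK.fderiv_right (m := (⊤ : ℕ∞)) (by simp))

theorem IsCut.hamField {B : ℝ} {K : EuclideanSpace ℂ κ → ℝ} (h : IsCut B K) :
    IsCut B (hamField K) :=
  ⟨fun z n => by rw [_root_.hamField, h.fderiv_cut.periodic, _root_.hamField],
    fun z hz => by rw [_root_.hamField, h.fderiv_cut.eq_zero z hz, map_zero]⟩

theorem IsCut.exists_isTameHamiltonian {B : ℝ} {K : EuclideanSpace ℂ κ → ℝ} (h : IsCut B K)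
    (hK : ContDiff ℝ (⊤ : ℕ∞) K) : ∃ DX M c L, IsTameHamiltonian K (_root_.hamField K) DX M c L := by
  have hX := contDiff_hamField hK
  have hD := hX.fderiv_right (m := (⊤ : ℕ∞)) (by simp)
  have hXc := h.hamField
  obtain ⟨M₁, h₁⟩ := h.exists_norm_le hK.continuous
  obtain ⟨M₂, h₂⟩ := hXc.exists_norm_le hX.continuous
  obtain ⟨c, hc⟩ := hXc.fderiv_cut.exists_norm_le hD.continuous
  obtain ⟨L, hL⟩ := hXc.fderiv_cut.fderiv_cut.exists_norm_le
    (hD.fderiv_right (m := (⊤ : ℕ∞)) (by simp)).continuous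
  have hK' := hK.fderiv_right (m := (⊤ : ℕ∞)) (by simp)
  have hdf : Differentiable ℝ (fderiv ℝ K) := hK'.differentiable (by simp)
  have e : ∀ z v, fderiv ℝ (_root_.hamField K) z v = hamOp (fderiv ℝ (fderiv ℝ K) z v) := fun z v => by
    have := (hamOp.hasFDerivAt.comp z (hdf z).hasFDerivAt).fderiv
    rw [show _root_.hamField K = hamOp ∘ fderiv ℝ K from rfl, this]; rfl
  refine ⟨fderiv ℝ (_root_.hamField K), max M₁ M₂, c, L, ⟨fun x => (hX.differentiable (by simp) x).hasFDerivAt,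
    hD.of_le (by exact_mod_cast le_top), fun x => (h₂ x).trans (le_max_right _ _), hc, fun x y => ?_⟩,
    (norm_nonneg _).trans (hL 0), fun x => (h₁ x).trans (le_max_left _ _),
    hK.differentiable (by simp), fun x v => (sympl_hamOp _ _).symm, fun x u v => ?_⟩
  · exact convex_univ.norm_image_sub_le_of_norm_fderiv_le
      (fun x _ => hD.differentiable (by simp) x) (fun x _ => hL x) (mem_univ y) (mem_univ x)
  · rw [e, e, sympl_hamOp, sympl_hamOp]
    exact (hK.contDiffAt.isSymmSndFDerivAt (by
      rw [minSmoothness_of_isRCLikeNormedField]; exact WithTop.coe_le_coe.2 le_top)) v u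

end Ham

/-- Solutions of `X n`, a field agreeing with `Y` on large balls, converge to solutions of `Y`. -/
theorem tendsto_of_hasDerivAt {F : Type*} [NormedAddCommGroup F] [NormedSpace ℝ F]
    [FiniteDimensional ℝ F] {Y : F → F} {X : ℕ → F → F} (hY : ContDiff ℝ 1 Y)
    (hX : ∀ n : ℕ, ∀ z, ‖z‖ ≤ n → X n z = Y z) {c : ℕ → ℝ → F} {γ : ℝ → F}
    (hc : ∀ n s, HasDerivAt (c n) (X n (c n s)) s) (hγ : ∀ s, HasDerivAt γ (Y (γ s)) s)
    (h0 : Filter.Tendsto (fun n => c n 0) Filter.atTop (nhds (γ 0))) {t : ℕ → ℝ} {T : ℝ}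
    (ht : Filter.Tendsto t Filter.atTop (nhds T)) (ht0 : ∀ n, 0 ≤ t n) :
    Filter.Tendsto (fun n => c n (t n)) Filter.atTop (nhds (γ T)) := by
  have hγc : Continuous γ := continuous_iff_continuousAt.2 fun s => (hγ s).continuousAt
  have hcc : ∀ n, Continuous (c n) :=
    fun n => continuous_iff_continuousAt.2 fun s => (hc n s).continuousAt
  obtain ⟨B, hB⟩ := (isCompact_Icc (a := (0 : ℝ)) (b := T + 1)).exists_bound_of_continuousOn
    hγc.continuousOn
  have := FiniteDimensional.proper_real F
  obtain ⟨k, hk⟩ := hY.contDiffOn.exists_lipschitzOnWith (by simp) (convex_closedBall (0 : F) (B + 1))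
    (isCompact_closedBall _ _)
  have hs : Filter.Tendsto (fun n => dist (c n 0) (γ 0) * exp (k * (T + 1))) Filter.atTop (nhds 0) := by
    simpa using (tendsto_iff_dist_tendsto_zero.1 h0).mul_const (exp (k * (T + 1)))
  have key : ∀ᶠ n in Filter.atTop,
      dist (c n (t n)) (γ (t n)) ≤ dist (c n 0) (γ 0) * exp (k * (T + 1)) := by
    filter_upwards [hs.eventually_lt_const one_pos, Filter.eventually_ge_atTop ⌈B + 1⌉₊,
      ht.eventually_le_const (lt_add_one T)] with n hn hnB hT
    have hle : ∀ σ ∈ Icc 0 (T + 1), (∀ s ∈ Ico 0 σ, dist (c n s) (γ s) ≤ 1) →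
        dist (c n σ) (γ σ) ≤ dist (c n 0) (γ 0) * exp (k * (T + 1)) := by
      intro σ hσ hσ'
      have hg : ∀ s ∈ Ico 0 σ, γ s ∈ Metric.closedBall (0 : F) (B + 1) := fun s hs =>
        mem_closedBall_zero_iff.2 (by linarith [hB s ⟨hs.1, hs.2.le.trans hσ.2⟩])
      have hf : ∀ s ∈ Ico 0 σ, c n s ∈ Metric.closedBall (0 : F) (B + 1) := fun s hs => by
        have h1 := hσ' s hs
        rw [dist_eq_norm] at h1
        have h2 := norm_sub_norm_le (c n s) (γ s)
        exact mem_closedBall_zero_iff.2 (by linarith [hB s ⟨hs.1, hs.2.le.trans hσ.2⟩])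
      refine (dist_le_of_trajectories_ODE_of_mem (v := fun _ => Y) (fun _ _ => hk)
        (hcc n).continuousOn (fun s hs => ?_) hf hγc.continuousOn
        (fun s _ => (hγ s).hasDerivWithinAt) hg le_rfl σ ⟨hσ.1, le_rfl⟩).trans ?_
      · rw [← hX n _ ((mem_closedBall_zero_iff.1 (hf s hs)).trans (Nat.ceil_le.1 hnB))]
        exact (hc n s).hasDerivWithinAt
      · have := hσ.2
        rw [sub_zero]
        gcongr
    have hlt : ∀ σ ∈ Icc 0 (T + 1), dist (c n σ) (γ σ) < 1 := by
      by_contra! hcon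
      have hcl : IsCompact {σ ∈ Icc 0 (T + 1) | 1 ≤ dist (c n σ) (γ σ)} :=
        isCompact_Icc.inter_right (isClosed_le continuous_const ((hcc n).dist hγc))
      obtain ⟨σ, hσ, hmin⟩ := hcl.exists_isLeast hcon
      refine (hle σ hσ.1 fun s hs => ?_).not_gt (hn.trans_le hσ.2)
      by_contra! h
      exact (hmin ⟨⟨hs.1, hs.2.le.trans hσ.1.2⟩, h.le⟩).not_gt hs.2
    exact hle _ ⟨ht0 n, hT⟩ fun s hs => (hlt s ⟨hs.1, hs.2.le.trans hT⟩).le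
  have h1 : Filter.Tendsto (fun n => dist (c n (t n)) (γ (t n))) Filter.atTop (nhds 0) :=
    squeeze_zero' (Filter.Eventually.of_forall fun _ => dist_nonneg) key hs
  have h2 : Filter.Tendsto (fun n => dist (γ (t n)) (γ T)) Filter.atTop (nhds 0) :=
    tendsto_iff_dist_tendsto_zero.1 ((hγc.tendsto T).comp ht)
  refine tendsto_iff_dist_tendsto_zero.2 (squeeze_zero (fun _ => dist_nonneg)
    (fun n => dist_triangle _ (γ (t n)) _) ?_)
  simpa using h1.add h2

/-- A smooth step of slope in `[0, 1]`, constant near the complement of an interval. -/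
theorem exists_step {a b η : ℝ} (hη : 0 < η) (hab : a + 4 * η < b) : ∃ (χ χ' : ℝ → ℝ) (Δ : ℝ),
    ContDiff ℝ (⊤ : ℕ∞) χ ∧ (∀ x, HasDerivAt χ (χ' x) x) ∧ (∀ x, χ' x ∈ Icc 0 1) ∧
    (∀ x, χ' x ≠ 0 → x ∈ Icc (a + η) (b - η)) ∧ (∀ x ≤ a + η, χ x = 0) ∧ (∀ x, b - η ≤ x → χ x = Δ) ∧
    b - a - 4 * η ≤ Δ := by
  set ψ : ℝ → ℝ := fun x =>
    smoothTransition ((x - a - η) / η) * smoothTransition ((b - η - x) / η) with hψ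
  have hψs : ContDiff ℝ (⊤ : ℕ∞) ψ :=
    (smoothTransition.contDiff.comp (by fun_prop)).mul (smoothTransition.contDiff.comp (by fun_prop))
  have hi : ∀ x y, IntervalIntegrable ψ volume x y := fun x y => hψs.continuous.intervalIntegrable _ _
  have hd : ∀ x, HasDerivAt (fun x => ∫ s in a + η..x, ψ s) (ψ x) x := fun x =>
    intervalIntegral.integral_hasDerivAt_right (hi _ _)
      (hψs.continuous.stronglyMeasurableAtFilter _ _) hψs.continuous.continuousAt
  have h0 : ∀ x ≤ a + η, ψ x = 0 := fun x hx => by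
    rw [hψ]
    simp only
    rw [smoothTransition.zero_of_nonpos (div_nonpos_of_nonpos_of_nonneg (by linarith) hη.le), zero_mul]
  have h1 : ∀ x, b - η ≤ x → ψ x = 0 := fun x hx => by
    rw [hψ]
    simp only
    rw [smoothTransition.zero_of_nonpos (x := (b - η - x) / η)
      (div_nonpos_of_nonpos_of_nonneg (by linarith) hη.le), mul_zero]
  have hnn : ∀ x, 0 ≤ ψ x := fun x => mul_nonneg (smoothTransition.nonneg _) (smoothTransition.nonneg _)
  refine ⟨fun x => ∫ s in a + η..x, ψ s, ψ, ∫ s in a + η..b - η, ψ s,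
    contDiff_infty_iff_deriv.2 ⟨fun x => (hd x).differentiableAt, ?_⟩, hd,
    fun x => ⟨hnn x, mul_le_one₀ (smoothTransition.le_one _) (smoothTransition.nonneg _)
      (smoothTransition.le_one _)⟩, fun x hx => ⟨?_, ?_⟩, fun x hx => ?_, fun x hx => ?_, ?_⟩
  · rwa [funext fun x => (hd x).deriv]
  · by_contra! h
    exact hx (h0 x h.le)
  · by_contra! h
    exact hx (h1 x h.le)
  · simp only
    rw [intervalIntegral.integral_congr (g := fun _ => (0 : ℝ)) fun s hs => h0 s ?_,
      intervalIntegral.integral_zero]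
    rw [uIcc_of_ge hx] at hs
    exact hs.2
  · simp only
    rw [← intervalIntegral.integral_add_adjacent_intervals (hi _ (b - η)) (hi _ _),
      intervalIntegral.integral_congr (a := b - η) (g := fun _ => (0 : ℝ)) fun s hs => h1 s ?_,
      intervalIntegral.integral_zero, add_zero]
    rw [uIcc_of_le hx] at hs
    exact hs.1
  · have h2 : ∫ _ in a + 2 * η..b - 2 * η, (1 : ℝ) = ∫ s in a + 2 * η..b - 2 * η, ψ s := by
      refine intervalIntegral.integral_congr fun s hs => ?_
      rw [uIcc_of_le (by linarith)] at hs
      simp only [hψ]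
      rw [smoothTransition.one_of_one_le, smoothTransition.one_of_one_le, one_mul]
      · rw [le_div_iff₀ hη]; linarith [hs.2]
      · rw [le_div_iff₀ hη]; linarith [hs.1]
    rw [intervalIntegral.integral_const, smul_eq_mul, mul_one] at h2
    have h3 := intervalIntegral.integral_mono_interval (f := ψ) (a := a + 2 * η) (b := b - 2 * η)
      (c := a + η) (d := b - η) (μ := volume) (by linarith) (by linarith) (by linarith)
      (Filter.Eventually.of_forall hnn) (hi _ _)
    linarith

/-- The profile `(R₀ + R₁) / 2 + (R₁ - R₀) / π * arctan (n u)`. -/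
def arctanProfile (R₀ R₁ n u : ℝ) : ℝ := (R₀ + R₁) / 2 + (R₁ - R₀) / π * arctan (n * u)

section Profile
variable {R₀ R₁ n b : ℝ}

theorem arctanProfile_mem (hR : R₀ < R₁) (n u : ℝ) : arctanProfile R₀ R₁ n u ∈ Icc R₀ R₁ := by
  have h1 := arctan_lt_pi_div_two (n * u)
  have h2 := neg_pi_div_two_lt_arctan (n * u)
  have h3 : 0 < (R₁ - R₀) / π := div_pos (sub_pos.2 hR) pi_pos
  have h4 : (R₁ - R₀) / π * (π / 2) = (R₁ - R₀) / 2 := by field_simp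
  have h5 := mul_le_mul_of_nonneg_left h1.le h3.le
  have h6 := mul_le_mul_of_nonneg_left h2.le h3.le
  rw [mul_neg] at h6
  unfold arctanProfile
  constructor <;> linarith

theorem isProfile_arctanProfile (h₀ : 0 < R₀) (hR : R₀ < R₁) (hn : 0 < n) :
    ∃ R' m M L, IsProfile (arctanProfile R₀ R₁ n) R' R₀ R₁ m M L := by
  set a := (R₁ - R₀) / π with ha
  have ha0 : 0 < a := div_pos (sub_pos.2 hR) pi_pos
  have hpos : ∀ u : ℝ, 0 < 1 + (n * u) ^ 2 := fun u => by positivity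
  refine ⟨fun u => a * (1 / (1 + (n * u) ^ 2) * n), a * (1 / (1 + n ^ 2) * n), a * n,
    a * n * (2 * n), fun u => ?_, h₀, arctanProfile_mem hR n, by positivity, fun u hu => ?_,
    fun u => ?_, fun u v => ?_⟩
  · exact ((((hasDerivAt_id u).const_mul n).congr_deriv (mul_one n)).arctan.const_mul a).const_add _
  · have h1 : u ^ 2 ≤ 1 := by nlinarith [hu.1, hu.2]
    have h2 : (n * u) ^ 2 ≤ n ^ 2 := by rw [mul_pow]; nlinarith [sq_nonneg n]
    gcongr
  · rw [abs_of_nonneg (by have := hpos u; positivity)]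
    have h1 : 1 / (1 + (n * u) ^ 2) ≤ 1 := by
      rw [div_le_one (hpos u)]; nlinarith [sq_nonneg (n * u)]
    calc _ ≤ a * (1 * n) := by gcongr
      _ = _ := by rw [one_mul]
  · have hx := hpos u
    have hy := hpos v
    have e : a * (1 / (1 + (n * u) ^ 2) * n) - a * (1 / (1 + (n * v) ^ 2) * n) =
        a * n * ((n * (v - u)) * ((n * v + n * u) / ((1 + (n * u) ^ 2) * (1 + (n * v) ^ 2)))) := by
      field_simp
      ring
    have h1 : |(n * v + n * u) / ((1 + (n * u) ^ 2) * (1 + (n * v) ^ 2))| ≤ 2 := by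
      rw [abs_div, abs_of_pos (mul_pos hx hy), div_le_iff₀ (mul_pos hx hy)]
      have h3 : ∀ x : ℝ, |x| ≤ 1 + x ^ 2 := fun x => by
        rw [← sq_abs]; nlinarith [sq_nonneg (|x| - 1), abs_nonneg x]
      have h4 := abs_add_le (n * v) (n * u)
      have h5 := h3 (n * u)
      have h6 := h3 (n * v)
      nlinarith [mul_nonneg (sq_nonneg (n * u)) (sq_nonneg (n * v))]
    rw [e, abs_mul (a * n), abs_mul (n * (v - u)), abs_mul n, abs_of_pos (mul_pos ha0 hn), abs_of_pos hn, abs_sub_comm v]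
    calc _ ≤ a * n * (n * |u - v| * 2) := by gcongr
      _ = _ := by ring

theorem integral_abs_cos : ∫ s in (0 : ℝ)..2 * π, |cos s| = 4 := by
  have hi : ∀ x y : ℝ, IntervalIntegrable (fun s => |cos s|) volume x y := fun x y =>
    continuous_cos.abs.intervalIntegrable _ _
  have hp : Function.Periodic (fun s : ℝ => |cos s|) π := fun s => by simp [cos_add_pi]
  have h1 : ∫ s in -(π / 2)..-(π / 2) + π, |cos s| = 2 := by
    rw [show -(π / 2) + π = π / 2 by ring, intervalIntegral.integral_congr (g := cos) fun s hs => ?_,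
      integral_cos, sin_neg, sin_pi_div_two]
    · norm_num
    · rw [uIcc_of_le (by linarith [pi_pos])] at hs
      exact abs_of_nonneg (cos_nonneg_of_mem_Icc hs)
  have h2 := hp.intervalIntegral_add_eq 0 (-(π / 2))
  have h3 := hp.intervalIntegral_add_eq π (-(π / 2))
  rw [← intervalIntegral.integral_add_adjacent_intervals (hi 0 π) (hi _ _)]
  rw [zero_add] at h2
  rw [show 2 * π = π + π by ring, h2, h3, h1]
  norm_num

theorem areaFun_arctanProfile_mem (hR : R₀ < R₁) (hn : 0 < n) (hb : 0 < b) :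
    areaFun (arctanProfile R₀ R₁ n) b (2 * π) ∈ Icc 0 ((R₁ - R₀) * (2 * b)) := by
  have hc : Continuous (fun s => arctanProfile R₀ R₁ n (cos s) * (b * cos s)) := by
    unfold arctanProfile
    have := continuous_arctan
    fun_prop
  have hc₂ : Continuous fun s => (R₀ + R₁) / 2 * b * cos s := continuous_const.mul continuous_cos
  have e : areaFun (arctanProfile R₀ R₁ n) b (2 * π) = ∫ s in (0 : ℝ)..2 * π,
      (arctanProfile R₀ R₁ n (cos s) * (b * cos s) - (R₀ + R₁) / 2 * b * cos s) := by
    rw [intervalIntegral.integral_sub (hc.intervalIntegrable _ _) (hc₂.intervalIntegrable _ _),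
      intervalIntegral.integral_const_mul, integral_cos]
    simp [areaFun]
  have h3 : 0 < (R₁ - R₀) / π := div_pos (sub_pos.2 hR) pi_pos
  have hbd : ∀ s, arctanProfile R₀ R₁ n (cos s) * (b * cos s) - (R₀ + R₁) / 2 * b * cos s ∈
      Icc 0 ((R₁ - R₀) / 2 * b * |cos s|) := fun s => by
    have e1 : arctanProfile R₀ R₁ n (cos s) * (b * cos s) - (R₀ + R₁) / 2 * b * cos s =
        (R₁ - R₀) / π * b * (arctan (n * cos s) * cos s) := by unfold arctanProfile; ring
    have h4 : (R₁ - R₀) / π * b * (π / 2 * |cos s|) = (R₁ - R₀) / 2 * b * |cos s| := by field_simp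
    have h5 : 0 ≤ arctan (n * cos s) * cos s := by
      rcases le_total 0 (cos s) with h | h
      · exact mul_nonneg (arctan_nonneg.2 (by positivity)) h
      · exact mul_nonneg_of_nonpos_of_nonpos
          (arctan_le_zero.2 (mul_nonpos_of_nonneg_of_nonpos hn.le h)) h
    rw [e1, ← h4]
    refine ⟨by positivity, mul_le_mul_of_nonneg_left ?_ (by positivity)⟩
    rw [← abs_of_nonneg h5, abs_mul]
    exact mul_le_mul_of_nonneg_right (abs_le.2 ⟨(neg_pi_div_two_lt_arctan _).le,
      (arctan_lt_pi_div_two _).le⟩) (abs_nonneg _)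
  rw [e]
  refine ⟨intervalIntegral.integral_nonneg (by positivity) fun s _ => (hbd s).1, ?_⟩
  calc _ ≤ ∫ s in (0 : ℝ)..2 * π, (R₁ - R₀) / 2 * b * |cos s| :=
        intervalIntegral.integral_mono_on (by positivity) ((hc.sub hc₂).intervalIntegrable _ _)
          ((continuous_const.mul continuous_cos.abs).intervalIntegrable _ _) fun s _ => (hbd s).2
    _ = _ := by rw [intervalIntegral.integral_const_mul, integral_abs_cos]; ring

theorem tendsto_arctanProfile {u ν : ℕ → ℝ} {u₀ : ℝ} (hu : Filter.Tendsto u Filter.atTop (nhds u₀))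
    (hν : Filter.Tendsto ν Filter.atTop Filter.atTop) :
    (u₀ < 0 → Filter.Tendsto (fun n => arctanProfile R₀ R₁ (ν n) (u n)) Filter.atTop (nhds R₀)) ∧
    (0 < u₀ → Filter.Tendsto (fun n => arctanProfile R₀ R₁ (ν n) (u n)) Filter.atTop (nhds R₁)) := by
  have hpi := pi_ne_zero
  constructor <;> intro h
  · have h1 := (tendsto_arctan_atBot.mono_right nhdsWithin_le_nhds).comp (hν.atTop_mul_neg h hu)
    have h2 := (h1.const_mul ((R₁ - R₀) / π)).const_add ((R₀ + R₁) / 2)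
    rwa [show (R₀ + R₁) / 2 + (R₁ - R₀) / π * -(π / 2) = R₀ by field_simp; ring] at h2
  · have h1 := (tendsto_arctan_atTop.mono_right nhdsWithin_le_nhds).comp (hν.atTop_mul_pos h hu)
    have h2 := (h1.const_mul ((R₁ - R₀) / π)).const_add ((R₀ + R₁) / 2)
    rwa [show (R₀ + R₁) / 2 + (R₁ - R₀) / π * (π / 2) = R₁ by field_simp; ring] at h2

end Profile

section Tetragon
variable {κ : Type*} [Fintype κ]

local notation "V" => EuclideanSpace ℂ κ
local notation "E" => EuclideanSpace ℝ κ

/-- The point `(ρ + i x) e + i y`. -/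
def boxPt (p : ℝ × ℝ × E × E) : V :=
  ((p.1 : ℂ) + (p.2.1 : ℂ) * Complex.I) • ofRealV p.2.2.1 + Complex.I • ofRealV p.2.2.2

theorem continuous_boxPt : Continuous (boxPt : ℝ × ℝ × E × E → V) := by
  have := (ofRealV (κ := κ)).continuous
  unfold boxPt
  fun_prop

theorem reV_boxPt (p : ℝ × ℝ × E × E) : reV (boxPt p) = p.1 • p.2.2.1 := by
  simp [boxPt, reV_smul]

theorem imV_boxPt (p : ℝ × ℝ × E × E) : imV (boxPt p) = p.2.1 • p.2.2.1 + p.2.2.2 := by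
  simp [boxPt, imV_smul]

/-- The parameters of the region swept by the tetragon. -/
def boxDom (S : Set κ) (R₀ R₁ r : ℝ) : Set (ℝ × ℝ × E × E) :=
  Icc R₀ R₁ ×ˢ Icc 0 r ×ˢ {e | IsDir S e} ×ˢ {y | coordProj ℝ S y = 0}

theorem isClosed_boxDom (S : Set κ) (R₀ R₁ r : ℝ) : IsClosed (boxDom S R₀ R₁ r) :=
  isClosed_Icc.prod (isClosed_Icc.prod ((IsChannel.isCompact_isDir S).isClosed.prod
    (isClosed_eq (coordProj ℝ S).continuous continuous_const)))

theorem norm_reV_boxPt {S : Set κ} {R₀ R₁ r : ℝ} (h₀ : 0 < R₀) {p : ℝ × ℝ × E × E}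
    (hp : p ∈ boxDom S R₀ R₁ r) : ‖reV (boxPt p)‖ = p.1 := by
  rw [reV_boxPt, norm_smul, hp.2.2.1.norm_eq, mul_one, Real.norm_eq_abs,
    abs_of_pos (h₀.trans_le hp.1.1)]

/-- Chords between bounded parameters subconverge. -/
theorem exists_limit_chord {S : Set κ} {R₀ R₁ r T : ℝ} {Y : V → V} {X : ℕ → V → V}
    (hY : ContDiff ℝ 1 Y) (hX : ∀ n : ℕ, ∀ z, ‖z‖ ≤ n → X n z = Y z) {Γ : V → ℝ → V}
    (hΓ₀ : ∀ z, Γ z 0 = z) (hΓ : ∀ z s, HasDerivAt (Γ z) (Y (Γ z s)) s) {c : ℕ → ℝ → V}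
    (hc : ∀ n s, HasDerivAt (c n) (X n (c n s)) s) {p q : ℕ → ℝ × ℝ × E × E} {t : ℕ → ℝ}
    (ht : ∀ n, t n ∈ Icc 0 T) (hp : ∀ n, p n ∈ boxDom S R₀ R₁ r)
    (hp' : ∀ n i, (p n).2.2.2 i ∈ Icc (0 : ℝ) 1) (hq : ∀ n, q n ∈ boxDom S R₀ R₁ r)
    (hcp : ∀ n, c n 0 = boxPt (p n)) (hcq : ∀ n, c n (t n) = boxPt (q n)) :
    ∃ (ψ : ℕ → ℕ) (p₀ q₀ : ℝ × ℝ × E × E) (t₀ : ℝ), StrictMono ψ ∧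
      Filter.Tendsto (p ∘ ψ) Filter.atTop (nhds p₀) ∧ Filter.Tendsto (q ∘ ψ) Filter.atTop (nhds q₀) ∧
      Filter.Tendsto (t ∘ ψ) Filter.atTop (nhds t₀) ∧ p₀ ∈ boxDom S R₀ R₁ r ∧
      q₀ ∈ boxDom S R₀ R₁ r ∧ Γ (boxPt p₀) t₀ = boxPt q₀ := by
  have hcomp : IsCompact ((Icc R₀ R₁ ×ˢ Icc 0 r ×ˢ {e : E | IsDir S e} ×ˢ
      Metric.closedBall (0 : E) (√(Fintype.card κ))) ×ˢ Icc 0 T ×ˢ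
      (Icc R₀ R₁ ×ˢ Icc 0 r ×ˢ {e : E | IsDir S e})) :=
    (isCompact_Icc.prod (isCompact_Icc.prod ((IsChannel.isCompact_isDir S).prod
      (isCompact_closedBall _ _)))).prod (isCompact_Icc.prod (isCompact_Icc.prod
      (isCompact_Icc.prod (IsChannel.isCompact_isDir S))))
  obtain ⟨⟨p₀, t₀, ρ, x, e⟩, -, ψ, hψ, hlim⟩ := hcomp.tendsto_subseq
    (x := fun n => (p n, t n, (q n).1, (q n).2.1, (q n).2.2.1)) fun n =>
      ⟨⟨(hp n).1, (hp n).2.1, (hp n).2.2.1, mem_closedBall_zero_iff.2 (norm_le_of_forall_mem (hp' n))⟩,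
        ht n, (hq n).1, (hq n).2.1, (hq n).2.2.1⟩
  obtain ⟨hlp, hlim⟩ := (Prod.tendsto_iff _ _).1 hlim
  obtain ⟨hlt, hlim⟩ := (Prod.tendsto_iff _ _).1 hlim
  obtain ⟨hlρ, hlim⟩ := (Prod.tendsto_iff _ _).1 hlim
  obtain ⟨hlx, hle⟩ := (Prod.tendsto_iff _ _).1 hlim
  have hlc : Filter.Tendsto (fun n => boxPt (q (ψ n))) Filter.atTop (nhds (Γ (boxPt p₀) t₀)) := by
    have := tendsto_of_hasDerivAt hY
      (fun n z hz => hX (ψ n) z (hz.trans (Nat.cast_le.2 (hψ.id_le n)))) (fun n => hc (ψ n))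
      (hΓ (boxPt p₀)) (t := t ∘ ψ) (T := t₀) ?_ hlt fun n => (ht _).1
    · simpa only [Function.comp_apply, hcq] using this
    · simp only [hcp, hΓ₀]
      exact (continuous_boxPt.tendsto p₀).comp hlp
  have hly : Filter.Tendsto (fun n => (q (ψ n)).2.2.2) Filter.atTop
      (nhds (imV (Γ (boxPt p₀) t₀) - x • e)) := by
    have h1 := ((imV.continuous.tendsto _).comp hlc).sub (hlx.smul hle)
    refine h1.congr fun n => ?_
    simp only [Function.comp_apply, imV_boxPt, add_sub_cancel_left]
  have hlq : Filter.Tendsto (q ∘ ψ) Filter.atTop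
      (nhds (ρ, x, e, imV (Γ (boxPt p₀) t₀) - x • e)) :=
    hlρ.prodMk_nhds (hlx.prodMk_nhds (hle.prodMk_nhds hly))
  exact ⟨ψ, p₀, _, t₀, hψ, hlp, hlq, hlt,
    (isClosed_boxDom S R₀ R₁ r).mem_of_tendsto hlp (Filter.Eventually.of_forall fun n => hp _),
    (isClosed_boxDom S R₀ R₁ r).mem_of_tendsto hlq (Filter.Eventually.of_forall fun n => hq _),
    tendsto_nhds_unique hlc ((continuous_boxPt.tendsto _).comp hlq)⟩

variable [DecidableEq κ]

/-- An autonomous periodic Hamiltonian separating the walls of the tetragon. -/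
structure IsTetragon (S : Set κ) (G : EuclideanSpace ℂ κ → ℝ) (R₀ R₁ b α β : ℝ) : Prop where
  contDiff : ContDiff ℝ (⊤ : ℕ∞) G
  periodic : ∀ z n, G (z + Complex.I • ofRealV (intVec n)) = G z
  pos : 0 < R₀
  lt : R₀ < R₁
  b_pos : 0 < b
  nonempty : S.Nonempty
  le_high : ∀ p ∈ boxDom S R₀ R₁ (2 * b), p.2.1 = 0 → β ≤ G (boxPt p)
  low_le : ∀ p ∈ boxDom S R₀ R₁ (2 * b), p.2.1 = 2 * b → G (boxPt p) ≤ α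
  gap : α < β

theorem exists_cut {f : V → ℝ} (hf : ContDiff ℝ (⊤ : ℕ∞) f)
    (hper : ∀ z n, f (z + Complex.I • ofRealV (intVec n)) = f z) {B : ℝ} (hB : 0 < B) :
    ∃ K : V → ℝ, ContDiff ℝ (⊤ : ℕ∞) K ∧ IsCut (B + 1) K ∧
      ∀ z, ‖reV z‖ < B → K =ᶠ[nhds z] f := by
  let ω : ContDiffBump (0 : E) := ⟨B, B + 1, hB, by linarith⟩
  have hω : ContDiff ℝ (⊤ : ℕ∞) fun z : V => ω (reV z) :=
    ω.contDiff.comp (reV (κ := κ)).contDiff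
  refine ⟨fun z => ω (reV z) * f z, hω.mul hf, ⟨fun z n => ?_,
    fun z hz => ?_⟩, fun z hz => ?_⟩
  · simp only [hper, map_add, reV_smul, imV_ofRealV, Complex.I_re, zero_smul, smul_zero, sub_zero,
      add_zero]
  · rw [ω.zero_of_le_dist (by rw [dist_zero_right]; exact hz.le), zero_mul]
  · filter_upwards [(isOpen_lt reV.continuous.norm continuous_const).mem_nhds hz] with w hw
    rw [ω.one_of_mem_closedBall (mem_closedBall_zero_iff.2 (le_of_lt hw)), one_mul]

theorem hamField_comp {G : V → ℝ} (hG : ContDiff ℝ (⊤ : ℕ∞) G) {χ χ' : ℝ → ℝ}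
    (hχ : ∀ x, HasDerivAt χ (χ' x) x) (z : V) :
    hamField (χ ∘ G) z = χ' (G z) • hamField G z := by
  rw [hamField, hamField, ((hχ (G z)).comp_hasFDerivAt z
    (hG.differentiable (by simp) z).hasFDerivAt).fderiv, map_smul]

theorem Filter.EventuallyEq.hamField_eq {f g : V → ℝ} {z : V} (h : f =ᶠ[nhds z] g) :
    hamField f z = hamField g z := by
  rw [hamField, hamField, h.fderiv_eq]

theorem eq_of_hasDerivAt_hamField {G : V → ℝ} (hG : ContDiff ℝ (⊤ : ℕ∞) G) {c : ℝ → V}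
    (hc : ∀ s, HasDerivAt c (hamField G (c s)) s) (s : ℝ) : G (c s) = G (c 0) := by
  have h1 : ∀ s, HasDerivAt (G ∘ c) 0 s := fun s => by
    have := (hG.differentiable (by simp) (c s)).hasFDerivAt.comp_hasDerivAt s (hc s)
    rwa [← sympl_hamOp, ← hamField, sympl_self] at this
  exact is_const_of_deriv_eq_zero (fun s => (h1 s).differentiableAt) (fun s => (h1 s).deriv) s 0

namespace IsTetragon
variable {S : Set κ} {G : EuclideanSpace ℂ κ → ℝ} {R₀ R₁ b α β : ℝ}

theorem exists_abs_sub_le (h : IsTetragon S G R₀ R₁ b α β) : ∃ M, 0 ≤ M ∧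
    ∀ p ∈ boxDom S R₀ R₁ (2 * b), ∀ p' ∈ boxDom S R₀ R₁ (2 * b), p.1 = p'.1 → p.2.2 = p'.2.2 →
      |G (boxPt p) - G (boxPt p')| ≤ M * |p.2.1 - p'.2.1| := by
  obtain ⟨K, hK, hc, hKG⟩ := exists_cut h.contDiff h.periodic (B := R₁ + 1)
    (by linarith [h.pos, h.lt])
  obtain ⟨M, hM⟩ := hc.fderiv_cut.exists_norm_le
    (hK.fderiv_right (m := (⊤ : ℕ∞)) (by simp)).continuous
  refine ⟨M, (norm_nonneg _).trans (hM 0), fun p hp p' hp' h1 h2 => ?_⟩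
  have e : ∀ p ∈ boxDom S R₀ R₁ (2 * b), G (boxPt p) = K (boxPt p) := fun p hp =>
    (hKG _ (by rw [norm_reV_boxPt h.pos hp]; linarith [hp.1.2])).eq_of_nhds.symm
  have e1 : boxPt p - boxPt p' = (((p.2.1 - p'.2.1 : ℝ) : ℂ) * Complex.I) • ofRealV p.2.2.1 := by
    rw [boxPt, boxPt, h1, h2]; push_cast; module
  rw [e p hp, e p' hp', ← Real.norm_eq_abs]
  refine (convex_univ.norm_image_sub_le_of_norm_fderiv_le
    (fun x _ => hK.differentiable (by simp) x) (fun x _ => hM x) (mem_univ _) (mem_univ _)).trans_eq ?_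
  rw [e1, norm_smul, norm_mul, Complex.norm_I, Complex.norm_real, LinearIsometry.norm_map,
    hp.2.2.1.norm_eq, mul_one, mul_one, Real.norm_eq_abs]

theorem exists_chord_cut (h : IsTetragon S G R₀ R₁ b α β) {η Δ : ℝ} {χ χ' : ℝ → ℝ} (hη : 0 < η)
    (hχ : ContDiff ℝ (⊤ : ℕ∞) χ) (hχd : ∀ x, HasDerivAt χ (χ' x) x)
    (hχ' : ∀ x, χ' x ≠ 0 → x ∈ Icc (α + η) (β - η)) (hlo : ∀ x ≤ α + η, χ x = 0)
    (hhi : ∀ x, β - η ≤ x → χ x = Δ) (hΔ : 0 < Δ) (n : ℕ) :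
    ∃ (X : V → V) (c : ℝ → V) (t a a' : ℝ) (e y e' y' : E),
      (∀ z, ‖z‖ ≤ n → X z = hamField (χ ∘ G) z) ∧ (∀ s, HasDerivAt c (X (c s)) s) ∧
      t ∈ Icc 0 ((R₁ - R₀) * (2 * b) / Δ) ∧ IsDir S e ∧ coordProj ℝ S y = 0 ∧ IsDir S e' ∧
      coordProj ℝ S y' = 0 ∧ cos a < 0 ∧ 0 < cos a' ∧ (∀ i, y i ∈ Icc (0 : ℝ) 1) ∧
      c 0 = tubePt (arctanProfile R₀ R₁ (n + 1)) b a e y ∧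
      c t = tubePt (arctanProfile R₀ R₁ (n + 1)) b a' e' y' ∧ G (c 0) ∈ Icc (α + η) (β - η) := by
  have hn : (0 : ℝ) < n + 1 := by positivity
  set R := arctanProfile R₀ R₁ (n + 1) with hRdef
  have hRm : ∀ u, R u ∈ Icc R₀ R₁ := arctanProfile_mem h.lt _
  obtain ⟨R', m, MR, LR, hprof⟩ := isProfile_arctanProfile h.pos h.lt hn
  have hB : 0 < n + R₁ + 1 := by linarith [h.pos, h.lt]
  have hχG : ContDiff ℝ (⊤ : ℕ∞) (χ ∘ G) := hχ.comp h.contDiff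
  obtain ⟨K, hK, hcut, hKG⟩ := exists_cut hχG (fun z n => congrArg χ (h.periodic z n)) hB
  obtain ⟨DX, M, c₀, L, hham⟩ := hcut.exists_isTameHamiltonian hK
  obtain ⟨φ, Ξ, hφ⟩ := hham.tame.exists_flow hham.nonneg
  obtain ⟨N, hN, hNG⟩ := h.exists_abs_sub_le
  have hbox : ∀ (a : ℝ) (e y : E), tubePt R b a e y = boxPt (R (cos a), b * (1 + sin a), e, y) := fun a e y => rfl
  have hmem : ∀ (a : ℝ) (e y : E), IsDir S e → coordProj ℝ S y = 0 →
      (R (cos a), b * (1 + sin a), e, y) ∈ boxDom S R₀ R₁ (2 * b) := fun a e y he hy =>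
    ⟨hRm _, ⟨mul_nonneg h.b_pos.le (by linarith [neg_one_le_sin a]),
      by nlinarith [sin_le_one a, h.b_pos]⟩, he, hy⟩
  have hnear : ∀ (a : ℝ) (e y : E), IsDir S e → coordProj ℝ S y = 0 →
      K =ᶠ[nhds (tubePt R b a e y)] χ ∘ G := fun a e y he hy => hKG _ (by
    rw [hbox, norm_reV_boxPt h.pos (hmem a e y he hy)]
    have := (hRm (cos a)).2
    have := Nat.cast_nonneg (α := ℝ) n
    simp only; linarith)
  set ε := min (1 / 2) (η / (N * b + 1)) with hε
  have hNb : 0 ≤ N * b := mul_nonneg hN h.b_pos.le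
  have hε0 : 0 < ε := lt_min (by norm_num) (by positivity)
  have hNε : N * b * ε < η := by
    have h1 : (N * b + 1) * ε ≤ η := by
      rw [mul_comm, ← le_div_iff₀ (by positivity)]; exact min_le_right _ _
    linarith
  have hhigh : ∀ (a : ℝ) (e y : E), IsDir S e → coordProj ℝ S y = 0 → |cos a| < ε → sin a < 0 →
      K =ᶠ[nhds (tubePt R b a e y)] fun _ => Δ := fun a e y he hy ha hs => by
    have h0 : (R (cos a), (0 : ℝ), e, y) ∈ boxDom S R₀ R₁ (2 * b) :=
      ⟨hRm _, ⟨le_rfl, by linarith [h.b_pos]⟩, he, hy⟩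
    have h1 := hNG _ (hmem a e y he hy) _ h0 rfl rfl
    have h2 := h.le_high _ h0 rfl
    have h3 : 1 + sin a ≤ |cos a| := by
      have h4 := sin_sq_add_cos_sq a
      rw [← sq_abs (cos a)] at h4
      nlinarith [neg_one_le_sin a, abs_nonneg (cos a), abs_cos_le_one a]
    simp only [sub_zero] at h1
    rw [abs_of_nonneg (a := b * (1 + sin a))
      (mul_nonneg h.b_pos.le (by linarith [neg_one_le_sin a]))] at h1
    have h5 : N * (b * (1 + sin a)) ≤ N * b * ε := by
      rw [← mul_assoc]; exact mul_le_mul_of_nonneg_left (h3.trans ha.le) hNb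
    have h6 : β - η < G (tubePt R b a e y) := by
      rw [hbox]; linarith [(abs_le.1 h1).1]
    filter_upwards [hnear a e y he hy,
      (isOpen_lt continuous_const h.contDiff.continuous).mem_nhds h6] with w hw hw'
    rw [hw]; exact hhi _ (le_of_lt hw')
  have hlow : ∀ (a : ℝ) (e y : E), IsDir S e → coordProj ℝ S y = 0 → |cos a| < ε → 0 < sin a →
      K =ᶠ[nhds (tubePt R b a e y)] fun _ => 0 := fun a e y he hy ha hs => by
    have h0 : (R (cos a), 2 * b, e, y) ∈ boxDom S R₀ R₁ (2 * b) :=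
      ⟨hRm _, ⟨by linarith [h.b_pos], le_rfl⟩, he, hy⟩
    have h1 := hNG _ (hmem a e y he hy) _ h0 rfl rfl
    have h2 := h.low_le _ h0 rfl
    have h3 : 1 - sin a ≤ |cos a| := by
      have h4 := sin_sq_add_cos_sq a
      rw [← sq_abs (cos a)] at h4
      nlinarith [sin_le_one a, abs_nonneg (cos a), abs_cos_le_one a]
    simp only at h1
    rw [show b * (1 + sin a) - 2 * b = -(b * (1 - sin a)) by ring, abs_neg,
      abs_of_nonneg (a := b * (1 - sin a))
      (mul_nonneg h.b_pos.le (by linarith [sin_le_one a]))] at h1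
    have h5 : N * (b * (1 - sin a)) ≤ N * b * ε := by
      rw [← mul_assoc]; exact mul_le_mul_of_nonneg_left (h3.trans ha.le) hNb
    have h6 : G (tubePt R b a e y) < α + η := by
      rw [hbox]; linarith [(abs_le.1 h1).2]
    filter_upwards [hnear a e y he hy,
      (isOpen_lt h.contDiff.continuous continuous_const).mem_nhds h6] with w hw hw'
    rw [hw]; exact hlo _ (le_of_lt hw')
  have hconst : ∀ z (d : ℝ), (K =ᶠ[nhds z] fun _ => d) → ∀ᶠ w in nhds z, hamField K w = 0 :=
    fun z d hz => hz.eventuallyEq_nhds.mono fun w hw => by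
      rw [hw.hamField_eq, hamField, fderiv_fun_const, Pi.zero_apply, map_zero]
  have hlat : ∀ N : κ → ℤ, ∃ N' : κ → ℤ, latticeVec S N = intVec N' := fun N =>
    ⟨Sᶜ.indicator N, by
      ext i; by_cases hi : i ∈ S <;> simp [latticeVec, coordProj_apply, intVec, hi]⟩
  obtain ⟨har0, har1⟩ := areaFun_arctanProfile_mem h.lt hn h.b_pos
  by_contra hcon
  refine IsChannel.false_of_nonempty (S := S) (t := areaFun R b (2 * π) / Δ) (ε := ε)
    ⟨hham, hφ, hprof, h.b_pos, hε0, min_le_left _ _, fun z N => ?_, fun a e y he hy ha => ?_,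
    fun a e y he hy ha hs => (hhigh a e y he hy ha hs).eq_of_nhds,
    fun a e y he hy ha hs => (hlow a e y he hy ha hs).eq_of_nhds, div_mul_cancel₀ _ hΔ.ne',
    fun a e y a' e' y' he hy he' hy' hca hca' heq => hcon ?_⟩ h.nonempty
  · obtain ⟨N', hN'⟩ := hlat N
    rw [hN']; exact hcut.hamField.periodic z N'
  · rcases (sin_ne_zero_of_abs_cos_lt (ha.trans_le (min_le_left _ _))).lt_or_gt with hs | hs
    · exact hconst _ _ (hhigh a e y he hy ha hs)
    · exact hconst _ _ (hlow a e y he hy ha hs)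
  · set w := intVec fun i => -⌊y i⌋ with hw
    have hyi : ∀ i ∈ S, y i = 0 := fun i hi => by
      have := congrArg (fun v : E => v i) hy
      simpa [coordProj_apply, hi] using this
    have hw0 : coordProj ℝ S w = 0 := by
      ext i; by_cases hi : i ∈ S <;> simp [coordProj_apply, hw, intVec, hi, hyi]
    have hcw : ∀ z, hamField K (z + Complex.I • ofRealV w) = hamField K z := fun z =>
      hcut.hamField.periodic z _
    refine ⟨hamField K, fun s => φ s (tubePt R b a e y) + Complex.I • ofRealV w,
      areaFun R b (2 * π) / Δ, a, a', e, y + w, e', y' + w, fun z hz => ?_, fun s => ?_,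
      ⟨by positivity, by gcongr⟩, he, by rw [map_add, hy, hw0, add_zero], he',
      by rw [map_add, hy', hw0, add_zero], hca, hca', fun i => ?_, ?_, ?_, ?_⟩
    · refine (hKG z ?_).hamField_eq
      have := norm_reV_le z
      linarith [h.pos, h.lt]
    · rw [hcw]
      exact (hφ.hasDerivAt _ s).add_const _
    · have h1 := Int.floor_le (y i)
      have h2 := Int.lt_floor_add_one (y i)
      simp only [hw, intVec, PiLp.add_apply, Int.cast_neg, mem_Icc]
      constructor <;> linarith
    · simp only [hφ.zero, tubePt_add]
    · exact (congrArg (· + Complex.I • ofRealV w) heq).trans (tubePt_add ..).symm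
    · have hG₀ : G (φ 0 (tubePt R b a e y) + Complex.I • ofRealV w) = G (tubePt R b a e y) := by
        rw [hφ.zero, hw, h.periodic]
      rw [hG₀]
      by_contra hG
      have h1 : hamField K (tubePt R b a e y) = 0 := by
        rw [(hnear a e y he hy).hamField_eq, hamField_comp h.contDiff hχd,
          not_not.1 (mt (hχ' _) hG), zero_smul]
      rw [hφ.eq_self hham.tame h1] at heq
      have h2 : ‖reV (tubePt R b a e y)‖ = R (cos a) := by
        rw [hbox, norm_reV_boxPt h.pos (hmem a e y he hy)]
      rw [heq, hbox, norm_reV_boxPt h.pos (hmem a' e' y' he' hy')] at h2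
      have h3 : R (cos a) < R (cos a') := by
        have := (sub_pos.2 h.lt)
        have := pi_pos
        simp only [hRdef, arctanProfile]
        have h4 : arctan ((n + 1) * cos a) < arctan ((n + 1) * cos a') :=
          arctan_strictMono (by gcongr; linarith)
        gcongr
      exact h3.ne' h2

end IsTetragon
end Tetragon

section Chord
variable {κ : Type*} [Fintype κ]

local notation "V" => EuclideanSpace ℂ κ
local notation "E" => EuclideanSpace ℝ κ

theorem tendsto_abs_cos {a : ℕ → ℝ} {b x : ℝ} (hb : 0 < b) (hx : x ∈ Ioo 0 (2 * b))
    (ha : Filter.Tendsto (fun n => b * (1 + sin (a n))) Filter.atTop (nhds x)) :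
    ∃ u, 0 < u ∧ Filter.Tendsto (fun n => |cos (a n)|) Filter.atTop (nhds u) := by
  refine ⟨√(1 - (x / b - 1) ^ 2), sqrt_pos.2 ?_, ?_⟩
  · have h1 : x / b < 2 := (div_lt_iff₀ hb).2 hx.2
    have h2 : 0 < x / b := div_pos hx.1 hb
    nlinarith
  · simp only [abs_cos_eq_sqrt_one_sub_sin_sq]
    refine ((((ha.div_const b).sub_const 1).pow 2).const_sub 1).sqrt.congr fun n => ?_
    rw [mul_div_cancel_left₀ _ hb.ne', add_sub_cancel_left]

variable [DecidableEq κ]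

namespace IsTetragon
variable {S : Set κ} {G : EuclideanSpace ℂ κ → ℝ} {R₀ R₁ b α β : ℝ}
  {Γ : EuclideanSpace ℂ κ → ℝ → EuclideanSpace ℂ κ}

theorem exists_chord_of_gap (h : IsTetragon S G R₀ R₁ b α β) (hΓ₀ : ∀ z, Γ z 0 = z)
    (hΓ : ∀ z s, HasDerivAt (Γ z) (hamField G (Γ z s)) s) {η : ℝ} (hη : 0 < η)
    (hηg : α + 4 * η < β) :
    ∃ p ∈ boxDom S R₀ R₁ (2 * b), ∃ q ∈ boxDom S R₀ R₁ (2 * b),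
      ∃ t ∈ Icc 0 ((R₁ - R₀) * (2 * b) / (β - α - 4 * η)), p.1 = R₀ ∧ q.1 = R₁ ∧
        (∀ i, p.2.2.2 i ∈ Icc (0 : ℝ) 1) ∧ Γ (boxPt p) t = boxPt q := by
  obtain ⟨χ, χ', Δ, hχ, hχd, hχ1, hχ', hlo, hhi, hΔ⟩ := exists_step hη hηg
  have hΔ0 : 0 < Δ := by linarith
  have hΓG : ∀ z s, G (Γ z s) = G z := fun z s => by
    rw [eq_of_hasDerivAt_hamField h.contDiff (hΓ z), hΓ₀]
  choose X c t a a' e y e' y' hX hc ht he hy he' hy' hca hca' hbox hc0 hct hG using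
    h.exists_chord_cut hη hχ hχd hχ' hlo hhi hΔ0
  set p : ℕ → ℝ × ℝ × E × E := fun n =>
    (arctanProfile R₀ R₁ (n + 1) (cos (a n)), b * (1 + sin (a n)), e n, y n) with hp
  set q : ℕ → ℝ × ℝ × E × E := fun n =>
    (arctanProfile R₀ R₁ (n + 1) (cos (a' n)), b * (1 + sin (a' n)), e' n, y' n) with hq
  have hI : ∀ a : ℝ, b * (1 + sin a) ∈ Icc 0 (2 * b) := fun a =>
    ⟨mul_nonneg h.b_pos.le (by linarith [neg_one_le_sin a]), by nlinarith [sin_le_one a, h.b_pos]⟩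
  obtain ⟨ψ, p₀, q₀, t₀, hψ, hlp, hlq, hlt, hp₀, hq₀, hpq⟩ := exists_limit_chord (S := S)
    (R₀ := R₀) (R₁ := R₁) (r := 2 * b) (Y := hamField (χ ∘ G))
    ((contDiff_hamField (hχ.comp h.contDiff)).of_le (by exact_mod_cast le_top)) hX
    (Γ := fun z s => Γ z (χ' (G z) * s)) (fun z => by simp only [mul_zero, hΓ₀])
    (fun z s => by
      have h1 := (hΓ z (χ' (G z) * s)).scomp s ((hasDerivAt_id s).const_mul (χ' (G z)))
      rw [hamField_comp h.contDiff hχd, hΓG]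
      exact h1.congr_deriv (by rw [mul_one]))
    hc ht (p := p) (q := q) (fun n => ⟨arctanProfile_mem h.lt _ _, hI _, he n, hy n⟩) hbox
    (fun n => ⟨arctanProfile_mem h.lt _ _, hI _, he' n, hy' n⟩) hc0 hct
  have hGp : G (boxPt p₀) ∈ Icc (α + η) (β - η) :=
    isClosed_Icc.mem_of_tendsto (((h.contDiff.continuous.comp continuous_boxPt).tendsto p₀).comp hlp)
      (Filter.Eventually.of_forall fun n => by
        have := hG (ψ n)
        rw [hc0] at this
        exact this)
  have hGq : G (boxPt q₀) ∈ Icc (α + η) (β - η) := by rw [← hpq, hΓG]; exact hGp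
  have hwall : ∀ p ∈ boxDom S R₀ R₁ (2 * b), G (boxPt p) ∈ Icc (α + η) (β - η) →
      p.2.1 ∈ Ioo 0 (2 * b) := fun p hp hGp =>
    ⟨lt_of_le_of_ne hp.2.1.1 fun h0 => by linarith [h.le_high p hp h0.symm, hGp.2],
      lt_of_le_of_ne hp.2.1.2 fun h0 => by linarith [h.low_le p hp h0, hGp.1]⟩
  have hν : Filter.Tendsto (fun n => (ψ n : ℝ) + 1) Filter.atTop Filter.atTop :=
    Filter.tendsto_atTop_add_const_right _ _ (tendsto_natCast_atTop_atTop.comp hψ.tendsto_atTop)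
  obtain ⟨hlp1, hlp'⟩ := (Prod.tendsto_iff _ _).1 hlp
  obtain ⟨hlp2, hlp'⟩ := (Prod.tendsto_iff _ _).1 hlp'
  obtain ⟨-, hlp4⟩ := (Prod.tendsto_iff _ _).1 hlp'
  obtain ⟨hlq1, hlq'⟩ := (Prod.tendsto_iff _ _).1 hlq
  obtain ⟨hlq2, -⟩ := (Prod.tendsto_iff _ _).1 hlq'
  obtain ⟨u, hu, hlu⟩ := tendsto_abs_cos h.b_pos (hwall _ hp₀ hGp) hlp2
  obtain ⟨u', hu', hlu'⟩ := tendsto_abs_cos h.b_pos (hwall _ hq₀ hGq) hlq2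
  have hcos : Filter.Tendsto (fun n => cos (a (ψ n))) Filter.atTop (nhds (-u)) :=
    hlu.neg.congr fun n => by rw [abs_of_neg (hca _), neg_neg]
  have hcos' : Filter.Tendsto (fun n => cos (a' (ψ n))) Filter.atTop (nhds u') :=
    hlu'.congr fun n => abs_of_pos (hca' _)
  have htT := isClosed_Icc.mem_of_tendsto hlt (Filter.Eventually.of_forall fun n => ht _)
  have hχp := hχ1 (G (boxPt p₀))
  refine ⟨p₀, hp₀, q₀, hq₀, χ' (G (boxPt p₀)) * t₀, ⟨mul_nonneg hχp.1 htT.1, ?_⟩,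
    tendsto_nhds_unique hlp1 ((tendsto_arctanProfile hcos hν).1 (neg_lt_zero.2 hu)),
    tendsto_nhds_unique hlq1 ((tendsto_arctanProfile hcos' hν).2 hu'), fun i => ?_, hpq⟩
  · refine (mul_le_of_le_one_left htT.1 hχp.2).trans (htT.2.trans ?_)
    have := mul_pos (sub_pos.2 h.lt) (mul_pos two_pos h.b_pos)
    gcongr
    linarith
  · have hcont : Continuous fun v : E => v i := by fun_prop
    exact isClosed_Icc.mem_of_tendsto ((hcont.tendsto _).comp hlp4)
      (Filter.Eventually.of_forall fun n => hbox _ i)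

/-- The flow of `G` has a chord from the floor to the ceiling. -/
theorem exists_chord (h : IsTetragon S G R₀ R₁ b α β) (hΓ₀ : ∀ z, Γ z 0 = z)
    (hΓ : ∀ z s, HasDerivAt (Γ z) (hamField G (Γ z s)) s) :
    ∃ p ∈ boxDom S R₀ R₁ (2 * b), ∃ q ∈ boxDom S R₀ R₁ (2 * b),
      ∃ t ∈ Ioc 0 ((R₁ - R₀) * (2 * b) / (β - α)), p.1 = R₀ ∧ q.1 = R₁ ∧
        Γ (boxPt p) t = boxPt q := by
  have hg := sub_pos.2 h.gap
  set η : ℕ → ℝ := fun j => (β - α) / 4 * (1 / ((j : ℝ) + 1 + 1)) with hη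
  have hη1 : ∀ j : ℕ, 1 / ((j : ℝ) + 1 + 1) ≤ 1 / 2 := fun j =>
    one_div_le_one_div_of_le two_pos (by linarith [Nat.cast_nonneg (α := ℝ) j])
  have hηle : ∀ j, 4 * η j ≤ (β - α) / 2 := fun j => by
    have := mul_le_mul_of_nonneg_left (hη1 j) hg.le
    simp only [hη]; linarith
  choose p hp q hq t ht hpR hqR hbox hpq using fun j => h.exists_chord_of_gap hΓ₀ hΓ (η := η j)
    (mul_pos (by positivity) (by positivity)) (by linarith [hηle j])
  have hpos := mul_pos (sub_pos.2 h.lt) (mul_pos two_pos h.b_pos)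
  obtain ⟨ψ, p₀, q₀, t₀, hψ, hlp, hlq, hlt, hp₀, hq₀, heq⟩ := exists_limit_chord (S := S)
    (R₀ := R₀) (R₁ := R₁) (r := 2 * b) (Y := hamField G) (X := fun _ => hamField G)
    (T := (R₁ - R₀) * (2 * b) / ((β - α) / 2))
    ((contDiff_hamField h.contDiff).of_le (by exact_mod_cast le_top)) (fun _ _ _ => rfl)
    hΓ₀ hΓ (c := fun j => Γ (boxPt (p j))) (fun j => hΓ _) (t := t)
    (fun j => ⟨(ht j).1, (ht j).2.trans (by gcongr; linarith [hηle j])⟩) hp hbox hq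
    (fun j => hΓ₀ _) hpq
  have hp1 : p₀.1 = R₀ := tendsto_nhds_unique ((Prod.tendsto_iff _ _).1 hlp).1
    (tendsto_const_nhds.congr fun n => (hpR _).symm)
  have hq1 : q₀.1 = R₁ := tendsto_nhds_unique ((Prod.tendsto_iff _ _).1 hlq).1
    (tendsto_const_nhds.congr fun n => (hqR _).symm)
  have ht0 : 0 ≤ t₀ := ge_of_tendsto' hlt fun n => (ht _).1
  refine ⟨p₀, hp₀, q₀, hq₀, t₀, ⟨lt_of_le_of_ne ht0 fun h0 => ?_, ?_⟩, hp1, hq1, heq⟩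
  · rw [← h0, hΓ₀] at heq
    have := norm_reV_boxPt h.pos hp₀
    rw [heq, norm_reV_boxPt h.pos hq₀, hp1, hq1] at this
    exact h.lt.ne' this
  · have h1 : Filter.Tendsto η Filter.atTop (nhds ((β - α) / 4 * 0)) :=
      ((Filter.tendsto_add_atTop_iff_nat 1).2 (tendsto_one_div_add_atTop_nhds_zero_nat (𝕜 := ℝ))
        |>.congr fun n => by push_cast; rfl).const_mul _
    have h2 := ((h1.comp hψ.tendsto_atTop).const_mul 4).const_sub (β - α)
    have h3 := (tendsto_const_nhds (x := (R₁ - R₀) * (2 * b))).div h2 (by simpa using hg.ne')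
    rw [mul_zero, mul_zero, sub_zero] at h3
    exact le_of_tendsto_of_tendsto' hlt h3 fun n => (ht _).2

end IsTetragon
end Chord

section Extended

theorem apply_add_intVec {κ : Type*} [Fintype κ] [DecidableEq κ] {f : EuclideanSpace ℂ κ → ℝ}
    (hf : ∀ z i, f (z + Complex.I • EuclideanSpace.single i 1) = f z) (z : EuclideanSpace ℂ κ)
    (n : κ → ℤ) : f (z + Complex.I • ofRealV (intVec n)) = f z := by
  let P : AddSubgroup (EuclideanSpace ℂ κ) :=
    { carrier := {v | ∀ z, f (z + v) = f z}
      zero_mem' := fun z => by rw [add_zero]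
      add_mem' := fun {v w} hv hw z => by rw [← add_assoc, hw, hv]
      neg_mem' := fun {v} hv z => by rw [← hv, neg_add_cancel_right] }
  have e : Complex.I • ofRealV (intVec n) =
      ∑ i, n i • (Complex.I • EuclideanSpace.single i (1 : ℂ)) := by
    ext j
    simp only [WithLp.ofLp_sum, Finset.sum_apply, PiLp.smul_apply, PiLp.single_apply, smul_eq_mul,
      ofRealV_apply, intVec]
    rw [Finset.sum_eq_single j (fun i _ hi => by simp [hi.symm]) (by simp)]
    simp [mul_comm]
  have h1 : Complex.I • ofRealV (intVec n) ∈ P := by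
    rw [e]
    exact sum_mem fun i _ => zsmul_mem (show _ ∈ P from fun z => hf z i) _
  exact h1 z

variable {k m : ℕ}

/-- The extended phase space as a complex vector space: the coordinates `(p, q, p', q', t)` and the
energy `s` conjugate to `t` correspond to `p + i q`, `p' + i q'` and `s + i t`. -/
def extEquiv (k m : ℕ) :
    ((Phase2 k m × ℝ) × ℝ) ≃L[ℝ] EuclideanSpace ℂ (Fin k ⊕ Fin m ⊕ Unit) :=
  LinearEquiv.toContinuousLinearEquiv
    { toFun := fun w => WithLp.toLp 2 (Sum.elim (fun i => ⟨w.1.1.1.1 i, w.1.1.1.2 i⟩)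
        (Sum.elim (fun j => ⟨w.1.1.2.1 j, w.1.1.2.2 j⟩) fun _ => ⟨w.2, w.1.2⟩))
      invFun := fun z => ((((fun i => (z (Sum.inl i)).re, fun i => (z (Sum.inl i)).im),
        (fun j => (z (Sum.inr (Sum.inl j))).re, fun j => (z (Sum.inr (Sum.inl j))).im)),
        (z (Sum.inr (Sum.inr ()))).im), (z (Sum.inr (Sum.inr ()))).re)
      map_add' := fun v w => by ext i; rcases i with i | i | i <;> rfl
      map_smul' := fun a v => by
        ext i; rcases i with i | i | i <;> apply Complex.ext <;> simp
      left_inv := fun w => rfl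
      right_inv := fun z => by ext i; rcases i with i | i | i <;> rfl }

theorem extEquiv_apply (w : (Phase2 k m × ℝ) × ℝ) (i : Fin k ⊕ Fin m ⊕ Unit) :
    extEquiv k m w i = i.elim (fun i => ⟨w.1.1.1.1 i, w.1.1.1.2 i⟩)
      (Sum.elim (fun j => ⟨w.1.1.2.1 j, w.1.1.2.2 j⟩) fun _ => ⟨w.2, w.1.2⟩) := rfl

/-- The autonomous Hamiltonian `G(x, t) + s` on the extended phase space. -/
def extHam (G : Phase2 k m × ℝ → ℝ) (z : EuclideanSpace ℂ (Fin k ⊕ Fin m ⊕ Unit)) : ℝ :=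
  G ((extEquiv k m).symm z).1 + ((extEquiv k m).symm z).2

variable {G : Phase2 k m × ℝ → ℝ}

theorem contDiff_extHam (hG : ContDiff ℝ (⊤ : ℕ∞) G) : ContDiff ℝ (⊤ : ℕ∞) (extHam G) :=
  (hG.comp (contDiff_fst.comp (extEquiv k m).symm.contDiff)).add
    (contDiff_snd.comp (extEquiv k m).symm.contDiff)

theorem fderiv_extHam (hG : Differentiable ℝ G) (z v : EuclideanSpace ℂ (Fin k ⊕ Fin m ⊕ Unit)) :
    fderiv ℝ (extHam G) z v = fderiv ℝ G ((extEquiv k m).symm z).1 ((extEquiv k m).symm v).1 +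
      ((extEquiv k m).symm v).2 := by
  have h1 := (extEquiv k m).symm.hasFDerivAt (x := z)
  have h2 := ((hG _).hasFDerivAt.comp z h1.fst).add h1.snd
  rw [show extHam G = (G ∘ fun z => ((extEquiv k m).symm z).1) + fun z =>
    ((extEquiv k m).symm z).2 from rfl, h2.fderiv]
  rfl

theorem extEquiv_symm_single (i : Fin k ⊕ Fin m ⊕ Unit) :
    (extEquiv k m).symm (EuclideanSpace.single i 1) =
      i.elim (fun i => ((((Pi.single i 1, 0), 0), 0), 0))
        (Sum.elim (fun j => (((0, (Pi.single j 1, 0)), 0), 0)) fun _ => (0, 1)) ∧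
    (extEquiv k m).symm (Complex.I • EuclideanSpace.single i 1) =
      i.elim (fun i => ((((0, Pi.single i 1), 0), 0), 0))
        (Sum.elim (fun j => (((0, (0, Pi.single j 1)), 0), 0)) fun _ => ((0, 1), 0)) := by
  simp only [ContinuousLinearEquiv.symm_apply_eq]
  constructor <;> ext l <;> rcases i with i | i | i <;> rcases l with l | l | l <;>
    apply Complex.ext <;> simp [extEquiv_apply, Pi.single_apply, apply_ite]

theorem hamField_extHam (hG : Differentiable ℝ G) (x : Phase2 k m) (t s : ℝ) :
    ((extEquiv k m).symm (hamField (extHam G) (extEquiv k m ((x, t), s)))).1 =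
      (((-(gradVec (fun q => G (((x.1.1, q), x.2), t)) x.1.2),
        gradVec (fun p => G (((p, x.1.2), x.2), t)) x.1.1),
       (-(gradVec (fun q' => G ((x.1, (x.2.1, q')), t)) x.2.2),
        gradVec (fun p' => G ((x.1, (p', x.2.2)), t)) x.2.1)), 1) := by
  have hd := (hG (x, t)).hasFDerivAt
  have hl := hd.comp x (g := G) (f := fun y => (y, t)) (hasFDerivAt_prodMk_left x t)
  have hl1 := HasFDerivAt.comp x.1 (f := fun y => (y, x.2)) hl (hasFDerivAt_prodMk_left x.1 x.2)
  have hl2 := HasFDerivAt.comp x.2 (f := fun y => (x.1, y)) hl (hasFDerivAt_prodMk_right x.1 x.2)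
  have h1 := (HasFDerivAt.comp x.1.2 (f := fun y => (x.1.1, y)) hl1
    (hasFDerivAt_prodMk_right x.1.1 x.1.2)).fderiv
  have h2 := (HasFDerivAt.comp x.1.1 (f := fun y => (y, x.1.2)) hl1
    (hasFDerivAt_prodMk_left x.1.1 x.1.2)).fderiv
  have h3 := (HasFDerivAt.comp x.2.2 (f := fun y => (x.2.1, y)) hl2
    (hasFDerivAt_prodMk_right x.2.1 x.2.2)).fderiv
  have h4 := (HasFDerivAt.comp x.2.1 (f := fun y => (y, x.2.2)) hl2
    (hasFDerivAt_prodMk_left x.2.1 x.2.2)).fderiv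
  have e : ∀ v, fderiv ℝ (extHam G) (extEquiv k m ((x, t), s)) v =
      fderiv ℝ G (x, t) ((extEquiv k m).symm v).1 + ((extEquiv k m).symm v).2 := fun v => by
    rw [fderiv_extHam hG, ContinuousLinearEquiv.symm_apply_apply]
  have e1 := fun i => (e _).trans (congrArg (fun w => fderiv ℝ G (x, t) w.1 + w.2)
    (extEquiv_symm_single (k := k) (m := m) i).1)
  have e2 := fun i => (e _).trans (congrArg (fun w => fderiv ℝ G (x, t) w.1 + w.2)
    (extEquiv_symm_single (k := k) (m := m) i).2)
  refine Prod.ext (Prod.ext (Prod.ext (funext fun i => ?_) (funext fun i => ?_))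
    (Prod.ext (funext fun i => ?_) (funext fun i => ?_))) ?_
  · exact congrArg Neg.neg ((e2 (.inl i)).trans ((add_zero _).trans
      (DFunLike.congr_fun h1 (Pi.single i 1)).symm))
  · exact (e1 (.inl i)).trans ((add_zero _).trans (DFunLike.congr_fun h2 (Pi.single i 1)).symm)
  · exact congrArg Neg.neg ((e2 (.inr (.inl i))).trans ((add_zero _).trans
      (DFunLike.congr_fun h3 (Pi.single i 1)).symm))
  · exact (e1 (.inr (.inl i))).trans ((add_zero _).trans
      (DFunLike.congr_fun h4 (Pi.single i 1)).symm)
  · refine (e1 (.inr (.inr ()))).trans ?_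
    simp

/-- A solution of Hamilton's equations of `G` lifts to an integral curve of `hamField (extHam G)`. -/
theorem IsHamSolOn2.hasDerivAt_extEquiv (hG : Differentiable ℝ G) {γ : ℝ → Phase2 k m}
    (hγ : IsHamSolOn2 G γ univ) (t₀ E s : ℝ) :
    HasDerivAt (fun s => extEquiv k m ((γ (t₀ + s), t₀ + s), E - G (γ (t₀ + s), t₀ + s)))
      (hamField (extHam G)
        (extEquiv k m ((γ (t₀ + s), t₀ + s), E - G (γ (t₀ + s), t₀ + s)))) s := by
  set z := extEquiv k m ((γ (t₀ + s), t₀ + s), E - G (γ (t₀ + s), t₀ + s)) with hz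
  set v := (extEquiv k m).symm (hamField (extHam G) z) with hv
  obtain ⟨h1, h2, h3, h4⟩ := hγ (t₀ + s) (mem_univ _)
  have hw : HasDerivAt (fun s => (γ s, s)) v.1 (t₀ + s) := by
    rw [hv, hz, hamField_extHam hG]
    exact ((h1.prodMk h2).prodMk (h3.prodMk h4)).prodMk (hasDerivAt_id _)
  have hw' := hw.comp_const_add t₀ s
  have hGw := ((hG _).hasFDerivAt.comp_hasDerivAt s hw').const_sub E
  have h0 : fderiv ℝ G (γ (t₀ + s), t₀ + s) v.1 + v.2 = 0 := by
    have := fderiv_extHam hG z (hamField (extHam G) z)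
    rw [← sympl_hamOp, ← hamField, sympl_self, hz, ContinuousLinearEquiv.symm_apply_apply,
      ← hz] at this
    exact this.symm
  have h5 := (extEquiv k m).hasFDerivAt.comp_hasDerivAt s
    (hw'.prodMk (hGw.congr_deriv (neg_eq_of_add_eq_zero_right h0)))
  exact h5.congr_deriv ((extEquiv k m).apply_symm_apply _)

end Extended

section Walls
variable {k m : ℕ}

theorem eucNorm_eq (x : Vec k) : eucNorm x = ‖(WithLp.toLp 2 x : EuclideanSpace ℝ (Fin k))‖ := by
  rw [eucNorm, EuclideanSpace.norm_eq]
  simp only [Real.norm_eq_abs, sq_abs]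

theorem eucNorm_smul (a : ℝ) (x : Vec k) : eucNorm (a • x) = |a| * eucNorm x := by
  rw [eucNorm_eq, eucNorm_eq, WithLp.toLp_smul, norm_smul, Real.norm_eq_abs]

theorem isCompact_eucNorm_eq (r : ℝ) : IsCompact {q : Vec k | eucNorm q = r} := by
  have h1 := (isCompact_sphere (0 : EuclideanSpace ℝ (Fin k)) r).image
    (PiLp.continuous_ofLp 2 fun _ : Fin k => ℝ)
  refine h1.of_isClosed_subset (isClosed_eq ?_ continuous_const) fun q hq =>
    ⟨WithLp.toLp 2 q, by rw [mem_sphere_zero_iff_norm, ← eucNorm_eq, hq], rfl⟩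
  unfold eucNorm
  fun_prop

theorem norm_reV_extEquiv (x : Phase2 k m) (t : ℝ) (hx : x.2.1 = 0) :
    ‖reV (extEquiv k m ((x, t), 0))‖ = eucNorm x.1.1 := by
  rw [EuclideanSpace.norm_eq, eucNorm]
  simp [Fintype.sum_sum_type, extEquiv_apply, hx]

theorem periodic_extEquiv {f : Phase2 k m × ℝ → ℝ}
    (hq : ∀ (x : Phase2 k m) (t : ℝ) (i : Fin k),
      f (((x.1.1, x.1.2 + Pi.single i 1), x.2), t) = f (x, t))
    (hq' : ∀ (x : Phase2 k m) (t : ℝ) (j : Fin m),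
      f ((x.1, (x.2.1, x.2.2 + Pi.single j 1)), t) = f (x, t))
    (ht : ∀ x t, f (x, t + 1) = f (x, t)) (z : EuclideanSpace ℂ (Fin k ⊕ Fin m ⊕ Unit))
    (i : Fin k ⊕ Fin m ⊕ Unit) :
    f ((extEquiv k m).symm (z + Complex.I • EuclideanSpace.single i 1)).1 =
      f ((extEquiv k m).symm z).1 := by
  rw [map_add, (extEquiv_symm_single i).2]
  set w := (extEquiv k m).symm z
  rcases i with i | i | i
  · refine (congrArg f ?_).trans (hq w.1.1 w.1.2 i)
    simp [Prod.ext_iff]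
  · refine (congrArg f ?_).trans (hq' w.1.1 w.1.2 i)
    simp [Prod.ext_iff]
  · refine (congrArg f ?_).trans (ht w.1.1 w.1.2)
    simp [Prod.ext_iff]

theorem exists_abs_le_of_periodic {f : Phase2 k m × ℝ → ℝ} (hf : ContDiff ℝ (⊤ : ℕ∞) f)
    (hper : ∀ z i, f ((extEquiv k m).symm (z + Complex.I • EuclideanSpace.single i 1)).1 =
      f ((extEquiv k m).symm z).1) {B : ℝ} (hB : 0 < B) :
    ∃ M, ∀ (x : Phase2 k m) (t : ℝ), eucNorm x.1.1 < B → x.2.1 = 0 → |f (x, t)| ≤ M := by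
  obtain ⟨K, hK, hc, hKf⟩ := exists_cut
    (hf.comp (contDiff_fst.comp (extEquiv k m).symm.contDiff))
    (fun z n => apply_add_intVec hper z n) hB
  obtain ⟨M, hM⟩ := hc.exists_norm_le hK.continuous
  refine ⟨M, fun x t hx hx' => ?_⟩
  have h1 := (hKf (extEquiv k m ((x, t), 0)) (by rwa [norm_reV_extEquiv x t hx'])).eq_of_nhds
  have h2 := hM (extEquiv k m ((x, t), 0))
  rwa [h1, Function.comp_apply, Function.comp_apply, ContinuousLinearEquiv.symm_apply_apply,
    Real.norm_eq_abs] at h2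

theorem boxPt_eq_extEquiv {ρ x : ℝ} {e y : EuclideanSpace ℝ (Fin k ⊕ Fin m ⊕ Unit)}
    (he : IsDir (range Sum.inl) e) (hy : coordProj ℝ (range Sum.inl) y = 0) :
    ∃ e₀ : Vec k, eucNorm e₀ = 1 ∧ boxPt (ρ, x, e, y) = extEquiv k m
      ((((ρ • e₀, x • e₀), (0, fun j => y (Sum.inr (Sum.inl j)))), y (Sum.inr (Sum.inr ()))), 0) := by
  have he0 : ∀ i, e (Sum.inr i) = 0 := fun i => by
    have := congrArg (fun v : EuclideanSpace ℝ (Fin k ⊕ Fin m ⊕ Unit) => v (Sum.inr i)) he.proj_eq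
    simpa [coordProj_apply] using this.symm
  have hy0 : ∀ i, y (Sum.inl i) = 0 := fun i => by
    have := congrArg (fun v : EuclideanSpace ℝ (Fin k ⊕ Fin m ⊕ Unit) => v (Sum.inl i)) hy
    simpa [coordProj_apply] using this
  refine ⟨fun i => e (Sum.inl i), ?_, ?_⟩
  · rw [← he.norm_eq, EuclideanSpace.norm_eq, eucNorm]
    simp [Fintype.sum_sum_type, he0]
  · ext i
    rcases i with i | i | i <;> apply Complex.ext <;>
      simp [boxPt, extEquiv_apply, he0, hy0]

end Walls

end Preliminaries

/-- Corollary 1.7, superconductivity channels: for the Nekhoroshev-type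
Hamiltonian `H = Σ pᵢhᵢ(p') + U(q)` and any perturbation `F` that is sufficiently small
on the walls (`δ < γ := β - α`), the complete Hamiltonian `G = H + F` has a chord from
`𝓕 × Z` to `𝓒 × Z` of time-length at most `(R₁-R₀)·r/(γ-δ)`; along it `|p|` increases
from `R₀` to `R₁`. -/
theorem stmt_3 (k m : ℕ) (hk : 1 ≤ k) (R₀ R₁ r : ℝ) (hR₀ : 0 < R₀) (hR : R₀ < R₁)
    (hr₀ : 0 < r) (hr : r < 1 / 2)
    (U : Vec k → ℝ) (hU : ContDiff ℝ (⊤ : ℕ∞) U)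
    (hUper : ∀ (q : Vec k) (n : Fin k → ℤ), U (q + fun i => (n i : ℝ)) = U q)
    (β α gam : ℝ) (hβ : β = U 0) (hα : α = sSup (U '' {q | eucNorm q = r}))
    (hαβ : α < β) (hgam : gam = β - α)
    (h : Fin k → Vec m → ℝ) (hh : ∀ i, ContDiff ℝ (⊤ : ℕ∞) (h i)) (hh0 : ∀ i, h i 0 = 0)
    (H : Phase2 k m → ℝ) (hH : H = fun x => (∑ i, x.1.1 i * h i x.2.1) + U x.1.2)
    (F : Phase2 k m × ℝ → ℝ) (hF : ContDiff ℝ (⊤ : ℕ∞) F)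
    (hFq : ∀ (x : Phase2 k m) (t : ℝ) (i : Fin k),
      F (((x.1.1, x.1.2 + Pi.single i 1), x.2), t) = F (x, t))
    (hFq' : ∀ (x : Phase2 k m) (t : ℝ) (j : Fin m),
      F ((x.1, (x.2.1, x.2.2 + Pi.single j 1)), t) = F (x, t))
    (hFt : ∀ x t, F (x, t + 1) = F (x, t))
    (δ : ℝ)
    (hδ : δ = |sInf (F '' (stab (m := m) (torusHigh k R₀ R₁) ×ˢ univ)) -
               sSup (F '' (stab (m := m) (torusLow k R₀ R₁ r) ×ˢ univ))|)
    (hδγ : δ < gam)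
    (G : Phase2 k m × ℝ → ℝ) (hG : G = fun z => H z.1 + F z)
    (hcomp : HamComplete2 G) :
    ∃ (t₀ τ : ℝ) (γ : ℝ → Phase2 k m), 0 < τ ∧ τ ≤ (R₁ - R₀) * r / (gam - δ) ∧
      IsHamSolOn2 G γ (Icc t₀ (t₀ + τ)) ∧
      γ t₀ ∈ stab (m := m) (torusFloor k R₀ r) ∧
      γ (t₀ + τ) ∈ stab (m := m) (torusFloor k R₁ r) ∧
      eucNorm ((γ t₀).1.1) = R₀ ∧ eucNorm ((γ (t₀ + τ)).1.1) = R₁ := by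
  have hUsingle : ∀ q i, U (q + Pi.single i 1) = U q := fun q i => by
    refine (congrArg (fun v => U (q + v)) (funext fun j => ?_)).trans (hUper q (Pi.single i 1))
    simp [Pi.single_apply]
  have hGs : ContDiff ℝ (⊤ : ℕ∞) G := by
    rw [hG, hH]
    refine ContDiff.add (ContDiff.add (ContDiff.sum fun i _ => ContDiff.mul ?_
      ((hh i).comp (by fun_prop))) (hU.comp (by fun_prop))) hF
    fun_prop
  have hFper := periodic_extEquiv hFq hFq' hFt
  have hGper := periodic_extEquiv (f := G) (fun x t i => by simp only [hG, hH, hFq, hUsingle])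
    (fun x t j => by simp only [hG, hH, hFq']) (fun x t => by simp only [hG, hFt])
  obtain ⟨M, hM⟩ := exists_abs_le_of_periodic hF hFper (B := R₁ + 1) (by linarith)
  have hbdd : ∀ X : Set (Phase k), (∀ x ∈ X, eucNorm x.1 ≤ R₁) →
      ∀ v ∈ F '' (stab (m := m) X ×ˢ univ), |v| ≤ M := by
    rintro X hX _ ⟨⟨x, t⟩, ⟨⟨hx, hx'⟩, -⟩, rfl⟩
    exact hM x t (by linarith [hX _ hx]) hx'
  have hlow : BddAbove (F '' (stab (m := m) (torusLow k R₀ R₁ r) ×ˢ univ)) :=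
    ⟨M, fun v hv => (abs_le.1 (hbdd _ (fun x hx => hx.2.1) v hv)).2⟩
  have hhigh : BddBelow (F '' (stab (m := m) (torusHigh k R₀ R₁) ×ˢ univ)) :=
    ⟨-M, fun v hv => (abs_le.1 (hbdd _ (fun x hx => hx.2.1) v hv)).1⟩
  set I := sInf (F '' (stab (m := m) (torusHigh k R₀ R₁) ×ˢ univ)) with hI
  set J := sSup (F '' (stab (m := m) (torusLow k R₀ R₁ r) ×ˢ univ)) with hJ
  have hgap : gam - δ ≤ β + I - (α + J) := by
    rw [hδ, hgam]; linarith [neg_abs_le (I - J)]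
  have hext : ∀ (x : Phase2 k m) (t : ℝ), x.2.1 = 0 →
      extHam G (extEquiv k m ((x, t), 0)) = U x.1.2 + F (x, t) := fun x t hx => by
    simp [extHam, hG, hH, hx, hh0]
  have htet : IsTetragon (range Sum.inl) (extHam G) R₀ R₁ (r / 2) (α + J) (β + I) := by
    refine ⟨contDiff_extHam hGs, apply_add_intVec fun z i => ?_, hR₀, hR, by positivity,
      ⟨_, ⟨⟨0, hk⟩, rfl⟩⟩, ?_, ?_, by linarith⟩
    · rw [extHam, extHam, hGper, map_add, (extEquiv_symm_single i).2]
      rcases i with i | i | i <;> exact congrArg _ (add_zero _)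
    · rintro ⟨ρ, x, e, y⟩ ⟨hρ, -, he, hy⟩ hx
      obtain ⟨e₀, he₀, hp⟩ := boxPt_eq_extEquiv (ρ := ρ) (x := x) he hy
      rw [hp, hext _ _ rfl, hβ]
      have hn : eucNorm (ρ • e₀) = ρ := by
        rw [eucNorm_smul, he₀, mul_one, abs_of_pos (hR₀.trans_le hρ.1)]
      have hx0 : x • e₀ = 0 := by rw [show x = 0 from hx, zero_smul]
      refine add_le_add (by rw [hx0]) (csInf_le hhigh ⟨_, ⟨⟨⟨hn.symm ▸ hρ.1, hn.symm ▸ hρ.2, 0, ?_⟩,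
        rfl⟩, mem_univ _⟩, rfl⟩)
      simp only [hx0]; ext; simp
    · rintro ⟨ρ, x, e, y⟩ ⟨hρ, -, he, hy⟩ hx
      obtain ⟨e₀, he₀, hp⟩ := boxPt_eq_extEquiv (ρ := ρ) (x := x) he hy
      have hρ0 := hR₀.trans_le hρ.1
      rw [hp, hext _ _ rfl, hα]
      have hn : eucNorm (ρ • e₀) = ρ := by rw [eucNorm_smul, he₀, mul_one, abs_of_pos hρ0]
      have hxr : x = r := (show x = 2 * (r / 2) from hx).trans (by ring)
      refine add_le_add (le_csSup ((isCompact_eucNorm_eq r).image hU.continuous).bddAbove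
        ⟨_, ?_, rfl⟩) (le_csSup hlow ⟨_, ⟨⟨⟨hn.symm ▸ hρ.1, hn.symm ▸ hρ.2, 0, ?_⟩,
        rfl⟩, mem_univ _⟩, rfl⟩)
      · simp only [mem_ofPred_eq, eucNorm_smul, he₀, hxr, mul_one, abs_of_pos hr₀]
      · simp only [hn, smul_smul, div_mul_cancel₀ _ hρ0.ne', hxr]; ext; simp
  have hGd : Differentiable ℝ G := hGs.differentiable (by simp)
  choose γ hγ₀ hγ using fun z => hcomp ((extEquiv k m).symm z).1.2 ((extEquiv k m).symm z).1.1
  obtain ⟨p, hp, q, hq, τ, hτ, hp1, hq1, hpq⟩ := htet.exists_chord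
    (Γ := fun z s => extEquiv k m ((γ z (((extEquiv k m).symm z).1.2 + s),
      ((extEquiv k m).symm z).1.2 + s), extHam G z - G (γ z (((extEquiv k m).symm z).1.2 + s),
      ((extEquiv k m).symm z).1.2 + s)))
    (fun z => by
      rw [← ContinuousLinearEquiv.eq_symm_apply, add_zero, hγ₀]
      refine Prod.ext rfl (add_sub_cancel_left _ _))
    (fun z s => (hγ z).hasDerivAt_extEquiv hGd _ _ s)
  have hfloor : ∀ p ∈ boxDom (range Sum.inl) R₀ R₁ (2 * (r / 2)),
      ((extEquiv k m).symm (boxPt p)).1.1 ∈ stab (m := m) (torusFloor k p.1 r) ∧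
      eucNorm ((extEquiv k m).symm (boxPt p)).1.1.1.1 = p.1 := by
    rintro ⟨ρ, x, e, y⟩ ⟨hρ, hx, he, hy⟩
    obtain ⟨e₀, he₀, hp⟩ := boxPt_eq_extEquiv (ρ := ρ) (x := x) he hy
    have hρ0 := hR₀.trans_le hρ.1
    have hn : eucNorm (ρ • e₀) = ρ := by rw [eucNorm_smul, he₀, mul_one, abs_of_pos hρ0]
    rw [hp, ContinuousLinearEquiv.symm_apply_apply]
    refine ⟨⟨⟨hn, x, 0, ⟨hx.1, hx.2.trans_eq (by ring)⟩, ?_⟩, rfl⟩, hn⟩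
    simp only [hn, smul_smul, div_mul_cancel₀ _ hρ0.ne']; ext; simp
  set t₀ := ((extEquiv k m).symm (boxPt p)).1.2 with ht₀
  have hend : γ (boxPt p) (t₀ + τ) = ((extEquiv k m).symm (boxPt q)).1.1 := by
    rw [← hpq, ContinuousLinearEquiv.symm_apply_apply]
  obtain ⟨hp2, hp3⟩ := hfloor p hp
  obtain ⟨hq2, hq3⟩ := hfloor q hq
  rw [hp1, ← hγ₀ (boxPt p)] at hp2 hp3
  rw [hq1, ← hend] at hq2 hq3
  refine ⟨t₀, τ, γ (boxPt p), hτ.1, hτ.2.trans ?_, fun t _ => hγ _ t (mem_univ _), hp2, hq2, hp3, hq3⟩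
  have := sub_pos.2 hR
  have := sub_pos.2 hδγ
  rw [mul_div_cancel₀ r two_ne_zero]
  gcongr
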